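/- If λ and μ are strict partitions, then Q_λ · Q_μ = Σ_ν g^ν_{λμ} Q_ν, where the sum is over strict partitions ν and g^ν_{λμ} is the number of elements of shape ν in the set {P_EGᴼ(a) : a ∈ R_inv^+(z_λ × z_μ)}. -/

import Mathlib

/-! ## Primed letters: the alphabet `ℤ ⊔ ℤ'`, with `i' = i - 1/2`.
A letter is encoded by its "ceiling" together with a flag recording whether it is primed. -/

structure Letter where
  ceil : ℤ
  primed : Bool
deriving DecidableEq, Repr

instance : Inhabited Letter := ⟨⟨0, false⟩⟩

/-- The order `⋯ < 1' < 1 < 2' < 2 < ⋯`. -/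
instance : LinearOrder Letter :=
  LinearOrder.lift' (fun x : Letter => toLex (x.ceil, !x.primed))
    (fun a b h => by
      have h' : (a.ceil, !a.primed) = (b.ceil, !b.primed) := toLex.injective h
      obtain ⟨ac, ap⟩ := a
      obtain ⟨bc, bp⟩ := b
      simp only [Prod.mk.injEq] at h'
      obtain ⟨h1, h2⟩ := h'
      cases ap <;> cases bp <;> simp_all)

/-- A primed word. -/
abbrev PWord := List Letter

def Letter.unprime (x : Letter) : Letter := ⟨x.ceil, false⟩

def Letter.succL (x : Letter) : Letter := ⟨x.ceil + 1, x.primed⟩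

/-- `unprime` of a primed word: replace each letter `x` by `⌈x⌉`. -/
def unprimeWord (a : PWord) : List ℤ := a.map Letter.ceil

/-- `unprime` of a primed word, as a primed word with no primes. -/
def unprimeP (a : PWord) : PWord := a.map Letter.unprime

/-! ## Involution words -/

/-- The simple transposition `s_i = (i, i+1)` of `ℤ`. -/
def sPerm (i : ℤ) : Equiv.Perm ℤ := Equiv.swap i (i + 1)

/-- The Demazure product `s_{w_1} ∘ s_{w_2} ∘ ⋯ ∘ s_{w_k}` of a word, computed by the
defining recursion `σ ∘ s_i = σ·s_i` if `σ(i) < σ(i+1)` and `σ ∘ s_i = σ` otherwise. -/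
def heckeProd (w : List ℤ) : Equiv.Perm ℤ :=
  w.foldl (fun σ i => if σ i < σ (i + 1) then σ * sPerm i else σ) 1

/-- `s_{a_n} ∘ ⋯ ∘ s_{a_2} ∘ s_{a_1} ∘ s_{a_2} ∘ ⋯ ∘ s_{a_n}` for `a = a_1 a_2 ⋯ a_n`. -/
def invHecke (a : List ℤ) : Equiv.Perm ℤ := heckeProd (a.reverse ++ a.tail)

/-- Membership in `I_ℤ`: a finitely supported involution of `ℤ`. -/
def IZ (z : Equiv.Perm ℤ) : Prop := {x : ℤ | z x ≠ x}.Finite ∧ z * z = 1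

/-- The set of involution words of `z`. -/
def Rinv (z : Equiv.Perm ℤ) : Set (List ℤ) :=
  {a | invHecke a = z ∧ ∀ b : List ℤ, invHecke b = z → a.length ≤ b.length}

/-- 0-based index `k` is a commutation in the word `a` (this corresponds to the 1-based
index `k+1`): `a_{k+1}` and `a_{k+1} + 1` are both fixed points of
`s_{a_k} ∘ ⋯ ∘ s_{a_1} ∘ ⋯ ∘ s_{a_k}`. -/
def IsCommutation (a : List ℤ) (k : ℕ) : Prop :=
  ∃ x, a[k]? = some x ∧ invHecke (a.take k) x = x ∧ invHecke (a.take k) (x + 1) = x + 1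

/-- The set of primed involution words of `z`. -/
def RinvPlus (z : Equiv.Perm ℤ) : Set PWord :=
  {a | unprimeWord a ∈ Rinv z ∧
     ∀ (k : ℕ) (x : Letter), a[k]? = some x → x.primed = true →
       IsCommutation (unprimeWord a) k}

/-! ## Shifted tableaux.
A shifted tableau is recorded as its list of rows, from the first (bottom) row upward;
the entry at 0-based index `k` of 0-based row `r` occupies the box in row `r+1` and
column `r+1+k` of the shifted diagram. -/

abbrev STab := List (List Letter)

/-- A strict partition, recorded as its (strictly decreasing) list of positive parts. -/
def IsStrictPartition (sh : List ℕ) : Prop :=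
  List.Chain' (fun a b => b < a) sh ∧ ∀ m ∈ sh, 0 < m

def shapeOf {α : Type*} (T : List (List α)) : List ℕ := T.map List.length

/-- The rows form the shifted diagram of a strict partition. -/
def IsShifted {α : Type*} (T : List (List α)) : Prop := IsStrictPartition (shapeOf T)

/-- The entry of `T` in (0-based) row `r` and column `c` of the shifted diagram. -/
def entryG? {α : Type*} (T : List (List α)) (r c : ℕ) : Option α :=
  if r ≤ c then (T[r]?).bind (fun row => row[c - r]?) else none

def entry? (T : STab) (r c : ℕ) : Option Letter := entryG? T r c

def setRowG {α : Type*} (T : List (List α)) (r : ℕ) (row : List α) : List (List α) :=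
  if r < T.length then T.set r row else T ++ [row]

def setEntryG {α : Type*} (T : List (List α)) (r c : ℕ) (x : α) : List (List α) :=
  T.set r ((T.getD r []).set (c - r) x)

def numCols {α : Type*} (T : List (List α)) : ℕ := (T.getD 0 []).length

/-- Row reading word: rows left to right, starting with the last (top) row. -/
def rowWord (T : STab) : PWord := T.reverse.flatten

/-- Column reading word: columns top to bottom, starting with the first column. -/
def colWord (T : STab) : PWord :=
  (List.range (numCols T)).flatMap (fun c =>
    ((List.range (c + 1)).reverse).filterMap (fun r => entry? T r c))

def unprimeT (T : STab) : STab := T.map (List.map Letter.unprime)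

/-- Remove the primes from all main-diagonal entries. -/
def unprimeDiagT (T : STab) : STab :=
  T.map (fun row =>
    match row with
    | [] => []
    | x :: rest => Letter.unprime x :: rest)

/-- Rows and columns are strictly increasing. -/
def IsIncreasing (T : STab) : Prop :=
  (∀ r c x y, entry? T r c = some x → entry? T r (c + 1) = some y → x < y) ∧
  (∀ r c x y, entry? T r c = some x → entry? T (r + 1) c = some y → x < y)

/-- No primed entries on the main diagonal. -/
def NoDiagPrimes (T : STab) : Prop :=
  ∀ r x, entry? T r r = some x → x.primed = false

/-- Entries positive, rows and columns weakly increasing, no primed entry repeated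
in a row and no unprimed entry repeated in a column. -/
def IsSemistandard (T : STab) : Prop :=
  (∀ x ∈ T.flatten, 0 < x.ceil) ∧
  (∀ r c x y, entry? T r c = some x → entry? T r (c + 1) = some y → x ≤ y) ∧
  (∀ r c x y, entry? T r c = some x → entry? T (r + 1) c = some y → x ≤ y) ∧
  (∀ r c c' x, c < c' → entry? T r c = some x → entry? T r c' = some x →
    x.primed = false) ∧
  (∀ r r' c x, r < r' → entry? T r c = some x → entry? T r' c = some x →
    x.primed = true)

/-- Increasing, with exactly one of `i` or `i'` as an entry for each `i = 1, …, n`,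
where `n` is the number of boxes. -/
def IsStandard (T : STab) : Prop :=
  IsIncreasing T ∧
  ∀ i : ℤ, 1 ≤ i → i ≤ (T.flatten.length : ℤ) →
    T.flatten.countP (fun x => decide (x.ceil = i)) = 1
/-! ## Orthogonal Edelman–Greene insertion -/

/-- "Switching the primes" of a pair: reverse the primes on both letters if exactly one
of them is unprimed, and leave them unchanged otherwise. -/
def switchPrimes (x y : Letter) : Letter × Letter :=
  if x.primed = y.primed then (x, y)
  else (⟨x.ceil, !x.primed⟩, ⟨y.ceil, !y.primed⟩)

/-- Column-insertion stage of orthogonal Edelman–Greene insertion: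
insert letter `w` into column `c` of `T` (then continue into later columns). -/
def egCol : ℕ → STab → ℕ → Letter → STab × Bool
  | 0, T, _, _ => (T, true)
  | fuel + 1, T, c, w =>
    let occ := (List.range (c + 1)).filterMap (fun r => (entry? T r c).map (fun x => (r, x)))
    match occ.findIdx? (fun p => decide (w.ceil < p.2.ceil)) with
    | none =>
        -- place `w` in the first empty box of the column
        let r := occ.length
        let w' := if r = c ∧ w.primed then Letter.unprime w else w
        (setRowG T r ((T.getD r []) ++ [w']), if r = c then w.primed else true)
    | some kM =>
        let km := (occ.findIdx? (fun p => decide (w.ceil ≤ p.2.ceil))).getD kM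
        let im := (occ.getD km (0, default)).1
        let m := (occ.getD km (0, default)).2
        if km = kM then
          if im = c then
            -- m = M on the main diagonal
            egCol fuel (setEntryG T im c (Letter.unprime w)) (c + 1) ⟨m.ceil, w.primed⟩
          else
            -- m = M off the main diagonal
            egCol fuel (setEntryG T im c w) (c + 1) m
        else
          -- m < M : switch the primes on m and M, insert w+1 into the next column
          let iM := (occ.getD kM (0, default)).1
          let M := (occ.getD kM (0, default)).2
          let p := switchPrimes m M
          egCol fuel (setEntryG (setEntryG T im c p.1) iM c p.2) (c + 1) (Letter.succL w)

/-- Row-insertion stage of orthogonal Edelman–Greene insertion: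
insert letter `w` into row `r` of `T`. -/
def egRow : ℕ → STab → ℕ → Letter → STab × Bool
  | 0, T, _, _ => (T, true)
  | fuel + 1, T, r, w =>
    let row := T.getD r []
    match row.findIdx? (fun x => decide (w.ceil < x.ceil)) with
    | none =>
        if row.isEmpty ∧ w.primed then (setRowG T r [Letter.unprime w], true)
        else (setRowG T r (row ++ [w]), false)
    | some kM =>
        let km := (row.findIdx? (fun x => decide (w.ceil ≤ x.ceil))).getD kM
        let m := row.getD km default
        if km = kM then
          if km = 0 then
            -- m = M on the main diagonal
            egCol fuel (setRowG T r (row.set 0 (Letter.unprime w))) (r + 1)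
              ⟨m.ceil, w.primed⟩
          else
            -- m = M off the main diagonal
            egRow fuel (setRowG T r (row.set km w)) (r + 1) m
        else
          -- m < M : switch primes; insert w+1 into the next column (if m is on the
          -- main diagonal) or the next row (otherwise)
          let M := row.getD kM default
          let p := switchPrimes m M
          let row' := (row.set km p.1).set kM p.2
          if km = 0 then egCol fuel (setRowG T r row') (r + 1) (Letter.succL w)
          else egRow fuel (setRowG T r row') (r + 1) (Letter.succL w)

/-- `T ←ᴼ u` together with the flag recording whether the insertion ended in
column insertion. -/
def egInsert (T : STab) (u : Letter) : STab × Bool :=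
  egRow (T.flatten.length + T.length + 2) T 0 u

/-- The orthogonal Edelman–Greene insertion tableau `P_EGᴼ(a)`. -/
def PEG (a : PWord) : STab := a.foldl (fun T u => (egInsert T u).1) []

/-- Add the recording letter `x` to `Q` in the unique box of `Pnew` not in `Pold`. -/
def addBox (Q Pold Pnew : STab) (x : Letter) : STab :=
  match (List.range Pnew.length).find?
      (fun r => decide ((Pold.getD r []).length ≠ (Pnew.getD r []).length)) with
  | some r => setRowG Q r ((Q.getD r []) ++ [x])
  | none => Q

def QEGaux : STab → STab → ℕ → PWord → STab
  | _, Q, _, [] => Q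
  | P, Q, n, u :: rest =>
      let res := egInsert P u
      QEGaux res.1 (addBox Q P res.1 ⟨(n : ℤ), res.2⟩) (n + 1) rest

/-- The orthogonal Edelman–Greene recording tableau `Q_EGᴼ(a)`. -/
def QEG (a : PWord) : STab := QEGaux [] [] 1 a

/-! ## Orthogonal Coxeter–Knuth operators -/

def ock1 (x : Letter) : Letter := ⟨x.ceil, !x.primed⟩

def ock2 (x y : Letter) : Letter × Letter := (⟨y.ceil, x.primed⟩, ⟨x.ceil, y.primed⟩)

def ock3 (x y z : Letter) : Letter × Letter × Letter :=
  if x.ceil = z.ceil ∧ (x.ceil - y.ceil = 1 ∨ y.ceil - x.ceil = 1) then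
    if x.primed = false ∧ y.primed = false ∧ z.primed = false then
      -- XYX ↔ YXY
      (⟨y.ceil, false⟩, ⟨x.ceil, false⟩, ⟨y.ceil, false⟩)
    else if x.primed = true ∧ y.primed = false ∧ z.primed = false then
      -- X'YX ↦ YXY'
      (⟨y.ceil, false⟩, ⟨x.ceil, false⟩, ⟨y.ceil, true⟩)
    else if x.primed = false ∧ y.primed = false ∧ z.primed = true then
      -- YXY' ↦ X'YX
      (⟨y.ceil, true⟩, ⟨x.ceil, false⟩, ⟨y.ceil, false⟩)
    else (x, y, z)
  else if (x.ceil < z.ceil ∧ z.ceil < y.ceil) ∨ (y.ceil < z.ceil ∧ z.ceil < x.ceil) then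
    -- ACB ↔ CAB
    (y, x, z)
  else if (y.ceil < x.ceil ∧ x.ceil < z.ceil) ∨ (z.ceil < x.ceil ∧ x.ceil < y.ceil) then
    -- BCA ↔ BAC
    (x, z, y)
  else (x, y, z)

/-- The operator `ock_i` for `i ∈ ℤ`. -/
def ockW (i : ℤ) (a : PWord) : PWord :=
  if i = -1 then
    match a with
    | [] => []
    | x :: rest => ock1 x :: rest
  else if i = 0 then
    match a with
    | x :: y :: rest => (ock2 x y).1 :: (ock2 x y).2 :: rest
    | _ => a
  else if 1 ≤ i ∧ i + 2 ≤ (a.length : ℤ) then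
    let k := (i - 1).toNat
    match a[k]?, a[k + 1]?, a[k + 2]? with
    | some x, some y, some z =>
        a.take k ++ [(ock3 x y z).1, (ock3 x y z).2.1, (ock3 x y z).2.2] ++ a.drop (k + 3)
    | _, _, _ => a
  else a

/-- Orthogonal Coxeter–Knuth equivalence: generated by `a ∼ ock_i(a)` for all `i ∈ ℤ`. -/
def OckEquiv : PWord → PWord → Prop :=
  Relation.EqvGen (fun a b => ∃ i : ℤ, b = ockW i a)
/-! ## Descents -/

/-- Descent set of a primed word (as a set of 1-based positions). -/
def DesWord (a : PWord) : Set ℤ :=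
  {i | ∃ k : ℕ, i = (k : ℤ) + 1 ∧ ∃ x y, a[k]? = some x ∧ a[k + 1]? = some y ∧ y < x}

/-- Descent set of a standard shifted tableau. -/
def DesT (T : STab) : Set ℤ :=
  {i | 0 < i ∧ (
    (∃ r c r' c', entry? T r c = some ⟨i, false⟩ ∧
        entry? T r' c' = some ⟨i + 1, false⟩ ∧ r < r') ∨
    (∃ r c r' c', entry? T r c = some ⟨i, true⟩ ∧
        entry? T r' c' = some ⟨i + 1, true⟩ ∧ c < c') ∨
    (∃ r c r' c', entry? T r c = some ⟨i, false⟩ ∧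
        entry? T r' c' = some ⟨i + 1, true⟩))}

/-! ## Dual equivalence operators on standard shifted tableaux -/

def numPrimes (T : STab) : ℕ := T.flatten.countP (fun x => x.primed)

/-- The entries of column `c`, read from bottom to top (increasing). -/
def colLetters (T : STab) (c : ℕ) : PWord :=
  (List.range (c + 1)).filterMap (fun r => entry? T r c)

/-- The shifted reading word `unprime(C_q R_q ⋯ C_1 R_1)`. -/
def shword (T : STab) : List ℤ :=
  (((List.range (numCols T)).reverse).flatMap (fun idx =>
    (colLetters T idx).filter (fun x => x.primed) ++
      ((T.getD idx []).filter (fun x => !x.primed)))).map Letter.ceil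

def idxOfZ (v : ℤ) : List ℤ → ℕ
  | [] => 0
  | x :: r => if x = v then 0 else idxOfZ v r + 1

def positionsOf (T : STab) : List (ℕ × ℕ) :=
  (List.range T.length).flatMap (fun r =>
    (List.range (T.getD r []).length).map (fun k => (r, r + k)))

/-- The box `□_v` of `T` containing `v` or `v'`. -/
def boxOf (T : STab) (v : ℤ) : Option (ℕ × ℕ) :=
  (positionsOf T).find? (fun p =>
    match entry? T p.1 p.2 with
    | some x => decide (x.ceil = v)
    | none => false)

/-- Reverse the prime of the entry in position `(r, c)`. -/
def togglePos (T : STab) (r c : ℕ) : STab :=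
  match entry? T r c with
  | some x => setEntryG T r c ⟨x.ceil, !x.primed⟩
  | none => T

/-- Switch the primes of the entries in the two given positions. -/
def switchAt (T : STab) (p q : ℕ × ℕ) : STab :=
  match entry? T p.1 p.2, entry? T q.1 q.2 with
  | some x, some y =>
      if x.primed = y.primed then T else togglePos (togglePos T p.1 p.2) q.1 q.2
  | _, _ => T

/-- The row index of `□_v` if it is a main-diagonal box. -/
def diagBox? (T : STab) (v : ℤ) : Option ℕ :=
  (boxOf T v).bind (fun p => if p.1 = p.2 then some p.1 else none)

def switchDiag (T T' : STab) (u v : ℤ) : STab :=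
  match diagBox? T u, diagBox? T v with
  | some r, some s => switchAt T' (r, r) (s, s)
  | _, _ => T'

/-- The operator `𝔰_i`. -/
def sOp (i : ℤ) (T : STab) : STab :=
  match boxOf T i, boxOf T (i + 1) with
  | some (r1, c1), some (r2, c2) =>
      if r1 ≠ r2 ∧ c1 ≠ c2 then
        -- swap i ↔ i+1 and i' ↔ (i+1)'
        setEntryG (setEntryG T r1 c1 ⟨i + 1, ((entry? T r1 c1).getD default).primed⟩)
          r2 c2 ⟨i, ((entry? T r2 c2).getD default).primed⟩
      else if r1 ≠ c1 ∧ r2 ≠ c2 then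
        -- same row or column, neither box diagonal: reverse both primes
        togglePos (togglePos T r1 c1) r2 c2
      else
        -- same row or column, one box diagonal
        let T1 := if r1 = c1 then togglePos T r2 c2 else togglePos T r1 c1
        let T2 :=
          if 1 ≤ i - 1 ∧ (diagBox? T (i - 1)).isSome ∧ (diagBox? T (i + 1)).isSome then
            switchDiag T T1 (i - 1) (i + 1)
          else T1
        if i + 2 ≤ (T.flatten.length : ℤ) ∧ (diagBox? T i).isSome ∧
            (diagBox? T (i + 2)).isSome then
          switchDiag T T2 i (i + 2)
        else T2
  | _, _ => T

def btwn (a m b : ℕ) : Prop := (a < m ∧ m < b) ∨ (b < m ∧ m < a)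

instance (a m b : ℕ) : Decidable (btwn a m b) := by unfold btwn; infer_instance

/-- The dual equivalence operator `𝔡_i` for `i ∈ ℤ`. -/
def dOp (i : ℤ) (T : STab) : STab :=
  if ¬(1 ≤ i + 2 ∧ i + 2 ≤ (T.flatten.length : ℤ)) then T
  else if i = -1 then togglePos T 0 0
  else if i = 0 then togglePos T 0 1
  else
    let w := shword T
    if btwn (idxOfZ i w) (idxOfZ (i + 2) w) (idxOfZ (i + 1) w) then sOp i T
    else if btwn (idxOfZ (i + 1) w) (idxOfZ i w) (idxOfZ (i + 2) w) then sOp (i + 1) T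
    else T

/-! ## Marked cycles -/

/-- The 2-cycles of `z`, as ordered pairs `(i, j)` with `i < j = z(i)`. -/
def cycSet (z : Equiv.Perm ℤ) : Set (ℤ × ℤ) := {p | p.1 < p.2 ∧ z p.1 = p.2}

/-- `s_{a_n} ⋯ s_{a_{k+2}} s_{a_{k+1}}` (ordinary product; 0-based index `k`). -/
def suffixPerm (a : List ℤ) (k : ℕ) : Equiv.Perm ℤ :=
  ((a.drop (k + 1)).reverse.map sPerm).prod

/-- `γ_{k+1}(a)` as an ordered pair (junk value `(0,0)` off the commutation set). -/
def gammaPair (a : List ℤ) (k : ℕ) : ℤ × ℤ :=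
  match a[k]? with
  | some x => (min (suffixPerm a k x) (suffixPerm a k (x + 1)),
               max (suffixPerm a k x) (suffixPerm a k (x + 1)))
  | none => (0, 0)
/-! ## Increasing factorization sequences and Schur Q-functions -/

/-- `Incr_∞(R_inv^+(z))`: sequences of weakly increasing primed words, all but
finitely many empty, whose concatenation is a primed involution word for `z`. -/
def IncrSeq (z : Equiv.Perm ℤ) : Set (ℕ → PWord) :=
  {φ | (∀ n, List.Chain' (· ≤ ·) (φ n)) ∧
    ∃ N, (∀ n, N ≤ n → φ n = []) ∧ ((List.range N).map φ).flatten ∈ RinvPlus z}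

/-- Least bound past which a sequence of words is empty. -/
noncomputable def seqBound (φ : ℕ → PWord) : ℕ := sInf {N | ∀ n, N ≤ n → φ n = []}

/-- The concatenation `a^1 a^2 ⋯` of a sequence of words. -/
noncomputable def concatSeq (φ : ℕ → PWord) : PWord :=
  ((List.range (seqBound φ)).map φ).flatten

/-- `ℓ(a^1) + ⋯ + ℓ(a^i)`. -/
def prefLen (φ : ℕ → PWord) (i : ℕ) : ℕ := (((List.range i).map φ).map List.length).sum

/-- The minimal `i ≥ 1` with `j ≤ ℓ(a^1) + ⋯ + ℓ(a^i)`. -/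
noncomputable def relabel (φ : ℕ → PWord) (j : ℤ) : ℤ :=
  ((sInf {i : ℕ | 1 ≤ i ∧ j ≤ (prefLen φ i : ℤ)} : ℕ) : ℤ)

/-- The semistandard recording tableau `Q_EGᴼ(φ)`. -/
noncomputable def QEGseq (φ : ℕ → PWord) : STab :=
  (QEG (concatSeq φ)).map (List.map (fun x => (⟨relabel φ x.ceil, x.primed⟩ : Letter)))

/-- The insertion tableau `P_EGᴼ(φ)`. -/
noncomputable def PEGseq (φ : ℕ → PWord) : STab := PEG (concatSeq φ)

/-- The Schur Q-function of a strict partition: the coefficient of the monomial with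
exponent vector `d` is the number of semistandard shifted tableaux `T` of the given
shape with `x^T = x^d`. -/
noncomputable def SchurQ (sh : List ℕ) : MvPowerSeries ℤ ℤ :=
  fun d => (({T : STab | shapeOf T = sh ∧ IsSemistandard T ∧
    ∀ i : ℤ, d i = T.flatten.countP (fun x => decide (x.ceil = i))} : Set STab).ncard : ℤ)

/-- `Q_z = Σ_{φ ∈ Incr_∞(R_inv^+(z))} x^φ`. -/
noncomputable def Qz (z : Equiv.Perm ℤ) : MvPowerSeries ℤ ℤ :=
  fun d => (({φ : ℕ → PWord | φ ∈ IncrSeq z ∧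
    (∀ i : ℕ, d ((i : ℤ) + 1) = (φ i).length) ∧
    (∀ j : ℤ, j ≤ 0 → d j = 0)} : Set (ℕ → PWord)).ncard : ℤ)

/-! ## Dominant involutions -/

/-- The shifted diagram `SD_λ ⊆ ℤ × ℤ` of a strict partition. -/
def SDset (sh : List ℕ) : Set (ℤ × ℤ) :=
  {p | ∃ i j : ℕ, 1 ≤ i ∧ i ≤ sh.length ∧ 1 ≤ j ∧ j ≤ sh.getD (i - 1) 0 ∧
    p.1 = (i : ℤ) ∧ p.2 = (i : ℤ) + (j : ℤ) - 1}

/-- The involution Rothe diagram `D̂(z) = {(i,j) : z(i) > j ≤ i < z(j)}`. -/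
def invRothe (z : Equiv.Perm ℤ) : Set (ℤ × ℤ) :=
  {p | p.2 < z p.1 ∧ p.2 ≤ p.1 ∧ p.1 < z p.2}

/-- The tableau `T_λ` with entry `i + j - 1` in box `(i, j)` of `SD_λ`. -/
def Tlam (sh : List ℕ) : STab :=
  (List.range sh.length).map (fun r =>
    (List.range (sh.getD r 0)).map (fun k =>
      (⟨2 * (r : ℤ) + (k : ℤ) + 1, false⟩ : Letter)))

/-- The permutation `i + m ↦ w(i) + m` (fixing everything outside `m + support`). -/
def shiftPerm (m : ℕ) (w : Equiv.Perm ℤ) : Equiv.Perm ℤ :=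
  (Equiv.addLeft (m : ℤ)).permCongr w

/-- `z ∈ S_m`: `z` fixes every point outside `[1, m]`. -/
def SupportedOn (z : Equiv.Perm ℤ) (m : ℕ) : Prop :=
  ∀ x : ℤ, x < 1 ∨ (m : ℤ) < x → z x = x
/-! ## Primed compatible sequences -/

/-- A primed compatible sequence, recorded as the list of its columns `(index; value)`. -/
def IsPrimedCompatible (φ : List (ℕ × Letter)) : Prop :=
  (∀ p ∈ φ, 0 < p.1 ∧ 0 < p.2.ceil) ∧
  List.Chain' (fun p q : ℕ × Letter => p.1 ≤ q.1 ∧ (p.1 = q.1 → p.2 ≤ q.2)) φ ∧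
  (∀ (k l : ℕ) (p : ℕ × Letter), k < l → φ[k]? = some p → φ[l]? = some p →
    p.2.primed = false)

def IsIndexStrict (φ : List (ℕ × Letter)) : Prop :=
  List.Chain' (fun p q : ℕ × Letter => p.1 < q.1) φ

/-! ## Sagan–Worley insertion (orthogonal and symplectic versions) -/

/-- Whether `u` bumps `v`: strict comparison when inserting an unprimed letter into a
row or a primed letter into a column, weak comparison otherwise. -/
def swBump (isRow : Bool) (u v : Letter) : Bool :=
  if (isRow && !u.primed) || (!isRow && u.primed) then decide (u < v) else decide (u ≤ v)

/-- Column stage of orthogonal Sagan–Worley insertion. -/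
def swColO : ℕ → STab → ℕ → Letter → STab × Bool
  | 0, T, _, _ => (T, true)
  | fuel + 1, T, c, u =>
    let occ := (List.range (c + 1)).filterMap (fun r => (entry? T r c).map (fun x => (r, x)))
    match occ.find? (fun p => swBump false u p.2) with
    | none =>
        let r := occ.length
        let u' := if r = c ∧ u.primed then Letter.unprime u else u
        (setRowG T r ((T.getD r []) ++ [u']), true)
    | some p =>
        if p.1 = c then
          if u.ceil = p.2.ceil then swColO fuel T (c + 1) (Letter.unprime p.2)
          else
            let q := switchPrimes u p.2
            swColO fuel (setEntryG T p.1 c q.1) (c + 1) q.2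
        else swColO fuel (setEntryG T p.1 c u) (c + 1) p.2

/-- Row stage of orthogonal Sagan–Worley insertion. -/
def swRowO : ℕ → STab → ℕ → Letter → STab × Bool
  | 0, T, _, _ => (T, true)
  | fuel + 1, T, r, u =>
    let row := T.getD r []
    match row.findIdx? (fun v => swBump true u v) with
    | none =>
        if row.isEmpty ∧ u.primed then (setRowG T r [Letter.unprime u], true)
        else (setRowG T r (row ++ [u]), false)
    | some k =>
        let v := row.getD k default
        if k = 0 then
          if u.ceil = v.ceil then swColO fuel T (r + 1) (Letter.unprime v)
          else
            let q := switchPrimes u v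
            swColO fuel (setRowG T r (row.set 0 q.1)) (r + 1) q.2
        else swRowO fuel (setRowG T r (row.set k u)) (r + 1) v

def swInsertO (T : STab) (u : Letter) : STab × Bool :=
  swRowO (T.flatten.length + T.length + 2) T 0 u

/-- Column stage of symplectic (original) Sagan–Worley insertion. -/
def swColSp : ℕ → STab → ℕ → Letter → STab × Bool
  | 0, T, _, _ => (T, true)
  | fuel + 1, T, c, u =>
    let occ := (List.range (c + 1)).filterMap (fun r => (entry? T r c).map (fun x => (r, x)))
    match occ.find? (fun p => swBump false u p.2) with
    | none => (setRowG T occ.length ((T.getD occ.length []) ++ [u]), true)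
    | some p =>
        if p.1 = c then
          if u.ceil = p.2.ceil then swColSp fuel T (c + 1) (Letter.unprime p.2)
          else swColSp fuel (setEntryG T p.1 c u) (c + 1) p.2
        else swColSp fuel (setEntryG T p.1 c u) (c + 1) p.2

/-- Row stage of symplectic (original) Sagan–Worley insertion. -/
def swRowSp : ℕ → STab → ℕ → Letter → STab × Bool
  | 0, T, _, _ => (T, true)
  | fuel + 1, T, r, u =>
    let row := T.getD r []
    match row.findIdx? (fun v => swBump true u v) with
    | none => (setRowG T r (row ++ [u]), false)
    | some k =>
        let v := row.getD k default
        if k = 0 then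
          if u.ceil = v.ceil then swColSp fuel T (r + 1) (Letter.unprime v)
          else swColSp fuel (setRowG T r (row.set 0 u)) (r + 1) v
        else swRowSp fuel (setRowG T r (row.set k u)) (r + 1) v

def swInsertSp (T : STab) (u : Letter) : STab × Bool :=
  swRowSp (T.flatten.length + T.length + 2) T 0 u

def PSWO (φ : List (ℕ × Letter)) : STab := φ.foldl (fun T p => (swInsertO T p.2).1) []

def PSWSp (φ : List (ℕ × Letter)) : STab := φ.foldl (fun T p => (swInsertSp T p.2).1) []

def QSWaux (ins : STab → Letter → STab × Bool) : STab → STab → List (ℕ × Letter) → STab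
  | _, Q, [] => Q
  | P, Q, p :: rest =>
      let res := ins P p.2
      QSWaux ins res.1 (addBox Q P res.1 ⟨(p.1 : ℤ), res.2⟩) rest

def QSWO (φ : List (ℕ × Letter)) : STab := QSWaux swInsertO [] [] φ

def QSWSp (φ : List (ℕ × Letter)) : STab := QSWaux swInsertSp [] [] φ

/-- Entry `A_{ij}` of the circled matrix of `φ` (forgetting the circles). -/
def cmEntry (φ : List (ℕ × Letter)) (i j : ℕ) : ℕ :=
  φ.countP (fun p => decide (p.1 = i ∧ p.2.ceil = (j : ℤ)))

/-! ## Shifted mixed insertion (orthogonal and symplectic versions) -/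

/-- Tableaux whose entries are signed letters `(ε, u)`, `ε ∈ {+, -}`
(`true` records the sign `-`). -/
abbrev MTab := List (List (Bool × Letter))

def extractO (U : MTab) : STab :=
  U.map (fun row =>
    match row with
    | [] => []
    | (e, x) :: rest => (if e then (⟨x.ceil, true⟩ : Letter) else x) :: rest.map Prod.snd)

def extractSp (U : MTab) : STab := U.map (List.map Prod.snd)

/-- One mixed insertion, of the pair `β` into row (`isCol = false`) or column
(`isCol = true`) number `idx`; returns the tableau and the added box. -/
def hmIns (sympl : Bool) : ℕ → MTab → Bool → ℕ → Bool × Letter → MTab × (ℕ × ℕ)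
  | 0, T, _, _, _ => (T, (0, 0))
  | fuel + 1, T, isCol, idx, β =>
    if isCol then
      let c := idx
      let occ := (List.range (c + 1)).filterMap
        (fun r => (entryG? T r c).map (fun x => (r, x)))
      match occ.find? (fun p => decide (β.2 < p.2.2)) with
      | none =>
          let r := occ.length
          (setRowG T r ((T.getD r []) ++ [β]), (r, c))
      | some p =>
          if p.1 = c then
            hmIns sympl fuel
              (setEntryG T p.1 c (if sympl then (p.2.1, β.2) else β)) true (c + 1)
              (if sympl then (β.1, ⟨p.2.2.ceil, true⟩) else (p.2.1, ⟨p.2.2.ceil, true⟩))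
          else
            hmIns sympl fuel (setEntryG T p.1 c (p.2.1, β.2)) p.2.2.primed
              (if p.2.2.primed then c + 1 else p.1 + 1) (β.1, p.2.2)
    else
      let r := idx
      let row := T.getD r []
      match row.findIdx? (fun p => decide (β.2 < p.2)) with
      | none => (setRowG T r (row ++ [β]), (r, r + row.length))
      | some k =>
          let q := row.getD k default
          if k = 0 then
            hmIns sympl fuel
              (setRowG T r (row.set 0 (if sympl then (q.1, β.2) else β))) true (r + 1)
              (if sympl then (β.1, ⟨q.2.ceil, true⟩) else (q.1, ⟨q.2.ceil, true⟩))
          else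
            hmIns sympl fuel (setRowG T r (row.set k (q.1, β.2))) q.2.primed
              (if q.2.primed then r + k + 1 else r + 1) (β.1, q.2)

def hmInsert (sympl : Bool) (T : MTab) (x : Letter) : MTab × (ℕ × ℕ) :=
  hmIns sympl (2 * T.flatten.length + 4) T false 0 (x.primed, ⟨x.ceil, false⟩)

def hmAuxCS (sympl : Bool) : MTab → STab → List (ℕ × Letter) → MTab × STab
  | U, Q, [] => (U, Q)
  | U, Q, p :: rest =>
      let res := hmInsert sympl U p.2
      let pos := res.2
      let sgn := ((entryG? res.1 pos.1 pos.2).map Prod.fst).getD false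
      let pr : Bool := if sympl then sgn else (decide (pos.1 ≠ pos.2) && sgn)
      hmAuxCS sympl res.1
        (setRowG Q pos.1 ((Q.getD pos.1 []) ++ [(⟨(p.1 : ℤ), pr⟩ : Letter)])) rest

def PHMO (φ : List (ℕ × Letter)) : STab := extractO (hmAuxCS false [] [] φ).1
def QHMO (φ : List (ℕ × Letter)) : STab := (hmAuxCS false [] [] φ).2
def PHMSp (φ : List (ℕ × Letter)) : STab := extractSp (hmAuxCS true [] [] φ).1
def QHMSp (φ : List (ℕ × Letter)) : STab := (hmAuxCS true [] [] φ).2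

/-- A primed word, identified with the primed compatible sequence with
index row `1, 2, …, n`. -/
def wordCS (a : PWord) : List (ℕ × Letter) :=
  ((List.range a.length).zip a).map (fun p => (p.1 + 1, p.2))

/-! ## The transpose of a primed compatible sequence -/

def insSortedCS (p : ℕ × Letter) : List (ℕ × Letter) → List (ℕ × Letter)
  | [] => [p]
  | q :: rest =>
      if p.1 < q.1 ∨ (p.1 = q.1 ∧ p.2 ≤ q.2) then p :: q :: rest
      else q :: insSortedCS p rest

def sortCS (l : List (ℕ × Letter)) : List (ℕ × Letter) := l.foldr insSortedCS []

/-- `φ^⊤`: move each prime from the value to the index above it, interchange the two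
rows, and reorder the columns lexicographically. -/
def transposeCS (φ : List (ℕ × Letter)) : List (ℕ × Letter) :=
  sortCS (φ.map (fun p => (p.2.ceil.toNat, (⟨(p.1 : ℤ), p.2.primed⟩ : Letter))))

/-! ## Demazure actions and involution words -/

abbrev PZ := Equiv.Perm ℤ

theorem sPerm_apply (x t : ℤ) :
    sPerm x t = if t = x then x + 1 else if t = x + 1 then x else t := by
  simp [sPerm, Equiv.swap_apply_def]

theorem sPerm_mul_self (x : ℤ) : sPerm x * sPerm x = 1 := by
  simp [sPerm]

theorem sPerm_inv (x : ℤ) : (sPerm x)⁻¹ = sPerm x := by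
  simp [sPerm]

/-- Right Demazure multiplication by `s_x`. -/
def dR (x : ℤ) (σ : PZ) : PZ := if σ x < σ (x + 1) then σ * sPerm x else σ

theorem dR_pos {x : ℤ} {σ : PZ} (h : σ x < σ (x + 1)) : dR x σ = σ * sPerm x := if_pos h

/-- Left Demazure multiplication by `s_x`. -/
def dL (x : ℤ) (σ : PZ) : PZ := if σ.symm x < σ.symm (x + 1) then sPerm x * σ else σ

theorem sPerm_lt_iff {y p q : ℤ} (h : ¬ (p = y ∧ q = y + 1)) (h' : ¬ (p = y + 1 ∧ q = y)) :
    sPerm y p < sPerm y q ↔ p < q := by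
  simp only [sPerm_apply]; split_ifs <;> omega

theorem mul_sPerm_eq {σ : PZ} {x y : ℤ} (h1 : σ y = x) (h2 : σ (y + 1) = x + 1) :
    σ * sPerm y = sPerm x * σ := by
  ext t
  simp only [Equiv.Perm.mul_apply, sPerm_apply]
  have h3 : σ t = x ↔ t = y := by rw [← h1]; exact σ.injective.eq_iff
  have h4 : σ t = x + 1 ↔ t = y + 1 := by rw [← h2]; exact σ.injective.eq_iff
  simp only [h3, h4]
  split_ifs <;> simp_all

theorem symm_mul_sPerm (σ : PZ) (y t : ℤ) : (σ * sPerm y).symm t = sPerm y (σ.symm t) := by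
  rw [Equiv.symm_apply_eq]; simp [sPerm]

theorem dL_dR (x y : ℤ) (σ : PZ) : dL x (dR y σ) = dR y (dL x σ) := by
  by_cases h1 : σ y = x ∧ σ (y + 1) = x + 1
  · obtain ⟨h1, h2⟩ := h1
    have e1 : σ.symm x = y := by rw [← h1]; simp
    have e2 : σ.symm (x + 1) = y + 1 := by rw [← h2]; simp
    have a : dR y σ = σ * sPerm y := by simp [dR, h1, h2]
    have b : dL x σ = sPerm x * σ := by simp [dL, e1, e2]
    have c : dL x (σ * sPerm y) = σ * sPerm y := by
      simp [dL, symm_mul_sPerm, e1, e2, sPerm_apply]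
    have d : dR y (sPerm x * σ) = sPerm x * σ := by
      simp [dR, h1, h2, sPerm_apply]
    rw [a, b, c, d, mul_sPerm_eq h1 h2]
  by_cases h2 : σ y = x + 1 ∧ σ (y + 1) = x
  · obtain ⟨h1, h2⟩ := h2
    have e1 : σ.symm x = y + 1 := by rw [← h2]; simp
    have e2 : σ.symm (x + 1) = y := by rw [← h1]; simp
    have a : dR y σ = σ := by unfold dR; rw [if_neg]; omega
    have b : dL x σ = σ := by unfold dL; rw [if_neg]; omega
    rw [a, b, a]
  have c1 : sPerm y (σ.symm x) < sPerm y (σ.symm (x + 1)) ↔ σ.symm x < σ.symm (x + 1) := by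
    apply sPerm_lt_iff
    · rintro ⟨a, b⟩; exact h1 ⟨by rw [← a]; simp, by rw [← b]; simp⟩
    · rintro ⟨a, b⟩; exact h2 ⟨by rw [← b]; simp, by rw [← a]; simp⟩
  have c2 : sPerm x (σ y) < sPerm x (σ (y + 1)) ↔ σ y < σ (y + 1) :=
    sPerm_lt_iff h1 h2
  by_cases a : σ y < σ (y + 1) <;> by_cases b : σ.symm x < σ.symm (x + 1) <;>
    simp only [dL, dR, symm_mul_sPerm, Equiv.Perm.mul_apply, a, b, c1, c2, if_true, if_false,
      mul_assoc]

theorem heckeProd_append (w : List ℤ) (x : ℤ) : heckeProd (w ++ [x]) = dR x (heckeProd w) := by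
  rw [heckeProd, List.foldl_append]; rfl

theorem heckeProd_cons (w : List ℤ) (x : ℤ) : heckeProd (x :: w) = dL x (heckeProd w) := by
  induction w using List.reverseRecOn with
  | nil => rw [heckeProd, dL, if_pos]; · simp [heckeProd]
           · change x < x + 1; omega
  | append_singleton w y ih =>
    rw [← List.cons_append, heckeProd_append, heckeProd_append, ih, dL_dR]

/-- The Demazure conjugation action of `s_x` on involutions. -/
def act (y : PZ) (x : ℤ) : PZ :=
  if y x < y (x + 1) then
    if y x = x ∧ y (x + 1) = x + 1 then y * sPerm x else sPerm x * y * sPerm x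
  else y

theorem apply_self {y : PZ} (h : y * y = 1) (t : ℤ) : y (y t) = t := by
  rw [← Equiv.Perm.mul_apply, h]; rfl

theorem symm_apply_self {y : PZ} (h : y * y = 1) (t : ℤ) : y.symm t = y t := by
  rw [Equiv.symm_apply_eq, apply_self h]

theorem act_eq {y : PZ} (h : y * y = 1) (x : ℤ) : act y x = dR x (dL x y) := by
  rw [← dL_dR]
  by_cases a : y x < y (x + 1)
  · rw [dR_pos a]
    by_cases b : y x = x ∧ y (x + 1) = x + 1
    · simp only [act, b, dL, symm_mul_sPerm, symm_apply_self h, sPerm_apply]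
      simp
    · have c : sPerm x (y x) < sPerm x (y (x + 1)) ↔ y x < y (x + 1) := by
        apply sPerm_lt_iff b; omega
      simp only [act, a, b, dL, symm_mul_sPerm, symm_apply_self h, c, if_true, if_false, mul_assoc]
  · simp only [act, a, dL, dR, symm_apply_self h, if_false]

theorem act_mul_self {y : PZ} (h : y * y = 1) (x : ℤ) : act y x * act y x = 1 := by
  unfold act
  split_ifs with a b
  · have := mul_sPerm_eq b.1 b.2
    calc y * sPerm x * (y * sPerm x) = y * (sPerm x * y) * sPerm x := by group
      _ = (y * y) * (sPerm x * sPerm x) := by rw [← this]; group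
      _ = 1 := by rw [h, sPerm_mul_self]; simp
  · calc sPerm x * y * sPerm x * (sPerm x * y * sPerm x)
        = sPerm x * y * (sPerm x * sPerm x) * y * sPerm x := by group
      _ = sPerm x * (y * y) * sPerm x := by rw [sPerm_mul_self]; group
      _ = 1 := by rw [h]; simp [sPerm_mul_self]
  · exact h

theorem foldl_act_mul_self (a : List ℤ) {y : PZ} (h : y * y = 1) :
    a.foldl act y * a.foldl act y = 1 := by
  induction a generalizing y with
  | nil => simpa
  | cons x a ih => exact ih (act_mul_self h x)

theorem invHecke_eq (a : List ℤ) : invHecke a = a.foldl act 1 := by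
  induction a using List.reverseRecOn with
  | nil => simp [invHecke, heckeProd]
  | append_singleton a x ih =>
    rw [List.foldl_append, ← ih]
    have hi : invHecke a * invHecke a = 1 := by
      rw [ih]; exact foldl_act_mul_self _ (by simp)
    simp only [List.foldl_cons, List.foldl_nil]
    cases a with
    | nil => simp [invHecke, heckeProd, act]
    | cons b a =>
      rw [act_eq hi, ← dL_dR]
      simp only [invHecke, List.reverse_append, List.reverse_cons, List.reverse_nil,
        List.nil_append, List.cons_append, List.tail_cons]
      rw [heckeProd_cons, ← heckeProd_append]
      simp

theorem sPerm_braid (x : ℤ) :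
    sPerm x * sPerm (x + 1) * sPerm x = sPerm (x + 1) * sPerm x * sPerm (x + 1) := by
  simp only [sPerm]
  rw [Equiv.swap_mul_swap_mul_swap (by omega) (by omega), Equiv.swap_comm (x + 1),
      Equiv.swap_comm x (x + 1), Equiv.swap_mul_swap_mul_swap (by omega) (by omega),
      Equiv.swap_comm]

theorem dR_braid (x : ℤ) (σ : PZ) :
    dR x (dR (x + 1) (dR x σ)) = dR (x + 1) (dR x (dR (x + 1) σ)) := by
  have h1 : σ x ≠ σ (x + 1) := by simp
  have h2 : σ x ≠ σ (x + 1 + 1) := by rw [Ne, σ.injective.eq_iff]; omega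
  have h3 : σ (x + 1) ≠ σ (x + 1 + 1) := by simp
  have hb := sPerm_braid x
  have e1 : sPerm x x = x + 1 := by simp [sPerm_apply]
  have e2 : sPerm x (x + 1) = x := by simp [sPerm_apply]
  have e3 : sPerm x (x + 1 + 1) = x + 1 + 1 := by rw [sPerm_apply, if_neg (by omega), if_neg (by omega)]
  have e4 : sPerm (x + 1) x = x := by rw [sPerm_apply, if_neg (by omega), if_neg (by omega)]
  have e5 : sPerm (x + 1) (x + 1) = x + 1 + 1 := by simp [sPerm_apply]
  have e6 : sPerm (x + 1) (x + 1 + 1) = x + 1 := by simp [sPerm_apply]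
  have key : ∀ τ : PZ, ∀ y, dR y τ = if τ y < τ (y + 1) then τ * sPerm y else τ := fun _ _ => rfl
  rcases lt_or_gt_of_ne h1 with a | a <;> rcases lt_or_gt_of_ne h2 with b | b <;>
    rcases lt_or_gt_of_ne h3 with c | c <;> first
    | (exfalso; omega)
    | simp only [key, a, b, c, e1, e2, e3, e4, e5, e6, a.not_gt, b.not_gt, c.not_gt, if_true,
        if_false, Equiv.Perm.mul_apply]
  simpa only [mul_assoc] using congrArg (σ * ·) hb

theorem dR_far {x y : ℤ} (h : x + 2 ≤ y ∨ y + 2 ≤ x) (σ : PZ) :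
    dR x (dR y σ) = dR y (dR x σ) := by
  have hb : sPerm x * sPerm y = sPerm y * sPerm x := by
    ext t; simp only [Equiv.Perm.mul_apply, sPerm_apply]; split_ifs <;> omega
  have e1 : sPerm x y = y := by simp only [sPerm_apply]; split_ifs <;> omega
  have e2 : sPerm x (y + 1) = y + 1 := by simp only [sPerm_apply]; split_ifs <;> omega
  have e3 : sPerm y x = x := by simp only [sPerm_apply]; split_ifs <;> omega
  have e4 : sPerm y (x + 1) = x + 1 := by simp only [sPerm_apply]; split_ifs <;> omega
  simp only [dR]
  by_cases a : σ x < σ (x + 1) <;> by_cases b : σ y < σ (y + 1) <;>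
    simp [a, b, e1, e2, e3, e4, mul_assoc, hb]

theorem dL_eq (x : ℤ) (σ : PZ) : dL x σ = (dR x σ⁻¹)⁻¹ := by
  simp only [dL, dR]
  split_ifs with h1 h2 h2
  · simp [sPerm_inv]
  · exact absurd h1 h2
  · exact absurd h2 h1
  · simp

theorem dL_braid (x : ℤ) (σ : PZ) :
    dL x (dL (x + 1) (dL x σ)) = dL (x + 1) (dL x (dL (x + 1) σ)) := by
  simp only [dL_eq, inv_inv, dR_braid]

theorem dL_far {x y : ℤ} (h : x + 2 ≤ y ∨ y + 2 ≤ x) (σ : PZ) :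
    dL x (dL y σ) = dL y (dL x σ) := by
  simp only [dL_eq, inv_inv, dR_far h]

theorem act_far {x y : ℤ} (h : x + 2 ≤ y ∨ y + 2 ≤ x) {σ : PZ} (hσ : σ * σ = 1) :
    act (act σ x) y = act (act σ y) x := by
  rw [act_eq (act_mul_self hσ x), act_eq (act_mul_self hσ y), act_eq hσ, act_eq hσ,
    dL_dR, dL_dR, dR_far h, dL_far h]

theorem act_braid (x : ℤ) {σ : PZ} (hσ : σ * σ = 1) :
    act (act (act σ x) (x + 1)) x = act (act (act σ (x + 1)) x) (x + 1) := by
  have h1 := act_mul_self hσ x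
  have h2 := act_mul_self hσ (x + 1)
  have h3 := act_mul_self h1 (x + 1)
  have h4 := act_mul_self h2 x
  rw [act_eq h3, act_eq h4, act_eq h1, act_eq h2, act_eq hσ, act_eq hσ]
  simp only [dL_dR]
  rw [dL_braid, dR_braid]

/-! ## Runs of primed words -/

/-- Whether the letter `l` may be applied to the involution `y` in a primed involution word. -/
def Ok (y : PZ) (l : Letter) : Prop :=
  y * y = 1 ∧ y l.ceil < y (l.ceil + 1) ∧
    (l.primed = true → y l.ceil = l.ceil ∧ y (l.ceil + 1) = l.ceil + 1)

open Classical in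
/-- Partial action of a primed letter on (optional) involutions. -/
noncomputable def stepO (l : Letter) (o : Option PZ) : Option PZ :=
  o.bind fun y => if Ok y l then some (act y l.ceil) else none

theorem stepO_pos {l : Letter} {y : PZ} (h : Ok y l) : stepO l (some y) = some (act y l.ceil) := by
  simp [stepO, h]

theorem stepO_neg {l : Letter} {y : PZ} (h : ¬ Ok y l) : stepO l (some y) = none := by
  simp [stepO, h]

theorem stepO_eq_some {l : Letter} {o : Option PZ} {z : PZ} :
    stepO l o = some z ↔ ∃ y, o = some y ∧ Ok y l ∧ act y l.ceil = z := by
  cases o with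
  | none => simp [stepO]
  | some y =>
    by_cases h : Ok y l
    · simp [stepO_pos h, h]
    · simp [stepO_neg h, h]

theorem act_apply_conj {y : PZ} {x : ℤ} (h : y x < y (x + 1))
    (h' : ¬ (y x = x ∧ y (x + 1) = x + 1)) (t : ℤ) :
    act y x t = sPerm x (y (sPerm x t)) := by
  simp [act, h, h']

theorem act_apply_comm {y : PZ} {x : ℤ} (h1 : y x = x) (h2 : y (x + 1) = x + 1) (t : ℤ) :
    act y x t = y (sPerm x t) := by
  simp [act, h1, h2]

/-- On the relevant three values, the involution property amounts to this. -/
theorem inv_iff {y : PZ} (h : y * y = 1) (s t : ℤ) : y s = t ↔ y t = s := by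
  constructor <;> (rintro rfl; exact apply_self h _)

theorem Ok.act_apply {y : PZ} {l : Letter} (h : Ok y l) (t : ℤ) :
    act y l.ceil t = if y l.ceil = l.ceil ∧ y (l.ceil + 1) = l.ceil + 1 then
      y (sPerm l.ceil t) else sPerm l.ceil (y (sPerm l.ceil t)) := by
  split_ifs with h'
  · exact act_apply_comm h'.1 h'.2 t
  · exact act_apply_conj h.2.1 h' t

theorem bind_stepO_congr {f g : Option PZ → Option PZ} (hf : f none = none) (hg : g none = none)
    (h : ∀ y : PZ, y * y = 1 → f (some y) = g (some y)) (hf' : ∀ y : PZ, y * y ≠ 1 → f (some y) = none)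
    (hg' : ∀ y : PZ, y * y ≠ 1 → g (some y) = none) : f = g := by
  funext o
  cases o with
  | none => rw [hf, hg]
  | some y =>
    by_cases hy : y * y = 1
    · exact h y hy
    · rw [hf' y hy, hg' y hy]

theorem stepO_not_inv {l : Letter} {y : PZ} (h : y * y ≠ 1) : stepO l (some y) = none :=
  stepO_neg fun h' => h h'.1

theorem stepO_far {l k : Letter} (h : l.ceil + 2 ≤ k.ceil ∨ k.ceil + 2 ≤ l.ceil) (o : Option PZ) :
    stepO k (stepO l o) = stepO l (stepO k o) := by
  refine congrFun (bind_stepO_congr (f := fun o => stepO k (stepO l o))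
    (g := fun o => stepO l (stepO k o)) rfl rfl ?_ ?_ ?_) o
  · intro y hy
    have key : ∀ l k : Letter, (l.ceil + 2 ≤ k.ceil ∨ k.ceil + 2 ≤ l.ceil) → Ok y l →
        Ok (act y l.ceil) k → Ok y k ∧ Ok (act y k.ceil) l := by
      intro l k h hl hk
      have hx := inv_iff hy
      have e1 : sPerm l.ceil k.ceil = k.ceil := by simp only [sPerm_apply]; split_ifs <;> omega
      have e2 : sPerm l.ceil (k.ceil + 1) = k.ceil + 1 := by
        simp only [sPerm_apply]; split_ifs <;> omega
      have e3 : sPerm k.ceil l.ceil = l.ceil := by simp only [sPerm_apply]; split_ifs <;> omega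
      have e4 : sPerm k.ceil (l.ceil + 1) = l.ceil + 1 := by
        simp only [sPerm_apply]; split_ifs <;> omega
      have a1 := hl.act_apply k.ceil
      have a2 := hl.act_apply (k.ceil + 1)
      rw [e1] at a1; rw [e2] at a2
      have i1 := hx l.ceil k.ceil
      have i2 := hx l.ceil (k.ceil + 1)
      have i3 := hx (l.ceil + 1) k.ceil
      have i4 := hx (l.ceil + 1) (k.ceil + 1)
      obtain ⟨-, hl1, hl2⟩ := id hl
      obtain ⟨-, hk1, hk2⟩ := hk
      have hk' : Ok y k := by
        refine ⟨hy, ?_⟩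
        by_cases hc : y l.ceil = l.ceil ∧ y (l.ceil + 1) = l.ceil + 1
        · rw [if_pos hc] at a1 a2
          rw [a1, a2] at hk1 hk2; exact ⟨hk1, hk2⟩
        · rw [if_neg hc, sPerm_apply] at a1 a2
          grind
      refine ⟨hk', act_mul_self hy _, ?_⟩
      have b1 := hk'.act_apply l.ceil
      have b2 := hk'.act_apply (l.ceil + 1)
      rw [e3] at b1; rw [e4] at b2
      rw [sPerm_apply] at a1 a2 b1 b2
      clear hx hl hk' e1 e2 e3 e4
      grind
    have half : ∀ l k : Letter, (l.ceil + 2 ≤ k.ceil ∨ k.ceil + 2 ≤ l.ceil) → ∀ z,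
        stepO k (stepO l (some y)) = some z → stepO l (stepO k (some y)) = some z := by
      intro l k h z hz
      obtain ⟨_, h1, h2, rfl⟩ := stepO_eq_some.1 hz
      obtain ⟨_, h3, h4, rfl⟩ := stepO_eq_some.1 h1
      cases h3
      obtain ⟨h5, h6⟩ := key l k h h4 h2
      rw [stepO_pos h5, stepO_pos h6, act_far h hy]
    exact Option.ext fun z => ⟨half l k h z, half k l h.symm z⟩
  · intro y hy; simp only [stepO_not_inv hy]; rfl
  · intro y hy; simp only [stepO_not_inv hy]; rfl

theorem act_vals (y : PZ) (x : ℤ) (h : y x < y (x + 1)) :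
    act y x x = (if y x = x ∧ y (x + 1) = x + 1 then y (x + 1) else sPerm x (y (x + 1))) ∧
    act y x (x + 1) = (if y x = x ∧ y (x + 1) = x + 1 then y x else sPerm x (y x)) ∧
    ∀ t, t < x ∨ x + 1 < t →
    act y x t = (if y x = x ∧ y (x + 1) = x + 1 then y t else sPerm x (y t)) := by
  have e1 : sPerm x x = x + 1 := by simp [sPerm]
  have e2 : sPerm x (x + 1) = x := by simp [sPerm]
  refine ⟨?_, ?_, fun t ht => ?_⟩
  · by_cases hc : y x = x ∧ y (x + 1) = x + 1
    · rw [if_pos hc, act_apply_comm hc.1 hc.2, e1]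
    · rw [if_neg hc, act_apply_conj h hc, e1]
  · by_cases hc : y x = x ∧ y (x + 1) = x + 1
    · rw [if_pos hc, act_apply_comm hc.1 hc.2, e2]
    · rw [if_neg hc, act_apply_conj h hc, e2]
  · have e3 : sPerm x t = t := by rw [sPerm_apply, if_neg (by omega), if_neg (by omega)]
    by_cases hc : y x = x ∧ y (x + 1) = x + 1
    · rw [if_pos hc, act_apply_comm hc.1 hc.2, e3]
    · rw [if_neg hc, act_apply_conj h hc, e3]

theorem stepO_braid_aux {y : PZ} (hy : y * y = 1) {x : ℤ} (b e c : Bool) :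
    (Ok y ⟨x, b⟩ ∧ Ok (act y x) ⟨x + 1, e⟩ ∧ Ok (act (act y x) (x + 1)) ⟨x, c⟩) →
    (Ok y ⟨x + 1, c⟩ ∧ Ok (act y (x + 1)) ⟨x, e⟩ ∧ Ok (act (act y (x + 1)) x) ⟨x + 1, b⟩) := by
  have hx := inv_iff hy
  have i0 : y (x + 1) = x ↔ y x = x + 1 := hx _ _
  have i1 : y (x + 1 + 1) = x ↔ y x = x + 1 + 1 := hx _ _
  have i2 : y (x + 1 + 1) = x + 1 ↔ y (x + 1) = x + 1 + 1 := hx _ _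
  have n1 : y x ≠ y (x + 1) := by simp
  have n2 : y x ≠ y (x + 1 + 1) := by rw [Ne, y.injective.eq_iff]; omega
  have n3 : y (x + 1) ≠ y (x + 1 + 1) := by simp
  clear hx
  rintro ⟨⟨-, h1, h1'⟩, ⟨-, h2, h2'⟩, ⟨-, h3, h3'⟩⟩
  simp only at h1 h1' h2 h2' h3 h3'
  obtain ⟨a1, a2, a3⟩ := act_vals y x h1
  obtain ⟨b1, b2, b3⟩ := act_vals (act y x) (x + 1) h2
  specialize a3 (x + 1 + 1) (by omega)
  specialize b3 x (by omega)
  have g1 : y (x + 1) < y (x + 1 + 1) := by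
    simp only [sPerm_apply] at *
    grind (splits := 40)
  have g2 : act y (x + 1) x < act y (x + 1) (x + 1) := by
    obtain ⟨c1, c2, c3⟩ := act_vals y (x + 1) g1
    specialize c3 x (by omega)
    simp only [sPerm_apply] at *
    grind (splits := 40)
  obtain ⟨c1, c2, c3⟩ := act_vals y (x + 1) g1
  specialize c3 x (by omega)
  obtain ⟨d1, d2, d3⟩ := act_vals (act y (x + 1)) x g2
  specialize d3 (x + 1 + 1) (by omega)
  refine ⟨⟨hy, g1, ?_⟩, ⟨act_mul_self hy _, g2, ?_⟩, act_mul_self (act_mul_self hy _) _, ?_, ?_⟩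
  all_goals simp only [sPerm_apply] at *
  all_goals grind (splits := 40)

theorem stepO_braid_aux' {y : PZ} (hy : y * y = 1) {x : ℤ} (b e c : Bool) :
    (Ok y ⟨x + 1, c⟩ ∧ Ok (act y (x + 1)) ⟨x, e⟩ ∧ Ok (act (act y (x + 1)) x) ⟨x + 1, b⟩) →
    (Ok y ⟨x, b⟩ ∧ Ok (act y x) ⟨x + 1, e⟩ ∧ Ok (act (act y x) (x + 1)) ⟨x, c⟩) := by
  have hx := inv_iff hy
  have i0 : y (x + 1) = x ↔ y x = x + 1 := hx _ _
  have i1 : y (x + 1 + 1) = x ↔ y x = x + 1 + 1 := hx _ _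
  have i2 : y (x + 1 + 1) = x + 1 ↔ y (x + 1) = x + 1 + 1 := hx _ _
  have n1 : y x ≠ y (x + 1) := by simp
  have n2 : y x ≠ y (x + 1 + 1) := by rw [Ne, y.injective.eq_iff]; omega
  have n3 : y (x + 1) ≠ y (x + 1 + 1) := by simp
  clear hx
  rintro ⟨⟨-, h1, h1'⟩, ⟨-, h2, h2'⟩, ⟨-, h3, h3'⟩⟩
  simp only at h1 h1' h2 h2' h3 h3'
  obtain ⟨a1, a2, a3⟩ := act_vals y (x + 1) h1
  obtain ⟨b1, b2, b3⟩ := act_vals (act y (x + 1)) x h2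
  specialize a3 x (by omega)
  specialize b3 (x + 1 + 1) (by omega)
  have g1 : y x < y (x + 1) := by
    simp only [sPerm_apply] at *
    grind (splits := 40)
  have g2 : act y x (x + 1) < act y x (x + 1 + 1) := by
    obtain ⟨c1, c2, c3⟩ := act_vals y x g1
    specialize c3 (x + 1 + 1) (by omega)
    simp only [sPerm_apply] at *
    grind (splits := 40)
  obtain ⟨c1, c2, c3⟩ := act_vals y x g1
  specialize c3 (x + 1 + 1) (by omega)
  obtain ⟨d1, d2, d3⟩ := act_vals (act y x) (x + 1) g2
  specialize d3 x (by omega)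
  refine ⟨⟨hy, g1, ?_⟩, ⟨act_mul_self hy _, g2, ?_⟩, act_mul_self (act_mul_self hy _) _, ?_, ?_⟩
  all_goals simp only [sPerm_apply] at *
  all_goals grind (splits := 40)

theorem stepO_braid_succ (x : ℤ) (b e c : Bool) (o : Option PZ) :
    stepO ⟨x, c⟩ (stepO ⟨x + 1, e⟩ (stepO ⟨x, b⟩ o)) =
      stepO ⟨x + 1, b⟩ (stepO ⟨x, e⟩ (stepO ⟨x + 1, c⟩ o)) := by
  refine congrFun (bind_stepO_congr (f := fun o => stepO ⟨x, c⟩ (stepO ⟨x + 1, e⟩ (stepO ⟨x, b⟩ o)))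
    (g := fun o => stepO ⟨x + 1, b⟩ (stepO ⟨x, e⟩ (stepO ⟨x + 1, c⟩ o))) rfl rfl ?_ ?_ ?_) o
  · intro y hy
    refine Option.ext fun z => ⟨fun hz => ?_, fun hz => ?_⟩
    all_goals
      obtain ⟨_, ha, h3, rfl⟩ := stepO_eq_some.1 hz
      obtain ⟨_, hb, h2, rfl⟩ := stepO_eq_some.1 ha
      obtain ⟨_, hc, h1, rfl⟩ := stepO_eq_some.1 hb
      cases hc
    · obtain ⟨g1, g2, g3⟩ := stepO_braid_aux hy b e c ⟨h1, h2, h3⟩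
      rw [stepO_pos g1, stepO_pos g2, stepO_pos g3, act_braid x hy]
    · obtain ⟨g1, g2, g3⟩ := stepO_braid_aux' hy b e c ⟨h1, h2, h3⟩
      rw [stepO_pos g1, stepO_pos g2, stepO_pos g3, act_braid x hy]
  · intro y hy; simp only [stepO_not_inv hy]; rfl
  · intro y hy; simp only [stepO_not_inv hy]; rfl

theorem stepO_braid {x y : ℤ} (h : y = x + 1 ∨ x = y + 1) (b e c : Bool) (o : Option PZ) :
    stepO ⟨x, c⟩ (stepO ⟨y, e⟩ (stepO ⟨x, b⟩ o)) =
      stepO ⟨y, b⟩ (stepO ⟨x, e⟩ (stepO ⟨y, c⟩ o)) := by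
  rcases h with rfl | rfl
  · exact stepO_braid_succ x b e c o
  · exact (stepO_braid_succ y c e b o).symm

theorem stepO_same (x : ℤ) (b c : Bool) (o : Option PZ) :
    stepO ⟨x, c⟩ (stepO ⟨x, b⟩ o) = none := by
  by_contra hne
  obtain ⟨z, hz⟩ := Option.ne_none_iff_exists'.1 hne
  obtain ⟨_, h, h2, rfl⟩ := stepO_eq_some.1 hz
  obtain ⟨y, rfl, h1, rfl⟩ := stepO_eq_some.1 h
  obtain ⟨-, h2, -⟩ := h2
  obtain ⟨hy, h1, -⟩ := h1
  simp only at h1 h2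
  obtain ⟨a1, a2, -⟩ := act_vals y x h1
  have i0 : y (x + 1) = x ↔ y x = x + 1 := inv_iff hy _ _
  simp only [sPerm_apply] at *
  grind

theorem Ok_one (l : Letter) : Ok 1 l := by
  refine ⟨by simp, ?_, fun _ => ⟨rfl, rfl⟩⟩
  change l.ceil < l.ceil + 1; omega

theorem act_one (x : ℤ) : act 1 x = sPerm x := by simp [act]

theorem Ok_sPerm {x : ℤ} {l : Letter} : Ok (sPerm x) l ↔ x ≠ l.ceil ∧
    (l.primed = true → x + 2 ≤ l.ceil ∨ l.ceil + 2 ≤ x) := by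
  simp only [Ok, sPerm_mul_self, true_and, sPerm_apply]
  refine and_congr ?_ (imp_congr_right fun _ => ?_)
  · grind
  · grind

theorem stepO_init {x y : ℤ} (h : x ≠ y) (e f : Bool) :
    stepO ⟨y, f⟩ (stepO ⟨x, e⟩ (some 1)) = stepO ⟨x, f⟩ (stepO ⟨y, e⟩ (some 1)) := by
  rw [stepO_pos (Ok_one _), stepO_pos (Ok_one _)]
  simp only [act_one]
  by_cases hfar : x + 2 ≤ y ∨ y + 2 ≤ x
  · rw [stepO_pos (Ok_sPerm.2 ⟨h, fun _ => hfar⟩),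
      stepO_pos (Ok_sPerm.2 ⟨h.symm, fun _ => hfar.symm⟩), ← act_one, ← act_one,
      act_far hfar (by simp)]
  · cases f with
    | true =>
      rw [stepO_neg, stepO_neg]
      · rw [Ok_sPerm]; simp only [forall_const, not_and]; omega
      · rw [Ok_sPerm]; simp only [forall_const, not_and]; omega
    | false =>
      rw [stepO_pos (Ok_sPerm.2 ⟨h, by simp⟩), stepO_pos (Ok_sPerm.2 ⟨h.symm, by simp⟩)]
      congr 1
      have key : ∀ x : ℤ, act (sPerm x) (x + 1) = act (sPerm (x + 1)) x := by
        intro x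
        rw [act, act, if_pos, if_neg, if_pos, if_neg]
        · exact (sPerm_braid x).symm
        all_goals simp only [sPerm_apply]; grind
      have : y = x + 1 ∨ x = y + 1 := by omega
      rcases this with rfl | rfl
      · exact key x
      · exact (key y).symm

/-- The monoid of partial operations on involutions, multiplied from left to right. -/
abbrev OpM := (Function.End (Option PZ))ᵐᵒᵖ

/-- The operation attached to a letter. -/
noncomputable def sg (l : Letter) : OpM := MulOpposite.op (stepO l)

/-- Evaluation of an operation at the identity. -/
noncomputable def ev (w : OpM) : Option PZ := w.unop (some 1)

theorem ev_mul_sg (w : OpM) (l : Letter) : ev (w * sg l) = stepO l (ev w) := rfl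

theorem sg_far {l k : Letter} (h : l.ceil + 2 ≤ k.ceil ∨ k.ceil + 2 ≤ l.ceil) :
    sg l * sg k = sg k * sg l :=
  MulOpposite.unop_injective (funext fun o => stepO_far h o)

theorem sg_braid {x y : ℤ} (h : y = x + 1 ∨ x = y + 1) (b e c : Bool) :
    sg ⟨x, b⟩ * sg ⟨y, e⟩ * sg ⟨x, c⟩ = sg ⟨y, c⟩ * sg ⟨x, e⟩ * sg ⟨y, b⟩ :=
  MulOpposite.unop_injective (funext fun o => stepO_braid h b e c o)

/-- Operations that preserve `none`. -/
def NoneFix (w : OpM) : Prop := w.unop none = none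

theorem NoneFix.mul {v w : OpM} (hv : NoneFix v) (hw : NoneFix w) : NoneFix (v * w) := by
  change w.unop (v.unop none) = none
  rw [hv, hw]

theorem noneFix_sg (l : Letter) : NoneFix (sg l) := rfl

theorem noneFix_one : NoneFix 1 := rfl

theorem noneFix_prod {L : List OpM} (h : ∀ w ∈ L, NoneFix w) : NoneFix L.prod := by
  induction L with
  | nil => exact noneFix_one
  | cons w L ih =>
    rw [List.prod_cons]
    exact (h w (by simp)).mul (ih fun v hv => h v (by simp [hv]))

/-- The operation of a primed word. -/
noncomputable def opW (a : List Letter) : OpM := (a.map sg).prod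

theorem opW_append (a b : List Letter) : opW (a ++ b) = opW a * opW b := by simp [opW]

theorem opW_singleton (l : Letter) : opW [l] = sg l := by simp [opW]

theorem ev_same (v w : OpM) (hw : NoneFix w) (x : ℤ) (b c : Bool) :
    ev (v * sg ⟨x, b⟩ * sg ⟨x, c⟩ * w) = none := by
  change w.unop (stepO _ (stepO _ _)) = none
  rw [stepO_same, hw]

/-- The involution produced by a primed word, if the word is reduced and properly primed. -/
noncomputable def run (a : List Letter) : Option PZ := ev (opW a)

theorem run_nil : run [] = some 1 := rfl

theorem run_append_singleton (a : List Letter) (l : Letter) :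
    run (a ++ [l]) = stepO l (run a) := by
  rw [run, opW_append, opW_singleton, ev_mul_sg, run]

theorem run_append_singleton_eq_some {a : List Letter} {l : Letter} {z : PZ} :
    run (a ++ [l]) = some z ↔ ∃ y, run a = some y ∧ Ok y l ∧ act y l.ceil = z := by
  rw [run_append_singleton, stepO_eq_some]

/-! ## Statistics of involutions -/

/-- The set of inversions. -/
def invSet (σ : PZ) : Set (ℤ × ℤ) := {p | p.1 < p.2 ∧ σ p.2 < σ p.1}

/-- The set of moved points. -/
def mvSet (σ : PZ) : Set ℤ := {t | σ t ≠ t}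

theorem sPerm_sPerm (x t : ℤ) : sPerm x (sPerm x t) = t := by simp [sPerm]

theorem invSet_mul_sPerm {σ : PZ} {x : ℤ} (h : σ x < σ (x + 1)) :
    invSet (σ * sPerm x) = insert (x, x + 1) (Prod.map (sPerm x) (sPerm x) '' invSet σ) := by
  have e1 : sPerm x x = x + 1 := by simp [sPerm]
  have e2 : sPerm x (x + 1) = x := by simp [sPerm]
  ext ⟨i, j⟩
  simp only [invSet, Set.mem_ofPred_eq, Equiv.Perm.mul_apply, Set.mem_insert_iff, Set.mem_image,
    Prod.exists, Prod.map_apply, Prod.mk.injEq]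
  by_cases h1 : i = x ∧ j = x + 1
  · obtain ⟨rfl, rfl⟩ := h1; simp [e1, e2, h]
  · constructor
    · rintro ⟨a, b⟩
      refine Or.inr ⟨sPerm x i, sPerm x j, ⟨?_, b⟩, sPerm_sPerm _ _, sPerm_sPerm _ _⟩
      rwa [sPerm_lt_iff h1 (by omega)]
    · rintro (a | ⟨k, l, ⟨a, b⟩, rfl, rfl⟩)
      · exact absurd a h1
      · rw [sPerm_sPerm, sPerm_sPerm]
        refine ⟨?_, b⟩
        rwa [sPerm_lt_iff]
        · rintro ⟨rfl, rfl⟩; omega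
        · rintro ⟨rfl, rfl⟩; omega

theorem pair_mem_image_invSet {σ : PZ} {x : ℤ} :
    (x, x + 1) ∉ Prod.map (sPerm x) (sPerm x) '' invSet σ := by
  rintro ⟨⟨k, l⟩, ⟨a, -⟩, e⟩
  simp only [Prod.map_apply, Prod.mk.injEq] at e
  have h1 : k = x + 1 := by rw [← sPerm_sPerm x k, e.1]; simp [sPerm]
  have h2 : l = x := by rw [← sPerm_sPerm x l, e.2]; simp [sPerm]
  simp only at a; omega

theorem prodMap_sPerm_injective (x : ℤ) : Function.Injective (Prod.map (sPerm x) (sPerm x)) :=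
  (sPerm x).injective.prodMap (sPerm x).injective

theorem invSet_step {σ : PZ} {x : ℤ} (hf : (invSet σ).Finite) (h : σ x < σ (x + 1)) :
    (invSet (σ * sPerm x)).Finite ∧ (invSet (σ * sPerm x)).ncard = (invSet σ).ncard + 1 := by
  have hf' := hf.image (Prod.map (sPerm x) (sPerm x))
  rw [invSet_mul_sPerm h]
  refine ⟨hf'.insert _, ?_⟩
  rw [Set.ncard_insert_of_notMem pair_mem_image_invSet hf',
    Set.ncard_image_of_injective _ (prodMap_sPerm_injective x)]

theorem invSet_inv (σ : PZ) : invSet σ⁻¹ = (fun p => (σ p.2, σ p.1)) '' invSet σ := by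
  ext ⟨i, j⟩
  simp only [invSet, Set.mem_ofPred_eq, Set.mem_image, Prod.exists, Prod.mk.injEq]
  constructor
  · rintro ⟨a, b⟩
    exact ⟨σ⁻¹ j, σ⁻¹ i, ⟨b, by simpa using a⟩, by simp, by simp⟩
  · rintro ⟨k, l, ⟨a, b⟩, rfl, rfl⟩
    simpa using ⟨b, a⟩

theorem invSet_inv_ncard (σ : PZ) : (invSet σ⁻¹).ncard = (invSet σ).ncard := by
  rw [invSet_inv, Set.ncard_image_of_injective]
  rintro ⟨a, b⟩ ⟨c, d⟩ h
  simpa [and_comm] using h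

theorem invSet_inv_finite {σ : PZ} (h : (invSet σ).Finite) : (invSet σ⁻¹).Finite := by
  rw [invSet_inv]; exact h.image _

/-- Whether a letter acts as a commutation. -/
def IsC (y : PZ) (x : ℤ) : Prop := y x = x ∧ y (x + 1) = x + 1

theorem perm_inv_eq_self {y : PZ} (h : y * y = 1) : y⁻¹ = y := inv_eq_of_mul_eq_one_left h

open Classical in
theorem invSet_act {y : PZ} {x : ℤ} (hy : y * y = 1) (hf : (invSet y).Finite)
    (h : y x < y (x + 1)) : (invSet (act y x)).Finite ∧
      (invSet (act y x)).ncard + (if IsC y x then 1 else 0) = (invSet y).ncard + 2 := by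
  by_cases hc : IsC y x
  · have := invSet_step hf h
    have e : act y x = y * sPerm x := by
      rw [act, if_pos h, if_pos (show y x = x ∧ y (x + 1) = x + 1 from hc)]
    rw [e, if_pos hc]
    exact ⟨this.1, by omega⟩
  · obtain ⟨h1, h2⟩ := invSet_step hf h
    have e : act y x = sPerm x * y * sPerm x := by
      rw [act, if_pos h, if_neg (show ¬(y x = x ∧ y (x + 1) = x + 1) from hc)]
    rw [e, if_neg hc]
    have h3 := invSet_inv_finite h1
    have h4 := invSet_inv_ncard (y * sPerm x)
    rw [mul_inv_rev, sPerm_inv, perm_inv_eq_self hy] at h3 h4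
    have h5 : (sPerm x * y) x < (sPerm x * y) (x + 1) := by
      rw [Equiv.Perm.mul_apply, Equiv.Perm.mul_apply, sPerm_lt_iff hc (by omega)]; exact h
    obtain ⟨h6, h7⟩ := invSet_step h3 h5
    exact ⟨h6, by omega⟩

theorem mvSet_conj (y : PZ) (x : ℤ) : mvSet (sPerm x * y * sPerm x) = sPerm x '' mvSet y := by
  ext t
  simp only [mvSet, Set.mem_ofPred_eq, Equiv.Perm.mul_apply, Set.mem_image]
  constructor
  · intro h
    refine ⟨sPerm x t, fun h' => h ?_, sPerm_sPerm _ _⟩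
    rw [h', sPerm_sPerm]
  · rintro ⟨t, h, rfl⟩ h'
    rw [sPerm_sPerm] at h'
    exact h ((sPerm x).injective h')

theorem mvSet_comm {y : PZ} {x : ℤ} (h : IsC y x) :
    mvSet (y * sPerm x) = insert x (insert (x + 1) (mvSet y)) := by
  obtain ⟨h1, h2⟩ := h
  ext t
  simp only [mvSet, Set.mem_ofPred_eq, Equiv.Perm.mul_apply, Set.mem_insert_iff]
  by_cases a : t = x
  · subst a; simp [sPerm, h2]
  by_cases b : t = x + 1
  · subst b; simp [sPerm, h1]
  rw [sPerm_apply, if_neg a, if_neg b]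
  simp [a, b]

open Classical in
theorem mvSet_act {y : PZ} {x : ℤ} (hf : (mvSet y).Finite)
    (h : y x < y (x + 1)) : (mvSet (act y x)).Finite ∧
      (mvSet (act y x)).ncard = (mvSet y).ncard + (if IsC y x then 2 else 0) := by
  by_cases hc : IsC y x
  · have e : act y x = y * sPerm x := by
      rw [act, if_pos h, if_pos (show y x = x ∧ y (x + 1) = x + 1 from hc)]
    rw [e, if_pos hc, mvSet_comm hc]
    refine ⟨(hf.insert _).insert _, ?_⟩
    rw [Set.ncard_insert_of_notMem _ (hf.insert _), Set.ncard_insert_of_notMem _ hf]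
    · simpa [mvSet] using hc.2
    · simpa [mvSet] using hc.1
  · have e : act y x = sPerm x * y * sPerm x := by
      rw [act, if_pos h, if_neg (show ¬(y x = x ∧ y (x + 1) = x + 1) from hc)]
    rw [e, if_neg hc, mvSet_conj]
    exact ⟨hf.image _, by rw [Set.ncard_image_of_injective _ (sPerm x).injective]; rfl⟩

/-! ## Words and runs -/

/-- The unprimed letter of a given value. -/
def toL (x : ℤ) : Letter := ⟨x, false⟩

open Classical in
/-- The positions of the commutations in a word. -/
noncomputable def commF (a : List ℤ) : Finset ℕ :=
  (Finset.range a.length).filter (IsCommutation a)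

theorem invHecke_append (a : List ℤ) (x : ℤ) : invHecke (a ++ [x]) = act (invHecke a) x := by
  rw [invHecke_eq, invHecke_eq, List.foldl_append]; rfl

theorem invHecke_nil : invHecke [] = 1 := by rw [invHecke_eq]; rfl

theorem invHecke_mul_self (a : List ℤ) : invHecke a * invHecke a = 1 := by
  rw [invHecke_eq]; exact foldl_act_mul_self _ (by simp)

theorem isCommutation_append_lt {a : List ℤ} {x : ℤ} {k : ℕ} (h : k < a.length) :
    IsCommutation (a ++ [x]) k ↔ IsCommutation a k := by
  unfold IsCommutation
  rw [List.getElem?_append_left h, List.take_append_of_le_length h.le]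

theorem isCommutation_append_eq {a : List ℤ} {x : ℤ} :
    IsCommutation (a ++ [x]) a.length ↔ IsC (invHecke a) x := by
  simp [IsCommutation, IsC]

open Classical in
theorem commF_append (a : List ℤ) (x : ℤ) :
    (commF (a ++ [x])).card = (commF a).card + if IsC (invHecke a) x then 1 else 0 := by
  have h1 : (Finset.range a.length).filter (IsCommutation (a ++ [x])) = commF a := by
    apply Finset.filter_congr
    intro k hk
    exact isCommutation_append_lt (Finset.mem_range.1 hk)
  rw [commF, List.length_append, List.length_singleton, Finset.range_add_one,
    Finset.filter_insert, isCommutation_append_eq, h1]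
  split_ifs with h
  · rw [Finset.card_insert_of_notMem]; simp [commF]
  · rfl

theorem run_eq_invHecke {a : List Letter} {z : PZ} (h : run a = some z) :
    invHecke (unprimeWord a) = z := by
  induction a using List.reverseRecOn generalizing z with
  | nil => rw [run_nil] at h; cases h; exact invHecke_nil
  | append_singleton a l ih =>
    obtain ⟨y, h1, h2, rfl⟩ := run_append_singleton_eq_some.1 h
    simp [unprimeWord] at ih ⊢
    rw [invHecke_append, ih h1]

theorem run_mul_self {a : List Letter} {z : PZ} (h : run a = some z) : z * z = 1 := by
  rw [← run_eq_invHecke h]; exact invHecke_mul_self _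

theorem run_stats {a : List Letter} {z : PZ} (h : run a = some z) :
    (invSet z).Finite ∧ (mvSet z).Finite ∧ (mvSet z).ncard = 2 * (commF (unprimeWord a)).card ∧
      (invSet z).ncard + (commF (unprimeWord a)).card = 2 * a.length := by
  classical
  induction a using List.reverseRecOn generalizing z with
  | nil =>
    rw [run_nil] at h; cases h
    have h1 : invSet 1 = ∅ := by
      ext p; simp [invSet]; intro h; exact h.le
    have h2 : mvSet 1 = ∅ := by ext p; simp [mvSet]
    simp [h1, h2, unprimeWord, commF]
  | append_singleton a l ih =>
    obtain ⟨y, h1, h2, rfl⟩ := run_append_singleton_eq_some.1 h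
    obtain ⟨i1, i2, i3, i4⟩ := ih h1
    have h3 := invSet_act h2.1 i1 h2.2.1
    have h4 := mvSet_act i2 h2.2.1
    have h5 : unprimeWord (a ++ [l]) = unprimeWord a ++ [l.ceil] := by simp [unprimeWord]
    rw [h5, commF_append, run_eq_invHecke h1, List.length_append, List.length_singleton]
    refine ⟨h3.1, h4.1, ?_, ?_⟩
    · rw [h4.2, i3]; split_ifs <;> ring
    · have := h3.2; split_ifs at * <;> omega

theorem run_length_eq {a b : List Letter} {z : PZ} (ha : run a = some z) (hb : run b = some z) :
    a.length = b.length := by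
  have h1 := run_stats ha
  have h2 := run_stats hb
  omega

theorem exists_run_le (b : List ℤ) :
    ∃ a : List ℤ, a.length ≤ b.length ∧ run (a.map toL) = some (invHecke b) ∧
      (a.length = b.length → a = b) := by
  induction b using List.reverseRecOn with
  | nil => exact ⟨[], le_rfl, by rw [invHecke_nil]; rfl, fun _ => rfl⟩
  | append_singleton b x ih =>
    obtain ⟨a, h1, h2, h3⟩ := ih
    by_cases h : invHecke b x < invHecke b (x + 1)
    · refine ⟨a ++ [x], by simpa using h1, ?_, fun h' => by rw [h3 (by simpa using h')]⟩
      rw [List.map_append, List.map_singleton, run_append_singleton, h2,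
        stepO_pos ⟨invHecke_mul_self b, h, by simp [toL]⟩, invHecke_append]; rfl
    · refine ⟨a, by simp; omega, ?_, fun h' => by simp at h'; omega⟩
      rw [h2, invHecke_append, act, if_neg h]

theorem unprimeWord_map_toL (a : List ℤ) : unprimeWord (a.map toL) = a := by
  simp [unprimeWord, toL, Function.comp_def]

theorem mem_Rinv_iff {a : List ℤ} {z : PZ} : a ∈ Rinv z ↔ run (a.map toL) = some z := by
  constructor
  · rintro ⟨rfl, h⟩
    obtain ⟨b, h1, h2, h3⟩ := exists_run_le a
    have h4 := run_eq_invHecke h2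
    rw [unprimeWord_map_toL] at h4
    have := h b h4
    rw [← h3 (by omega), h2, h3 (by omega)]
  · intro h
    have h4 := run_eq_invHecke h
    rw [unprimeWord_map_toL] at h4
    refine ⟨h4, fun b hb => ?_⟩
    obtain ⟨c, h1, h2, -⟩ := exists_run_le b
    rw [hb] at h2
    have := run_length_eq h h2
    simp at this; omega

theorem run_iff {a : List Letter} {z : PZ} :
    run a = some z ↔ run ((unprimeWord a).map toL) = some z ∧
      ∀ (k : ℕ) (x : Letter), a[k]? = some x → x.primed = true →
        IsCommutation (unprimeWord a) k := by
  induction a using List.reverseRecOn generalizing z with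
  | nil => simp [unprimeWord]
  | append_singleton a l ih =>
    have e1 : unprimeWord (a ++ [l]) = unprimeWord a ++ [l.ceil] := by simp [unprimeWord]
    rw [e1, List.map_append, List.map_singleton, run_append_singleton_eq_some,
      run_append_singleton_eq_some]
    have e2 : ∀ k, k < a.length → (IsCommutation (unprimeWord a ++ [l.ceil]) k ↔
        IsCommutation (unprimeWord a) k) := fun k hk =>
      isCommutation_append_lt (by simpa [unprimeWord] using hk)
    have e3 : IsCommutation (unprimeWord a ++ [l.ceil]) a.length ↔
        IsC (invHecke (unprimeWord a)) l.ceil := by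
      have := isCommutation_append_eq (a := unprimeWord a) (x := l.ceil)
      rwa [show (unprimeWord a).length = a.length by simp [unprimeWord]] at this
    constructor
    · rintro ⟨y, h1, h2, rfl⟩
      obtain ⟨h3, h4⟩ := ih.1 h1
      refine ⟨⟨y, h3, ⟨h2.1, h2.2.1, by simp [toL]⟩, rfl⟩, fun k x hk hx => ?_⟩
      rcases lt_or_ge k a.length with hlt | hge
      · rw [List.getElem?_append_left hlt] at hk
        exact (e2 k hlt).2 (h4 k x hk hx)
      · rw [List.getElem?_append_right hge, List.getElem?_singleton] at hk
        split_ifs at hk with h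
        have : k = a.length := by omega
        cases hk; subst this
        rw [e3, run_eq_invHecke h1]; exact h2.2.2 hx
    · rintro ⟨⟨y, h1, h2, rfl⟩, h3⟩
      have h4 : run a = some y := ih.2 ⟨h1, fun k x hk hx => by
        have hlt := (List.getElem?_eq_some_iff.1 hk).1
        exact (e2 k hlt).1 (h3 k x (by rw [List.getElem?_append_left hlt]; exact hk) hx)⟩
      refine ⟨y, h4, ⟨h2.1, h2.2.1, fun hx => ?_⟩, rfl⟩
      have := h3 a.length l (by simp) hx
      rw [e3, run_eq_invHecke h4] at this; exact this

theorem mem_RinvPlus_iff {a : List Letter} {z : PZ} : a ∈ RinvPlus z ↔ run a = some z := by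
  rw [run_iff, ← mem_Rinv_iff]; rfl

theorem run_unprime {a : List Letter} {z : PZ} (h : run a = some z) :
    run ((unprimeWord a).map toL) = some z := (run_iff.1 h).1

theorem invSet_finite {z : PZ} (h : (mvSet z).Finite) : (invSet z).Finite := by
  obtain ⟨A, hA⟩ := h.bddBelow
  obtain ⟨B, hB⟩ := h.bddAbove
  have key : ∀ t, z t ≠ t → A ≤ t ∧ t ≤ B ∧ A ≤ z t ∧ z t ≤ B := by
    intro t ht
    have ht' : z t ∈ mvSet z := fun h => ht (z.injective h)
    exact ⟨hA ht, hB ht, hA ht', hB ht'⟩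
  refine Set.Finite.subset ((Set.finite_Icc A B).prod (Set.finite_Icc A B)) ?_
  rintro ⟨i, j⟩ ⟨h1, h2⟩
  simp only at h1 h2
  simp only [Set.mem_prod, Set.mem_Icc]
  have hi := key i
  have hj := key j
  by_cases hzi : z i = i <;> by_cases hzj : z j = j
  · omega
  · have := hj hzj; omega
  · have := hi hzi; omega
  · have := hi hzi; have := hj hzj; omega

theorem eq_one_of_no_descent {z : PZ} (hz : IZ z) (h : ∀ x, z x < z (x + 1)) : z = 1 := by
  have hm : StrictMono z := strictMono_int_of_lt_succ h
  ext t
  have h1 : z (z t) = t := apply_self hz.2 t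
  rcases lt_trichotomy (z t) t with h2 | h2 | h2
  · have := hm h2; rw [h1] at this; omega
  · simpa using h2
  · have := hm h2; rw [h1] at this; omega

/-- The predecessor of an involution along a descent. -/
theorem exists_pred {z : PZ} (hz : IZ z) {x : ℤ} (h : z (x + 1) < z x) :
    ∃ y, IZ y ∧ y x < y (x + 1) ∧ act y x = z := by
  have hinv := hz.2
  have i0 : z (x + 1) = x ↔ z x = x + 1 := inv_iff hinv _ _
  have e1 : sPerm x x = x + 1 := by simp [sPerm]
  have e2 : sPerm x (x + 1) = x := by simp [sPerm]
  have hmv : (mvSet z).Finite := hz.1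
  by_cases hc : z x = x + 1
  · have hc' := i0.2 hc
    have hcm : z * sPerm x = sPerm x * z := by
      ext t
      simp only [Equiv.Perm.mul_apply, sPerm_apply]
      have h3 : z t = x ↔ t = x + 1 :=
        ⟨fun h => z.injective (h.trans hc'.symm), fun h => by rw [h, hc']⟩
      have h4 : z t = x + 1 ↔ t = x :=
        ⟨fun h => z.injective (h.trans hc.symm), fun h => by rw [h, hc]⟩
      simp only [h3, h4]
      split_ifs <;> simp_all
    refine ⟨z * sPerm x, ⟨?_, ?_⟩, ?_, ?_⟩
    · refine hmv.subset ?_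
      intro t ht h'
      simp only [Equiv.Perm.mul_apply, Set.mem_ofPred_eq] at ht
      apply ht
      by_cases a : t = x
      · subst a; omega
      by_cases b : t = x + 1
      · subst b; omega
      rw [sPerm_apply, if_neg a, if_neg b, h']
    · calc z * sPerm x * (z * sPerm x) = z * sPerm x * (sPerm x * z) := by rw [hcm]
        _ = z * (sPerm x * sPerm x) * z := by group
        _ = 1 := by rw [sPerm_mul_self]; simpa using hinv
    · simp [e1, e2, hc, hc']
    · rw [act, if_pos, if_pos]
      · rw [mul_assoc, sPerm_mul_self, mul_one]
      · simp [e1, e2, hc, hc']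
      · simp [e1, e2, hc, hc']
  · have hlt : sPerm x (z (x + 1)) < sPerm x (z x) := by
      rw [sPerm_lt_iff]
      · exact h
      · omega
      · intro h'; omega
    refine ⟨sPerm x * z * sPerm x, ⟨?_, ?_⟩, ?_, ?_⟩
    · have := mvSet_conj z x
      rw [mvSet] at this; rw [this]; exact hmv.image _
    · calc sPerm x * z * sPerm x * (sPerm x * z * sPerm x)
          = sPerm x * z * (sPerm x * sPerm x) * z * sPerm x := by group
        _ = sPerm x * (z * z) * sPerm x := by rw [sPerm_mul_self]; group
        _ = 1 := by rw [hinv]; simp [sPerm_mul_self]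
    · simpa [e1, e2] using hlt
    · rw [act, if_pos, if_neg]
      · calc sPerm x * (sPerm x * z * sPerm x) * sPerm x
            = (sPerm x * sPerm x) * z * (sPerm x * sPerm x) := by group
          _ = z := by simp [sPerm_mul_self]
      · simp only [Equiv.Perm.mul_apply, e1, e2]
        rintro ⟨h1, h2⟩
        have : z (x + 1) = x + 1 := by rw [← sPerm_sPerm x (z (x+1)), h1, e1]
        have : z x = x := by rw [← sPerm_sPerm x (z x), h2, e2]
        omega
      · simpa [e1, e2] using hlt

theorem exists_run {z : PZ} (hz : IZ z) : ∃ a : List ℤ, run (a.map toL) = some z := by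
  induction hn : (invSet z).ncard using Nat.strong_induction_on generalizing z with
  | _ n ih =>
    by_cases h : ∀ x, z x < z (x + 1)
    · exact ⟨[], by rw [eq_one_of_no_descent hz h]; rfl⟩
    · push Not at h
      obtain ⟨x, hx⟩ := h
      have hx' : z (x + 1) < z x := lt_of_le_of_ne hx (by simp)
      obtain ⟨y, hy, h1, rfl⟩ := exists_pred hz hx'
      have := invSet_act hy.2 (invSet_finite hy.1) h1
      obtain ⟨a, ha⟩ := ih (invSet y).ncard (by have := this.2; split_ifs at this <;> omega) hy rfl
      refine ⟨a ++ [x], ?_⟩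
      rw [List.map_append, List.map_singleton, run_append_singleton, ha,
        stepO_pos ⟨hy.2, h1, by simp [toL]⟩]; rfl

theorem IZ_of_run {a : List Letter} {z : PZ} (h : run a = some z) : IZ z :=
  ⟨(run_stats h).2.1, run_mul_self h⟩

/-- Support bounds are inherited by all letters of a reduced word. -/
theorem run_letters_bound {a : List Letter} {z : PZ} (h : run a = some z) {A B : ℤ}
    (hs : ∀ t, t < A ∨ B < t → z t = t) : ∀ l ∈ a, A ≤ l.ceil ∧ l.ceil + 1 ≤ B := by
  induction a using List.reverseRecOn generalizing z with
  | nil => simp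
  | append_singleton a l ih =>
    obtain ⟨y, h1, h2, rfl⟩ := run_append_singleton_eq_some.1 h
    have hinv := run_mul_self h
    obtain ⟨v1, v2, v3⟩ := act_vals y l.ceil h2.2.1
    have hy := h2.2.1
    have hd : act y l.ceil (l.ceil + 1) < act y l.ceil l.ceil := by
      rw [v1, v2]
      split_ifs with hc
      · exact hy
      · rw [sPerm_lt_iff hc (by omega)]; exact hy
    have hl : A ≤ l.ceil ∧ l.ceil + 1 ≤ B := by
      have key : ∀ t, act y l.ceil t < A ∨ B < act y l.ceil t → act y l.ceil t = t := by
        intro t ht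
        have := hs _ ht
        exact (act y l.ceil).injective this
      have k1 := key l.ceil
      have k2 := key (l.ceil + 1)
      have k3 := hs l.ceil
      have k4 := hs (l.ceil + 1)
      omega
    have hys : ∀ t, t < A ∨ B < t → y t = t := by
      intro t ht
      have h3 := v3 t (by omega)
      rw [hs t ht] at h3
      split_ifs at h3 with hc
      · exact h3.symm
      · have := congrArg (sPerm l.ceil) h3
        rw [sPerm_sPerm] at this
        rw [← this, sPerm_apply, if_neg (by omega), if_neg (by omega)]
    intro k hk
    rcases List.mem_append.1 hk with hk | hk
    · exact ih h1 hys k hk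
    · rw [List.mem_singleton.1 hk]; exact hl

theorem RinvPlus_finite {z : PZ} (hz : IZ z) : (RinvPlus z).Finite := by
  obtain ⟨w, hw⟩ := exists_run hz
  obtain ⟨A, hA⟩ := hz.1.bddBelow
  obtain ⟨B, hB⟩ := hz.1.bddAbove
  have hs : ∀ t, t < A ∨ B < t → z t = t := by
    intro t ht
    by_contra h
    have h1 := hA h
    have h2 := hB h
    omega
  have hfin : {l : Letter | A ≤ l.ceil ∧ l.ceil ≤ B}.Finite := by
    refine Set.Finite.subset ((((Set.finite_Icc A B).prod
      (Set.finite_univ (α := Bool)))).image fun p => (⟨p.1, p.2⟩ : Letter)) ?_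
    rintro ⟨c, b⟩ hl
    exact ⟨(c, b), ⟨hl, trivial⟩, rfl⟩
  have := hfin.to_subtype
  refine ((List.finite_length_eq {l : Letter | A ≤ l.ceil ∧ l.ceil ≤ B} w.length).image
    (List.map Subtype.val)).subset ?_
  intro a ha
  rw [mem_RinvPlus_iff] at ha
  have hb := run_letters_bound ha hs
  refine ⟨a.attach.map fun l => ⟨l.1, ⟨(hb l.1 l.2).1, by have := (hb l.1 l.2).2; omega⟩⟩, ?_, ?_⟩
  · have := run_length_eq ha hw
    rw [Set.mem_ofPred_eq]
    simpa using this
  · simp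

/-! ## Ordered products -/

section Products

variable {M : Type*} [Monoid M]

/-- The product `f a * f (a+1) * ⋯ * f (b-1)`. -/
def pr (f : ℕ → M) (a b : ℕ) : M := ((List.range' a (b - a)).map f).prod

/-- The product `f (b-1) * ⋯ * f (a+1) * f a`. -/
def pd (f : ℕ → M) (a b : ℕ) : M := (pr (fun i => MulOpposite.op (f i)) a b).unop

theorem pr_of_le (f : ℕ → M) {a b : ℕ} (h : b ≤ a) : pr f a b = 1 := by
  simp [pr, Nat.sub_eq_zero_of_le h]

theorem pr_succ (f : ℕ → M) {a b : ℕ} (h : a ≤ b) : pr f a (b + 1) = pr f a b * f b := by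
  have e : b + 1 - a = (b - a) + 1 := by omega
  rw [pr, e, List.range'_concat, List.map_append, List.prod_append, pr]
  simp [Nat.add_sub_cancel' h]

theorem pr_split (f : ℕ → M) {a b c : ℕ} (h1 : a ≤ b) (h2 : b ≤ c) :
    pr f a c = pr f a b * pr f b c := by
  induction c, h2 using Nat.le_induction with
  | base => rw [pr_of_le f le_rfl, mul_one]
  | succ n hn ih => rw [pr_succ f (h1.trans hn), pr_succ f hn, ih, mul_assoc]

theorem pr_one (f : ℕ → M) (a : ℕ) : pr f a (a + 1) = f a := by
  rw [pr_succ f le_rfl, pr_of_le f le_rfl, one_mul]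

theorem pr_head (f : ℕ → M) {a b : ℕ} (h : a < b) : pr f a b = f a * pr f (a + 1) b := by
  rw [pr_split f (Nat.le_succ a) h, pr_one]

theorem pr_pick (f : ℕ → M) {a p b : ℕ} (h1 : a ≤ p) (h2 : p < b) :
    pr f a b = pr f a p * f p * pr f (p + 1) b := by
  rw [pr_split f h1 h2.le, pr_head f h2, mul_assoc]

theorem pr_congr {f g : ℕ → M} {a b : ℕ} (h : ∀ j, a ≤ j → j < b → f j = g j) :
    pr f a b = pr g a b := by
  unfold pr
  congr 1
  apply List.map_congr_left
  intro j hj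
  rw [List.mem_range'_1] at hj
  exact h j (by omega) (by omega)

theorem pr_commute {f : ℕ → M} {x : M} {a b : ℕ} (h : ∀ j, a ≤ j → j < b → Commute (f j) x) :
    Commute (pr f a b) x := by
  apply Commute.list_prod_left
  intro y hy
  obtain ⟨j, hj, rfl⟩ := List.mem_map.1 hy
  rw [List.mem_range'_1] at hj
  exact h j (by omega) (by omega)

theorem pr_eq_one {f : ℕ → M} {a b : ℕ} (h : ∀ j, a ≤ j → j < b → f j = 1) : pr f a b = 1 := by
  apply List.prod_eq_one
  intro y hy
  obtain ⟨j, hj, rfl⟩ := List.mem_map.1 hy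
  rw [List.mem_range'_1] at hj
  exact h j (by omega) (by omega)

theorem pd_of_le (f : ℕ → M) {a b : ℕ} (h : b ≤ a) : pd f a b = 1 := by
  rw [pd, pr_of_le _ h]; rfl

theorem pd_split (f : ℕ → M) {a b c : ℕ} (h1 : a ≤ b) (h2 : b ≤ c) :
    pd f a c = pd f b c * pd f a b := by
  rw [pd, pr_split _ h1 h2]; rfl

theorem pd_succ (f : ℕ → M) {a b : ℕ} (h : a ≤ b) : pd f a (b + 1) = f b * pd f a b := by
  rw [pd, pr_succ _ h]; rfl

theorem pd_head (f : ℕ → M) {a b : ℕ} (h : a < b) : pd f a b = pd f (a + 1) b * f a := by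
  rw [pd, pr_head _ h]; rfl

theorem pd_congr {f g : ℕ → M} {a b : ℕ} (h : ∀ j, a ≤ j → j < b → f j = g j) :
    pd f a b = pd g a b := by
  rw [pd, pd, pr_congr fun j h1 h2 => by rw [h j h1 h2]]

theorem pd_commute {f : ℕ → M} {x : M} {a b : ℕ} (h : ∀ j, a ≤ j → j < b → Commute (f j) x) :
    Commute (pd f a b) x := by
  rw [← MulOpposite.commute_op]
  exact pr_commute fun j h1 h2 => MulOpposite.commute_op.2 (h j h1 h2)

theorem pd_eq_one {f : ℕ → M} {a b : ℕ} (h : ∀ j, a ≤ j → j < b → f j = 1) : pd f a b = 1 := by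
  rw [pd, pr_eq_one fun j h1 h2 => by rw [h j h1 h2]; rfl]; rfl

theorem pd_mul {r t : ℕ → M} {a b : ℕ}
    (h : ∀ i j, a ≤ j → j < i → i < b → Commute (t i) (r j)) :
    pd (fun i => r i * t i) a b = pd r a b * pd t a b := by
  rcases le_or_gt a b with hab | hab
  · induction b, hab using Nat.le_induction with
    | base => simp [pd_of_le]
    | succ b hb ih =>
      rw [pd_succ _ hb, pd_succ _ hb, pd_succ _ hb,
        ih fun i j h1 h2 h3 => h i j h1 h2 (by omega)]
      have : Commute (t b) (pd r a b) :=
        (pd_commute fun j h1 h2 => (h b j h1 h2 (by omega)).symm).symm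
      simp only [mul_assoc]
      rw [← mul_assoc (t b), this.eq, mul_assoc]
  · simp [pd_of_le _ hab.le]

/-- The row and column readings of a staircase array agree, if cells that are strictly
northeast of each other commute. -/
theorem row_reading_eq_col_reading (c : ℕ → ℕ → M)
    (h : ∀ i j i' j', i ≤ j → i' ≤ j' → i < i' → j < j' → Commute (c i j) (c i' j')) (n : ℕ) :
    pd (fun i => pr (c i) i n) 0 n = pr (fun j => pd (fun i => c i j) 0 (j + 1)) 0 n := by
  induction n with
  | zero => simp [pr_of_le, pd_of_le]
  | succ n ih =>
    rw [pr_succ _ (Nat.zero_le n), ← ih, pd_succ _ (Nat.zero_le n), pd_succ _ (Nat.zero_le n),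
      pr_one]
    have e : pd (fun i => pr (c i) i (n + 1)) 0 n
        = pd (fun i => pr (c i) i n * c i n) 0 n :=
      pd_congr fun i _ hi => pr_succ _ hi.le
    rw [e, pd_mul]
    · have : Commute (c n n) (pd (fun i => pr (c i) i n) 0 n) :=
        (pd_commute fun i _ hi => pr_commute fun j h1 h2 => h i j n n h1 le_rfl hi h2).symm
      rw [← mul_assoc, ← mul_assoc, this.eq]
    · intro i j _ hji hi
      exact (pr_commute fun l h1 h2 => h j l i n h1 hi.le hji h2).symm

end Products

/-! ## Letters with values in `ℤ ∪ {∞}` -/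

/-- Strictly less, or infinite on the right. -/
def Prec (x y : WithTop ℤ) : Prop := x < y ∨ y = ⊤

infix:50 " ⊰ " => Prec

theorem Prec.trans {x y z : WithTop ℤ} (h1 : x ⊰ y) (h2 : y ⊰ z) : x ⊰ z := by
  rcases h2 with h2 | h2
  · rcases h1 with h1 | rfl
    · exact Or.inl (h1.trans h2)
    · exact absurd h2 not_top_lt
  · exact Or.inr h2

theorem Prec.le {x y : WithTop ℤ} (h : x ⊰ y) : x ≤ y := by
  rcases h with h | rfl
  · exact h.le
  · exact le_top

theorem Prec.lt {x y : WithTop ℤ} (h : x ⊰ y) (hx : x < ⊤) : x < y := by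
  rcases h with h | rfl
  · exact h
  · exact hx

theorem prec_of_lt_of_le {x y z : WithTop ℤ} (h1 : x < y) (h2 : y ≤ z) : x ⊰ z :=
  Or.inl (h1.trans_le h2)

section Letters

variable {M : Type*} [Monoid M]

/-- The relations satisfied by the operators attached to primed letters. -/
structure BraidRel (s : ℤ → Bool → M) : Prop where
  far : ∀ x y b c, x + 2 ≤ y → Commute (s x b) (s y c)
  braid : ∀ x b e c, s x b * s (x + 1) e * s x c = s (x + 1) c * s x e * s (x + 1) b
  braid' : ∀ x b e c, s (x + 1) b * s x e * s (x + 1) c = s x c * s (x + 1) e * s x b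

theorem BraidRel.op {s : ℤ → Bool → M} (h : BraidRel s) :
    BraidRel (fun x b => MulOpposite.op (s x b)) where
  far x y b c hxy := MulOpposite.commute_op.2 (h.far x y b c hxy)
  braid x b e c := by
    simp only [← MulOpposite.op_mul, ← mul_assoc, h.braid]
  braid' x b e c := by
    simp only [h.braid', ← MulOpposite.op_mul, ← mul_assoc]

/-- Extend the letter operators by `1` at infinity. -/
def tT (s : ℤ → Bool → M) (x : WithTop ℤ) (b : Bool) : M :=
  match x with
  | ⊤ => 1
  | (x : ℤ) => s x b

theorem tT_coe (s : ℤ → Bool → M) (x : ℤ) (b : Bool) : tT s x b = s x b := rfl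

theorem tT_op (s : ℤ → Bool → M) (x : WithTop ℤ) (b : Bool) :
    tT (fun x b => MulOpposite.op (s x b)) x b = MulOpposite.op (tT s x b) := by
  cases x <;> rfl

theorem tT_commute {s : ℤ → Bool → M} (hs : BraidRel s) {x y z : WithTop ℤ} (h1 : x ⊰ y)
    (h2 : y ⊰ z) (b c : Bool) : Commute (tT s x b) (tT s z c) := by
  rcases h2 with h2 | rfl
  · rcases h1 with h1 | rfl
    · induction x with
      | top => exact Commute.one_left _
      | coe x =>
      induction z with
      | top => exact Commute.one_right _
      | coe z =>
      induction y with
      | top => exact absurd h2 not_top_lt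
      | coe y =>
      rw [WithTop.coe_lt_coe] at h1 h2
      exact hs.far x z b c (by omega)
    · exact absurd h2 not_top_lt
  · exact Commute.one_right _

/-- Inserting `w` into a strictly increasing row: the generic move. -/
theorem row_move {s : ℤ → Bool → M} (hs : BraidRel s) {f : ℕ → WithTop ℤ} (b : ℕ → Bool)
    {a p n : ℕ} {w : WithTop ℤ} (e : Bool) (hap : a ≤ p) (hpn : p < n)
    (h1 : ∀ j, a ≤ j → j < p → f j < w) (h2 : w < f p) (h3 : ∀ j, p < j → f p ⊰ f j) :
    pr (fun j => tT s (f j) (b j)) a n * tT s w e = tT s (f p) (b p) *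
      pr (fun j => tT s (if j = p then w else f j) (if j = p then e else b j)) a n := by
  rw [pr_pick _ hap hpn, pr_pick _ hap hpn]
  have e1 : pr (fun j => tT s (if j = p then w else f j) (if j = p then e else b j)) a p
      = pr (fun j => tT s (f j) (b j)) a p :=
    pr_congr fun j _ hj => by rw [if_neg hj.ne, if_neg hj.ne]
  have e2 : pr (fun j => tT s (if j = p then w else f j) (if j = p then e else b j)) (p + 1) n
      = pr (fun j => tT s (f j) (b j)) (p + 1) n :=
    pr_congr fun j hj _ => by rw [if_neg (by omega), if_neg (by omega)]
  rw [e1, e2, if_pos rfl, if_pos rfl]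
  have c1 : Commute (pr (fun j => tT s (f j) (b j)) (p + 1) n) (tT s w e) :=
    pr_commute fun j hj _ => (tT_commute hs (Or.inl h2) (h3 j (by omega)) e (b j)).symm
  have c2 : Commute (pr (fun j => tT s (f j) (b j)) a p) (tT s (f p) (b p)) :=
    pr_commute fun j hj hj' => tT_commute hs (Or.inl (h1 j hj hj')) (Or.inl h2) _ _
  rw [mul_assoc, c1.eq, c2.eq]
  simp only [mul_assoc]

/-- Inserting `w` into a strictly increasing row containing `w` and `w + 1`. -/
theorem row_special {s : ℤ → Bool → M} (hs : BraidRel s) {f : ℕ → WithTop ℤ} (b : ℕ → Bool)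
    {a q n : ℕ} {w : ℤ} (e : Bool) (haq : a ≤ q) (hqn : q + 1 < n)
    (h1 : ∀ j, a ≤ j → j < q → f j < f q) (hq : f q = w) (hq1 : f (q + 1) = (w + 1 : ℤ))
    (h3 : ∀ j, q + 1 < j → f (q + 1) ⊰ f j) :
    pr (fun j => tT s (f j) (b j)) a n * s w e = s (w + 1) e *
      pr (fun j => tT s (f j) (if j = q then b (q + 1) else if j = q + 1 then b q else b j))
        a n := by
  have hlt : f q < f (q + 1) := by rw [hq, hq1, WithTop.coe_lt_coe]; omega
  rw [pr_pick _ haq (by omega : q < n), pr_pick _ haq (by omega : q < n), pr_head _ hqn,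
    pr_head _ hqn]
  have e1 : pr (fun j => tT s (f j) (if j = q then b (q + 1) else if j = q + 1 then b q else b j))
      a q = pr (fun j => tT s (f j) (b j)) a q :=
    pr_congr fun j _ hj => by rw [if_neg (by omega), if_neg (by omega)]
  have e2 : pr (fun j => tT s (f j) (if j = q then b (q + 1) else if j = q + 1 then b q else b j))
      (q + 1 + 1) n = pr (fun j => tT s (f j) (b j)) (q + 1 + 1) n :=
    pr_congr fun j _ hj => by rw [if_neg (by omega), if_neg (by omega)]
  rw [e1, e2, if_pos rfl, if_neg (by omega), if_pos rfl]
  have c1 : Commute (pr (fun j => tT s (f j) (b j)) (q + 1 + 1) n) (s w e) := by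
    refine pr_commute fun j hj _ => ?_
    have := tT_commute hs (Or.inl hlt) (h3 j (by omega)) e (b j)
    rw [hq, tT_coe] at this
    exact this.symm
  have c2 : Commute (pr (fun j => tT s (f j) (b j)) a q) (s (w + 1) e) := by
    refine pr_commute fun j hj hj' => ?_
    have := tT_commute hs (Or.inl (h1 j hj hj')) (Or.inl hlt) (b j) e
    rwa [hq1, tT_coe] at this
  rw [hq, hq1, tT_coe, tT_coe, tT_coe, tT_coe]
  calc _ = pr (fun j => tT s (f j) (b j)) a q * (s w (b q) * s (w + 1) (b (q + 1)) *
        s w e) * pr (fun j => tT s (f j) (b j)) (q + 1 + 1) n := by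
        simp only [mul_assoc]; rw [c1.eq]
    _ = _ := by
        rw [hs.braid]
        simp only [← mul_assoc]; rw [c2.eq]

/-- Inserting `w` into a strictly increasing row containing `w` but not `w + 1`. -/
theorem row_dead {s : ℤ → Bool → M} (hs : BraidRel s) {f : ℕ → WithTop ℤ} (b : ℕ → Bool)
    {a q n : ℕ} {w : ℤ} (e : Bool) (haq : a ≤ q) (hqn : q < n)
    (hq : f q = w) (h3 : ∀ j, q < j → ((w + 1 : ℤ) : WithTop ℤ) ⊰ f j) :
    pr (fun j => tT s (f j) (b j)) a n * s w e = pr (fun j => tT s (f j) (b j)) a q *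
      (s w (b q) * s w e) * pr (fun j => tT s (f j) (b j)) (q + 1) n := by
  rw [pr_pick _ haq hqn, hq, tT_coe]
  have c1 : Commute (pr (fun j => tT s (f j) (b j)) (q + 1) n) (s w e) := by
    refine pr_commute fun j hj _ => ?_
    have := tT_commute hs (x := w) (Or.inl (by rw [WithTop.coe_lt_coe]; omega))
      (h3 j (by omega)) e (b j)
    rw [tT_coe] at this
    exact this.symm
  simp only [mul_assoc]; rw [c1.eq]

end Letters

/-! ## Initial letters -/

/-- The letter operators, as a family. -/
noncomputable abbrev sgf : ℤ → Bool → OpM := fun x b => sg ⟨x, b⟩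

theorem braidRel_sgf : BraidRel sgf where
  far _ _ _ _ h := sg_far (Or.inl h)
  braid _ b e c := sg_braid (Or.inl rfl) b e c
  braid' _ b e c := sg_braid (Or.inr rfl) b e c

/-- The operator of a letter with value in `ℤ ∪ {∞}`. -/
noncomputable abbrev tg (x : WithTop ℤ) (b : Bool) : OpM := tT sgf x b

theorem tg_top (b : Bool) : tg ⊤ b = 1 := rfl

theorem tg_coe (x : ℤ) (b : Bool) : tg x b = sgf x b := rfl

theorem tg_commute {x y z : WithTop ℤ} (h1 : x ⊰ y) (h2 : y ⊰ z) (b c : Bool) :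
    Commute (tg x b) (tg z c) := tT_commute braidRel_sgf h1 h2 b c

theorem noneFix_tg (x : WithTop ℤ) (b : Bool) : NoneFix (tg x b) := by
  cases x
  · exact noneFix_one
  · exact noneFix_sg _

theorem ev_mul_congr {v v' : OpM} (h : ev v = ev v') (w : OpM) : ev (v * w) = ev (v' * w) := by
  change w.unop (ev v) = w.unop (ev v')
  rw [h]

theorem ev_mul_none {v w : OpM} (h : ev v = none) (hw : NoneFix w) : ev (v * w) = none := by
  change w.unop (ev v) = none
  rw [h, hw]

theorem ev_init_bit (x : WithTop ℤ) (b c : Bool) : ev (tg x b) = ev (tg x c) := by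
  cases x with
  | top => rfl
  | coe x =>
    change stepO _ (some 1) = stepO _ (some 1)
    rw [stepO_pos (Ok_one _), stepO_pos (Ok_one _)]

theorem ev_init_swap {x y : WithTop ℤ} (h : x ≠ y) (e f e' : Bool) :
    ev (tg x e * tg y f) = ev (tg y e' * tg x f) := by
  cases x with
  | top => simp only [tg_top, one_mul, mul_one]; exact ev_init_bit y f e'
  | coe x =>
    cases y with
    | top => simp only [tg_top, one_mul, mul_one]; exact ev_init_bit x e f
    | coe y =>
      rw [ev_mul_congr (ev_init_bit (y : WithTop ℤ) e' e)]
      exact stepO_init (by rintro rfl; exact h rfl) e f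

theorem ev_init_three {d M d' : WithTop ℤ} (h1 : d < M) (h2 : M ⊰ d') (f b f' : Bool) :
    ev (tg d' f * tg M false * tg d b) = ev (tg d f' * tg M b * tg d' false) := by
  by_cases hM : M = ⊤
  · subst hM
    have : d' = ⊤ := by
      rcases h2 with h2 | h2
      · exact absurd h2 not_top_lt
      · exact h2
    subst this
    simp only [tg_top, one_mul, mul_one]
    exact ev_init_bit d b f'
  · have hne : d' ≠ M := by
      rcases h2 with h2 | h2
      · exact h2.ne'
      · rw [h2]; exact fun h => hM h.symm
    rw [ev_mul_congr (ev_init_swap hne f false f), mul_assoc,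
      ← (tg_commute (Or.inl h1) h2 b false).eq, ← mul_assoc,
      ev_mul_congr (ev_init_swap h1.ne' f b f')]

theorem ev_not_comm {x : ℤ} {y : ℤ} (h : y = x + 1 ∨ x = y + 1) (b : Bool) :
    ev (sgf x b * sgf y true) = none := by
  change stepO _ (stepO _ (some 1)) = none
  rw [stepO_pos (Ok_one _), act_one, stepO_neg]
  rw [Ok_sPerm]
  simp only [forall_const, not_and]
  omega

/-- If a row starts with adjacent letters `d < M = d + 1`, and the larger one has been
inserted, then the letters involved are unprimed. -/
theorem bits_of_special {d M : ℤ} {d' : WithTop ℤ} (hM : M = d + 1) (hd' : (M : WithTop ℤ) ⊰ d')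
    {f e c g : Bool} {Y : OpM} (hY : NoneFix Y)
    (h : ev (tg d' f * sgf M e * sgf d c * sgf M g * Y) ≠ none) : e = false ∧ c = false := by
  have dead : ev (sgf M e * sgf d c * sgf M g) = none := by
    subst hM
    have e1 := ev_init_swap (x := d) (y := (d + 1 : ℤ)) (by rw [Ne, WithTop.coe_inj]; omega) g c g
    simp only [tg_coe] at e1
    rw [braidRel_sgf.braid', ev_mul_congr e1]
    have := ev_same (sgf (d + 1) g) 1 rfl d c e
    rwa [mul_one] at this
  have hdM : (d : WithTop ℤ) < M := by rw [WithTop.coe_lt_coe]; omega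
  by_cases hfar : d' = (M + 1 : ℤ)
  · subst hfar
    have he : e = false := by
      cases e with
      | false => rfl
      | true =>
        exfalso; apply h
        refine ev_mul_none (ev_mul_none (ev_mul_none ?_ (noneFix_sg _)) (noneFix_sg _)) hY
        exact ev_not_comm (Or.inr rfl) f
    subst he
    refine ⟨rfl, ?_⟩
    cases c with
    | false => rfl
    | true =>
      exfalso; apply h
      refine ev_mul_none (ev_mul_none ?_ (noneFix_sg _)) hY
      have e1 := ev_init_swap (x := ((M + 1 : ℤ) : WithTop ℤ)) (y := (M : ℤ))
        (by rw [Ne, WithTop.coe_inj]; omega) f false f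
      rw [← tg_coe, ← tg_coe, ev_mul_congr e1, mul_assoc,
        ← (tg_commute (Or.inl hdM) hd' true false).eq, ← mul_assoc]
      exact ev_mul_none (ev_not_comm (Or.inr hM) f) (noneFix_sg _)
  · exfalso; apply h
    have c0 : ∀ (x : ℤ) (b : Bool), x ≤ M → Commute (tg x b) (tg d' f) := by
      intro x b hx
      refine tg_commute (y := (M + 1 : ℤ)) (Or.inl (by rw [WithTop.coe_lt_coe]; omega)) ?_ _ _
      rcases hd' with hd' | hd'
      · left
        cases d' with
        | top => exact WithTop.coe_lt_top _
        | coe d' =>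
          rw [WithTop.coe_lt_coe] at hd' ⊢
          rw [WithTop.coe_inj] at hfar
          omega
      · exact Or.inr hd'
    have c1 : Commute (sgf M e * sgf d c * sgf M g) (tg d' f) :=
      ((c0 M e le_rfl).mul_left (c0 d c (by omega))).mul_left (c0 M g le_rfl)
    have e1 : tg d' f * sgf M e * sgf d c * sgf M g * Y
        = sgf M e * sgf d c * sgf M g * (tg d' f * Y) := by
      calc _ = tg d' f * (sgf M e * sgf d c * sgf M g) * Y := by simp only [mul_assoc]
        _ = _ := by rw [← c1.eq, mul_assoc]
    rw [e1]
    exact ev_mul_none dead ((noneFix_tg _ _).mul hY)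

/-! ## Symmetric increasing arrays and their reading words -/

/-- The symmetric unfolding of an increasing shifted tableau, with `⊤` for empty positions. -/
structure Inc (n : ℕ) (S : ℕ → ℕ → WithTop ℤ) : Prop where
  symm : ∀ i j, S i j = S j i
  incr : ∀ i j, S i j ⊰ S i (j + 1)
  bd : ∀ i j, n ≤ j → S i j = ⊤

namespace Inc

variable {n : ℕ} {S : ℕ → ℕ → WithTop ℤ}

theorem mono (h : Inc n S) {m : ℕ} (hm : n ≤ m) : Inc m S :=
  ⟨h.symm, h.incr, fun i j hj => h.bd i j (hm.trans hj)⟩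

theorem row (h : Inc n S) (i : ℕ) {j j' : ℕ} (hj : j < j') : S i j ⊰ S i j' := by
  induction j', hj using Nat.le_induction with
  | base => exact h.incr i j
  | succ k _ ih => exact ih.trans (h.incr i k)

theorem row_le (h : Inc n S) (i : ℕ) {j j' : ℕ} (hj : j ≤ j') : S i j ≤ S i j' := by
  rcases hj.eq_or_lt with rfl | hj
  · rfl
  · exact (h.row i hj).le

theorem col (h : Inc n S) {i i' : ℕ} (j : ℕ) (hi : i < i') : S i j ⊰ S i' j := by
  rw [h.symm i, h.symm i']; exact h.row j hi

theorem col_le (h : Inc n S) {i i' : ℕ} (j : ℕ) (hi : i ≤ i') : S i j ≤ S i' j := by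
  rw [h.symm i, h.symm i']; exact h.row_le j hi

theorem row_lt_iff (h : Inc n S) {i j j' : ℕ} (hj : S i j < ⊤) : S i j < S i j' ↔ j < j' := by
  constructor
  · intro hlt
    by_contra hle
    exact absurd (h.row_le i (not_lt.1 hle)) (not_le.2 hlt)
  · intro hlt
    exact (h.row i hlt).lt hj

theorem row_inj (h : Inc n S) {i j j' : ℕ} (hj : S i j < ⊤) (he : S i j = S i j') : j = j' := by
  rcases lt_trichotomy j j' with hlt | rfl | hlt
  · exact absurd he ((h.row_lt_iff hj).2 hlt).ne
  · rfl
  · rw [he] at hj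
    exact absurd he ((h.row_lt_iff hj).2 hlt).ne'

theorem bd' (h : Inc n S) {i j : ℕ} (hi : n ≤ i) : S i j = ⊤ := by
  rw [h.symm]; exact h.bd j i hi

end Inc

/-- Symmetric update of an array. -/
def upd {α : Type*} (S : ℕ → ℕ → α) (k p : ℕ) (w : α) : ℕ → ℕ → α :=
  fun i j => if (i = k ∧ j = p) ∨ (i = p ∧ j = k) then w else S i j

theorem upd_symm {α : Type*} {S : ℕ → ℕ → α} (h : ∀ i j, S i j = S j i) (k p : ℕ) (w : α)
    (i j : ℕ) : upd S k p w i j = upd S k p w j i := by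
  unfold upd
  rw [h i j]
  congr 1
  apply propext
  tauto

theorem upd_row {α : Type*} (S : ℕ → ℕ → α) (k p : ℕ) (w : α) (j : ℕ) :
    upd S k p w k j = if j = p then w else S k j := by
  unfold upd
  by_cases h : j = p
  · simp [h]
  · have : ¬(k = p ∧ j = k) := by omega
    simp [h, this]

theorem upd_self {α : Type*} (S : ℕ → ℕ → α) (k p : ℕ) (w : α) : upd S k p w k p = w := by
  rw [upd_row, if_pos rfl]

theorem upd_self' {α : Type*} (S : ℕ → ℕ → α) (k p : ℕ) (w : α) : upd S k p w p k = w := by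
  simp [upd]

theorem upd_of_ne {α : Type*} (S : ℕ → ℕ → α) {k p i j : ℕ} (w : α)
    (h : ¬((i = k ∧ j = p) ∨ (i = p ∧ j = k))) : upd S k p w i j = S i j := if_neg h

theorem upd_same {α : Type*} {S : ℕ → ℕ → α} (h : ∀ i j, S i j = S j i) (k p : ℕ) :
    upd S k p (S k p) = S := by
  funext i j
  unfold upd
  split_ifs with h1
  · rcases h1 with ⟨rfl, rfl⟩ | ⟨rfl, rfl⟩
    · rfl
    · exact h _ _
  · rfl

theorem upd_upd {α : Type*} (S : ℕ → ℕ → α) (k p : ℕ) (v w : α) :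
    upd (upd S k p v) k p w = upd S k p w := by
  funext i j
  unfold upd
  split_ifs <;> rfl

section Words

variable (S : ℕ → ℕ → WithTop ℤ) (B : ℕ → ℕ → Bool) (n : ℕ)

/-- The operator of a cell. -/
noncomputable def cellW (i j : ℕ) : OpM := tg (S i j) (B i j)

/-- The operator of a row, read from left to right. -/
noncomputable def rowW (i : ℕ) : OpM := pr (cellW S B i) i n

/-- The operator of a column, read from the diagonal to the first row. -/
noncomputable def colW (j : ℕ) : OpM := pd (fun i => cellW S B i j) 0 (j + 1)

/-- The word of a state of row insertion. -/
noncomputable def RS (k : ℕ) (w : WithTop ℤ) (e : Bool) : OpM :=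
  pd (rowW S B n) k n * tg w e * pd (rowW S B n) 0 k

/-- The word of a state of column insertion. -/
noncomputable def CS (k : ℕ) (w : WithTop ℤ) (e : Bool) : OpM :=
  pr (colW S B) 0 k * tg w e * pr (colW S B) k n

end Words

theorem noneFix_pr {f : ℕ → OpM} {a b : ℕ} (h : ∀ i, NoneFix (f i)) : NoneFix (pr f a b) :=
  noneFix_prod fun w hw => by
    obtain ⟨j, -, rfl⟩ := List.mem_map.1 hw
    exact h j

theorem noneFix_pd {f : ℕ → OpM} {a b : ℕ} (h : ∀ i, NoneFix (f i)) : NoneFix (pd f a b) := by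
  rcases le_or_gt a b with hab | hab
  · induction b, hab using Nat.le_induction with
    | base => rw [pd_of_le _ le_rfl]; exact noneFix_one
    | succ b hb ih => rw [pd_succ _ hb]; exact (h b).mul ih
  · rw [pd_of_le _ hab.le]; exact noneFix_one

theorem noneFix_rowW (S : ℕ → ℕ → WithTop ℤ) (B : ℕ → ℕ → Bool) (n i : ℕ) :
    NoneFix (rowW S B n i) := noneFix_pr fun _ => noneFix_tg _ _

theorem noneFix_colW (S : ℕ → ℕ → WithTop ℤ) (B : ℕ → ℕ → Bool) (i : ℕ) :
    NoneFix (colW S B i) := noneFix_pd fun _ => noneFix_tg _ _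

section Steps

variable {n : ℕ} {S S' : ℕ → ℕ → WithTop ℤ} {B B' : ℕ → ℕ → Bool}

theorem rowW_congr {i : ℕ} (h : ∀ j, i ≤ j → S i j = S' i j ∧ B i j = B' i j) :
    rowW S B n i = rowW S' B' n i :=
  pr_congr fun j hj _ => by rw [cellW, cellW, (h j hj).1, (h j hj).2]

theorem colW_congr {j : ℕ} (h : ∀ i, i ≤ j → S i j = S' i j ∧ B i j = B' i j) :
    colW S B j = colW S' B' j :=
  pd_congr fun i _ hi => by rw [cellW, cellW, (h i (by omega)).1, (h i (by omega)).2]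

/-- Transfer of a row move to the words of states. -/
theorem RS_step {k : ℕ} (hk : k < n) {w w' : WithTop ℤ} {e e' : Bool}
    (hrow : rowW S B n k * tg w e = tg w' e' * rowW S' B' n k)
    (h : ∀ i j, i ≠ k → i ≤ j → S i j = S' i j ∧ B i j = B' i j) :
    RS S B n k w e = RS S' B' n (k + 1) w' e' := by
  unfold RS
  rw [pd_head _ hk, pd_succ _ (Nat.zero_le k)]
  have e1 : pd (rowW S' B' n) (k + 1) n = pd (rowW S B n) (k + 1) n :=
    pd_congr fun i hi _ => (rowW_congr fun j hj => h i j (by omega) hj).symm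
  have e2 : pd (rowW S' B' n) 0 k = pd (rowW S B n) 0 k :=
    pd_congr fun i _ hi => (rowW_congr fun j hj => h i j (by omega) hj).symm
  rw [e1, e2]
  simp only [mul_assoc]
  rw [← mul_assoc (rowW S B n k), hrow]
  simp only [mul_assoc]

/-- Transfer of a column move to the words of states. -/
theorem CS_step {k : ℕ} (hk : k < n) {w w' : WithTop ℤ} {e e' : Bool}
    (hcol : tg w e * colW S B k = colW S' B' k * tg w' e')
    (h : ∀ i j, j ≠ k → i ≤ j → S i j = S' i j ∧ B i j = B' i j) :
    CS S B n k w e = CS S' B' n (k + 1) w' e' := by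
  unfold CS
  rw [pr_head _ hk, pr_succ _ (Nat.zero_le k)]
  have e1 : pr (colW S' B') (k + 1) n = pr (colW S B) (k + 1) n :=
    pr_congr fun i hi _ => (colW_congr fun j hj => h j i (by omega) hj).symm
  have e2 : pr (colW S' B') 0 k = pr (colW S B) 0 k :=
    pr_congr fun i _ hi => (colW_congr fun j hj => h j i (by omega) hj).symm
  rw [e1, e2]
  simp only [mul_assoc]
  rw [← mul_assoc (tg w e), hcol]
  simp only [mul_assoc]

theorem RS_generic (hS : Inc n S) {k p : ℕ} (hkp : k ≤ p) (hpn : p < n) {w : WithTop ℤ} (e : Bool)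
    (h1 : ∀ j, j < p → S k j < w) (h2 : w < S k p) :
    RS S B n k w e = RS (upd S k p w) (upd B k p e) n (k + 1) (S k p) (B k p) := by
  refine RS_step (by omega) ?_ fun i j hi hij => ?_
  · have := row_move braidRel_sgf (f := S k) (B k) e hkp hpn (fun j _ hj => h1 j hj) h2
      (fun j hj => hS.row k hj)
    unfold rowW cellW
    simp only [upd_row]
    exact this
  · rw [upd_of_ne _ _ (by omega), upd_of_ne _ _ (by omega)]; exact ⟨rfl, rfl⟩

/-- Columns as reversed rows. -/
theorem colW_eq (hS : ∀ i j, S i j = S j i) (hB : ∀ i j, B i j = B j i) (k : ℕ) :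
    colW S B k = (pr (fun j => tT (fun x b => MulOpposite.op (sgf x b)) (S k j) (B k j))
      0 (k + 1)).unop := by
  unfold colW pd cellW
  congr 1
  refine pr_congr fun j _ _ => ?_
  rw [tT_op, hS, hB]

theorem CS_generic (hS : Inc n S) (hB : ∀ i j, B i j = B j i) {k p : ℕ} (hkp : p ≤ k) (hkn : k < n)
    {w : WithTop ℤ} (e : Bool) (h1 : ∀ j, j < p → S k j < w) (h2 : w < S k p) :
    CS S B n k w e = CS (upd S k p w) (upd B k p e) n (k + 1) (S k p) (B k p) := by
  refine CS_step hkn ?_ fun i j hi hij => ?_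
  · have := row_move braidRel_sgf.op (f := S k) (B k) e (Nat.zero_le p) (Nat.lt_succ_of_le hkp)
      (fun j _ hj => h1 j hj) h2 (fun j hj => hS.row k hj)
    rw [colW_eq hS.symm hB, colW_eq (upd_symm hS.symm k p w) (upd_symm hB k p e)]
    simp only [upd_row]
    have := congrArg MulOpposite.unop this
    simpa only [MulOpposite.unop_mul, tT_op, MulOpposite.unop_op] using this
  · rw [upd_of_ne _ _ (by omega), upd_of_ne _ _ (by omega)]; exact ⟨rfl, rfl⟩

/-- Exchange the values in positions `(k, q)` and `(k, q + 1)`, symmetrically. -/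
def swp (B : ℕ → ℕ → Bool) (k q : ℕ) : ℕ → ℕ → Bool :=
  upd (upd B k q (B k (q + 1))) k (q + 1) (B k q)

theorem swp_row (B : ℕ → ℕ → Bool) (k q j : ℕ) :
    swp B k q k j = if j = q then B k (q + 1) else if j = q + 1 then B k q else B k j := by
  unfold swp
  rw [upd_row, upd_row]
  grind

theorem swp_symm (hB : ∀ i j, B i j = B j i) (k q i j : ℕ) : swp B k q i j = swp B k q j i :=
  upd_symm (upd_symm hB _ _ _) _ _ _ i j

theorem swp_of_ne {k q i j : ℕ} (h1 : ¬(i = k ∧ (j = q ∨ j = q + 1)))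
    (h2 : ¬((i = q ∨ i = q + 1) ∧ j = k)) : swp B k q i j = B i j := by
  unfold swp
  rw [upd_of_ne _ _ (by omega), upd_of_ne _ _ (by omega)]

theorem RS_special (hS : Inc n S) {k q : ℕ} (hkp : k ≤ q) (hpn : q + 1 < n) {w : ℤ} (e : Bool)
    (hq : S k q = w) (hq1 : S k (q + 1) = (w + 1 : ℤ)) :
    RS S B n k w e = RS S (swp B k q) n (k + 1) (w + 1 : ℤ) e := by
  refine RS_step (by omega) ?_ fun i j hi hij => ?_
  · have := row_special braidRel_sgf (f := S k) (B k) e hkp hpn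
      (fun j _ hj => (hS.row k hj).lt (by
        have := (hS.row k hj).le
        rw [hq] at this
        exact this.trans_lt (WithTop.coe_lt_top _))) hq hq1
      (fun j hj => hS.row k hj)
    unfold rowW cellW
    simp only [swp_row]
    exact this
  · rw [swp_of_ne (by omega) (by omega)]; exact ⟨rfl, rfl⟩

theorem CS_special (hS : Inc n S) (hB : ∀ i j, B i j = B j i) {k q : ℕ} (hkp : q + 1 ≤ k)
    (hpn : k < n) {w : ℤ} (e : Bool)
    (hq : S k q = w) (hq1 : S k (q + 1) = (w + 1 : ℤ)) :
    CS S B n k w e = CS S (swp B k q) n (k + 1) (w + 1 : ℤ) e := by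
  refine CS_step (by omega) ?_ fun i j hi hij => ?_
  · have := row_special braidRel_sgf.op (f := S k) (B k) e (Nat.zero_le q) (Nat.lt_succ_of_le hkp)
      (fun j _ hj => (hS.row k hj).lt (by
        have := (hS.row k hj).le
        rw [hq] at this
        exact this.trans_lt (WithTop.coe_lt_top _))) hq hq1
      (fun j hj => hS.row k hj)
    rw [colW_eq hS.symm hB, colW_eq hS.symm (swp_symm hB k q)]
    simp only [swp_row]
    have := congrArg MulOpposite.unop this
    simp only [MulOpposite.unop_mul, tT_op, MulOpposite.unop_op] at this ⊢
    exact this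
  · rw [swp_of_ne (by omega) (by omega)]; exact ⟨rfl, rfl⟩

end Steps

/-! ## Row readings and column readings -/

section Diag

variable {n : ℕ} {S : ℕ → ℕ → WithTop ℤ}

theorem Inc.cell_commute (hS : Inc n S) (B B' : ℕ → ℕ → Bool) {i j i' j' : ℕ} (hi : i < i')
    (hj : j < j') : Commute (cellW S B i j) (cellW S B' i' j') :=
  tg_commute (hS.row i hj) (hS.col j' hi) _ _

theorem rowRead_eq_colRead (hS : Inc n S) (B : ℕ → ℕ → Bool) (n : ℕ) :
    pd (rowW S B n) 0 n = pr (colW S B) 0 n :=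
  row_reading_eq_col_reading (cellW S B) (fun _ _ _ _ _ _ hi hj => hS.cell_commute B B hi hj) n

theorem RS_top (S : ℕ → ℕ → WithTop ℤ) (B : ℕ → ℕ → Bool) {n k : ℕ} (hk : k ≤ n) (e : Bool) :
    RS S B n k ⊤ e = pd (rowW S B n) 0 n := by
  rw [RS, tg_top, mul_one, ← pd_split _ (Nat.zero_le k) hk]

theorem CS_top {N : ℕ} (hS : Inc N S) (B : ℕ → ℕ → Bool) {n k : ℕ} (hk : k ≤ n) (e : Bool) :
    CS S B n k ⊤ e = pd (rowW S B n) 0 n := by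
  rw [CS, tg_top, mul_one, ← pr_split _ (Nat.zero_le k) hk, rowRead_eq_colRead hS]

/-- The transition from row insertion to column insertion at the main diagonal. -/
theorem ev_diag {N : ℕ} (hS : Inc N S) {B : ℕ → ℕ → Bool} {k : ℕ} (hk : k + 1 < n) {M : WithTop ℤ}
    (h1 : S k k < M) (h2 : M ⊰ S (k + 1) (k + 1)) (hB : B (k + 1) (k + 1) = false) (f : Bool) :
    ev (RS S B n (k + 1) M false) = ev (CS S (upd B k k f) n (k + 1) M (B k k)) := by
  set c : ℕ → ℕ → OpM := fun i j => if i = j ∧ (i = k ∨ i = k + 1) then 1 else cellW S B i j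
    with hc
  have hc0 : ∀ i j, ¬(i = j ∧ (i = k ∨ i = k + 1)) → c i j = cellW S B i j := fun i j h => by
    rw [hc]; exact if_neg h
  have hc1 : ∀ i, i = k ∨ i = k + 1 → c i i = 1 := fun i h => by rw [hc]; exact if_pos ⟨rfl, h⟩
  have hcu : ∀ i j, ¬(i = j ∧ (i = k ∨ i = k + 1)) → cellW S (upd B k k f) i j = c i j := by
    intro i j h
    rw [hc0 i j h, cellW, cellW, upd_of_ne _ _ (by omega)]
  have RR := row_reading_eq_col_reading c (fun i j i' j' _ _ hi hj => by
    simp only [hc]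
    split_ifs
    · exact Commute.one_left _
    · exact Commute.one_left _
    · exact Commute.one_right _
    · exact hS.cell_commute B B hi hj) n
  have rowc : ∀ i, i ≠ k → i ≠ k + 1 → pr (c i) i n = rowW S B n i := fun i h h' =>
    pr_congr fun j _ _ => hc0 i j (by omega)
  have rowd : ∀ i, i = k ∨ i = k + 1 → rowW S B n i = cellW S B i i * pr (c i) i n := by
    intro i hi
    rw [rowW, pr_head _ (by omega : i < n), pr_head (c i) (by omega : i < n), hc1 i hi, one_mul]
    congr 1
    exact pr_congr fun j hj _ => (hc0 i j (by omega)).symm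
  have colc : ∀ j, j ≠ k → j ≠ k + 1 →
      pd (fun i => c i j) 0 (j + 1) = colW S (upd B k k f) j := fun j h h' =>
    pd_congr fun i _ _ => (hcu i j (by omega)).symm
  have cold : ∀ j, j = k ∨ j = k + 1 → colW S (upd B k k f) j
      = cellW S (upd B k k f) j j * pd (fun i => c i j) 0 (j + 1) := by
    intro j hj
    rw [colW, pd_succ _ (Nat.zero_le j), pd_succ (fun i => c i j) (Nat.zero_le j), hc1 j hj,
      one_mul]
    congr 1
    exact pd_congr fun i _ _ => hcu i j (by omega)
  have hRS : RS S B n (k + 1) M false = tg (S (k + 1) (k + 1)) false * tg M false *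
      tg (S k k) (B k k) * pd (fun i => pr (c i) i n) 0 n := by
    have hU : ∀ x : OpM, (∀ i j, k + 1 ≤ i → k + 2 ≤ j → Commute (cellW S B i j) x) →
        Commute (pd (rowW S B n) (k + 2) n * pr (c (k + 1)) (k + 1) n) x := by
      intro x hx
      refine Commute.mul_left (pd_commute fun i hi _ => pr_commute fun j hj _ =>
        hx i j (by omega) (by omega)) (pr_commute fun j hj _ => ?_)
      rcases hj.eq_or_lt with rfl | hj
      · rw [hc1 _ (Or.inr rfl)]; exact Commute.one_left _
      · rw [hc0 _ _ (by omega)]; exact hx _ _ le_rfl (by omega)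
    have hM : ∀ i j, k + 1 ≤ i → k + 2 ≤ j → S (k + 1) (k + 1) ⊰ S i j := fun i j hi hj => by
      rcases hS.row (k + 1) (show k + 1 < j by omega) with h | h
      · exact prec_of_lt_of_le h (hS.col_le j hi)
      · exact Or.inr (top_le_iff.1 (h.symm.le.trans (hS.col_le j hi)))
    have c1 : Commute (pd (rowW S B n) (k + 2) n) (cellW S B (k + 1) (k + 1)) :=
      pd_commute fun i hi _ => pr_commute fun j hj _ =>
        (hS.cell_commute B B (by omega) (by omega)).symm
    have c2 := hU (tg M false) fun i j hi hj => (tg_commute h2 (hM i j hi hj) _ _).symm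
    have c3 := hU (tg (S k k) (B k k)) fun i j hi hj =>
      (tg_commute (hS.row k (show k < k + 1 by omega))
        ((hS.col (k + 1) (show k < k + 1 by omega)).trans (hM i j hi hj)) _ _).symm
    have e1 : pd (fun i => pr (c i) i n) 0 n = pd (rowW S B n) (k + 2) n * pr (c (k + 1)) (k + 1) n
        * pr (c k) k n * pd (rowW S B n) 0 k := by
      rw [pd_split _ (Nat.zero_le (k + 2)) (show k + 2 ≤ n by omega), pd_succ _ (Nat.zero_le (k + 1)),
        pd_succ _ (Nat.zero_le k)]
      rw [pd_congr (f := fun i => pr (c i) i n) (g := rowW S B n)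
          (a := k + 2) (b := n) fun i hi _ => rowc i (by omega) (by omega),
        pd_congr (f := fun i => pr (c i) i n) (g := rowW S B n) (a := 0) (b := k)
        fun i _ hi => rowc i (by omega) (by omega)]
      simp only [mul_assoc]
    have hd' : cellW S B (k + 1) (k + 1) = tg (S (k + 1) (k + 1)) false := by rw [cellW, hB]
    rw [RS, pd_head _ hk, pd_succ _ (Nat.zero_le k), rowd _ (Or.inl rfl), rowd _ (Or.inr rfl), e1]
    rw [hd'] at c1 ⊢
    rw [show cellW S B k k = tg (S k k) (B k k) from rfl]
    calc _ = (pd (rowW S B n) (k + 2) n * tg (S (k + 1) (k + 1)) false) *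
          pr (c (k + 1)) (k + 1) n * tg M false *
          tg (S k k) (B k k) * (pr (c k) k n * pd (rowW S B n) 0 k) := by simp only [mul_assoc]
      _ = tg (S (k + 1) (k + 1)) false * ((pd (rowW S B n) (k + 2) n *
          pr (c (k + 1)) (k + 1) n) * (tg M false *
          tg (S k k) (B k k))) * (pr (c k) k n * pd (rowW S B n) 0 k) := by
          rw [c1.eq]; simp only [mul_assoc]
      _ = _ := by rw [(c2.mul_right c3).eq]; simp only [mul_assoc]
  have hCS : CS S (upd B k k f) n (k + 1) M (B k k) = tg (S k k) f * tg M (B k k) *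
      tg (S (k + 1) (k + 1)) false * pd (fun i => pr (c i) i n) 0 n := by
    rw [RR]
    have hU : ∀ x : OpM, (∀ i j b, i < k → j ≤ k → Commute (tg (S i j) b) x) →
        Commute (pr (colW S (upd B k k f)) 0 k * pd (fun i => c i k) 0 (k + 1)) x := by
      intro x hx
      refine Commute.mul_left (pr_commute fun j _ hj => pd_commute fun i _ hi =>
        hx i j _ (by omega) (by omega)) (pd_commute fun i _ hi => ?_)
      rcases (Nat.lt_succ_iff.1 hi).eq_or_lt with rfl | hi
      · rw [hc1 _ (Or.inl rfl)]; exact Commute.one_left _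
      · rw [hc0 _ _ (by omega)]; exact hx _ _ _ hi le_rfl
    have hM : ∀ i j, i < k → j ≤ k → S i j ⊰ S k k := fun i j hi hj =>
      match hS.col k hi with
      | .inl h => Or.inl ((hS.row_le i hj).trans_lt h)
      | .inr h => Or.inr h
    have c1 : Commute (pr (colW S (upd B k k f)) 0 k) (tg (S k k) f) :=
      pr_commute fun j _ hj => pd_commute fun i _ hi =>
        tg_commute (hS.row i hj) (hS.col k (by omega)) _ _
    have c2 := hU (tg M (B k k)) fun i j b hi hj => tg_commute (hM i j hi hj) (Or.inl h1) _ _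
    have c3 := hU (tg (S (k + 1) (k + 1)) false) fun i j b hi hj =>
      tg_commute ((hM i j hi hj).trans (Or.inl h1)) h2 _ _
    have e1 : pr (fun j => pd (fun i => c i j) 0 (j + 1)) 0 n
        = pr (colW S (upd B k k f)) 0 k * pd (fun i => c i k) 0 (k + 1) *
          pd (fun i => c i (k + 1)) 0 (k + 1 + 1) * pr (colW S (upd B k k f)) (k + 2) n := by
      rw [pr_split _ (Nat.zero_le (k + 2)) (show k + 2 ≤ n by omega), pr_succ _ (Nat.zero_le (k + 1)),
        pr_succ _ (Nat.zero_le k)]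
      rw [pr_congr (f := fun j => pd (fun i => c i j) 0 (j + 1)) (g := colW S (upd B k k f))
          (a := k + 2) (b := n) fun i hi _ => colc i (by omega) (by omega),
        pr_congr (f := fun j => pd (fun i => c i j) 0 (j + 1)) (g := colW S (upd B k k f))
          (a := 0) (b := k) fun i _ hi => colc i (by omega) (by omega)]
    have hd : cellW S (upd B k k f) k k = tg (S k k) f := by rw [cellW, upd_self]
    have hd' : cellW S (upd B k k f) (k + 1) (k + 1) = tg (S (k + 1) (k + 1)) false := by
      rw [cellW, upd_of_ne _ _ (by omega), hB]
    rw [CS, pr_head _ hk, pr_succ _ (Nat.zero_le k), cold _ (Or.inl rfl), cold _ (Or.inr rfl), e1,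
      hd, hd']
    calc _ = (pr (colW S (upd B k k f)) 0 k * tg (S k k) f) * pd (fun i => c i k) 0 (k + 1) *
          tg M (B k k) * tg (S (k + 1) (k + 1)) false * (pd (fun i => c i (k + 1)) 0 (k + 1 + 1) *
          pr (colW S (upd B k k f)) (k + 2) n) := by simp only [mul_assoc]
      _ = tg (S k k) f * ((pr (colW S (upd B k k f)) 0 k * pd (fun i => c i k) 0 (k + 1)) *
          (tg M (B k k) * tg (S (k + 1) (k + 1)) false)) *
          (pd (fun i => c i (k + 1)) 0 (k + 1 + 1) *
          pr (colW S (upd B k k f)) (k + 2) n) := by rw [c1.eq]; simp only [mul_assoc]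
      _ = _ := by rw [(c2.mul_right c3).eq]; simp only [mul_assoc]
  rw [hRS, hCS]
  exact ev_mul_congr (ev_init_three h1 h2 _ _ _) _

end Diag

/-! ## States of the insertion process -/

/-- A state of the insertion process: the array with its primes, the moving letter with its
prime. -/
structure St where
  S : ℕ → ℕ → WithTop ℤ
  B : ℕ → ℕ → Bool
  w : WithTop ℤ
  e : Bool

/-- The position at which the moving letter acts. -/
noncomputable def pos (S : ℕ → ℕ → WithTop ℤ) (k : ℕ) (w : WithTop ℤ) : ℕ := sInf {p | w < S k p}

open Classical in
/-- One step of insertion, in the `k`-th row or column. -/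
noncomputable def step (k : ℕ) (X : St) : St :=
  if X.w = ⊤ then X
  else if ∃ j, X.S k j = X.w then
    ⟨X.S, swp X.B k (pos X.S k X.w - 1), X.S k (pos X.S k X.w), X.e⟩
  else
    ⟨upd X.S k (pos X.S k X.w) X.w,
      upd X.B k (pos X.S k X.w) (if pos X.S k X.w = k then false else X.e),
      X.S k (pos X.S k X.w), if pos X.S k X.w = k then X.e else X.B k (pos X.S k X.w)⟩

open Classical in
/-- The word of a state. -/
noncomputable def SW (n k : ℕ) (X : St) : OpM :=
  if ∀ k', k = k' + 1 → X.S k' k < X.w then RS X.S X.B n k X.w X.e else CS X.S X.B n k X.w X.e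

/-- The condition on the moving letter inherited from the preceding step. -/
def Valid (S : ℕ → ℕ → WithTop ℤ) (k : ℕ) (w : WithTop ℤ) : Prop :=
  k = 0 ∨ ∃ k' x, k = k' + 1 ∧
    ((S k' x < w ∧ w ⊰ S k x) ∨ (w < ⊤ ∧ S k' (x + 1) = w ∧ S k x = w))

/-- Admissible primes: symmetric, off the diagonal, and on finite entries. -/
structure WB (S : ℕ → ℕ → WithTop ℤ) (B : ℕ → ℕ → Bool) : Prop where
  symm : ∀ i j, B i j = B j i
  diag : ∀ i, B i i = false
  top : ∀ i j, S i j = ⊤ → B i j = false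

/-- If the moving letter occurs in the segment then so does its successor. -/
def Alive (S : ℕ → ℕ → WithTop ℤ) (k : ℕ) (w : WithTop ℤ) : Prop :=
  ∀ q (x : ℤ), S k q = x → w = x → S k (q + 1) = (x + 1 : ℤ)

section Step

variable {m n k : ℕ} {S : ℕ → ℕ → WithTop ℤ} {B : ℕ → ℕ → Bool} {w : WithTop ℤ} {e : Bool}

theorem pos_eq {p : ℕ} (h1 : ∀ j, j < p → S k j ≤ w) (h2 : w < S k p) : pos S k w = p := by
  refine le_antisymm (Nat.sInf_le h2) (le_csInf ⟨p, h2⟩ fun j hj => ?_)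
  by_contra hlt
  exact absurd (h1 j (not_le.1 hlt)) (not_le.2 hj)

theorem step_gen (hS : Inc m S) {p : ℕ} (h1 : ∀ j, j < p → S k j < w) (h2 : w < S k p) :
    step k ⟨S, B, w, e⟩ = ⟨upd S k p w, upd B k p (if p = k then false else e), S k p,
      if p = k then e else B k p⟩ := by
  have hp := pos_eq (fun j hj => (h1 j hj).le) h2
  have hn : ¬∃ j, S k j = w := by
    rintro ⟨j, hj⟩
    rcases lt_or_ge j p with hjp | hjp
    · exact (h1 j hjp).ne hj
    · exact absurd (h2.trans_le (hS.row_le k hjp)) (by rw [hj]; exact lt_irrefl _)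
  unfold step
  simp only
  rw [if_neg (h2.trans_le le_top).ne, if_neg hn, hp]

theorem step_spec (hS : Inc m S) {q : ℕ} (hq : S k q = w) (hw : w < ⊤) :
    step k ⟨S, B, w, e⟩ = ⟨S, swp B k q, S k (q + 1), e⟩ := by
  have h2 : w < S k (q + 1) := by
    have := (hS.incr k q).lt (hq ▸ hw)
    rwa [hq] at this
  have hp : pos S k w = q + 1 := pos_eq (fun j hj => by
    rw [← hq]; exact hS.row_le k (by omega)) h2
  unfold step
  simp only
  rw [if_neg hw.ne, if_pos ⟨q, hq⟩, hp, Nat.add_sub_cancel]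

theorem step_cases (hS : Inc m S) (hw : w < ⊤) :
    (∃ p, p ≤ m ∧ (∀ j, j < p → S k j < w) ∧ w < S k p) ∨
      ∃ q, q < m ∧ S k q = w ∧ w < S k (q + 1) := by
  by_cases h : ∃ j, S k j = w
  · obtain ⟨q, hq⟩ := h
    refine Or.inr ⟨q, ?_, hq, ?_⟩
    · by_contra hlt
      rw [hS.bd k q (not_lt.1 hlt)] at hq
      exact hw.ne hq.symm
    · have := (hS.incr k q).lt (hq ▸ hw)
      rwa [hq] at this
  · push Not at h
    left
    have hex : ∃ p, w < S k p := ⟨m, by rw [hS.bd k m le_rfl]; exact hw⟩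
    classical
    refine ⟨Nat.find hex, Nat.find_min' hex (by rw [hS.bd k m le_rfl]; exact hw), fun j hj => ?_,
      Nat.find_spec hex⟩
    exact lt_of_le_of_ne (not_lt.1 (Nat.find_min hex hj)) (h j)

theorem Inc.update (hS : Inc m S) {p : ℕ} {v : WithTop ℤ} {M : ℕ} (hM : m ≤ M) (hk : k < M)
    (hp : p < M) (hl : ∀ j, j + 1 = p → S k j ⊰ v) (hl' : ∀ j, j + 1 = k → S p j ⊰ v)
    (hr : v ⊰ S k (p + 1)) (hr' : v ⊰ S p (k + 1)) : Inc M (upd S k p v) where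
  symm := upd_symm hS.symm k p v
  bd i j hj := by rw [upd_of_ne _ _ (by omega)]; exact hS.bd i j (by omega)
  incr i j := by
    by_cases h1 : (i = k ∧ j = p) ∨ (i = p ∧ j = k)
    · rw [upd_of_ne S v (by omega : ¬((i = k ∧ j + 1 = p) ∨ (i = p ∧ j + 1 = k)))]
      rcases h1 with ⟨rfl, rfl⟩ | ⟨rfl, rfl⟩
      · rw [upd_self]; exact hr
      · rw [upd_self']; exact hr'
    · rw [upd_of_ne S v h1]
      by_cases h2 : (i = k ∧ j + 1 = p) ∨ (i = p ∧ j + 1 = k)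
      · rcases h2 with ⟨rfl, rfl⟩ | ⟨rfl, rfl⟩
        · rw [upd_self]; exact hl _ rfl
        · rw [upd_self']; exact hl' _ rfl
      · rw [upd_of_ne S v h2]; exact hS.incr i j

theorem Valid.col_lt (hS : Inc m S) (hv : Valid S k w) {p : ℕ} (h1 : ∀ j, j < p → S k j < w)
    (h2 : w < S k p) {j : ℕ} (hj : j + 1 = k) : S p j < w := by
  rcases hv with rfl | ⟨k', x, rfl, ⟨h3, h4⟩ | ⟨h3, h4, h5⟩⟩
  · omega
  · obtain rfl : j = k' := by omega
    refine lt_of_le_of_lt ?_ h3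
    rw [hS.symm]
    refine hS.row_le _ ?_
    by_contra hx
    refine absurd (h1 x (by omega)) (not_lt.2 h4.le)
  · exfalso
    rcases lt_or_ge x p with hx | hx
    · exact (h1 x hx).ne h5
    · exact absurd (h2.trans_le (hS.row_le _ hx)) (by rw [h5]; exact lt_irrefl _)

theorem update_inc (hS : Inc m S) (hv : Valid S k w) {p : ℕ}
    (h1 : ∀ j, j < p → S k j < w) (h2 : w < S k p) {M : ℕ} (hM : m ≤ M) (hkM : k < M)
    (hpM : p < M) : Inc M (upd S k p w) :=
  hS.update hM hkM hpM (fun j hj => Or.inl (h1 j (by omega)))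
    (fun j hj => Or.inl (hv.col_lt hS h1 h2 hj))
    (prec_of_lt_of_le h2 (hS.row_le k (Nat.le_succ p)))
    (prec_of_lt_of_le h2 (by rw [hS.symm k]; exact hS.row_le p (Nat.le_succ k)))

theorem valid_next_gen (hS : Inc m S) {p : ℕ} (h2 : w < S k p) :
    Valid (upd S k p w) (k + 1) (S k p) := by
  refine Or.inr ⟨k, p, rfl, Or.inl ⟨by rwa [upd_self], ?_⟩⟩
  rw [upd_of_ne _ _ (by omega)]
  exact hS.col p (Nat.lt_succ_self k)

theorem Valid.next_spec (hS : Inc m S) (ha : Alive S k w) {q : ℕ} (hq : S k q = w)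
    (hw : w < ⊤) : Valid S (k + 1) (S k (q + 1)) := by
  refine Or.inr ⟨k, q, rfl, ?_⟩
  obtain ⟨x, rfl⟩ := WithTop.ne_top_iff_exists.1 hw.ne
  have h1 := ha q x hq rfl
  have h2 : (x : WithTop ℤ) < S (k + 1) q := by
    have := (hS.col q (Nat.lt_succ_self k)).lt (hq ▸ hw)
    rwa [hq] at this
  rw [h1]
  rcases lt_trichotomy ((x + 1 : ℤ) : WithTop ℤ) (S (k + 1) q) with h | h | h
  · exact Or.inl ⟨by rw [hq, WithTop.coe_lt_coe]; omega, Or.inl h⟩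
  · exact Or.inr ⟨WithTop.coe_lt_top _, rfl, h.symm⟩
  · exfalso
    obtain ⟨y, hy⟩ := WithTop.ne_top_iff_exists.1 (h.trans (WithTop.coe_lt_top _)).ne
    rw [← hy, WithTop.coe_lt_coe] at h h2
    omega

theorem row_phase (hS : Inc m S) (hr : ∀ k', k = k' + 1 → S k' k < w) {j : ℕ} (hj : j < k) :
    S k j < w := by
  obtain ⟨k', rfl⟩ : ∃ k', k = k' + 1 := ⟨k - 1, by omega⟩
  rw [hS.symm]
  exact (hS.col_le _ (by omega)).trans_lt (hr k' rfl)

theorem not_row_phase (hS : Inc m S) (hr : ¬∀ k', k = k' + 1 → S k' k < w) :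
    ∃ k', k = k' + 1 ∧ w ≤ S k k' := by
  push Not at hr
  obtain ⟨k', hk, h⟩ := hr
  exact ⟨k', hk, by rwa [hS.symm]⟩

end Step

section Step

variable {m k : ℕ} {S : ℕ → ℕ → WithTop ℤ} {B : ℕ → ℕ → Bool} {w : WithTop ℤ} {e : Bool}

theorem NoneFix.pd_rowW (S : ℕ → ℕ → WithTop ℤ) (B : ℕ → ℕ → Bool) (n i j : ℕ) :
    NoneFix (pd (rowW S B n) i j) := noneFix_pd fun _ => noneFix_rowW _ _ _ _

theorem NoneFix.pr_colW (S : ℕ → ℕ → WithTop ℤ) (B : ℕ → ℕ → Bool) (i j : ℕ) :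
    NoneFix (pr (colW S B) i j) := noneFix_pr fun _ => noneFix_colW _ _ _

theorem not_special_gap (hS : Inc m S) {q : ℕ} {x : ℤ} (hq : S k q = x)
    (h : S k (q + 1) ≠ (x + 1 : ℤ)) : ∀ j, q < j → ((x + 1 : ℤ) : WithTop ℤ) ⊰ S k j := by
  intro j hj
  have h1 : (x : WithTop ℤ) < S k (q + 1) := by
    have := (hS.incr k q).lt (hq ▸ WithTop.coe_lt_top x)
    rwa [hq] at this
  have h2 : ((x + 1 : ℤ) : WithTop ℤ) < S k (q + 1) := by
    cases h3 : S k (q + 1) with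
    | top => exact WithTop.coe_lt_top _
    | coe y =>
      rw [h3, WithTop.coe_lt_coe] at h1
      rw [h3, Ne, WithTop.coe_inj] at h
      rw [WithTop.coe_lt_coe]
      omega
  exact prec_of_lt_of_le h2 (hS.row_le k hj)

theorem row_alive (hS : Inc m S) {n : ℕ} (hmn : m < n)
    (hr : ∀ k', k = k' + 1 → S k' k < w) (h : ev (RS S B n k w e) ≠ none) : Alive S k w := by
  rintro q x hq rfl
  by_contra hne
  apply h
  have hqm : q < m := by
    by_contra hlt
    rw [hS.bd k q (not_lt.1 hlt)] at hq
    exact WithTop.top_ne_coe hq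
  have hkm : k < m := by
    by_contra hlt
    rw [hS.bd' (not_lt.1 hlt)] at hq
    exact WithTop.top_ne_coe hq
  have hkq : k ≤ q := by
    by_contra hlt
    exact (row_phase hS hr (not_le.1 hlt)).ne hq
  rw [RS, pd_head _ (by omega : k < n), tg_coe, mul_assoc (pd _ _ _), rowW]
  have := row_dead braidRel_sgf (f := S k) (B k) e hkq (by omega : q < n) hq
    (not_special_gap hS hq hne)
  have e1 : pr (cellW S B k) k n * sgf x e = _ := this
  rw [e1]
  simp only [← mul_assoc]
  rw [mul_assoc, mul_assoc]
  exact ev_same _ _ ((noneFix_pr fun _ => noneFix_tg _ _).mul (NoneFix.pd_rowW _ _ _ _ _)) _ _ _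

theorem col_alive (hS : Inc m S) (hB : ∀ i j, B i j = B j i) {n : ℕ} (hmn : m < n)
    (hr : ¬∀ k', k = k' + 1 → S k' k < w) (h : ev (CS S B n k w e) ≠ none) : Alive S k w := by
  rintro q x hq rfl
  by_contra hne
  apply h
  obtain ⟨k', rfl, hk'⟩ := not_row_phase hS hr
  have hkm : k' + 1 < m := by
    by_contra hlt
    rw [hS.bd' (not_lt.1 hlt)] at hq
    exact WithTop.top_ne_coe hq
  have hkq : q ≤ k' := by
    by_contra hlt
    have : S (k' + 1) k' < x := by
      have := (hS.row (k' + 1) (not_le.1 hlt))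
      rw [hq] at this
      exact this.resolve_right WithTop.coe_ne_top
    exact absurd this (not_lt.2 hk')
  rw [CS, pr_head _ (by omega : k' + 1 < n), tg_coe]
  have e1 := row_dead braidRel_sgf.op (f := S (k' + 1)) (B (k' + 1)) e (Nat.zero_le q)
    (by omega : q < k' + 1 + 1) hq (not_special_gap hS hq hne)
  have e2 := congrArg MulOpposite.unop e1
  simp only [MulOpposite.unop_mul, MulOpposite.unop_op] at e2
  rw [← colW_eq hS.symm hB] at e2
  rw [mul_assoc, ← mul_assoc (sgf x e), e2]
  simp only [← mul_assoc]
  rw [mul_assoc]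
  refine ev_same _ _ (NoneFix.mul ?_ (NoneFix.pr_colW _ _ _ _)) _ _ _
  have : ∀ a b, NoneFix (pr (fun j => tT (fun x b => MulOpposite.op (sgf x b)) (S (k' + 1) j)
      (B (k' + 1) j)) a b).unop := by
    intro a b
    have : (pr (fun j => tT (fun x b => MulOpposite.op (sgf x b)) (S (k' + 1) j)
      (B (k' + 1) j)) a b).unop = pd (fun j => tg (S (k' + 1) j) (B (k' + 1) j)) a b := by
      rw [pd]
      congr 1
      exact pr_congr fun j _ _ => tT_op _ _ _
    rw [this]
    exact noneFix_pd fun _ => noneFix_tg _ _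
  exact this _ _

theorem alive_of_ev (hS : Inc m S) (hB : ∀ i j, B i j = B j i) {n : ℕ} (hmn : m < n)
    (h : ev (SW n k ⟨S, B, w, e⟩) ≠ none) : Alive S k w := by
  unfold SW at h
  split_ifs at h with hr
  · exact row_alive hS hmn hr h
  · exact col_alive hS hB hmn hr h

/-- Unprimed letters in a special row insertion at the main diagonal. -/
theorem bits_of_ev (hS : Inc m S) {n : ℕ} (hmn : m < n) (hd : S k k = w)
    (hw : w < ⊤) (h : ev (SW n k ⟨S, B, w, e⟩) ≠ none) : e = false ∧ B k (k + 1) = false := by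
  obtain ⟨x, rfl⟩ := WithTop.ne_top_iff_exists.1 hw.ne
  have hr : ∀ k', k = k' + 1 → S k' k < x := fun k' hk => by
    have := (hS.col k (show k' < k by omega))
    rw [hd] at this
    exact this.resolve_right WithTop.coe_ne_top
  have h' := h
  unfold SW at h
  simp only at h
  rw [if_pos hr] at h
  have hM := row_alive hS hmn hr h k x hd rfl
  have hkm : k + 1 < m := by
    by_contra hlt
    rw [hS.bd _ _ (not_lt.1 hlt)] at hM
    exact WithTop.top_ne_coe hM
  rw [RS_special (hS.mono hmn.le) le_rfl (by omega : k + 1 < n) e hd hM, RS, pd_head _ (by omega : k + 1 < n),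
    pd_succ _ (Nat.zero_le k)] at h
  have h2 : ((x + 1 : ℤ) : WithTop ℤ) ⊰ S (k + 1) (k + 1) := by
    rw [← hM]; exact hS.col (k + 1) (Nat.lt_succ_self k)
  rw [rowW, pr_head (cellW S (swp B k k) (k + 1)) (by omega : k + 1 < n),
    rowW, pr_head (cellW S (swp B k k) k) (by omega : k < n),
    pr_head (cellW S (swp B k k) k) (by omega : k + 1 < n)] at h
  have c0 : cellW S (swp B k k) k k = sgf x (B k (k + 1)) := by
    rw [cellW, hd, tg_coe, swp_row, if_pos rfl]
  have c1 : cellW S (swp B k k) k (k + 1) = sgf (x + 1) (B k k) := by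
    rw [cellW, hM, tg_coe, swp_row, if_neg (by omega), if_pos rfl]
  rw [c0, c1, tg_coe] at h
  set d' := cellW S (swp B k k) (k + 1) (k + 1) with hd'
  set U := pd (rowW S (swp B k k) n) (k + 1 + 1) n with hU
  set T := pr (cellW S (swp B k k) (k + 1)) (k + 1 + 1) n with hT
  have hcell : ∀ i j, k + 1 ≤ i → k + 2 ≤ j → ∀ y b, y ≤ x + 1 →
      Commute (cellW S (swp B k k) i j) (tg (y : ℤ) b) := fun i j hi hj y b hy => by
    refine (tg_commute (y := S i (k + 1)) ?_ (hS.row i (by omega)) _ _).symm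
    have : ((x + 1 : ℤ) : WithTop ℤ) ⊰ S i (k + 1) := by
      rcases h2 with h2 | h2
      · exact prec_of_lt_of_le h2 (hS.col_le _ hi)
      · exact Or.inr (top_le_iff.1 (h2.symm.le.trans (hS.col_le _ hi)))
    rcases this with h | h
    · exact Or.inl (lt_of_le_of_lt (WithTop.coe_le_coe.2 hy) h)
    · exact Or.inr h
  have cU : Commute U d' := pd_commute fun i hi _ => pr_commute fun j hj _ =>
    (hS.cell_commute _ _ (by omega) (by omega)).symm
  have cUT : ∀ y b, y ≤ x + 1 → Commute (U * T) (tg (y : ℤ) b) := fun y b hy =>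
    (pd_commute fun i hi _ => pr_commute fun j hj _ => hcell i j (by omega) (by omega) y b hy).mul_left
      (pr_commute fun j hj _ => hcell _ j le_rfl (by omega) y b hy)
  have c3 := ((cUT (x + 1) e le_rfl).mul_right (cUT x (B k (k + 1)) (by omega))).mul_right
    (cUT (x + 1) (B k k) le_rfl)
  simp only [tg_coe] at c3
  refine bits_of_special (d := x) (M := x + 1) (d' := S (k + 1) (k + 1))
    (f := swp B k k (k + 1) (k + 1)) (g := B k k) rfl h2
    (Y := U * T * (pr (cellW S (swp B k k) k) (k + 1 + 1) n * pd (rowW S (swp B k k) n) 0 k))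
    (((NoneFix.pd_rowW _ _ _ _ _).mul (noneFix_pr fun _ => noneFix_tg _ _)).mul
      ((noneFix_pr fun _ => noneFix_tg _ _).mul (NoneFix.pd_rowW _ _ _ _ _))) ?_
  convert h using 2
  change d' * sgf (x + 1) e * sgf x (B k (k + 1)) * sgf (x + 1) (B k k) * _ = _
  calc _ = d' * ((sgf (x + 1) e * sgf x (B k (k + 1)) * sgf (x + 1) (B k k)) * (U * T)) *
        (pr (cellW S (swp B k k) k) (k + 1 + 1) n * pd (rowW S (swp B k k) n) 0 k) := by
        simp only [mul_assoc]
    _ = (d' * U) * T * (sgf (x + 1) e * sgf x (B k (k + 1)) * sgf (x + 1) (B k k)) *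
        (pr (cellW S (swp B k k) k) (k + 1 + 1) n * pd (rowW S (swp B k k) n) 0 k) := by
        rw [← c3.eq]; simp only [mul_assoc]
    _ = _ := by rw [← cU.eq]; simp only [mul_assoc]

theorem SW_row {n : ℕ} (hr : ∀ k', k = k' + 1 → S k' k < w) :
    SW n k ⟨S, B, w, e⟩ = RS S B n k w e := if_pos hr

theorem SW_col {n : ℕ} (hr : ¬∀ k', k = k' + 1 → S k' k < w) :
    SW n k ⟨S, B, w, e⟩ = CS S B n k w e := if_neg hr

/-- The value of the word of a state is unchanged by a step. -/
theorem ev_SW_step (hS : Inc m S) (hk : k ≤ m) (hv : Valid S k w) (hB : WB S B)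
    (hw : w < ⊤) (ha : Alive S k w) (hb : S k k = w → e = false ∧ B k (k + 1) = false) :
    ev (SW (m + 2) k ⟨S, B, w, e⟩) = ev (SW (m + 2) (k + 1) (step k ⟨S, B, w, e⟩)) := by
  rcases step_cases hS hw with ⟨p, hpm, h1, h2⟩ | ⟨q, hqm, hq, h2⟩
  · rw [step_gen hS h1 h2]
    have hS' : Inc (m + 1) (upd S k p w) :=
      update_inc hS hv h1 h2 (by omega) (by omega) (by omega)
    by_cases hr : ∀ k', k = k' + 1 → S k' k < w
    · have hkp : k ≤ p := by
        by_contra hlt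
        exact absurd (row_phase hS hr (not_le.1 hlt)) h2.not_gt
      rw [SW_row hr, RS_generic (hS.mono (Nat.le_add_right m 2)) hkp (by omega) e h1 h2]
      rcases hkp.eq_or_lt with rfl | hkp
      · rw [if_pos rfl, if_pos rfl, SW_col, hB.diag]
        · have := ev_diag hS' (n := m + 2) (B := upd B k k e) (k := k) (M := S k k) (by omega)
            (by rwa [upd_self]) (by
              rw [upd_of_ne _ _ (by omega)]
              exact (hS.row k (Nat.lt_succ_self k)).trans (hS.col _ (Nat.lt_succ_self k)))
            (by rw [upd_of_ne _ _ (by omega), hB.diag]) false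
          rw [this, upd_upd, upd_self]
        · push Not
          refine ⟨k, rfl, ?_⟩
          rw [upd_of_ne _ _ (by omega)]
          exact hS.row_le k (Nat.le_succ k)
      · rw [if_neg (by omega), if_neg (by omega), SW_row]
        rintro k' hk'
        obtain rfl : k = k' := by omega
        rw [upd_row]
        split_ifs with h
        · exact h2
        · exact (h1 _ (by omega)).trans h2
    · obtain ⟨k', rfl, hk'⟩ := not_row_phase hS hr
      have hpk : p ≤ k' := by
        by_contra hlt
        exact absurd (h1 k' (not_le.1 hlt)) (not_lt.2 hk')
      rw [SW_col hr, CS_generic (hS.mono (Nat.le_add_right m 2)) hB.symm (by omega) (by omega) e h1 h2, if_neg (by omega),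
        if_neg (by omega), SW_col]
      push Not
      refine ⟨k' + 1, rfl, ?_⟩
      rw [upd_of_ne _ _ (by omega)]
      exact hS.row_le _ (by omega)
  · obtain ⟨x, rfl⟩ := WithTop.ne_top_iff_exists.1 hw.ne
    have hM := ha q x hq rfl
    rw [step_spec hS hq hw, hM]
    by_cases hr : ∀ k', k = k' + 1 → S k' k < x
    · have hkq : k ≤ q := by
        by_contra hlt
        exact (row_phase hS hr (not_le.1 hlt)).ne hq
      rw [SW_row hr, RS_special (hS.mono (Nat.le_add_right m 2)) hkq (by omega) e hq hM]
      rcases hkq.eq_or_lt with rfl | hkq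
      · rw [SW_col]
        · obtain ⟨rfl, h4⟩ := hb hq
          have hsw : swp B k k = B := by
            unfold swp
            rw [h4, hB.diag]
            funext i j
            unfold upd
            split_ifs with h5 h5
            · rcases h5 with ⟨rfl, rfl⟩ | ⟨rfl, rfl⟩
              · exact h4.symm
              · rw [hB.symm]; exact h4.symm
            · rcases h5 with ⟨rfl, rfl⟩ | ⟨rfl, rfl⟩ <;> exact (hB.diag _).symm
            · rfl
          rw [hsw, ev_diag hS (n := m + 2) (k := k) (by omega) (by rw [← hM]; exact hq ▸ h2)
            (by rw [← hM]; exact hS.col _ (Nat.lt_succ_self k)) (hB.diag _) false, hB.diag]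
          congr 1
          rw [← hB.diag k, upd_same hB.symm]
        · push Not
          exact ⟨k, rfl, hM.ge⟩
      · rw [SW_row]
        intro k' hk'
        obtain rfl : k = k' := by omega
        refine lt_of_le_of_lt (hS.row_le k (show k + 1 ≤ q by omega)) ?_
        rw [hq, WithTop.coe_lt_coe]; omega
    · obtain ⟨k', rfl, hk'⟩ := not_row_phase hS hr
      have hqk : q ≤ k' := by
        by_contra hlt
        have : S (k' + 1) k' < x := by
          have := (hS.row (k' + 1) (not_le.1 hlt))
          rw [hq] at this
          exact this.resolve_right WithTop.coe_ne_top
        exact absurd this (not_lt.2 hk')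
      have hkm : k' + 1 < m := by
        by_contra hlt
        rw [hS.bd' (not_lt.1 hlt)] at hq
        exact WithTop.top_ne_coe hq
      rw [SW_col hr, CS_special (hS.mono (Nat.le_add_right m 2)) hB.symm (by omega) (by omega) e hq hM, SW_col]
      push Not
      refine ⟨k' + 1, rfl, ?_⟩
      rw [← hM]
      exact hS.row_le _ (by omega)

end Step

/-! ## Forward and backward steps -/

/-- The state with all primes removed. -/
def flat (S : ℕ → ℕ → WithTop ℤ) (w : WithTop ℤ) : St := ⟨S, fun _ _ => false, w, false⟩

theorem swp_false (k q : ℕ) : swp (fun _ _ => false) k q = fun _ _ => false := by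
  funext i j
  unfold swp upd
  split_ifs <;> rfl

theorem upd_false (k q : ℕ) : upd (fun _ _ => false) k q false = fun _ _ => false := by
  funext i j
  unfold upd
  split_ifs <;> rfl

theorem step_flat (k : ℕ) (X : St) : step k (flat X.S X.w) = flat (step k X).S (step k X).w := by
  unfold step flat
  simp only
  split_ifs <;> simp [swp_false, upd_false]

/-- The states that occur during the insertion of a letter. -/
structure GB (m k : ℕ) (X : St) : Prop where
  inc : Inc (m + 1) X.S
  fin : X.w < ⊤ → Inc m X.S ∧ k ≤ m
  valid : Valid X.S k X.w
  wb : WB X.S X.B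
  bsp : ∀ k', k = k' + 1 → X.S k' k = X.w → X.w < ⊤ → X.B k' k = false
  ev : ev (SW (m + 2) k X) ≠ none

theorem WB_false (S : ℕ → ℕ → WithTop ℤ) : WB S (fun _ _ => false) :=
  ⟨fun _ _ => rfl, fun _ => rfl, fun _ _ _ => rfl⟩

section

variable {m k : ℕ} {S : ℕ → ℕ → WithTop ℤ} {B : ℕ → ℕ → Bool} {w : WithTop ℤ} {e : Bool}

theorem GB.alive (h : GB m k ⟨S, B, w, e⟩) (hw : w < ⊤) : Alive S k w :=
  alive_of_ev (h.fin hw).1 h.wb.symm (by omega) h.ev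

theorem GB.ev_step (h : GB m k ⟨S, B, w, e⟩) (hw : w < ⊤) :
    _root_.ev (SW (m + 2) k ⟨S, B, w, e⟩) =
      _root_.ev (SW (m + 2) (k + 1) (step k ⟨S, B, w, e⟩)) :=
  ev_SW_step (h.fin hw).1 (h.fin hw).2 h.valid h.wb hw (h.alive hw) fun hd =>
    bits_of_ev (h.fin hw).1 (by omega) hd hw h.ev

theorem GB.next (h : GB m k ⟨S, B, w, e⟩) (hw : w < ⊤) : GB m (k + 1) (step k ⟨S, B, w, e⟩) := by
  have hev := h.ev_step hw
  have hS : Inc m S := (h.fin hw).1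
  have hk : k ≤ m := (h.fin hw).2
  have hb : WB S B := h.wb
  refine ⟨?_, ?_, ?_, ?_, ?_, by rw [← hev]; exact h.ev⟩
  all_goals rcases step_cases hS hw with ⟨p, hpm, h1, h2⟩ | ⟨q, hqm, hq, h2⟩
  · rw [step_gen hS h1 h2]
    exact update_inc hS h.valid h1 h2 (by omega) (by omega) (by omega)
  · rw [step_spec hS hq hw]
    exact h.inc
  · rw [step_gen hS h1 h2]
    intro hlt
    have hp : p < m := by
      by_contra hle
      exact hlt.ne (hS.bd _ _ (not_lt.1 hle))
    have hk' : k < m := by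
      by_contra hle
      exact hlt.ne (hS.bd' (not_lt.1 hle))
    exact ⟨update_inc hS h.valid h1 h2 le_rfl hk' hp, hk'⟩
  · rw [step_spec hS hq hw]
    intro hlt
    refine ⟨hS, ?_⟩
    by_contra hle
    exact hlt.ne (hS.bd' (by omega))
  · rw [step_gen hS h1 h2]
    exact valid_next_gen hS h2
  · rw [step_spec hS hq hw]
    exact Valid.next_spec hS (h.alive hw) hq hw
  · rw [step_gen hS h1 h2]
    refine ⟨upd_symm hb.symm _ _ _, fun i => ?_, fun i j hij => ?_⟩
    · have := hb.diag i
      simp only [upd] at this ⊢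
      split_ifs <;> first | rfl | assumption | omega
    · simp only at hij ⊢
      have : ¬((i = k ∧ j = p) ∨ (i = p ∧ j = k)) := by
        intro hc
        rw [upd, if_pos hc] at hij
        exact hw.ne hij
      rw [upd_of_ne _ _ this] at hij ⊢
      exact hb.top i j hij
  · rw [step_spec hS hq hw]
    refine ⟨swp_symm hb.symm _ _, fun i => ?_, fun i j hij => ?_⟩
    · simp only
      by_cases hi : i = k ∧ (i = q ∨ i = q + 1)
      · obtain ⟨rfl, hi⟩ := hi
        rw [swp_row]
        rcases hi with rfl | rfl
        · rw [if_pos rfl]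
          exact (bits_of_ev hS (by omega) hq hw h.ev).2
        · rw [if_neg (by omega), if_pos rfl, hb.symm]
          exact h.bsp q rfl ((hS.symm _ _).trans hq) hw
      · rw [swp_of_ne (by omega) (by omega)]
        exact hb.diag i
    · obtain ⟨x, rfl⟩ := WithTop.ne_top_iff_exists.1 hw.ne
      have hM := h.alive hw q x hq rfl
      simp only at hij ⊢
      by_cases hc : i = k ∧ (j = q ∨ j = q + 1)
      · obtain ⟨rfl, rfl | rfl⟩ := hc
        · rw [hq] at hij; exact absurd hij WithTop.coe_ne_top
        · rw [hM] at hij; exact absurd hij WithTop.coe_ne_top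
      · by_cases hc' : (i = q ∨ i = q + 1) ∧ j = k
        · rw [hS.symm] at hij
          obtain ⟨rfl | rfl, rfl⟩ := hc'
          · rw [hq] at hij; exact absurd hij WithTop.coe_ne_top
          · rw [hM] at hij; exact absurd hij WithTop.coe_ne_top
        · rw [swp_of_ne hc hc']
          exact hb.top i j hij
  · rw [step_gen hS h1 h2]
    intro k' hk' heq hlt
    obtain rfl : k = k' := by omega
    simp only [upd_row] at heq hlt
    split_ifs at heq with hp
    · exact absurd heq h2.ne
    · exact absurd (hS.row_inj hlt heq.symm).symm hp
  · rw [step_spec hS hq hw]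
    intro k' hk' heq hlt
    obtain rfl : k = k' := by omega
    simp only at heq hlt ⊢
    obtain rfl : k = q := by
      have := hS.row_inj hlt heq.symm
      omega
    rw [swp_row, if_neg (by omega), if_pos rfl]
    exact hb.diag _

/-- Inserting a letter that must come after an equal letter, in a row. -/
theorem back_dead_row (hS : Inc m S) {n : ℕ} (hmn : m < n) {p : ℕ} (hkp : k ≤ p) {y : ℤ}
    (hy : S k (p + 1) = y) (hne : S k p ≠ (y - 1 : ℤ)) :
    ev (RS S B n (k + 1) y e) = none := by
  have hpm : p + 1 < m := by
    by_contra hlt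
    rw [hS.bd _ _ (not_lt.1 hlt)] at hy
    exact WithTop.top_ne_coe hy
  have hlt : ∀ j, j ≤ p → S k j < (y - 1 : ℤ) := fun j hj => by
    refine (hS.row_le k hj).trans_lt ?_
    have := hS.incr k p
    rw [hy] at this
    have := this.resolve_right WithTop.coe_ne_top
    obtain ⟨x, hx⟩ := WithTop.ne_top_iff_exists.1 (this.trans (WithTop.coe_lt_top _)).ne
    rw [← hx] at this hne ⊢
    rw [WithTop.coe_lt_coe] at this ⊢
    rw [Ne, WithTop.coe_inj] at hne
    omega
  rw [RS, pd_succ _ (Nat.zero_le k), rowW, pr_pick _ (by omega : k ≤ p + 1) (by omega)]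
  have c : Commute (pr (cellW S B k) k (p + 1)) (tg (y : ℤ) e) :=
    pr_commute fun j _ hj => tg_commute (Or.inl (hlt j (by omega)))
      (Or.inl (by rw [WithTop.coe_lt_coe]; omega)) _ _
  simp only [← mul_assoc]
  rw [mul_assoc (pd _ _ _), ← c.eq, ← mul_assoc, show cellW S B k (p + 1) = tg (y : ℤ) (B k (p + 1))
    by rw [cellW, hy], tg_coe, tg_coe, mul_assoc (_ * _ * _)]
  exact ev_same _ _ ((noneFix_pr fun _ => noneFix_tg _ _).mul (NoneFix.pd_rowW _ _ _ _ _)) _ _ _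

theorem back_dead_col (hS : Inc m S) {n : ℕ} {p : ℕ} (hkp : p < k) {y : ℤ}
    (hy : S k (p + 1) = y) (hne : S k p ≠ (y - 1 : ℤ)) :
    ev (CS S B n (k + 1) y e) = none := by
  have hlt : ∀ j, j ≤ p → S k j < (y - 1 : ℤ) := fun j hj => by
    refine (hS.row_le k hj).trans_lt ?_
    have := hS.incr k p
    rw [hy] at this
    have := this.resolve_right WithTop.coe_ne_top
    obtain ⟨x, hx⟩ := WithTop.ne_top_iff_exists.1 (this.trans (WithTop.coe_lt_top _)).ne
    rw [← hx] at this hne ⊢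
    rw [WithTop.coe_lt_coe] at this ⊢
    rw [Ne, WithTop.coe_inj] at hne
    omega
  rw [CS, pr_succ _ (Nat.zero_le k), colW, pd_split _ (Nat.zero_le (p + 1)) (by omega : p + 1 ≤ k + 1),
    pd_head _ (by omega : p + 1 < k + 1)]
  have c : Commute (pd (fun i => cellW S B i k) 0 (p + 1)) (tg (y : ℤ) e) :=
    pd_commute fun j _ hj => tg_commute (Or.inl (by rw [hS.symm]; exact hlt j (by omega)))
      (Or.inl (by rw [WithTop.coe_lt_coe]; omega)) _ _
  simp only [← mul_assoc]
  rw [mul_assoc _ (pd (fun i => cellW S B i k) 0 (p + 1)), c.eq, ← mul_assoc,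
    show cellW S B (p + 1) k = tg (y : ℤ) (B (p + 1) k)
    by rw [cellW, hS.symm, hy], tg_coe, tg_coe, mul_assoc _ (pd _ _ _)]
  exact ev_same _ _ ((noneFix_pd fun _ => noneFix_tg _ _).mul (NoneFix.pr_colW _ _ _ _)) _ _ _

/-- Every unprimed state comes from a state at the previous stage. -/
theorem exists_prev (h : GB m (k + 1) (_root_.flat S w)) (hS : Inc m S) :
    ∃ S₀ w₀, w₀ < ⊤ ∧ GB m k (_root_.flat S₀ w₀) ∧
      step k (_root_.flat S₀ w₀) = _root_.flat S w := by
  have hv : Valid S (k + 1) w := h.valid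
  have hex : ∃ p, S k p < w ∧ w ≤ S k (p + 1) := by
    obtain ⟨x, hx⟩ : ∃ x, S k x < w := by
      rcases hv with hv | ⟨k', x, hk', h1 | h1⟩
      · omega
      · obtain rfl : k = k' := by omega
        exact ⟨x, h1.1⟩
      · obtain rfl : k = k' := by omega
        refine ⟨x, ?_⟩
        have := hS.incr k x
        rw [h1.2.1] at this
        exact this.resolve_right h1.1.ne
    have hex : ∃ j, w ≤ S k j := ⟨m, by rw [hS.bd k m le_rfl]; exact le_top⟩
    classical
    have h0 : Nat.find hex ≠ 0 := fun h0 => by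
      have := Nat.find_spec hex
      rw [h0] at this
      exact absurd hx (not_lt.2 (this.trans (hS.row_le k (Nat.zero_le _))))
    refine ⟨Nat.find hex - 1, not_le.1 (Nat.find_min hex (by omega)), ?_⟩
    rw [Nat.sub_add_cancel (by omega)]
    exact Nat.find_spec hex
  obtain ⟨p, h1, h2⟩ := hex
  have hpm : p < m := by
    by_contra hle
    exact (h1.trans_le le_top).ne (hS.bd _ _ (not_lt.1 hle))
  have hkm : k < m := by
    by_contra hle
    exact (h1.trans_le le_top).ne (hS.bd' (not_lt.1 hle))
  by_cases hsp : S k (p + 1) = w ∧ w < ⊤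
  · obtain ⟨hsp, hw⟩ := hsp
    obtain ⟨y, rfl⟩ := WithTop.ne_top_iff_exists.1 hw.ne
    have hy : S k p = (y - 1 : ℤ) := by
      by_contra hne
      refine h.ev ?_
      unfold _root_.flat SW
      simp only
      split_ifs with hr
      · refine back_dead_row hS (by omega) ?_ hsp hne
        by_contra hlt
        have := hr k rfl
        have h9 := (hS.row_lt_iff (this.trans hw) (j' := p + 1)).1 (by rw [hsp]; exact this)
        omega
      · rcases lt_trichotomy p k with hpk | rfl | hpk
        · exact back_dead_col hS hpk hsp hne
        · have := ev_diag hS (B := fun _ _ => false) (n := m + 2) (k := p) (by omega) h1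
            (by rw [← hsp]; exact hS.col _ (Nat.lt_succ_self p)) rfl false
          rw [upd_false] at this
          rw [← this]
          exact back_dead_row hS (by omega) le_rfl hsp hne
        · exfalso
          apply hr
          intro k' hk'
          obtain rfl : k = k' := by omega
          exact (hS.row_le k (by omega)).trans_lt h1
    have hal : Alive S k (y - 1 : ℤ) := by
      intro q x hq hx
      obtain rfl : y - 1 = x := WithTop.coe_inj.1 hx
      obtain rfl : p = q := hS.row_inj (hy ▸ WithTop.coe_lt_top _) (hy.trans hq.symm)
      rw [hsp]
      congr 1
      omega
    have hst : step k (_root_.flat S (y - 1 : ℤ)) = _root_.flat S y := by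
      unfold _root_.flat
      rw [step_spec hS hy (WithTop.coe_lt_top _), hsp, swp_false]
    have hval : Valid S k (y - 1 : ℤ) := by
      rcases k with _ | k₀
      · exact Or.inl rfl
      · have h3 : S k₀ (p + 1) < (y : ℤ) := by
          rw [← hsp]
          exact (hS.col (p + 1) (Nat.lt_succ_self k₀)).resolve_right
            (by rw [hsp]; exact WithTop.coe_ne_top)
        obtain ⟨x, hx⟩ := WithTop.ne_top_iff_exists.1 (h3.trans hw).ne
        refine Or.inr ?_
        rw [← hx, WithTop.coe_lt_coe] at h3
        by_cases h4 : x = y - 1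
        · exact ⟨k₀, p, rfl, Or.inr ⟨WithTop.coe_lt_top _, by rw [← hx, h4], hy⟩⟩
        · refine ⟨k₀, p + 1, rfl, Or.inl ⟨by rw [← hx, WithTop.coe_lt_coe]; omega, Or.inl ?_⟩⟩
          rw [hsp, WithTop.coe_lt_coe]; omega
    refine ⟨S, (y - 1 : ℤ), WithTop.coe_lt_top _, ⟨h.inc, fun _ => ⟨hS, hkm.le⟩, hval,
      WB_false _, fun _ _ _ _ => rfl, ?_⟩, hst⟩
    have := ev_SW_step (B := fun _ _ => false) (e := false) hS hkm.le hval (WB_false _)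
      (WithTop.coe_lt_top _) hal (fun _ => ⟨rfl, rfl⟩)
    change ev (SW _ _ (_root_.flat S (y - 1 : ℤ))) = ev (SW _ _ (step k (_root_.flat S _))) at this
    rw [this, hst]
    exact h.ev
  · have h3 : w ⊰ S k (p + 1) := by
      rcases h2.lt_or_eq with h2 | h2
      · exact Or.inl h2
      · by_cases hw : w < ⊤
        · exact absurd ⟨h2.symm, hw⟩ hsp
        · exact Or.inr (top_le_iff.1 ((not_lt.1 hw).trans h2.le))
    have h4 : w ⊰ S p (k + 1) := by
      rcases hv with hv | ⟨k', x, hk', h5 | h5⟩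
      · omega
      · obtain rfl : k = k' := by omega
        have hxp : x ≤ p := by
          by_contra hlt
          exact absurd h5.1 (not_lt.2 (h2.trans (hS.row_le k (by omega))))
        rcases h5.2 with h6 | h6
        · rw [hS.symm]
          exact Or.inl (h6.trans_le (hS.row_le _ hxp))
        · right
          rw [hS.symm]
          exact top_le_iff.1 (h6.ge.trans (hS.row_le _ hxp))
      · obtain rfl : k = k' := by omega
        exfalso
        obtain ⟨h5, h6, -⟩ := h5
        rcases le_or_gt (x + 1) p with hx | hx
        · exact absurd (hS.row_le k hx) (not_le.2 (by rw [h6]; exact h1))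
        · have h7 := hS.row_le k (show p + 1 ≤ x + 1 by omega)
          rw [h6] at h7
          exact hsp ⟨le_antisymm h7 h2, h5⟩
    have hS₀ : Inc m (upd S k p w) := hS.update le_rfl hkm hpm
      (fun j hj => Or.inl (lt_of_le_of_lt (hS.row_le k (by omega)) h1))
      (fun j hj => Or.inl (lt_of_le_of_lt (hS.row_le p (by omega : j ≤ k)) (by rw [hS.symm p k]; exact h1))) h3 h4
    have hrow : ∀ j, j < p → upd S k p w k j < S k p := fun j hj => by
      rw [upd_row, if_neg hj.ne]
      exact (hS.row_lt_iff ((hS.row_le k hj.le).trans_lt (h1.trans_le le_top))).2 hj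
    have hst : step k (_root_.flat (upd S k p w) (S k p)) = _root_.flat S w := by
      unfold _root_.flat
      rw [step_gen hS₀ hrow (by rwa [upd_self]), upd_upd, upd_same hS.symm, upd_self]
      simp [upd_false]
    have hval : Valid (upd S k p w) k (S k p) := by
      rcases k with _ | k₀
      · exact Or.inl rfl
      · refine Or.inr ⟨k₀, p, rfl, Or.inl ⟨?_, Or.inl (by rwa [upd_self])⟩⟩
        rw [upd_of_ne _ _ (by omega)]
        exact (hS.col p (Nat.lt_succ_self k₀)).resolve_right (h1.trans_le le_top).ne
    have hal : Alive (upd S k p w) k (S k p) := by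
      intro q x hq hx
      exfalso
      rw [← hx, upd_row] at hq
      split_ifs at hq with hqp
      · exact h1.ne hq.symm
      · exact hqp (hS.row_inj (h1.trans_le le_top) hq.symm).symm
    have hw₀ : S k p < ⊤ := h1.trans_le le_top
    refine ⟨upd S k p w, S k p, hw₀, ⟨hS₀.mono (Nat.le_succ m), fun _ => ⟨hS₀, hkm.le⟩, hval,
      WB_false _, fun _ _ _ _ => rfl, ?_⟩, hst⟩
    have := ev_SW_step (B := fun _ _ => false) (e := false) hS₀ hkm.le hval (WB_false _)
      hw₀ hal (fun _ => ⟨rfl, rfl⟩)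
    change ev (SW _ _ (_root_.flat _ (S k p))) = ev (SW _ _ (step k (_root_.flat _ _))) at this
    rw [this, hst]
    exact h.ev

end

/-! ## Complete insertions -/

/-- The successive states of an insertion. -/
noncomputable def runS (X : St) : ℕ → St
  | 0 => X
  | k + 1 => step k (runS X k)

theorem runS_flat (X : St) (k : ℕ) :
    runS (flat X.S X.w) k = flat (runS X k).S (runS X k).w := by
  induction k with
  | zero => rfl
  | succ k ih => rw [runS, ih, step_flat]; rfl

/-- The properties of the sequence of arrays `S`, letters `u` and positions `p` of an insertion
whose last change happens in the `K`-th segment. -/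
structure Run (S : ℕ → ℕ → ℕ → WithTop ℤ) (u : ℕ → WithTop ℤ) (p : ℕ → ℕ) (K : ℕ) : Prop where
  inc : ∀ k, k ≤ K + 1 → ∃ m, Inc m (S k)
  fin : ∀ k, k ≤ K → u k < ⊤
  top : u (K + 1) = ⊤
  low : ∀ k, k ≤ K → ∀ j, j < p k → S k k j ≤ u k
  high : ∀ k, k ≤ K → u k < S k k (p k)
  next : ∀ k, k ≤ K → u (k + 1) = S k k (p k)
  keep : ∀ k, k ≤ K → ∀ i x, S (k + 1) i x = S k i x ∨
    (S k i x = u (k + 1) ∧ S (k + 1) i x = u k ∧ ((i = k ∧ x = p k) ∨ (i = p k ∧ x = k)))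
  cell : ∀ k, k ≤ K → S (k + 1) k (p k) = u k ∨
    (S (k + 1) = S k ∧ 1 ≤ p k ∧ S k k (p k - 1) = u k ∧
      ∃ z : ℤ, u k = z ∧ u (k + 1) = (z + 1 : ℤ))
  dec : ∀ k, k + 1 ≤ K → p (k + 1) ≤ p k

section Complete

variable {m : ℕ} {X : St}

theorem runS_GB (h : GB m 0 X) {k : ℕ} (hf : ∀ j, j < k → (runS X j).w < ⊤) :
    GB m k (runS X k) := by
  induction k with
  | zero => exact h
  | succ k ih => exact (ih fun j hj => hf j (by omega)).next (hf k (by omega))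

theorem exists_stop (h : GB m 0 X) (hX : X.w < ⊤) :
    ∃ K, K ≤ m ∧ (∀ k, k ≤ K → (runS X k).w < ⊤) ∧ (runS X (K + 1)).w = ⊤ := by
  have hex : ∃ k, ¬(runS X k).w < ⊤ := by
    by_contra hcon
    push Not at hcon
    have := ((runS_GB h (k := m + 1) fun j _ => hcon j).fin (hcon _)).2
    omega
  classical
  have h0 : Nat.find hex ≠ 0 := fun h0 => by
    have := Nat.find_spec hex
    rw [h0] at this
    exact this hX
  have hlt : ∀ k, k < Nat.find hex → (runS X k).w < ⊤ := fun k hk => not_not.1 (Nat.find_min hex hk)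
  refine ⟨Nat.find hex - 1, ?_, fun k hk => hlt k (by omega), ?_⟩
  · exact ((runS_GB h (k := Nat.find hex - 1) fun j hj => hlt j (by omega)).fin
      (hlt _ (by omega))).2
  · rw [Nat.sub_add_cancel (by omega)]
    exact not_lt_top_iff.1 (Nat.find_spec hex)

theorem GB.run (h : GB m 0 X) {K : ℕ} (hK : ∀ k, k ≤ K → (runS X k).w < ⊤)
    (hK' : (runS X (K + 1)).w = ⊤) :
    Run (fun k => (runS X k).S) (fun k => (runS X k).w)
      (fun k => pos (runS X k).S k (runS X k).w) K := by
  have hg : ∀ k, k ≤ K + 1 → GB m k (runS X k) := fun k hk =>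
    runS_GB h fun j hj => hK j (by omega)
  have key : ∀ k, k ≤ K → ∃ q, pos (runS X k).S k (runS X k).w = q ∧
      (∀ j, j < q → (runS X k).S k j ≤ (runS X k).w) ∧ (runS X k).w < (runS X k).S k q ∧
      (runS X (k + 1)).w = (runS X k).S k q ∧
      (((runS X (k + 1)).S = upd (runS X k).S k q (runS X k).w) ∨
      ((runS X (k + 1)).S = (runS X k).S ∧ 1 ≤ q ∧ (runS X k).S k (q - 1) = (runS X k).w ∧
      ∃ z : ℤ, (runS X k).w = z ∧ (runS X (k + 1)).w = (z + 1 : ℤ))) := by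
    intro k hk
    have hw := hK k hk
    have hG := hg k (by omega)
    rw [show runS X (k + 1) = step k (runS X k) from rfl]
    generalize runS X k = Y at hw hG ⊢
    obtain ⟨S, B, w, e⟩ := Y
    change w < ⊤ at hw
    have hS : Inc m S := (hG.fin hw).1
    rcases step_cases hS hw with ⟨p, hpm, h1, h2⟩ | ⟨q, hqm, hq, h2⟩
    · refine ⟨p, pos_eq (fun j hj => (h1 j hj).le) h2, fun j hj => (h1 j hj).le, h2, ?_⟩
      rw [step_gen hS h1 h2]
      exact ⟨rfl, Or.inl rfl⟩
    · have h1 : ∀ j, j < q + 1 → S k j ≤ w := fun j hj => by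
        rw [← hq]; exact hS.row_le k (by omega)
      refine ⟨q + 1, pos_eq h1 h2, h1, h2, ?_⟩
      rw [step_spec hS hq hw]
      obtain ⟨x, hx⟩ := WithTop.ne_top_iff_exists.1 hw.ne
      exact ⟨rfl, Or.inr ⟨rfl, by omega, hq, x, hx.symm, hG.alive hw q x (hq.trans hx.symm)
        hx.symm⟩⟩
  have hp : ∀ k, k ≤ K → (∀ j, j < pos (runS X k).S k (runS X k).w →
      (runS X k).S k j ≤ (runS X k).w) := fun k hk => by
    obtain ⟨q, rfl, h1, -⟩ := key k hk
    exact h1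
  refine ⟨fun k hk => ⟨_, (hg k hk).inc⟩, hK, hK', hp, ?_, ?_, ?_, ?_, ?_⟩
  · intro k hk
    obtain ⟨q, rfl, h1, h2, -⟩ := key k hk
    exact h2
  · intro k hk
    obtain ⟨q, rfl, h1, h2, h3, -⟩ := key k hk
    exact h3
  · intro k hk i x
    obtain ⟨q, hq, h1, h2, h3, h4 | ⟨h4, -⟩⟩ := key k hk
    · simp only [hq, h4, h3]
      by_cases hc : (i = k ∧ x = q) ∨ (i = q ∧ x = k)
      · right
        rcases hc with ⟨rfl, rfl⟩ | ⟨rfl, rfl⟩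
        · exact ⟨rfl, upd_self _ _ _ _, by omega⟩
        · exact ⟨(hg _ (by omega)).inc.symm _ _, upd_self' _ _ _ _, by omega⟩
      · exact Or.inl (upd_of_ne _ _ hc)
    · exact Or.inl (by simp only [h4])
  · intro k hk
    obtain ⟨q, hq, h1, h2, h3, h4 | h4⟩ := key k hk
    · left; simp only [h4, hq]; exact upd_self _ _ _ _
    · right; simp only [hq]; exact h4
  · intro k hk
    obtain ⟨q, hq, h1, h2, h3, h4⟩ := key k (by omega)
    have hI := (hg k (by omega)).inc
    have hlt : (runS X (k + 1)).w < (runS X (k + 1)).S (k + 1) q := by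
      have h5 := (hI.col q (Nat.lt_succ_self k)).lt (by rw [← h3]; exact hK _ hk)
      rw [h3]
      rcases h4 with h4 | h4
      · rwa [h4, upd_of_ne _ _ (by omega)]
      · rwa [h4.1]
    simp only [hq]
    exact Nat.sInf_le hlt

end Complete

namespace Run

variable {S S' : ℕ → ℕ → ℕ → WithTop ℤ} {u v : ℕ → WithTop ℤ} {p p' : ℕ → ℕ} {K K' : ℕ}

theorem lt_succ (h : Run S u p K) {k : ℕ} (hk : k ≤ K) : u k < u (k + 1) := by
  rw [h.next k hk]; exact h.high k hk

theorem mono (h : Run S u p K) {j k : ℕ} (hjk : j ≤ k) (hk : k ≤ K + 1) : u j ≤ u k := by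
  induction k, hjk using Nat.le_induction with
  | base => rfl
  | succ k hj ih => exact (ih (by omega)).trans (h.lt_succ (by omega)).le

theorem persist (h : Run S u p K) {j k : ℕ} (hjk : j ≤ k) (hk : k ≤ K + 1) {i x : ℕ}
    (hle : S j i x ≤ u j) : S k i x = S j i x := by
  induction k, hjk using Nat.le_induction with
  | base => rfl
  | succ k hj ih =>
    have ih := ih (by omega)
    rcases h.keep k (by omega) i x with h1 | ⟨h1, -⟩
    · rw [h1, ih]
    · exfalso
      rw [ih] at h1
      rw [h1] at hle
      exact absurd (hle.trans (h.mono hj (by omega))) (not_le.2 (h.lt_succ (by omega)))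

theorem lower (h : Run S u p K) {j k : ℕ} (hjk : j ≤ k) (hk : k ≤ K + 1) {i x : ℕ}
    {t : WithTop ℤ} (h1 : t ≤ S j i x) (h2 : t ≤ u j) : t ≤ S k i x := by
  induction k, hjk using Nat.le_induction with
  | base => exact h1
  | succ k hj ih =>
    rcases h.keep k (by omega) i x with h3 | ⟨-, h3, -⟩
    · rw [h3]; exact ih (by omega)
    · rw [h3]; exact h2.trans (h.mono hj (by omega))

theorem le (h : Run S u p K) {j k : ℕ} (hjk : j ≤ k) (hk : k ≤ K + 1) (i x : ℕ) :
    S k i x ≤ S j i x := by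
  induction k, hjk using Nat.le_induction with
  | base => rfl
  | succ k hj ih =>
    refine le_trans ?_ (ih (by omega))
    rcases h.keep k (by omega) i x with h3 | ⟨h2, h3, -⟩
    · rw [h3]
    · rw [h3, h2]; exact (h.lt_succ (by omega)).le

theorem changed (h : Run S u p K) {k : ℕ} (hk : k ≤ K + 1) {i x : ℕ} (hne : S k i x ≠ S 0 i x) :
    S k i x < u k ∧ ∃ l, l < k ∧ u (l + 1) = S 0 i x := by
  induction k with
  | zero => exact absurd rfl hne
  | succ k ih =>
    rcases h.keep k (by omega) i x with h1 | ⟨h1, h2, -⟩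
    · rw [h1] at hne ⊢
      obtain ⟨h3, l, hl, h4⟩ := ih (by omega) hne
      exact ⟨h3.trans (h.lt_succ (by omega)), l, by omega, h4⟩
    · refine ⟨by rw [h2]; exact h.lt_succ (by omega), k, by omega, ?_⟩
      by_cases h3 : S k i x = S 0 i x
      · rw [← h3, h1]
      · have := (ih (by omega) h3).1
        rw [h1] at this
        exact absurd this (not_lt.2 (h.lt_succ (by omega)).le)

theorem anti (h : Run S u p K) {j k : ℕ} (hjk : j ≤ k) (hk : k ≤ K) : p k ≤ p j := by
  induction k, hjk using Nat.le_induction with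
  | base => rfl
  | succ k hj ih => exact (h.dec k hk).trans (ih (by omega))

theorem last (h : Run S u p K) : S (K + 1) K (p K) = u K ∧ S K K (p K) = ⊤ := by
  refine ⟨?_, by rw [← h.next K le_rfl, h.top]⟩
  rcases h.cell K le_rfl with h1 | ⟨-, -, -, z, -, h2⟩
  · exact h1
  · rw [h.top] at h2
    exact absurd h2.symm WithTop.coe_ne_top

theorem dom (h : Run S u p K) (i x : ℕ) : S (K + 1) i x < ⊤ ↔
    S 0 i x < ⊤ ∨ (i = K ∧ x = p K) ∨ (i = p K ∧ x = K) := by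
  have h1 : ∀ k, k ≤ K → (S k i x < ⊤ ↔ S 0 i x < ⊤) := by
    intro k hk
    induction k with
    | zero => rfl
    | succ k ih =>
      rw [← ih (by omega)]
      rcases h.keep k (by omega) i x with h2 | ⟨h2, h3, -⟩
      · rw [h2]
      · rw [h2, h3]
        exact iff_of_true (h.fin k (by omega)) (h.fin _ hk)
  rw [← h1 K le_rfl]
  obtain ⟨m, hm⟩ := h.inc K (by omega)
  obtain ⟨m', hm'⟩ := h.inc (K + 1) le_rfl
  by_cases hc : (i = K ∧ x = p K) ∨ (i = p K ∧ x = K)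
  · refine iff_of_true ?_ (Or.inr hc)
    rcases hc with ⟨rfl, rfl⟩ | ⟨rfl, rfl⟩
    · rw [h.last.1]; exact h.fin _ le_rfl
    · rw [hm'.symm, h.last.1]; exact h.fin _ le_rfl
  · rcases h.keep K le_rfl i x with h2 | ⟨-, -, h2⟩
    · rw [h2]; simp [hc]
    · exact absurd h2 hc

theorem corner (h : Run S u p K) : S 0 K (p K) = ⊤ ∧ S (K + 1) (K + 1) (p K) = ⊤ ∧
    S (K + 1) K (p K + 1) = ⊤ := by
  have h0 := h.last.2
  have h1 : ∀ k, k ≤ K → ∀ i x, S k i x = ⊤ → S 0 i x = ⊤ := by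
    intro k hk i x hT
    exact top_le_iff.1 (hT ▸ h.le (Nat.zero_le k) (by omega) i x)
  obtain ⟨m, hm⟩ := h.inc K (by omega)
  obtain ⟨m', hm'⟩ := h.inc (K + 1) le_rfl
  have h2 : S K (K + 1) (p K) = ⊤ := top_le_iff.1 (h0 ▸ hm.col_le _ (Nat.le_succ K))
  have h3 : S K K (p K + 1) = ⊤ := top_le_iff.1 (h0 ▸ hm.row_le _ (Nat.le_succ _))
  refine ⟨h1 K le_rfl _ _ h0, ?_, ?_⟩
  · rw [← not_lt_top_iff, h.dom, not_or]
    exact ⟨by rw [h1 K le_rfl _ _ h2]; exact lt_irrefl _, by omega⟩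
  · rw [← not_lt_top_iff, h.dom, not_or]
    exact ⟨by rw [h1 K le_rfl _ _ h3]; exact lt_irrefl _, by omega⟩

theorem out (h : Run S u p K) {k : ℕ} (hk : k ≤ K) : u (k + 1) = S 0 k (p k) := by
  rw [h.next k hk]
  by_contra hne
  exact absurd (h.changed (by omega) hne).1 (not_lt.2 (h.high k hk).le)

theorem pair_cell (h : Run S u p K) {k : ℕ} (hk : k + 1 ≤ K) :
    S (K + 1) (k + 1) (p (k + 1)) ≤ S (K + 1) k (p k + 1) := by
  have hlt : u (k + 1) < S (k + 1) k (p k + 1) := by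
    obtain ⟨m, hm⟩ := h.inc k (by omega)
    have h1 := (hm.incr k (p k)).lt (by rw [← h.next k (by omega)]; exact h.fin _ hk)
    rw [← h.next k (by omega)] at h1
    rcases h.keep k (by omega) k (p k + 1) with h2 | ⟨h2, -⟩
    · rwa [h2]
    · rw [h2] at h1; exact absurd h1 (lt_irrefl _)
  rcases h.cell (k + 1) hk with h1 | ⟨h1, h2, h3, z, h4, h5⟩
  · have h2 := h.persist (show k + 1 + 1 ≤ K + 1 by omega) le_rfl
      (i := k + 1) (x := p (k + 1)) (by rw [h1]; exact (h.lt_succ hk).le)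
    rw [h2, h1]
    exact h.lower (by omega) le_rfl hlt.le le_rfl
  · have h6 := h.next (k + 1) hk
    have h7 := h.persist (show k + 1 + 1 ≤ K + 1 by omega) le_rfl
      (i := k + 1) (x := p (k + 1)) (by rw [h1, h6])
    rw [h7, h1, ← h6]
    refine h.lower (show k + 1 + 1 ≤ K + 1 by omega) le_rfl ?_ le_rfl
    rw [h1, h5]
    rw [h4] at hlt
    by_cases hT : S (k + 1) k (p k + 1) = ⊤
    · rw [hT]; exact le_top
    · obtain ⟨y, hy⟩ := WithTop.ne_top_iff_exists.1 hT
      rw [← hy, WithTop.coe_lt_coe] at hlt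
      rw [← hy, WithTop.coe_le_coe]
      omega

/-- Inserting increasing letters: the new cells move weakly up and strictly right. -/
theorem pair_lt (h : Run S u p K) (h' : Run S' v p' K') (hS : S' 0 = S (K + 1))
    (huv : u 0 < v 0) : K' ≤ K ∧ p K < p' K' := by
  have hlt : ∀ k, k ≤ K → k ≤ K' → S' k k (p k) ≤ v k → p k < p' k := by
    intro k hk hk' hle
    by_contra hc
    obtain ⟨m, hm⟩ := h'.inc k (by omega)
    exact absurd ((hm.row_le k (not_lt.1 hc)).trans hle) (not_le.2 (h'.high k hk'))
  have key : ∀ k, k ≤ K → k ≤ K' → S' k k (p k) ≤ v k := by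
    intro k hk hk'
    induction k with
    | zero =>
      rw [hS]
      rcases h.cell 0 hk with h1 | ⟨h1, h2, h3, z, h4, h5⟩
      · rw [h.persist (show 0 + 1 ≤ K + 1 by omega) le_rfl (by rw [h1]; exact (h.lt_succ hk).le), h1]
        exact huv.le
      · have h6 := h.next 0 hk
        rw [h.persist (show 0 + 1 ≤ K + 1 by omega) le_rfl (by rw [h1, h6]), h1, ← h6, h5]
        rw [h4] at huv
        obtain ⟨y, hy⟩ := WithTop.ne_top_iff_exists.1 (h'.fin 0 hk').ne
        rw [← hy, WithTop.coe_lt_coe] at huv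
        rw [← hy, WithTop.coe_le_coe]
        omega
    | succ k ih =>
      have ih := hlt k (by omega) (by omega) (ih (by omega) (by omega))
      rw [h'.out (by omega), hS]
      refine (h'.le (Nat.zero_le _) (by omega) _ _).trans ?_
      rw [hS]
      refine (h.pair_cell hk).trans ?_
      obtain ⟨m, hm⟩ := h.inc (K + 1) le_rfl
      exact hm.row_le _ ih
  have hKK : K' ≤ K := by
    by_contra hc
    have h1 := hlt K le_rfl (by omega) (key K le_rfl (by omega))
    have h2 := h'.out (show K ≤ K' by omega)
    obtain ⟨m, hm⟩ := h.inc (K + 1) le_rfl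
    have h3 := hm.row_le K (show p K + 1 ≤ p' K from h1)
    rw [h.corner.2.2, top_le_iff, ← hS, ← h2] at h3
    exact (h'.fin (K + 1) (by omega)).ne h3
  exact ⟨hKK, (h.anti hKK le_rfl).trans_lt (hlt K' hKK le_rfl (key K' hKK le_rfl))⟩

/-- Inserting decreasing letters: the new cells move strictly down. -/
theorem pair_gt (h : Run S u p K) (h' : Run S' v p' K') (hS : S' 0 = S (K + 1))
    (huv : v 0 < u 0) : K < K' := by
  have key : ∀ k, k ≤ K → k ≤ K' ∧ v k < u k ∧ v (k + 1) ≤ u k := by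
    intro k hk
    induction k using Nat.strong_induction_on with
    | _ k ih =>
    have h1 : k ≤ K' := by
      by_contra hc
      obtain ⟨k, rfl⟩ : ∃ k', k = k' + 1 := ⟨k - 1, by omega⟩
      obtain ⟨h2, -, h3⟩ := ih k (by omega) (by omega)
      obtain rfl : K' = k := by omega
      rw [h'.top] at h3
      exact (h.fin K' (by omega)).ne (top_le_iff.1 h3)
    have h2 : v k < u k := by
      rcases k with _ | k
      · exact huv
      · exact (ih k (by omega) (by omega)).2.2.trans_lt (h.lt_succ (by omega))
    refine ⟨h1, h2, ?_⟩
    obtain ⟨x, hx⟩ : ∃ x, S (K + 1) k x = u k := by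
      rcases h.cell k hk with h3 | ⟨h3, h4, h5, -⟩
      · exact ⟨p k, by rw [h.persist (show k + 1 ≤ K + 1 by omega) le_rfl
          (by rw [h3]; exact (h.lt_succ hk).le), h3]⟩
      · exact ⟨p k - 1, by rw [h.persist (show k ≤ K + 1 by omega) le_rfl (by rw [h5]), h5]⟩
    have h3 : S' k k x = u k := by
      by_contra hne
      rw [← hx, ← hS] at hne
      obtain ⟨-, l, hl, h4⟩ := h'.changed (by omega) hne
      rw [hS, hx] at h4
      have h5 := (ih l hl (by omega)).2.2
      rw [h4] at h5
      exact absurd (h5.trans_lt (h.lt_succ (by omega))) (not_lt.2 (h.mono (by omega) (by omega)))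
    rw [h'.next k h1, ← h3]
    obtain ⟨m, hm⟩ := h'.inc k (by omega)
    refine hm.row_le k ?_
    by_contra hc
    have := h'.low k h1 x (not_le.1 hc)
    rw [h3] at this
    exact absurd this (not_le.2 h2)
  by_contra hc
  have h1 := (key K le_rfl).1
  obtain rfl : K = K' := by omega
  have h2 := (key K le_rfl).2.2
  rw [h'.top] at h2
  exact (h.fin K le_rfl).ne (top_le_iff.1 h2)

end Run

/-! ## Reversibility of complete insertions -/

/-- The row reading word of an array, as an operator. -/
noncomputable def rd (S : ℕ → ℕ → WithTop ℤ) (B : ℕ → ℕ → Bool) (n : ℕ) : OpM :=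
  pd (rowW S B n) 0 n

section

variable {m n k : ℕ} {S S₂ : ℕ → ℕ → WithTop ℤ} {B B₂ : ℕ → ℕ → Bool} {w w₂ : WithTop ℤ}
  {e e₂ : Bool}

theorem rd_eq (hS : Inc m S) (hmn : m ≤ n) : rd S B n = rd S B m := by
  have hone : ∀ i j, m ≤ j → cellW S B i j = 1 := fun i j hj => by
    rw [cellW, hS.bd _ _ hj, tg_top]
  have hrow : ∀ i, i < m → rowW S B n i = rowW S B m i := fun i hi => by
    rw [rowW, pr_split _ hi.le hmn, rowW, pr_eq_one (a := m) fun j hj _ => hone i j hj, mul_one]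
  have hrow' : ∀ i, m ≤ i → rowW S B n i = 1 := fun i hi =>
    pr_eq_one fun j hj _ => hone i j (hi.trans hj)
  rw [rd, rd, pd_split _ (Nat.zero_le m) hmn, pd_eq_one (a := m) fun j hj _ => hrow' j hj, one_mul]
  exact pd_congr fun j _ hj => hrow j hj

theorem SW_zero (hS : Inc m S) : SW (m + 2) 0 ⟨S, B, w, e⟩ = rd S B m * tg w e := by
  rw [SW_row (fun k' hk' => by omega), RS, ← rd, rd_eq hS (by omega), pd_of_le _ le_rfl, mul_one]

theorem SW_top (hS : Inc (m + 1) S) (hk : k ≤ m + 2) :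
    SW (m + 2) k ⟨S, B, ⊤, e⟩ = rd S B (m + 1) := by
  by_cases hr : ∀ k', k = k' + 1 → S k' k < ⊤
  · rw [SW_row hr, RS_top _ _ hk, ← rd, rd_eq hS (by omega)]
  · rw [SW_col hr, CS_top hS _ hk, ← rd, rd_eq hS (by omega)]

theorem GB_zero (hS : Inc m S) (hB : WB S B) (h : ev (rd S B m * tg w e) ≠ none) :
    GB m 0 ⟨S, B, w, e⟩ :=
  ⟨hS.mono (Nat.le_succ m), fun _ => ⟨hS, Nat.zero_le m⟩, Or.inl rfl, hB, fun k' hk' => by omega,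
    by rwa [SW_zero hS]⟩

theorem runS_ev {X : St} (h : GB m 0 X) (hf : ∀ j, j < k → (runS X j).w < ⊤) :
    ev (SW (m + 2) k (runS X k)) = ev (SW (m + 2) 0 X) := by
  induction k with
  | zero => rfl
  | succ k ih =>
    rw [← ih fun j hj => hf j (by omega)]
    exact ((runS_GB h fun j hj => hf j (by omega)).ev_step (hf k (by omega))).symm

theorem step_inj_bits (hS : Inc m S) (hB : WB S B) (hB₂ : WB S B₂) (hw : w < ⊤)
    (h : step k ⟨S, B, w, e⟩ = step k ⟨S, B₂, w, e₂⟩) : B = B₂ ∧ e = e₂ := by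
  rcases step_cases hS hw with ⟨p, hpm, h1, h2⟩ | ⟨q, hqm, hq, h2⟩
  · rw [step_gen hS h1 h2, step_gen hS h1 h2] at h
    simp only [St.mk.injEq, true_and] at h
    obtain ⟨h3, h4⟩ := h
    have h5 : ∀ i j, upd B k p (if p = k then false else e) i j =
      upd B₂ k p (if p = k then false else e₂) i j := fun i j => by rw [h3]
    by_cases hp : p = k
    · subst hp
      simp only [if_true] at h4 h5
      refine ⟨?_, h4⟩
      funext i j
      have h6 := h5 i j
      unfold upd at h6
      split_ifs at h6 with hc
      · obtain ⟨rfl, rfl⟩ : i = p ∧ j = p := by omega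
        rw [hB.diag, hB₂.diag]
      · exact h6
    · simp only [if_neg hp] at h4 h5
      refine ⟨?_, by simpa [upd] using h5 k p⟩
      funext i j
      have h6 := h5 i j
      unfold upd at h6
      split_ifs at h6 with hc
      · rcases hc with ⟨rfl, rfl⟩ | ⟨rfl, rfl⟩
        · exact h4
        · rw [hB.symm, hB₂.symm, h4]
      · exact h6
  · rw [step_spec hS hq hw, step_spec hS hq hw] at h
    simp only [St.mk.injEq, true_and] at h
    refine ⟨?_, h.2⟩
    have h5 : ∀ i j, swp B k q i j = swp B₂ k q i j := fun i j => by rw [h.1]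
    have h6 : ∀ j, B k j = B₂ k j := fun j => by
      have h7 := h5 k j
      have h8 := h5 k q
      have h9 := h5 k (q + 1)
      simp only [swp_row] at h7 h8 h9
      split_ifs at h7 h8 h9 <;> first | omega | (subst_vars; assumption)
    funext i j
    by_cases hi : i = k
    · rw [hi, h6]
    by_cases hj : j = k
    · rw [hj, hB.symm, hB₂.symm, h6]
    · have h7 := h5 i j
      rwa [swp_of_ne (by omega) (by omega), swp_of_ne (by omega) (by omega)] at h7

theorem step_last (hS : Inc m S) (ha : Alive S k w) (hw : w < ⊤) :
    ∃ p, (step k (flat S w)).S k p < (step k (flat S w)).w ∧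
      (step k (flat S w)).w ≤ (step k (flat S w)).S k (p + 1) ∧
      (((step k (flat S w)).w ⊰ (step k (flat S w)).S k (p + 1) ∧
        (step k (flat S w)).S = upd S k p w ∧ (step k (flat S w)).w = S k p) ∨
      ((step k (flat S w)).w = S k (p + 1) ∧ (step k (flat S w)).w < ⊤ ∧
        (step k (flat S w)).S = S ∧ w = S k p)) := by
  unfold flat
  rcases step_cases hS hw with ⟨p, hpm, h1, h2⟩ | ⟨q, hqm, hq, h2⟩
  · rw [step_gen hS h1 h2]
    refine ⟨p, ?_, ?_, Or.inl ⟨?_, rfl, rfl⟩⟩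
    · simp only; rwa [upd_self]
    · simp only; rw [upd_row, if_neg (by omega)]; exact hS.row_le k (Nat.le_succ p)
    · simp only; rw [upd_row, if_neg (by omega)]; exact hS.incr k p
  · obtain ⟨x, hx⟩ := WithTop.ne_top_iff_exists.1 hw.ne
    rw [step_spec hS hq hw]
    refine ⟨q, ?_, le_rfl, Or.inr ⟨rfl, ?_, rfl, hq.symm⟩⟩
    · simp only; rwa [hq]
    · simp only
      rw [ha q x (hq.trans hx.symm) hx.symm]
      exact WithTop.coe_lt_top _

theorem step_inj (hX : GB m k (flat S w)) (hw : w < ⊤) (hY : GB m k (flat S₂ w₂)) (hw₂ : w₂ < ⊤)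
    (h : step k (flat S w) = step k (flat S₂ w₂)) : flat S w = flat S₂ w₂ := by
  have hS : Inc m S := (hX.fin hw).1
  have hS₂ : Inc m S₂ := (hY.fin hw₂).1
  obtain ⟨p, h1, h2, h3⟩ := step_last hS (hX.alive hw) hw
  obtain ⟨p', h1', h2', h3'⟩ := step_last hS₂ (hY.alive hw₂) hw₂
  have hI : Inc (m + 1) (step k (flat S w)).S := (hX.next hw).inc
  rw [← h] at h1' h2' h3'
  generalize step k (flat S w) = Z at *
  obtain rfl : p = p' := by
    rcases lt_trichotomy p p' with hlt | rfl | hlt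
    · exact absurd (h2.trans (hI.row_le k hlt)) (not_le.2 h1')
    · rfl
    · exact absurd (h2'.trans (hI.row_le k hlt)) (not_le.2 h1)
  have hdis : ∀ {a b : WithTop ℤ}, a ⊰ b → a = b → ¬a < ⊤ := by
    rintro a b (h | h) rfl
    · exact absurd h (lt_irrefl _)
    · rw [h]; exact lt_irrefl _
  rcases h3 with ⟨g1, g2, g3⟩ | ⟨g1, g2, g3, g4⟩ <;>
    rcases h3' with ⟨g1', g2', g3'⟩ | ⟨g1', g2', g3', g4'⟩
  · have hww : w = w₂ := by
      have := congrFun (congrFun (g2.symm.trans g2') k) p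
      rwa [upd_self, upd_self] at this
    have hSS : S = S₂ := by
      rw [← upd_same hS.symm k p, ← upd_same hS₂.symm k p, ← g3, ← g3', ← upd_upd S k p w,
        ← upd_upd S₂ k p w₂, ← g2, ← g2']
    rw [hww, hSS]
  · exact absurd g2' (hdis g1 (by rw [g1', g3']))
  · exact absurd g2 (hdis g1' (by rw [g1, g3]))
  · have hSS : S = S₂ := g3.symm.trans g3'
    rw [g4, g4', hSS]

theorem runS_inj {K : ℕ} (hX : GB m 0 (flat S w)) (hY : GB m 0 (flat S₂ w₂))
    (hfX : ∀ k, k ≤ K → (runS (flat S w) k).w < ⊤) (hfY : ∀ k, k ≤ K → (runS (flat S₂ w₂) k).w < ⊤)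
    (h : runS (flat S w) (K + 1) = runS (flat S₂ w₂) (K + 1)) : flat S w = flat S₂ w₂ := by
  have key : ∀ d k, k + d = K + 1 → runS (flat S w) k = runS (flat S₂ w₂) k := by
    intro d
    induction d with
    | zero => intro k hk; rw [show k = K + 1 by omega]; exact h
    | succ d ih =>
      intro k hk
      have h1 := ih (k + 1) (by omega)
      have gX := runS_GB hX (k := k) fun j hj => hfX j (by omega)
      have gY := runS_GB hY (k := k) fun j hj => hfY j (by omega)
      have fX := hfX k (by omega)
      have fY := hfY k (by omega)
      obtain ⟨A, a, hA⟩ : ∃ A a, runS (flat S w) k = flat A a := ⟨_, _, runS_flat (flat S w) k⟩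
      obtain ⟨A', a', hA'⟩ : ∃ A a, runS (flat S₂ w₂) k = flat A a :=
        ⟨_, _, runS_flat (flat S₂ w₂) k⟩
      rw [runS, runS] at h1
      rw [hA] at gX fX h1 ⊢
      rw [hA'] at gY fY h1 ⊢
      exact step_inj gX fX gY fY h1
  exact key (K + 1) 0 (by omega)

theorem runS_S {X Y : St} (hS : X.S = Y.S) (hw : X.w = Y.w) (k : ℕ) :
    (runS X k).S = (runS Y k).S ∧ (runS X k).w = (runS Y k).w := by
  have h1 := runS_flat X k
  rw [hS, hw, runS_flat Y k] at h1
  simp only [flat, St.mk.injEq] at h1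
  exact ⟨h1.1.symm, h1.2.2.1.symm⟩

theorem runS_inj_bits {K : ℕ} (hX : GB m 0 ⟨S, B, w, e⟩) (hY : GB m 0 ⟨S, B₂, w, e₂⟩)
    (hf : ∀ k, k ≤ K → (runS ⟨S, B, w, e⟩ k).w < ⊤)
    (h : runS ⟨S, B, w, e⟩ (K + 1) = runS ⟨S, B₂, w, e₂⟩ (K + 1)) : B = B₂ ∧ e = e₂ := by
  have hf' : ∀ k, k ≤ K → (runS ⟨S, B₂, w, e₂⟩ k).w < ⊤ := fun k hk => by
    rw [(runS_S (X := ⟨S, B₂, w, e₂⟩) (Y := ⟨S, B, w, e⟩) rfl rfl k).2]; exact hf k hk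
  have key : ∀ d k, k + d = K + 1 → runS ⟨S, B, w, e⟩ k = runS ⟨S, B₂, w, e₂⟩ k := by
    intro d
    induction d with
    | zero => intro k hk; rw [show k = K + 1 by omega]; exact h
    | succ d ih =>
      intro k hk
      have h1 : step k _ = step k _ := ih (k + 1) (by omega)
      have gX := runS_GB hX (k := k) fun j hj => hf j (by omega)
      have gY := runS_GB hY (k := k) fun j hj => hf' j (by omega)
      have fX := hf k (by omega)
      obtain ⟨hSS, hww⟩ := runS_S (X := ⟨S, B, w, e⟩) (Y := ⟨S, B₂, w, e₂⟩) rfl rfl k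
      generalize runS ⟨S, B, w, e⟩ k = X at *
      generalize runS ⟨S, B₂, w, e₂⟩ k = Y at *
      obtain ⟨S', B', w', e'⟩ := X
      obtain ⟨S₂', B₂', w₂', e₂'⟩ := Y
      simp only at hSS hww
      subst hSS hww
      obtain ⟨rfl, rfl⟩ := step_inj_bits (gX.fin fX).1 gX.wb gY.wb fX h1
      rfl
  have := key (K + 1) 0 (by omega)
  simpa [runS] using this

theorem exists_runS {S : ℕ → ℕ → WithTop ℤ} {w : WithTop ℤ} (hS : Inc m S)
    (h : GB m k (flat S w)) : ∃ S₀ w₀, GB m 0 (flat S₀ w₀) ∧ Inc m S₀ ∧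
      runS (flat S₀ w₀) k = flat S w ∧ ∀ j, j < k → (runS (flat S₀ w₀) j).w < ⊤ := by
  induction k generalizing S w with
  | zero => exact ⟨S, w, h, hS, rfl, fun j hj => by omega⟩
  | succ k ih =>
    obtain ⟨S₁, w₁, hw₁, h1, h2⟩ := exists_prev h hS
    obtain ⟨S₀, w₀, h3, h4, h5, h6⟩ := ih (S := S₁) (w := w₁) (h1.fin hw₁).1 h1
    refine ⟨S₀, w₀, h3, h4, by rw [runS, h5, h2], fun j hj => ?_⟩
    rcases Nat.lt_succ_iff_lt_or_eq.1 hj with hj | rfl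
    · exact h6 j hj
    · rw [h5]; exact hw₁

end

/-! ## Unprimed insertion as a correspondence -/

/-- The array without primes. -/
def nob : ℕ → ℕ → Bool := fun _ _ => false

/-- `S` is the array of an increasing tableau whose row word represents `z`. -/
def IncOf (z : PZ) (S : ℕ → ℕ → WithTop ℤ) : Prop := ∃ m, Inc m S ∧ ev (rd S nob m) = some z

theorem IncOf.eq {z : PZ} {S : ℕ → ℕ → WithTop ℤ} (h : IncOf z S) {m : ℕ} (hm : Inc m S) :
    ev (rd S nob m) = some z := by
  obtain ⟨m', hm', h1⟩ := h
  rw [← h1, ← rd_eq hm (le_max_left m m'), rd_eq hm' (le_max_right m m')]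

theorem IncOf.unique {z z' : PZ} {S : ℕ → ℕ → WithTop ℤ} (h : IncOf z S) (h' : IncOf z' S) :
    z = z' := by
  obtain ⟨m, hm, h1⟩ := h
  exact Option.some_injective _ (h1.symm.trans (h'.eq hm))

theorem inc_empty : Inc 0 (fun _ _ => (⊤ : WithTop ℤ)) :=
  ⟨fun _ _ => rfl, fun _ _ => Or.inr rfl, fun _ _ _ => rfl⟩

theorem incOf_empty : IncOf 1 (fun _ _ => ⊤) :=
  ⟨0, inc_empty, by rw [rd, pd_of_le _ le_rfl]; rfl⟩

/-- Inserting `u` into `S` gives `S'`, with the last change in segment `K` at position `p`. -/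
structure Ins (S : ℕ → ℕ → WithTop ℤ) (u : ℤ) (S' : ℕ → ℕ → WithTop ℤ) (K p : ℕ) : Prop where
  fin : ∀ k, k ≤ K → (runS (flat S u) k).w < ⊤
  end_eq : runS (flat S u) (K + 1) = flat S' ⊤
  pos_eq : pos (runS (flat S u) K).S K (runS (flat S u) K).w = p

section

variable {S S' S₁ S₂ : ℕ → ℕ → WithTop ℤ} {u u' : ℤ} {K p K' p' m : ℕ} {y z : PZ}

theorem GB_of_step (hm : Inc m S) (hy : IncOf y S) (h : stepO ⟨u, false⟩ (some y) = some z) :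
    GB m 0 (flat S u) := by
  refine GB_zero hm (WB_false S) ?_
  change stepO ⟨u, false⟩ (ev (rd S nob m)) ≠ none
  rw [hy.eq hm, h]
  exact Option.some_ne_none _

theorem Ins.unique (h : Ins S u S₁ K p) (h' : Ins S u S₂ K' p') : S₁ = S₂ ∧ K = K' ∧ p = p' := by
  have hK : K = K' := by
    rcases lt_trichotomy K K' with hlt | h1 | hlt
    · have := h'.fin (K + 1) hlt
      rw [h.end_eq] at this
      exact absurd this (lt_irrefl _)
    · exact h1
    · have := h.fin (K' + 1) hlt
      rw [h'.end_eq] at this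
      exact absurd this (lt_irrefl _)
  subst hK
  have h1 := h.end_eq.symm.trans h'.end_eq
  simp only [flat, St.mk.injEq] at h1
  exact ⟨h1.1, rfl, h.pos_eq.symm.trans h'.pos_eq⟩

theorem Ins.run (h : Ins S u S' K p) (hy : IncOf y S)
    (hs : stepO ⟨u, false⟩ (some y) = some z) : ∃ A a q, Run A a q K ∧ A 0 = S ∧ a 0 = u ∧
      A (K + 1) = S' ∧ q K = p := by
  obtain ⟨m, hm, -⟩ := id hy
  refine ⟨_, _, _, (GB_of_step hm hy hs).run h.fin (by rw [h.end_eq]; rfl), rfl, rfl,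
    by simp only [h.end_eq]; rfl, h.pos_eq⟩

theorem exists_Ins (hy : IncOf y S) (hs : stepO ⟨u, false⟩ (some y) = some z) :
    ∃ S' K p, Ins S u S' K p ∧ IncOf z S' := by
  obtain ⟨m, hm, hev⟩ := id hy
  have hG := GB_of_step hm hy hs
  obtain ⟨K, hKm, hf, ht⟩ := exists_stop hG (WithTop.coe_lt_top u)
  have hfl : runS (flat S u) (K + 1) = flat (runS (flat S u) (K + 1)).S ⊤ := by
    have := runS_flat (flat S u) (K + 1)
    rwa [ht] at this
  refine ⟨_, K, _, ⟨hf, hfl, rfl⟩, m + 1, (runS_GB hG (k := K + 1) fun j hj => hf j (by omega)).inc,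
    ?_⟩
  have h1 := runS_ev hG (k := K + 1) fun j hj => hf j (by omega)
  have h2 := (runS_GB hG (k := K + 1) fun j hj => hf j (by omega)).inc
  rw [hfl, flat, SW_top h2 (by omega), flat, SW_zero hm] at h1
  refine Eq.trans h1 ?_
  change stepO ⟨u, false⟩ (ev (rd S nob m)) = some z
  rw [hev, hs]

theorem Ins.inj {y₂ z₂ : PZ} {u₂ : ℤ} (h : Ins S u S' K p) (h' : Ins S₂ u₂ S' K p')
    (hy : IncOf y S) (hs : stepO ⟨u, false⟩ (some y) = some z) (hy' : IncOf y₂ S₂)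
    (hs' : stepO ⟨u₂, false⟩ (some y₂) = some z₂) : S = S₂ ∧ u = u₂ := by
  obtain ⟨m, hm, -⟩ := id hy
  obtain ⟨m', hm', -⟩ := id hy'
  have h1 := runS_inj (GB_of_step (hm.mono (le_max_left m m')) hy hs)
    (GB_of_step (hm'.mono (le_max_right m m')) hy' hs') h.fin h'.fin
    (h.end_eq.trans h'.end_eq.symm)
  simp only [flat, St.mk.injEq, WithTop.coe_inj] at h1
  exact ⟨h1.1, h1.2.2.1⟩

theorem exists_Ins_eq (hz : IncOf z S') (h1 : S' K p < ⊤) (h2 : S' (K + 1) p = ⊤)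
    (h3 : S' K (p + 1) = ⊤) : ∃ S u y, IncOf y S ∧ stepO ⟨u, false⟩ (some y) = some z ∧
      Ins S u S' K p := by
  obtain ⟨m, hm, hev⟩ := id hz
  have hKm : K < m := by
    by_contra hlt
    exact h1.ne (hm.bd' (not_lt.1 hlt))
  have hG : GB m (K + 1) (flat S' ⊤) := by
    refine ⟨hm.mono (Nat.le_succ m), fun hc => absurd hc (lt_irrefl _),
      Or.inr ⟨K, p, rfl, Or.inl ⟨h1, Or.inr h2⟩⟩, WB_false _, fun _ _ _ _ => rfl, ?_⟩
    rw [flat, SW_top (hm.mono (Nat.le_succ m)) (by omega), rd_eq hm (Nat.le_succ m)]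
    exact hev ▸ Option.some_ne_none _
  obtain ⟨S, w, hS, hSm, hr, hf⟩ := exists_runS hm hG
  obtain ⟨u, rfl⟩ := WithTop.ne_top_iff_exists.1 (hf 0 (Nat.succ_pos K)).ne
  have hf' : ∀ k, k ≤ K → (runS (flat S u) k).w < ⊤ := fun k hk => hf k (by omega)
  have hev' := runS_ev hS hf
  rw [hr, flat, SW_top (hm.mono (Nat.le_succ m)) (by omega), rd_eq hm (Nat.le_succ m), flat,
    SW_zero hSm] at hev'
  have hev'' : some z = stepO ⟨u, false⟩ (ev (rd S nob m)) := hev.symm.trans hev'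
  cases hy : ev (rd S nob m) with
  | none => rw [hy] at hev''; exact absurd hev'' (Option.some_ne_none _)
  | some y =>
    rw [hy] at hev''
    refine ⟨S, u, y, ⟨m, hSm, hy⟩, hev''.symm, hf', hr, ?_⟩
    have hR := hS.run hf' (by rw [hr]; rfl)
    obtain ⟨q, hq⟩ : ∃ q, pos (runS (flat S u) K).S K (runS (flat S u) K).w = q := ⟨_, rfl⟩
    have hc := hR.corner
    have hl := hR.last
    have hS' : (runS (flat S u) (K + 1)).S = S' := by rw [hr]; rfl
    simp only [hS', hq] at hc hl
    rw [hq]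
    have h4 : S' K q < ⊤ := by rw [hl.1]; exact hf' K le_rfl
    rcases lt_trichotomy q p with hlt | h5 | hlt
    · have := hm.row_le K (show q + 1 ≤ p from hlt)
      rw [hc.2.2] at this
      exact absurd (top_le_iff.1 this) h1.ne
    · exact h5
    · have := hm.row_le K (show p + 1 ≤ q from hlt)
      rw [h3] at this
      exact absurd (top_le_iff.1 this) h4.ne

end

/-- The involution represented by an unprimed word given from right to left. -/
noncomputable def runR : List ℤ → Option PZ
  | [] => some 1
  | u :: w => stepO ⟨u, false⟩ (runR w)

/-- A biword corresponds to an array together with a record of the insertion steps; all lists are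
written with the last step first. -/
inductive Ph : List (ℤ × ℤ) → (ℕ → ℕ → WithTop ℤ) → List (ℤ × ℕ × ℕ) → Prop
  | nil : Ph [] (fun _ _ => ⊤) []
  | cons {w S c S' u K p} (b : ℤ) (h : Ph w S c) (hi : Ins S u S' K p) :
      Ph ((b, u) :: w) S' ((b, K, p) :: c)

/-- The order on the steps of a record. -/
def CRel (x y : ℤ × ℕ × ℕ) : Prop :=
  y.1 < x.1 ∨ (y.1 = x.1 ∧ x.2.1 ≤ y.2.1 ∧ y.2.2 < x.2.2)

/-- The order on the letters of a biword. -/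
def BRel (x y : ℤ × ℤ) : Prop := y.1 < x.1 ∨ (y.1 = x.1 ∧ y.2 < x.2)

/-- The records of ways to build a diagram (a symmetric set of cells). -/
inductive CBuild : List (ℤ × ℕ × ℕ) → (ℕ → ℕ → Prop) → Prop
  | nil {D} (hD : ∀ i j, ¬D i j) : CBuild [] D
  | cons {c D E} (b : ℤ) (K p : ℕ) (h : CBuild c D) (hn : ¬D K p)
      (hD : ∀ i j, E i j ↔ D i j ∨ (i = K ∧ j = p) ∨ (i = p ∧ j = K))
      (h1 : ¬E (K + 1) p) (h2 : ¬E K (p + 1)) : CBuild ((b, K, p) :: c) E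

/-- The cells of an array. -/
def dm (S : ℕ → ℕ → WithTop ℤ) : ℕ → ℕ → Prop := fun i j => S i j < ⊤

section

variable {w w' : List (ℤ × ℤ)} {S S' : ℕ → ℕ → WithTop ℤ} {c c' : List (ℤ × ℕ × ℕ)} {z y : PZ}

theorem CBuild.congr {D D' : ℕ → ℕ → Prop} (h : CBuild c D) (hD : ∀ i j, D i j ↔ D' i j) :
    CBuild c D' := by
  obtain rfl : D = D' := by funext i j; exact propext (hD i j)
  exact h

theorem CBuild.symm {D : ℕ → ℕ → Prop} (h : CBuild c D) (i j : ℕ) : D i j ↔ D j i := by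
  induction h generalizing i j with
  | nil hD => exact iff_of_false (hD i j) (hD j i)
  | cons b K p h hn hD h1 h2 ih =>
    rw [hD, hD, ih i j]
    tauto

theorem Ph.map_fst (h : Ph w S c) : w.map Prod.fst = c.map Prod.fst := by
  induction h with
  | nil => rfl
  | cons b h hi ih => simp [ih]

theorem Ph.unique (h : Ph w S c) (h' : Ph w S' c') : S = S' ∧ c = c' := by
  induction h generalizing S' c' with
  | nil => cases h'; exact ⟨rfl, rfl⟩
  | cons b h hi ih =>
    cases h' with
    | cons b' h' hi' =>
      obtain ⟨rfl, rfl⟩ := ih h'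
      obtain ⟨rfl, rfl, rfl⟩ := hi.unique hi'
      exact ⟨rfl, rfl⟩

theorem Ph.incOf (h : Ph w S c) (hr : runR (w.map Prod.snd) = some z) : IncOf z S := by
  induction h generalizing z with
  | nil =>
    obtain rfl : (1 : PZ) = z := Option.some_injective _ hr
    exact incOf_empty
  | cons b h hi ih =>
    cases hw : runR (List.map Prod.snd _) with
    | none => rw [List.map_cons, runR, hw] at hr; cases hr
    | some y =>
      rw [List.map_cons, runR, hw] at hr
      obtain ⟨S₂, K, p, h1, h2⟩ := exists_Ins (ih hw) hr
      obtain ⟨rfl, -, -⟩ := hi.unique h1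
      exact h2

theorem exists_Ph (hr : runR (w.map Prod.snd) = some z) : ∃ S c, Ph w S c := by
  induction w generalizing z with
  | nil => exact ⟨_, _, Ph.nil⟩
  | cons x w ih =>
    obtain ⟨b, u⟩ := x
    rw [List.map_cons, runR] at hr
    cases hw : runR (w.map Prod.snd) with
    | none => rw [hw] at hr; cases hr
    | some y =>
      rw [hw] at hr
      obtain ⟨S, c, h⟩ := ih hw
      obtain ⟨S', K, p, h1, -⟩ := exists_Ins (h.incOf hw) hr
      exact ⟨_, _, h.cons b h1⟩

theorem Ph.build (h : Ph w S c) (hr : runR (w.map Prod.snd) = some z) : CBuild c (dm S) := by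
  induction h generalizing z with
  | nil => exact CBuild.nil fun i j hc => absurd hc (lt_irrefl _)
  | cons b h hi ih =>
    cases hw : runR (List.map Prod.snd _) with
    | none => rw [List.map_cons, runR, hw] at hr; cases hr
    | some y =>
      rw [List.map_cons, runR, hw] at hr
      obtain ⟨A, a, q, hR, rfl, h2, rfl, rfl⟩ := hi.run (h.incOf hw) hr
      have hc := hR.corner
      refine (ih hw).cons b _ _ ?_ hR.dom ?_ ?_
      · rw [dm, hc.1]; exact lt_irrefl _
      · rw [dm, hc.2.1]; exact lt_irrefl _
      · rw [dm, hc.2.2]; exact lt_irrefl _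

theorem exists_Ph_eq (hc : CBuild c (dm S)) (hz : IncOf z S) :
    ∃ w, Ph w S c ∧ runR (w.map Prod.snd) = some z := by
  induction c generalizing S z with
  | nil =>
    cases hc with
    | nil hD =>
      obtain rfl : S = fun _ _ => ⊤ := by
        funext i j
        exact not_lt_top_iff.1 (hD i j)
      obtain rfl := hz.unique incOf_empty
      exact ⟨[], Ph.nil, rfl⟩
  | cons x c ih =>
    cases hc with
    | cons b K p h hn hD h1 h2 =>
      obtain ⟨S₀, u, y, hy, hs, hi⟩ := exists_Ins_eq hz ((hD K p).2 (Or.inr (Or.inl ⟨rfl, rfl⟩)))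
        (not_lt_top_iff.1 h1) (not_lt_top_iff.1 h2)
      have h4 : CBuild c (dm S₀) := by
        refine h.congr fun i j => ?_
        obtain ⟨A, a, q, hR, rfl, h2, rfl, rfl⟩ := hi.run hy hs
        have h5 : A 0 (q K) K = ⊤ := by
          obtain ⟨m, hm⟩ := hR.inc 0 (by omega)
          rw [hm.symm]; exact hR.corner.1
        have h6 := (hD i j).symm.trans (hR.dom i j)
        have hn'' := fun hd => hn ((h.symm (q K) K).1 hd)
        by_cases hcell : (i = K ∧ j = q K) ∨ (i = q K ∧ j = K)
        · rcases hcell with ⟨rfl, rfl⟩ | ⟨rfl, rfl⟩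
          · exact iff_of_false hn fun hl => hl.ne hR.corner.1
          · exact iff_of_false hn'' fun hl => hl.ne h5
        · exact ⟨fun hd => (h6.1 (Or.inl hd)).resolve_right hcell,
            fun hd => (h6.2 (Or.inl hd)).resolve_right hcell⟩
      obtain ⟨w, hw, hr⟩ := ih h4 hy
      exact ⟨(b, u) :: w, hw.cons b hi, by rw [List.map_cons, runR, hr, hs]⟩

theorem Ph.inj (h : Ph w S c) (h' : Ph w' S c) (hr : runR (w.map Prod.snd) = some z)
    (hr' : runR (w'.map Prod.snd) = some y) : w = w' := by
  induction h generalizing w' y z with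
  | nil => cases h'; rfl
  | cons b h hi ih =>
    cases h' with
    | cons b' h' hi' =>
      rw [List.map_cons, runR] at hr hr'
      cases hw : runR (List.map Prod.snd _) with
      | none => rw [hw] at hr; cases hr
      | some y₁ =>
        cases hw' : runR (List.map Prod.snd _) with
        | none => rw [hw'] at hr'; cases hr'
        | some y₂ =>
          rw [hw] at hr
          rw [hw'] at hr'
          obtain ⟨rfl, rfl⟩ := hi.inj hi' (h.incOf hw) hr (h'.incOf hw') hr'
          rw [ih h' hw hw']

theorem Ph.sorted_iff (h : Ph w S c) (hr : runR (w.map Prod.snd) = some z) :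
    w.IsChain BRel ↔ c.IsChain CRel := by
  induction h generalizing z with
  | nil => simp
  | cons b h hi ih =>
    rw [List.map_cons, runR] at hr
    cases hw : runR (List.map Prod.snd _) with
    | none => rw [hw] at hr; cases hr
    | some y =>
      rw [hw] at hr
      have ih := ih hw
      have hy := h.incOf hw
      cases h with
      | nil => simp
      | cons b' h hi' =>
        rw [List.isChain_cons_cons, List.isChain_cons_cons, ih]
        refine and_congr_left fun _ => ?_
        rw [List.map_cons, runR] at hw
        cases hw' : runR (List.map Prod.snd _) with
        | none => rw [hw'] at hw; cases hw
        | some y' =>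
          rw [hw'] at hw
          rename_i u₀ _ _ w₁ S₁ c₁ u₁ K₁ p₁ _ _
          obtain ⟨A, a, q, hR, rfl, ha, h2, rfl⟩ := hi'.run (h.incOf hw') hw
          obtain ⟨A', a', q', hR', h1', h2', -, rfl⟩ := hi.run hy hr
          unfold BRel CRel
          simp only
          refine or_congr Iff.rfl (and_congr_right fun hb => ?_)
          have hS := h1'.trans h2.symm
          rcases lt_trichotomy u₁ u₀ with hlt | rfl | hlt
          · have h3 := hR.pair_lt hR' hS (by rw [h2', ha]; exact WithTop.coe_lt_coe.2 hlt)
            exact iff_of_true hlt h3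
          · rw [← hw, stepO_same] at hr
            cases hr
          · have h3 := hR.pair_gt hR' hS (by rw [h2', ha]; exact WithTop.coe_lt_coe.2 hlt)
            exact iff_of_false hlt.not_gt fun hc => by omega

end

/-! ## Counting biwords by insertion -/

theorem ncard_fiberwise {α β : Type*} {s : Set α} (hs : s.Finite) (t : Finset β) (f : α → β)
    (hf : ∀ a ∈ s, f a ∈ t) : s.ncard = ∑ b ∈ t, {a | a ∈ s ∧ f a = b}.ncard := by
  classical
  rw [Set.ncard_eq_toFinset_card s hs,
    Finset.card_eq_sum_card_fiberwise (f := f) (t := t) (by simpa [Set.MapsTo] using hf)]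
  refine Finset.sum_congr rfl fun b _ => ?_
  rw [← Set.ncard_coe_finset]
  congr 1
  ext a
  simp

theorem finite_lists {α : Type*} {s : Set α} (hs : s.Finite) (n : ℕ) :
    {l : List α | l.length = n ∧ ∀ x ∈ l, x ∈ s}.Finite := by
  have := hs.to_subtype
  refine ((List.finite_length_eq s n).image (List.map Subtype.val)).subset ?_
  rintro l ⟨hl, hx⟩
  exact ⟨l.attach.map fun x => ⟨x.1, hx x.1 x.2⟩, by simpa using hl, by simp⟩

/-- The list `l` of positive integers has content `d`. -/
def HasContent (d : ℤ →₀ ℕ) (l : List ℤ) : Prop := (∀ b ∈ l, 0 < b) ∧ ∀ i, d i = l.count i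

/-- The sorted biwords for `z` with content `d`, last column first. -/
def FB (z : PZ) (d : ℤ →₀ ℕ) : Set (List (ℤ × ℤ)) :=
  {w | w.IsChain BRel ∧ runR (w.map Prod.snd) = some z ∧ HasContent d (w.map Prod.fst)}

/-- The sorted records of building `D` with content `d`. -/
def CB (D : ℕ → ℕ → Prop) (d : ℤ →₀ ℕ) : Set (List (ℤ × ℕ × ℕ)) :=
  {c | CBuild c D ∧ c.IsChain CRel ∧ HasContent d (c.map Prod.fst)}

theorem runR_eq (l : List ℤ) : runR l = run (l.reverse.map toL) := by
  induction l with
  | nil => rfl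
  | cons u l ih =>
    rw [runR, ih, List.reverse_cons, List.map_append, run, run, opW_append, List.map_singleton,
      opW_singleton, ev_mul_sg]
    rfl

theorem finite_runR (z : PZ) : {l : List ℤ | runR l = some z}.Finite := by
  by_cases hz : IZ z
  · refine ((RinvPlus_finite hz).image fun a => (unprimeWord a).reverse).subset ?_
    intro l hl
    refine ⟨l.reverse.map toL, ?_, by simp only [unprimeWord_map_toL, List.reverse_reverse]⟩
    rw [mem_RinvPlus_iff, ← runR_eq]
    exact hl
  · convert Set.finite_empty (α := List ℤ)
    ext l
    simp only [Set.mem_ofPred_eq, Set.mem_empty_iff_false, iff_false]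
    intro h
    rw [runR_eq] at h
    exact hz (IZ_of_run h)

theorem FB_finite (z : PZ) (d : ℤ →₀ ℕ) : (FB z d).Finite := by
  have h1 := (finite_runR z)
  have h2 : (⋃ l ∈ {l : List ℤ | runR l = some z},
      {f : List ℤ | f.length = l.length ∧ ∀ x ∈ f, x ∈ (d.support : Set ℤ)} ×ˢ {l}).Finite :=
    h1.biUnion fun l _ => (finite_lists d.support.finite_toSet _).prod (Set.finite_singleton l)
  refine (h2.image fun p => p.1.zip p.2).subset ?_
  rintro w ⟨-, hr, -, hd⟩
  refine ⟨(w.map Prod.fst, w.map Prod.snd), ?_, ?_⟩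
  · simp only [Set.mem_iUnion]
    refine ⟨_, hr, ⟨by simp, fun x hx => ?_⟩, rfl⟩
    rw [Finset.mem_coe, Finsupp.mem_support_iff, hd]
    exact (List.count_pos_iff.2 hx).ne'
  · change (w.map Prod.fst).zip (w.map Prod.snd) = w
    clear hr hd
    induction w with
    | nil => rfl
    | cons x w ih => rw [List.map_cons, List.map_cons, List.zip_cons_cons, ih]

theorem exists_CBuild {D : ℕ → ℕ → Prop} (hf : {x : ℕ × ℕ | D x.1 x.2}.Finite)
    (hs : ∀ i j, D i j ↔ D j i) : ∃ c, CBuild c D ∧ ∀ x ∈ c, x.1 = (0 : ℤ) := by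
  induction hn : {x : ℕ × ℕ | D x.1 x.2}.ncard using Nat.strong_induction_on generalizing D with
  | _ n ih =>
    by_cases he : {x : ℕ × ℕ | D x.1 x.2}.Nonempty
    · obtain ⟨⟨K, p⟩, hKp, hmax⟩ := Set.exists_max_image _ (fun x : ℕ × ℕ => x.1 + x.2) hf he
      have hmax' : ∀ i j, K + p < i + j → ¬D i j := fun i j hij h => by
        have := hmax (i, j) h
        simp only at this
        omega
      have hsub : {x : ℕ × ℕ | D x.1 x.2 ∧ ¬((x.1 = K ∧ x.2 = p) ∨ (x.1 = p ∧ x.2 = K))} ⊂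
          {x : ℕ × ℕ | D x.1 x.2} :=
        ⟨fun x hx => hx.1, fun hc => (hc (a := (K, p)) hKp).2 (Or.inl ⟨rfl, rfl⟩)⟩
      obtain ⟨c, hc, hc0⟩ := ih _ (hn ▸ Set.ncard_lt_ncard hsub hf)
        (D := fun i j => D i j ∧ ¬((i = K ∧ j = p) ∨ (i = p ∧ j = K))) (hf.subset hsub.1)
        (fun i j => by rw [hs i j]; tauto) rfl
      refine ⟨(0, K, p) :: c, hc.cons 0 K p (fun h => h.2 (Or.inl ⟨rfl, rfl⟩)) (fun i j => ?_)
        (hmax' _ _ (by omega)) (hmax' _ _ (by omega)), by simpa using hc0⟩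
      by_cases h1 : (i = K ∧ j = p) ∨ (i = p ∧ j = K)
      · refine iff_of_true ?_ (Or.inr h1)
        rcases h1 with ⟨rfl, rfl⟩ | ⟨rfl, rfl⟩
        · exact hKp
        · exact (hs _ _).1 hKp
      · simp [h1]
    · refine ⟨[], CBuild.nil fun i j h => he ⟨(i, j), h⟩, by simp⟩

theorem Inc.finite_dm {m : ℕ} {S : ℕ → ℕ → WithTop ℤ} (h : Inc m S) :
    {x : ℕ × ℕ | dm S x.1 x.2}.Finite := by
  refine ((Set.finite_Iio m).prod (Set.finite_Iio m)).subset ?_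
  rintro ⟨i, j⟩ hx
  constructor
  · by_contra hc
    exact ne_of_lt (show S i j < ⊤ from hx) (h.bd' (not_lt.1 hc))
  · by_contra hc
    refine ne_of_lt (show S i j < ⊤ from hx) ?_
    rw [h.symm]
    exact h.bd' (not_lt.1 hc)

theorem IncOf.exists_word {z : PZ} {S : ℕ → ℕ → WithTop ℤ} (h : IncOf z S) :
    ∃ w c, Ph w S c ∧ runR (w.map Prod.snd) = some z ∧ ∀ x ∈ w, x.1 = 0 := by
  obtain ⟨m, hm, -⟩ := id h
  obtain ⟨c, hc, h0⟩ := exists_CBuild hm.finite_dm fun i j => by rw [dm, hm.symm]; rfl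
  obtain ⟨w, hw, hr⟩ := exists_Ph_eq hc h
  refine ⟨w, c, hw, hr, fun x hx => ?_⟩
  have h1 : x.1 ∈ w.map Prod.fst := List.mem_map_of_mem hx
  rw [hw.map_fst, List.mem_map] at h1
  obtain ⟨y, hy, hxy⟩ := h1
  rw [← hxy, h0 y hy]

open Classical in
/-- The array of the tableau obtained from a biword. -/
noncomputable def phS (w : List (ℤ × ℤ)) : ℕ → ℕ → WithTop ℤ :=
  if h : ∃ S c, Ph w S c then h.choose else fun _ _ => ⊤

theorem Ph.phS_eq {w : List (ℤ × ℤ)} {S : ℕ → ℕ → WithTop ℤ} {c : List (ℤ × ℕ × ℕ)}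
    (h : Ph w S c) : phS w = S := by
  have hex : ∃ S c, Ph w S c := ⟨S, c, h⟩
  rw [phS, dif_pos hex]
  exact (hex.choose_spec.choose_spec.unique h).1

theorem finite_IncOf (z : PZ) : {S | IncOf z S}.Finite := by
  refine ((finite_runR z).image fun l => phS (l.map fun u => (0, u))).subset ?_
  intro S hS
  obtain ⟨w, c, hw, hr, h0⟩ := IncOf.exists_word hS
  refine ⟨_, hr, ?_⟩
  have : (w.map Prod.snd).map (fun u => ((0 : ℤ), u)) = w := by
    rw [List.map_map]
    conv_rhs => rw [← List.map_id w]
    exact List.map_congr_left fun x hx => Prod.ext (h0 x hx).symm rfl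
  simp only [this]
  exact hw.phS_eq

/-- Sorted biwords for `z` correspond to pairs of a tableau and a sorted building record. -/
theorem ncard_FB (z : PZ) (d : ℤ →₀ ℕ) :
    (FB z d).ncard = ∑ S ∈ (finite_IncOf z).toFinset, (CB (dm S) d).ncard := by
  have h1 : ∀ w ∈ FB z d, ∃ c, Ph w (phS w) c := by
    rintro w ⟨-, hr, -⟩
    obtain ⟨S, c, h⟩ := exists_Ph hr
    exact ⟨c, h.phS_eq.symm ▸ h⟩
  rw [ncard_fiberwise (FB_finite z d) (finite_IncOf z).toFinset phS]
  · refine Finset.sum_congr rfl fun S hS => ?_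
    rw [Set.Finite.mem_toFinset] at hS
    refine Set.ncard_congr (fun w hw => (h1 w hw.1).choose) ?_ ?_ ?_
    · rintro w ⟨hw, rfl⟩
      have h := (h1 w hw).choose_spec
      exact ⟨h.build hw.2.1, (h.sorted_iff hw.2.1).1 hw.1, h.map_fst ▸ hw.2.2⟩
    · rintro w w' ⟨hw, h2⟩ ⟨hw', h2'⟩ heq
      have h := (h1 w hw).choose_spec
      have h' := (h1 w' hw').choose_spec
      have hS' : phS w' = phS w := h2'.trans h2.symm
      generalize (h1 w' hw').choose = c' at heq h'
      subst heq
      rw [hS'] at h'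
      exact h.inj h' hw.2.1 hw'.2.1
    · rintro c ⟨hc, hs, hd⟩
      obtain ⟨w, hw, hr⟩ := exists_Ph_eq hc hS
      have hF : w ∈ FB z d := ⟨(hw.sorted_iff hr).2 hs, hr, hw.map_fst ▸ hd⟩
      exact ⟨w, ⟨hF, hw.phS_eq⟩, ((h1 w hF).choose_spec.unique hw).2⟩
  · intro w hw
    obtain ⟨c, hc⟩ := h1 w hw
    rw [Set.Finite.mem_toFinset]
    exact hc.incOf hw.2.1

/-! ## Primes on a fixed tableau -/

section

variable {S : ℕ → ℕ → WithTop ℤ} {B B' : ℕ → ℕ → Bool} {m n : ℕ} {z : PZ}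

/-- Primes on the diagonal do not affect the represented involution. -/
theorem ev_rd_diag (hS : Inc m S) (hB : ∀ i j, i ≠ j → B i j = B' i j) (n : ℕ) :
    ev (rd S B n) = ev (rd S B' n) := by
  have key : ∀ t, t ≤ n → ev (pd (rowW S B n) (n - t) n) = ev (pd (rowW S B' n) (n - t) n) := by
    intro t
    induction t with
    | zero => intro _; rw [pd_of_le _ (by omega), pd_of_le _ (by omega)]
    | succ t ih =>
      intro ht
      have ih := ih (by omega)
      obtain ⟨a, ha⟩ : ∃ a, n - (t + 1) = a := ⟨_, rfl⟩
      have ha' : n - t = a + 1 := by omega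
      rw [ha'] at ih
      rw [ha, pd_head _ (by omega), pd_head (rowW S B' n) (by omega)]
      have hrest : pr (cellW S B a) (a + 1) n = pr (cellW S B' a) (a + 1) n :=
        pr_congr fun j hj _ => by rw [cellW, cellW, hB a j (by omega)]
      have hcomm : ∀ b, Commute (pd (rowW S B n) (a + 1) n) (tg (S a a) b) := fun b =>
        pd_commute fun i hi _ => pr_commute fun j hj _ =>
          (tg_commute (hS.row a (show a < j by omega)) (hS.col j (show a < i by omega)) _ _).symm
      rw [rowW, rowW, pr_head _ (by omega), pr_head (cellW S B' a) (by omega), hrest, ← mul_assoc,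
        ← mul_assoc]
      refine ev_mul_congr ?_ _
      calc ev (pd (rowW S B n) (a + 1) n * cellW S B a a)
          = ev (tg (S a a) (B a a) * pd (rowW S B n) (a + 1) n) := by rw [cellW, (hcomm _).eq]
        _ = ev (tg (S a a) (B' a a) * pd (rowW S B n) (a + 1) n) :=
          ev_mul_congr (ev_init_bit _ _ _) _
        _ = ev (pd (rowW S B n) (a + 1) n * tg (S a a) (B' a a)) := by rw [(hcomm _).eq]
        _ = _ := ev_mul_congr ih _
  have := key n le_rfl
  rwa [Nat.sub_self] at this

/-- The letters in a cell. -/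
noncomputable def cellL (S : ℕ → ℕ → WithTop ℤ) (B : ℕ → ℕ → Bool) (i j : ℕ) : List Letter :=
  match S i j with
  | ⊤ => []
  | (x : ℤ) => [⟨x, B i j⟩]

/-- The word of a row. -/
noncomputable def rowL (S : ℕ → ℕ → WithTop ℤ) (B : ℕ → ℕ → Bool) (n i : ℕ) : List Letter :=
  (List.range' i (n - i)).flatMap (cellL S B i)

/-- The row reading word of an array. -/
noncomputable def rdL (S : ℕ → ℕ → WithTop ℤ) (B : ℕ → ℕ → Bool) (n : ℕ) : List Letter :=
  (List.range n).reverse.flatMap (rowL S B n)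

theorem cellL_coe {i j : ℕ} {x : ℤ} (h : S i j = x) : cellL S B i j = [⟨x, B i j⟩] := by
  rw [cellL, h]

theorem cellL_top {i j : ℕ} (h : S i j = ⊤) : cellL S B i j = [] := by
  rw [cellL, h]

theorem opW_flatMap {α : Type*} (l : List α) (g : α → List Letter) :
    opW (l.flatMap g) = (l.map fun a => opW (g a)).prod := by
  induction l with
  | nil => rfl
  | cons a l ih => rw [List.flatMap_cons, opW_append, ih, List.map_cons, List.prod_cons]

theorem pd_eq_prod (f : ℕ → OpM) (n : ℕ) : pd f 0 n = ((List.range n).reverse.map f).prod := by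
  induction n with
  | zero => rw [pd_of_le _ le_rfl]; rfl
  | succ n ih => rw [pd_succ _ (Nat.zero_le n), ih, List.range_succ]; simp

theorem opW_rdL (S : ℕ → ℕ → WithTop ℤ) (B : ℕ → ℕ → Bool) (n : ℕ) : opW (rdL S B n) = rd S B n := by
  have h : ∀ i j, opW (cellL S B i j) = cellW S B i j := by
    intro i j
    cases h : S i j with
    | top => rw [cellL_top h, cellW, h]; rfl
    | coe x => rw [cellL_coe h, cellW, h, opW_singleton]; rfl
  rw [rdL, opW_flatMap, rd, pd_eq_prod]
  congr 1
  refine List.map_congr_left fun i _ => ?_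
  rw [rowL, opW_flatMap, rowW, pr]
  simp only [h]

theorem run_rdL (S : ℕ → ℕ → WithTop ℤ) (B : ℕ → ℕ → Bool) (n : ℕ) :
    run (rdL S B n) = ev (rd S B n) := by rw [run, opW_rdL]

theorem flatMap_inj {α β : Type*} {l : List α} {g g' : α → List β}
    (hl : ∀ a ∈ l, (g a).length = (g' a).length) (h : l.flatMap g = l.flatMap g') :
    ∀ a ∈ l, g a = g' a := by
  induction l with
  | nil => simp
  | cons a l ih =>
    rw [List.flatMap_cons, List.flatMap_cons] at h
    obtain ⟨h1, h2⟩ := List.append_inj h (hl a List.mem_cons_self)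
    intro b hb
    rcases List.mem_cons.1 hb with rfl | hb
    · exact h1
    · exact ih (fun c hc => hl c (List.mem_cons_of_mem _ hc)) h2 b hb

theorem cellL_map_ceil (i j : ℕ) :
    (cellL S B i j).map Letter.ceil = (cellL S B' i j).map Letter.ceil := by
  cases h : S i j with
  | top => rw [cellL_top h, cellL_top h]
  | coe x => rw [cellL_coe h, cellL_coe h]; rfl

theorem rowL_map_ceil (i : ℕ) :
    (rowL S B n i).map Letter.ceil = (rowL S B' n i).map Letter.ceil := by
  simp only [rowL, List.map_flatMap, cellL_map_ceil (B := B) (B' := B')]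

theorem rdL_map_ceil : (rdL S B n).map Letter.ceil = (rdL S B' n).map Letter.ceil := by
  simp only [rdL, List.map_flatMap, rowL_map_ceil (B := B) (B' := B')]

theorem rdL_inj (h : rdL S B n = rdL S B' n) {i j : ℕ} (hij : i ≤ j) (hj : j < n)
    (hf : S i j < ⊤) : B i j = B' i j := by
  have h1 : rowL S B n i = rowL S B' n i := by
    refine flatMap_inj (fun a _ => ?_) h i (by simp; omega)
    have := congrArg List.length (rowL_map_ceil (S := S) (B := B) (B' := B') (n := n) a)
    simpa using this
  have h2 : cellL S B i j = cellL S B' i j := by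
    refine flatMap_inj (fun a _ => ?_) h1 j (by simp; omega)
    have := congrArg List.length (cellL_map_ceil (S := S) (B := B) (B' := B') i a)
    simpa using this
  obtain ⟨x, hx⟩ := WithTop.ne_top_iff_exists.1 hf.ne
  rw [cellL_coe hx.symm, cellL_coe hx.symm] at h2
  simpa using h2

end

/-! ## The number of primed tableaux over a tableau -/

/-- Half the number of points moved by `z`. -/
noncomputable def kap (z : PZ) : ℕ := (mvSet z).ncard / 2

/-- The primed words for `z` with underlying word `a`. -/
def Prim (a : List ℤ) (z : PZ) : Set (List Letter) := {b | unprimeWord b = a ∧ run b = some z}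

theorem kap_eq {a : List Letter} {z : PZ} (h : run a = some z) :
    kap z = (commF (unprimeWord a)).card := by
  rw [kap, (run_stats h).2.2.1, Nat.mul_div_cancel_left _ two_pos]

theorem mem_commF {a : List ℤ} {k : ℕ} : k ∈ commF a ↔ k < a.length ∧ IsCommutation a k := by
  simp [commF]

theorem ncard_Prim {a : List ℤ} {z : PZ} (h : run (a.map toL) = some z) :
    (Prim a z).ncard = 2 ^ kap z := by
  classical
  rw [kap_eq h, unprimeWord_map_toL, ← Finset.card_powerset, ← Set.ncard_coe_finset]
  refine Set.ncard_congr
    (fun b _ => (commF a).filter fun k => ∃ x, b[k]? = some x ∧ x.primed = true) ?_ ?_ ?_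
  · intro b _
    rw [Finset.mem_coe, Finset.mem_powerset]
    exact Finset.filter_subset _ _
  · rintro b b' ⟨hb, hr⟩ ⟨hb', hr'⟩ heq
    have hmem : ∀ {b : List Letter}, unprimeWord b = a → run b = some z → ∀ k,
        (∃ x, b[k]? = some x ∧ x.primed = true) → k ∈ commF a := by
      rintro b rfl hr k ⟨x, hx, hp⟩
      refine mem_commF.2 ⟨?_, (run_iff.1 hr).2 k x hx hp⟩
      obtain ⟨hk, -⟩ := List.getElem?_eq_some_iff.1 hx
      simpa [unprimeWord] using hk
    have hl : b.length = b'.length := by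
      have := congrArg List.length (hb.trans hb'.symm)
      simpa [unprimeWord] using this
    refine List.ext_getElem hl fun k h1 h2 => ?_
    have hc : b[k].ceil = b'[k].ceil := by
      have := congrArg (fun l => l[k]?) (hb.trans hb'.symm)
      simpa [unprimeWord, h1, h2] using this
    have hp : b[k].primed = true ↔ b'[k].primed = true := by
      have h3 := Finset.ext_iff.1 heq k
      simp only [Finset.mem_filter, List.getElem?_eq_getElem h1, List.getElem?_eq_getElem h2,
        Option.some.injEq, exists_eq_left'] at h3
      constructor
      · intro h4
        exact (h3.1 ⟨hmem hb hr k ⟨_, List.getElem?_eq_getElem h1, h4⟩, h4⟩).2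
      · intro h4
        exact (h3.2 ⟨hmem hb' hr' k ⟨_, List.getElem?_eq_getElem h2, h4⟩, h4⟩).2
    have hp' := Bool.eq_iff_iff.2 hp
    generalize b[k] = x at *
    generalize b'[k] = y at *
    cases x
    cases y
    simp_all
  · intro s hs
    rw [Finset.mem_coe, Finset.mem_powerset] at hs
    have hu : unprimeWord (a.mapIdx fun k x => (⟨x, decide (k ∈ s)⟩ : Letter)) = a := by
      refine List.ext_getElem (by simp [unprimeWord]) fun k h1 h2 => ?_
      simp [unprimeWord]
    have hget : ∀ k x, (a.mapIdx fun k x => (⟨x, decide (k ∈ s)⟩ : Letter))[k]? = some x →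
        (x.primed = true ↔ k ∈ s) := by
      intro k x hx
      rw [List.getElem?_mapIdx] at hx
      cases h3 : a[k]? with
      | none => rw [h3] at hx; cases hx
      | some y =>
        rw [h3] at hx
        obtain rfl := Option.some_injective _ hx
        simp
    refine ⟨a.mapIdx fun k x => ⟨x, decide (k ∈ s)⟩, ⟨hu, ?_⟩, ?_⟩
    · rw [run_iff, hu]
      exact ⟨h, fun k x hx hp => (mem_commF.1 (hs ((hget k x hx).1 hp))).2⟩
    · ext k
      rw [Finset.mem_filter]
      constructor
      · rintro ⟨-, x, hx, hp⟩
        exact (hget k x hx).1 hp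
      · intro hk
        have hk' := (mem_commF.1 (hs hk)).1
        have h3 : (a.mapIdx fun k x => (⟨x, decide (k ∈ s)⟩ : Letter))[k]? =
          some ⟨a[k], decide (k ∈ s)⟩ := by simp [hk']
        exact ⟨hs hk, _, h3, (hget k _ h3).2 hk⟩

theorem Prim_finite {a : List ℤ} {z : PZ} (h : run (a.map toL) = some z) : (Prim a z).Finite :=
  (RinvPlus_finite (IZ_of_run h)).subset fun _ hb => mem_RinvPlus_iff.2 hb.2

/-- The ways to put primes on the array `S`, the diagonal included, compatible with `z`. -/
def EB (S : ℕ → ℕ → WithTop ℤ) (z : PZ) : Set (ℕ → ℕ → Bool) :=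
  {B | (∀ i j, B i j = B j i) ∧ (∀ i j, S i j = ⊤ → B i j = false) ∧
    ∃ m, Inc m S ∧ ev (rd S B m) = some z}

section

variable {S S' : ℕ → ℕ → WithTop ℤ} {B B' : ℕ → ℕ → Bool} {m n : ℕ} {z : PZ}

theorem EB_le (hz : IncOf z S) : (EB S z).Finite ∧ (EB S z).ncard ≤ 2 ^ kap z := by
  obtain ⟨m, hm, hev⟩ := hz
  rw [← run_rdL] at hev
  have hev' := run_unprime hev
  have hmap : ∀ B ∈ EB S z, rdL S B m ∈ Prim (unprimeWord (rdL S nob m)) z := by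
    rintro B ⟨-, -, m', hm', h⟩
    refine ⟨rdL_map_ceil, ?_⟩
    rw [run_rdL, ← h, ← rd_eq hm (le_max_left m m'), rd_eq hm' (le_max_right m m')]
  have hinj : Set.InjOn (fun B => rdL S B m) (EB S z) := by
    rintro B ⟨h1, h2, -⟩ B' ⟨h1', h2', -⟩ heq
    have key : ∀ i j, i ≤ j → B i j = B' i j := by
      intro i j hij
      by_cases hf : S i j < ⊤
      · refine rdL_inj heq hij ?_ hf
        by_contra hc
        exact hf.ne (hm.bd i j (not_lt.1 hc))
      · rw [h2 i j (not_lt_top_iff.1 hf), h2' i j (not_lt_top_iff.1 hf)]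
    funext i j
    rcases le_total i j with h | h
    · exact key i j h
    · rw [h1, h1', key j i h]
  refine ⟨Set.Finite.of_injOn hmap hinj (Prim_finite hev'), ?_⟩
  rw [← ncard_Prim hev']
  exact Set.ncard_le_ncard_of_injOn _ hmap hinj (Prim_finite hev')

end

open Classical in
/-- Insertion of a primed word, last letter first, recording the primes lost on the diagonal. -/
inductive PB : List Letter → (ℕ → ℕ → WithTop ℤ) → (ℕ → ℕ → Bool) → (ℕ → Bool) → Prop
  | nil : PB [] (fun _ _ => ⊤) nob (fun _ => false)
  | cons {l S B β S' B' e' K} (x : Letter) (h : PB l S B β)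
      (hf : ∀ k, k ≤ K → (runS ⟨S, B, x.ceil, x.primed⟩ k).w < ⊤)
      (he : runS ⟨S, B, x.ceil, x.primed⟩ (K + 1) = ⟨S', B', ⊤, e'⟩) :
      PB (x :: l) S' B' (if pos (runS ⟨S, B, x.ceil, x.primed⟩ K).S K
        (runS ⟨S, B, x.ceil, x.primed⟩ K).w = K then Function.update β K e' else β)

section

variable {S S' S₂ : ℕ → ℕ → WithTop ℤ} {B B' : ℕ → ℕ → Bool} {β β' : ℕ → Bool} {m n : ℕ} {z : PZ}
  {l l' : List Letter}

theorem run_reverse_cons (x : Letter) (l : List Letter) :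
    run (x :: l).reverse = stepO x (run l.reverse) := by
  rw [List.reverse_cons, run, opW_append, opW_singleton, ev_mul_sg]; rfl

theorem run_reverse_cons_eq_some {x : Letter} (h : run (x :: l).reverse = some z) :
    ∃ y, run l.reverse = some y ∧ stepO x (some y) = some z := by
  rw [run_reverse_cons] at h
  cases hy : run l.reverse with
  | none => rw [hy] at h; cases h
  | some y => rw [hy] at h; exact ⟨y, rfl, h⟩

theorem GB_of_stepO {x : Letter} {y : PZ} (hm : Inc m S) (hB : WB S B)
    (hev : ev (rd S B m) = some y) (h : stepO x (some y) = some z) :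
    GB m 0 ⟨S, B, x.ceil, x.primed⟩ := by
  refine GB_zero hm hB ?_
  change stepO x (ev (rd S B m)) ≠ none
  rw [hev, h]
  exact Option.some_ne_none _

/-- The invariants of a primed array for `z`. -/
def PInc (z : PZ) (S : ℕ → ℕ → WithTop ℤ) (B : ℕ → ℕ → Bool) : Prop :=
  ∃ m, Inc m S ∧ WB S B ∧ ev (rd S B m) = some z

theorem PInc.run_step {x : Letter} {y : PZ} {K : ℕ} {e' : Bool} (hy : PInc y S B)
    (h : stepO x (some y) = some z)
    (hf : ∀ k, k ≤ K → (runS ⟨S, B, x.ceil, x.primed⟩ k).w < ⊤)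
    (he : runS ⟨S, B, x.ceil, x.primed⟩ (K + 1) = ⟨S', B', ⊤, e'⟩) : PInc z S' B' := by
  obtain ⟨m, hm, hB, hev⟩ := hy
  have hG := GB_of_stepO hm hB hev h
  obtain ⟨K₂, hK₂, hf₂, ht₂⟩ := exists_stop hG (WithTop.coe_lt_top _)
  have hK : K₂ = K := by
    rcases lt_trichotomy K K₂ with hlt | h1 | hlt
    · have := hf₂ (K + 1) hlt
      rw [he] at this
      exact absurd this (lt_irrefl _)
    · exact h1.symm
    · have := hf (K₂ + 1) hlt
      rw [ht₂] at this
      exact absurd this (lt_irrefl _)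
  have hG' := runS_GB hG (k := K + 1) fun j hj => hf j (by omega)
  have h1 := runS_ev hG (k := K + 1) fun j hj => hf j (by omega)
  rw [he] at hG' h1
  refine ⟨m + 1, hG'.inc, hG'.wb, ?_⟩
  rw [SW_top hG'.inc (by omega), SW_zero hm] at h1
  rw [h1]
  change stepO x (ev (rd S B m)) = _
  rw [hev, h]

theorem PB.pInc (h : PB l S B β) (hr : run l.reverse = some z) : PInc z S B := by
  induction h generalizing z with
  | nil =>
    obtain rfl : (1 : PZ) = z := Option.some_injective _ hr
    exact ⟨0, inc_empty, WB_false _, by rw [rd, pd_of_le _ le_rfl]; rfl⟩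
  | cons x h hf he ih =>
    obtain ⟨y, hy, hs⟩ := run_reverse_cons_eq_some hr
    exact (ih hy).run_step hs hf he

theorem exists_PB (hr : run l.reverse = some z) : ∃ S B β, PB l S B β := by
  induction l generalizing z with
  | nil => exact ⟨_, _, _, PB.nil⟩
  | cons x l ih =>
    obtain ⟨y, hy, hs⟩ := run_reverse_cons_eq_some hr
    obtain ⟨S, B, β, h⟩ := ih hy
    obtain ⟨m, hm, hB, hev⟩ := h.pInc hy
    obtain ⟨K, -, hf, ht⟩ := exists_stop (GB_of_stepO hm hB hev hs) (WithTop.coe_lt_top _)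
    exact ⟨(runS ⟨S, B, x.ceil, x.primed⟩ (K + 1)).S, (runS ⟨S, B, x.ceil, x.primed⟩ (K + 1)).B, _,
      h.cons (K := K) (e' := (runS ⟨S, B, x.ceil, x.primed⟩ (K + 1)).e) x hf (by rw [← ht])⟩

theorem PB.ph (h : PB l S B β) : ∃ c, Ph (l.map fun x => ((0 : ℤ), x.ceil)) S c := by
  induction h with
  | nil => exact ⟨_, Ph.nil⟩
  | @cons l S B β S' B' e' K x h hf he ih =>
    obtain ⟨c, hc⟩ := ih
    have hfl := runS_flat ⟨S, B, x.ceil, x.primed⟩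
    refine ⟨_, hc.cons 0 (K := K) ⟨fun k hk => ?_, ?_, rfl⟩⟩
    · have := hf k hk
      have h1 := hfl k
      simp only at h1
      rw [h1]
      exact this
    · have h1 := hfl (K + 1)
      rw [he] at h1
      exact h1

/-- The corner in which an insertion ends. -/
theorem PB.corner {x : Letter} {y : PZ} {K : ℕ} {e' : Bool} (hy : PInc y S B)
    (h : stepO x (some y) = some z)
    (hf : ∀ k, k ≤ K → (runS ⟨S, B, x.ceil, x.primed⟩ k).w < ⊤)
    (he : runS ⟨S, B, x.ceil, x.primed⟩ (K + 1) = ⟨S', B', ⊤, e'⟩) :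
    S K (pos (runS ⟨S, B, x.ceil, x.primed⟩ K).S K (runS ⟨S, B, x.ceil, x.primed⟩ K).w) = ⊤ ∧
    (∀ i j, S' i j < ⊤ ↔ S i j < ⊤ ∨ (i = K ∧ j = pos (runS ⟨S, B, x.ceil, x.primed⟩ K).S K
      (runS ⟨S, B, x.ceil, x.primed⟩ K).w) ∨ (i = pos (runS ⟨S, B, x.ceil, x.primed⟩ K).S K
      (runS ⟨S, B, x.ceil, x.primed⟩ K).w ∧ j = K)) ∧
    (pos (runS ⟨S, B, x.ceil, x.primed⟩ K).S K (runS ⟨S, B, x.ceil, x.primed⟩ K).w ≠ K →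
      e' = false) := by
  obtain ⟨m, hm, hB, hev⟩ := hy
  have hG := GB_of_stepO hm hB hev h
  have hR := hG.run hf (by rw [he])
  have hd := hR.dom
  refine ⟨hR.corner.1, fun i j => ?_, ?_⟩
  · have := hd i j
    simp only [he] at this
    exact this
  · intro hne
    have hG' := runS_GB hG (k := K) fun j hj => hf j (by omega)
    have hw := hf K le_rfl
    have h1 : step K (runS ⟨S, B, x.ceil, x.primed⟩ K) = ⟨S', B', ⊤, e'⟩ := he
    generalize runS ⟨S, B, x.ceil, x.primed⟩ K = X at *
    obtain ⟨S₁, B₁, w₁, e₁⟩ := X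
    have hw : w₁ < ⊤ := hw
    have hi : Inc m S₁ := (hG'.fin hw).1
    rcases step_cases (k := K) hi hw with ⟨p, hp, h2, h3⟩ | ⟨q, hq, h2, h3⟩
    · have hpos := pos_eq (fun j hj => (h2 j hj).le) h3
      simp only [hpos] at hne
      rw [step_gen hi h2 h3, if_neg hne, if_neg hne] at h1
      simp only [St.mk.injEq] at h1
      rw [← h1.2.2.2]
      exact hG'.wb.top K p h1.2.2.1
    · obtain ⟨v, hv⟩ := WithTop.ne_top_iff_exists.1 hw.ne
      have h4 := hG'.alive hw q v (h2.trans hv.symm) hv.symm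
      rw [step_spec hi h2 hw] at h1
      simp only [St.mk.injEq] at h1
      rw [h1.2.2.1] at h4
      exact absurd h4.symm (WithTop.coe_ne_top)

theorem PB.lost_top (h : PB l S B β) (hr : run l.reverse = some z) {k : ℕ} (hk : S k k = ⊤) :
    β k = false := by
  induction h generalizing z with
  | nil => rfl
  | @cons l S B β S' B' e' K x h hf he ih =>
    obtain ⟨y, hy, hs⟩ := run_reverse_cons_eq_some hr
    have hc := PB.corner (h.pInc hy) hs hf he
    have h1 : ¬S' k k < ⊤ := fun h => h.ne hk
    rw [hc.2.1] at h1
    push Not at h1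
    have h2 := ih hy (top_le_iff.1 h1.1)
    split_ifs with hp
    · rw [Function.update_of_ne, h2]
      rintro rfl
      exact h1.2.1 rfl hp.symm
    · exact h2

theorem PInc.ev (h : PInc z S B) {m : ℕ} (hm : Inc m S) : WB S B ∧ _root_.ev (rd S B m) = some z := by
  obtain ⟨m', hm', hB, h1⟩ := h
  exact ⟨hB, by rw [← h1, ← rd_eq hm (le_max_left m m'), rd_eq hm' (le_max_right m m')]⟩

theorem PB.inj {z' : PZ} (h : PB l S B β) (h' : PB l' S' B' β') (hS : S = S') (hB : B = B')
    (hβ : β = β') (hr : run l.reverse = some z) (hr' : run l'.reverse = some z')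
    (hll : l.map Letter.ceil = l'.map Letter.ceil) : l = l' := by
  induction h generalizing l' S' B' β' z z' with
  | nil =>
    cases l' with
    | nil => rfl
    | cons x' l' => cases hll
  | @cons l S B β S₁ B₁ e₁ K x h hf he ih =>
    cases h' with
    | nil => cases hll
    | @cons l' S₀ B₂ β₂ _ _ e₂ K' x' h' hf' he' =>
      rw [List.map_cons, List.map_cons, List.cons.injEq] at hll
      obtain ⟨hx, hll⟩ := hll
      subst hS hB
      obtain ⟨y, hy, hs⟩ := run_reverse_cons_eq_some hr
      obtain ⟨y', hy', hs'⟩ := run_reverse_cons_eq_some hr'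
      obtain rfl : S = S₀ := by
        obtain ⟨c, hc⟩ := h.ph
        obtain ⟨c', hc'⟩ := h'.ph
        have h1 : l.map (fun x => ((0 : ℤ), x.ceil)) = l'.map (fun x => ((0 : ℤ), x.ceil)) := by
          have := congrArg (List.map fun x => ((0 : ℤ), x)) hll
          simpa [Function.comp_def] using this
        rw [h1] at hc
        exact (hc.unique hc').1
      have hc := PB.corner (h.pInc hy) hs hf he
      have hc' := PB.corner (h'.pInc hy') hs' hf' he'
      have htop := fun k => h.lost_top hy (k := k)
      have htop' := fun k => h'.lost_top hy' (k := k)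
      obtain ⟨m, hm, -⟩ := h.pInc hy
      have hE := (h.pInc hy).ev hm
      have hE' := (h'.pInc hy').ev hm
      have hG := GB_of_stepO hm hE.1 hE.2 hs
      have hG' := GB_of_stepO hm hE'.1 hE'.2 hs'
      obtain ⟨u, f⟩ := x
      obtain ⟨u', f'⟩ := x'
      obtain rfl : u = u' := hx
      have hSw := runS_S (X := ⟨S, B, u, f⟩) (Y := ⟨S, B₂, u, f'⟩) rfl rfl
      simp only at hf he hf' he' hc hc' hG hG' hβ
      have hK : K = K' := by
        rcases lt_trichotomy K K' with hlt | h1 | hlt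
        · have := hf' (K + 1) hlt
          rw [← (hSw (K + 1)).2, he] at this
          exact absurd this (lt_irrefl _)
        · exact h1
        · have := hf (K' + 1) hlt
          rw [(hSw (K' + 1)).2, he'] at this
          exact absurd this (lt_irrefl _)
      subst hK
      rw [(hSw K).1, (hSw K).2] at hβ hc
      generalize pos (runS ⟨S, B₂, u, f'⟩ K).S K (runS ⟨S, B₂, u, f'⟩ K).w = p at *
      have hbe : β = β₂ ∧ e₁ = e₂ := by
        by_cases hp : p = K
        · subst hp
          rw [if_pos rfl, if_pos rfl] at hβ
          constructor
          · funext k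
            by_cases hk : k = p
            · rw [hk, htop _ hc.1, htop' _ hc.1]
            · have := congrFun hβ k
              rwa [Function.update_of_ne hk, Function.update_of_ne hk] at this
          · have := congrFun hβ p
            rwa [Function.update_self, Function.update_self] at this
        · rw [if_neg hp, if_neg hp] at hβ
          exact ⟨hβ, (hc.2.2 hp).trans (hc'.2.2 hp).symm⟩
      obtain ⟨rfl, rfl⟩ := hbe
      obtain ⟨rfl, rfl⟩ := runS_inj_bits hG hG' hf (he.trans he'.symm)
      rw [ih h' rfl rfl rfl hy hy' hll]

end

section

variable {S : ℕ → ℕ → WithTop ℤ} {B : ℕ → ℕ → Bool} {m : ℕ} {z : PZ}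

/-- All primed tableaux over `S` are obtained by insertion, and there are as many of them as
primings of a word. -/
theorem EB_insertion (hz : IncOf z S) : (EB S z).ncard = 2 ^ kap z ∧
    ∀ B ∈ EB S z, ∃ l B' β, run l.reverse = some z ∧ PB l S B' β ∧
      ∀ i j, B i j = if i = j then β i else B' i j := by
  classical
  obtain ⟨w, c, hw, hr, h0⟩ := hz.exists_word
  rw [runR_eq] at hr
  have hP : ∀ b ∈ Prim (w.map Prod.snd).reverse z, ∃ B β, PB b.reverse S B β := by
    rintro b ⟨hb, hrb⟩
    obtain ⟨S', B, β, h⟩ := exists_PB (l := b.reverse) (by rwa [List.reverse_reverse])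
    obtain ⟨c', hc'⟩ := h.ph
    have h1 : b.reverse.map (fun x => ((0 : ℤ), x.ceil)) = w := by
      have h2 : b.reverse.map Letter.ceil = w.map Prod.snd := by
        rw [List.map_reverse]
        exact (congrArg List.reverse hb).trans (List.reverse_reverse _)
      have h3 := congrArg (List.map fun x => ((0 : ℤ), x)) h2
      rw [List.map_map, List.map_map] at h3
      refine Eq.trans h3 ?_
      conv_rhs => rw [← List.map_id w]
      exact List.map_congr_left fun x hx => Prod.ext (h0 x hx).symm rfl
    rw [h1] at hc'
    exact ⟨B, β, (hc'.unique hw).1 ▸ h⟩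
  choose! fB fβ hPB using hP
  have hcard := ncard_Prim hr
  have hmaps : ∀ b ∈ Prim (w.map Prod.snd).reverse z,
      (fun i j => if i = j then fβ b i else fB b i j) ∈ EB S z := by
    intro b hb
    have hrb : run b.reverse.reverse = some z := by rw [List.reverse_reverse]; exact hb.2
    have hI := (hPB b hb).pInc hrb
    obtain ⟨m, hm, hB, hev⟩ := id hI
    refine ⟨fun i j => ?_, fun i j hij => ?_, m, hm, ?_⟩
    · by_cases h : i = j
      · subst h; rfl
      · beta_reduce
        rw [if_neg h, if_neg (Ne.symm h), hB.symm]
    · by_cases h : i = j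
      · subst h
        beta_reduce
        rw [if_pos rfl]
        exact (hPB b hb).lost_top hrb hij
      · beta_reduce
        rw [if_neg h, hB.top _ _ hij]
    · rw [← hev]
      exact ev_rd_diag hm (fun i j hij => if_neg hij) m
  have hinj : Set.InjOn (fun b i j => if i = j then fβ b i else fB b i j)
      (Prim (w.map Prod.snd).reverse z) := by
    intro b hb b' hb' heq
    have hrb : run b.reverse.reverse = some z := by rw [List.reverse_reverse]; exact hb.2
    have hrb' : run b'.reverse.reverse = some z := by rw [List.reverse_reverse]; exact hb'.2
    have hI := (hPB b hb).pInc hrb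
    have hI' := (hPB b' hb').pInc hrb'
    obtain ⟨m, hm, hB, hev⟩ := id hI
    have hB' := (hI'.ev hm).1
    have hval := fun i j => congrFun (congrFun heq i) j
    simp only at hval
    refine List.reverse_injective ((hPB b hb).inj (hPB b' hb') rfl ?_ ?_ hrb hrb' ?_)
    · funext i j
      by_cases h : i = j
      · subst h
        rw [hB.diag, hB'.diag]
      · have := hval i j
        rwa [if_neg h, if_neg h] at this
    · funext i
      have := hval i i
      rwa [if_pos rfl, if_pos rfl] at this
    · rw [List.map_reverse, List.map_reverse]
      exact congrArg List.reverse (hb.1.trans hb'.1.symm)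
  obtain ⟨hfin, hle⟩ := EB_le hz
  have heq : (fun b i j => if i = j then fβ b i else fB b i j) ''
      (Prim (w.map Prod.snd).reverse z) = EB S z := by
    refine Set.eq_of_subset_of_ncard_le ?_ ?_ hfin
    · rintro _ ⟨b, hb, rfl⟩
      exact hmaps b hb
    · rw [hinj.ncard_image, hcard]
      exact hle
  constructor
  · rw [← heq, hinj.ncard_image, hcard]
  · intro B hB
    rw [← heq] at hB
    obtain ⟨b, hb, rfl⟩ := hB
    exact ⟨_, _, _, by rw [List.reverse_reverse]; exact hb.2, hPB b hb, fun i j => rfl⟩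

/-- The primed arrays over `S` for `z`. -/
def Fib (S : ℕ → ℕ → WithTop ℤ) (z : PZ) : Set (ℕ → ℕ → Bool) := {B | PInc z S B}

/-- The finite diagonal positions. -/
def dgS (S : ℕ → ℕ → WithTop ℤ) : Set ℕ := {k | S k k < ⊤}

theorem mem_Fib_iff : B ∈ Fib S z ↔ B ∈ EB S z ∧ ∀ k, B k k = false := by
  constructor
  · rintro ⟨m, hm, hB, hev⟩
    exact ⟨⟨hB.symm, hB.top, m, hm, hev⟩, hB.diag⟩
  · rintro ⟨⟨h1, h2, m, hm, hev⟩, h3⟩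
    exact ⟨m, hm, ⟨h1, h3, h2⟩, hev⟩

theorem Inc.dgS_finite (hm : Inc m S) : (dgS S).Finite := by
  refine (Set.finite_Iio m).subset fun k hk => ?_
  by_contra hc
  exact ne_of_lt (show S k k < ⊤ from hk) (hm.bd k k (not_lt.1 hc))

theorem ncard_Fib (hz : IncOf z S) : (Fib S z).ncard * 2 ^ (dgS S).ncard = 2 ^ kap z := by
  classical
  obtain ⟨m, hm, -⟩ := id hz
  rw [← (EB_insertion hz).1, ← Set.ncard_powerset _ hm.dgS_finite, ← Set.ncard_prod]
  symm
  refine Set.ncard_congr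
    (fun B _ => (fun i j => if i = j then false else B i j, {k | B k k = true})) ?_ ?_ ?_
  · rintro B ⟨h1, h2, m', hm', hev⟩
    refine ⟨⟨m', hm', ⟨fun i j => ?_, fun i => if_pos rfl, fun i j hij => ?_⟩, ?_⟩, ?_⟩
    · simp only [h1 i j, eq_comm]
    · simp only [h2 i j hij, ite_self]
    · rw [← hev]
      exact ev_rd_diag hm' (fun i j hij => if_neg hij) m'
    · intro k hk
      have hk : B k k = true := hk
      by_contra hc
      rw [h2 k k (not_lt_top_iff.1 hc)] at hk
      cases hk
  · rintro B B' - - heq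
    rw [Prod.mk.injEq] at heq
    funext i j
    by_cases h : i = j
    · subst h
      exact Bool.eq_iff_iff.2 (Set.ext_iff.1 heq.2 i)
    · have := congrFun (congrFun heq.1 i) j
      rwa [if_neg h, if_neg h] at this
  · rintro ⟨B, s⟩ ⟨hB, hs⟩
    obtain ⟨m', hm', hW, hev⟩ := hB
    simp only at hev hW
    refine ⟨fun i j => if i = j then decide (i ∈ s) else B i j, ⟨fun i j => ?_, fun i j hij => ?_,
      m', hm', ?_⟩, ?_⟩
    · by_cases h : i = j
      · subst h; rfl
      · beta_reduce
        rw [if_neg h, if_neg (Ne.symm h), hW.symm]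
    · by_cases h : i = j
      · subst h
        beta_reduce
        rw [if_pos rfl, decide_eq_false_iff_not]
        intro hi
        exact ne_of_lt (hs hi) hij
      · beta_reduce
        rw [if_neg h, hW.top _ _ hij]
    · rw [← hev]
      exact ev_rd_diag hm' (fun i j hij => if_neg hij) m'
    · refine Prod.ext ?_ ?_
      · funext i j
        by_cases h : i = j
        · subst h
          simp [hW.diag]
        · simp [h]
      · ext k
        simp

theorem mem_Fib_insertion (hz : IncOf z S) (hB : B ∈ Fib S z) :
    ∃ l β, run l.reverse = some z ∧ PB l S B β := by
  obtain ⟨h1, h2⟩ := mem_Fib_iff.1 hB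
  obtain ⟨l, B', β, hr, hl, h3⟩ := (EB_insertion hz).2 B h1
  obtain ⟨m, hm, hW, -⟩ := hl.pInc hr
  obtain rfl : B = B' := by
    funext i j
    by_cases h : i = j
    · subst h
      rw [h2, hW.diag]
    · rw [h3, if_neg h]
  exact ⟨l, β, hr, hl⟩

theorem map_toL_rdL (S : ℕ → ℕ → WithTop ℤ) (B : ℕ → ℕ → Bool) (n : ℕ) :
    ((rdL S B n).map Letter.ceil).map toL = rdL S nob n := by
  have h : ∀ i j, ((cellL S B i j).map Letter.ceil).map toL = cellL S nob i j := by
    intro i j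
    cases h : S i j with
    | top => rw [cellL_top h, cellL_top h]; rfl
    | coe x => rw [cellL_coe h, cellL_coe h]; rfl
  simp only [rdL, rowL, List.map_flatMap, h]
  rfl

theorem PInc.incOf (h : PInc z S B) : IncOf z S := by
  obtain ⟨m, hm, -, hev⟩ := h
  refine ⟨m, hm, ?_⟩
  rw [← run_rdL] at hev ⊢
  have h1 := run_unprime hev
  rwa [unprimeWord, map_toL_rdL] at h1

end

/-! ## Comparison with the tableau algorithm -/

theorem findIdx?_eq_some_of {α : Type*} {l : List α} {p : α → Bool} {n : ℕ} {x : α}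
    (h : l[n]? = some x) (hx : p x = true) (hl : ∀ j, j < n → ∀ y, l[j]? = some y → p y = false) :
    l.findIdx? p = some n := by
  rw [List.findIdx?_eq_some_iff_getElem]
  obtain ⟨hn, rfl⟩ := List.getElem?_eq_some_iff.1 h
  exact ⟨hn, hx, fun j hj => by
    rw [hl j hj _ (List.getElem?_eq_getElem (hj.trans hn))]
    exact Bool.false_ne_true⟩

theorem findIdx?_eq_none_of {α : Type*} {l : List α} {p : α → Bool}
    (h : ∀ (j : ℕ) (y : α), l[j]? = some y → p y = false) : l.findIdx? p = none := by
  rw [List.findIdx?_eq_none_iff]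
  intro x hx
  obtain ⟨j, hj, rfl⟩ := List.mem_iff_getElem.1 hx
  exact h j _ (List.getElem?_eq_getElem hj)

theorem length_eq_of_getElem? {α : Type*} {l : List α} {n : ℕ} (h1 : ∀ j, j < n → l[j]? ≠ none)
    (h2 : l[n]? = none) : l.length = n := by
  refine le_antisymm (List.getElem?_eq_none_iff.1 h2) ?_
  by_contra hlt
  exact h1 l.length (not_le.1 hlt) (List.getElem?_eq_none_iff.2 le_rfl)

theorem getElem?_filterMap_range {α : Type*} (f : ℕ → Option α) {n : ℕ}
    (hf : ∀ i j, i ≤ j → j < n → f i = none → f j = none) (i : ℕ) :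
    ((List.range n).filterMap fun r => (f r).map fun x => (r, x))[i]? =
      if i < n then (f i).map fun x => (i, x) else none := by
  induction n generalizing i with
  | zero => simp
  | succ n ih =>
    have ih := ih fun i j hij hj => hf i j hij (by omega)
    rw [List.range_succ, List.filterMap_append]
    cases h : f n with
    | none =>
      rw [show List.filterMap (fun r => (f r).map fun x => (r, x)) [n] = [] by simp [h],
        List.append_nil, ih]
      rcases lt_trichotomy i n with h1 | rfl | h1
      · rw [if_pos h1, if_pos (by omega)]
      · rw [if_neg (lt_irrefl _), if_pos (by omega), h]; rfl
      · rw [if_neg (by omega), if_neg (by omega)]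
    | some x =>
      have hl : ((List.range n).filterMap fun r => (f r).map fun x => (r, x)).length = n := by
        refine length_eq_of_getElem? (fun j hj => ?_) (by rw [ih, if_neg (lt_irrefl _)])
        rw [ih, if_pos hj]
        intro hn
        have := hf j n hj.le (Nat.lt_succ_self n) (by simpa using hn)
        rw [h] at this
        cases this
      rw [show List.filterMap (fun r => (f r).map fun x => (r, x)) [n] = [(n, x)] by simp [h]]
      rcases lt_trichotomy i n with h1 | rfl | h1
      · rw [List.getElem?_append_left (by omega), ih, if_pos h1, if_pos (by omega)]
      · rw [List.getElem?_append_right (by omega), hl, if_pos (by omega), h, Nat.sub_self]; rfl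
      · rw [if_neg (by omega)]
        exact List.getElem?_eq_none_iff.2 (by rw [List.length_append, hl, List.length_singleton]; omega)

open Classical in
/-- The decorated entry of an array in a given box. -/
noncomputable def dec (S : ℕ → ℕ → WithTop ℤ) (B : ℕ → ℕ → Bool) (i j : ℕ) : Option Letter :=
  if S i j = ⊤ then none else some ⟨(S i j).untopD 0, B i j⟩

/-- `T` is the tableau with entries given by `S` and `B`. -/
structure Enc (T : STab) (S : ℕ → ℕ → WithTop ℤ) (B : ℕ → ℕ → Bool) : Prop where
  entry : ∀ r c, r ≤ c → entry? T r c = dec S B r c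
  nil : [] ∉ T

section

variable {T T' : STab} {S S' : ℕ → ℕ → WithTop ℤ} {B B' : ℕ → ℕ → Bool} {m k p : ℕ}

theorem dec_coe {i j : ℕ} {x : ℤ} (h : S i j = x) : dec S B i j = some ⟨x, B i j⟩ := by
  rw [dec, h, if_neg (WithTop.coe_ne_top), WithTop.untopD_coe]

theorem dec_top {i j : ℕ} (h : S i j = ⊤) : dec S B i j = none := by
  rw [dec, if_pos h]

theorem dec_eq_none {i j : ℕ} : dec S B i j = none ↔ S i j = ⊤ := by
  rw [dec]; split <;> simp_all

theorem dec_eq_some {i j : ℕ} {x : Letter} : dec S B i j = some x ↔ S i j = x.ceil ∧ B i j = x.primed := by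
  cases h : S i j with
  | top => rw [dec_top h]; simp
  | coe y =>
    obtain ⟨x, b⟩ := x
    rw [dec_coe h]; simp

theorem dec_upd (x : Letter) (i j : ℕ) :
    dec (upd S k p x.ceil) (upd B k p x.primed) i j =
      if (i = k ∧ j = p) ∨ (i = p ∧ j = k) then some x else dec S B i j := by
  unfold dec upd
  split <;> simp

theorem getElem?_getD_nil (T : STab) (r j : ℕ) :
    (T.getD r [])[j]? = (T[r]?).bind fun row => row[j]? := by
  rw [List.getD_eq_getElem?_getD]
  cases T[r]? <;> simp

theorem Enc.row (h : Enc T S B) (r j : ℕ) : (T.getD r [])[j]? = dec S B r (r + j) := by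
  rw [← h.entry r (r + j) (by omega), entry?, entryG?, if_pos (by omega), Nat.add_sub_cancel_left,
    getElem?_getD_nil]

theorem Enc.lt_length (h : Enc T S B) {r : ℕ} (hr : S r r < ⊤) : r < T.length := by
  by_contra hlt
  have := h.row r 0
  rw [getElem?_getD_nil, List.getElem?_eq_none_iff.2 (not_lt.1 hlt), Nat.add_zero] at this
  exact hr.ne (dec_eq_none.1 this.symm)

theorem Enc.lt_top (h : Enc T S B) {r : ℕ} (hr : r < T.length) : S r r < ⊤ := by
  rw [lt_top_iff_ne_top]
  intro ht
  have := h.row r 0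
  rw [getElem?_getD_nil, Nat.add_zero, dec_top ht, List.getElem?_eq_getElem hr] at this
  refine h.nil ?_
  have h1 : T[r] = [] := by
    have : T[r][0]? = none := this
    simpa using this
  rw [← h1]
  exact List.getElem_mem hr

theorem getElem?_setRowG {r : ℕ} (hr : r ≤ T.length) (row : List Letter) (i : ℕ) :
    (setRowG T r row)[i]? = if i = r then some row else T[i]? := by
  unfold setRowG
  split
  · rename_i h
    rw [List.getElem?_set]
    grind
  · rename_i h
    obtain rfl : r = T.length := by omega
    rw [List.getElem?_append]
    grind

theorem setEntryG_eq {r : ℕ} (hr : r < T.length) (c : ℕ) (x : Letter) :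
    setEntryG T r c x = setRowG T r ((T.getD r []).set (c - r) x) := by
  rw [setEntryG, setRowG, if_pos hr]

theorem Enc.set (h : Enc T S B) {r : ℕ} (hr : r ≤ T.length) {row : List Letter} (h0 : row ≠ [])
    (hrow : ∀ j, row[j]? = dec S' B' r (r + j))
    (hoth : ∀ i j, i ≠ r → i ≤ j → dec S' B' i j = dec S B i j) : Enc (setRowG T r row) S' B' where
  entry i j hij := by
    rw [entry?, entryG?, if_pos hij, getElem?_setRowG hr]
    split
    · rename_i h1
      subst h1
      have := hrow (j - i)
      rw [Nat.add_sub_cancel' hij] at this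
      exact this
    · rename_i h1
      have := h.entry i j hij
      rw [entry?, entryG?, if_pos hij] at this
      rw [hoth i j h1 hij, this]
  nil hn := by
    obtain ⟨i, hi⟩ := List.mem_iff_getElem?.1 hn
    rw [getElem?_setRowG hr] at hi
    split at hi
    · exact h0 (Option.some_injective _ hi)
    · exact h.nil (List.mem_iff_getElem?.2 ⟨i, hi⟩)

theorem enc_ext (h : Enc T S B) (h' : Enc T' S B) : T = T' := by
  have hl : ∀ {T T' : STab}, Enc T S B → Enc T' S B → T.length ≤ T'.length := by
    intro T T' h h'
    by_contra hlt
    exact absurd (h'.lt_length (h.lt_top (not_le.1 hlt))) (lt_irrefl _)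
  refine List.ext_getElem (le_antisymm (hl h h') (hl h' h)) fun r h1 h2 => List.ext_getElem? fun j => ?_
  have h3 := h.row r j
  have h4 := h'.row r j
  rw [getElem?_getD_nil, List.getElem?_eq_getElem h1] at h3
  rw [getElem?_getD_nil, List.getElem?_eq_getElem h2] at h4
  exact h3.trans h4.symm

/-- The array of entries of a tableau is determined by the tableau. -/
theorem Enc.arr_eq (h : Enc T S B) (h' : Enc T S' B') (hS : ∀ i j, S i j = S j i)
    (hS' : ∀ i j, S' i j = S' j i) (hB : WB S B) (hB' : WB S' B') : S = S' ∧ B = B' := by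
  have key : ∀ i j, i ≤ j → S i j = S' i j ∧ B i j = B' i j := by
    intro i j hij
    have h1 := (h.entry i j hij).symm.trans (h'.entry i j hij)
    cases hc : S i j with
    | top =>
      rw [dec_top hc] at h1
      have h2 := dec_eq_none.1 h1.symm
      exact ⟨h2.symm, by rw [hB.top _ _ hc, hB'.top _ _ h2]⟩
    | coe x =>
      rw [dec_coe hc] at h1
      have h2 := dec_eq_some.1 h1.symm
      exact ⟨h2.1.symm, h2.2.symm⟩
  refine ⟨?_, ?_⟩ <;> funext i j <;> rcases le_total i j with hij | hij
  · exact (key i j hij).1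
  · rw [hS, hS', (key j i hij).1]
  · exact (key i j hij).2
  · rw [hB.symm, hB'.symm, (key j i hij).2]

theorem enc_nil : Enc [] (fun _ _ => ⊤) nob where
  entry r c h := by rw [dec_top rfl]; simp [entry?, entryG?]
  nil := by simp

end

theorem switchPrimes_eq (x y : Letter) :
    switchPrimes x y = (⟨x.ceil, y.primed⟩, ⟨y.ceil, x.primed⟩) := by
  obtain ⟨x, b⟩ := x
  obtain ⟨y, c⟩ := y
  cases b <;> cases c <;> rfl

theorem upd_comm' {α : Type*} (S : ℕ → ℕ → α) (k p : ℕ) (w : α) : upd S k p w = upd S p k w := by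
  funext i j
  unfold upd
  simp only [or_comm]

theorem upd_eq_self {α : Type*} {S : ℕ → ℕ → α} (hS : ∀ i j, S i j = S j i) (k p : ℕ) :
    upd S k p (S k p) = S := by
  funext i j
  unfold upd
  split
  · rename_i h
    rcases h with ⟨rfl, rfl⟩ | ⟨rfl, rfl⟩
    · rfl
    · exact hS _ _
  · rfl

section

variable {T T' : STab} {S S' : ℕ → ℕ → WithTop ℤ} {B B' : ℕ → ℕ → Bool} {m k p r c : ℕ}

theorem Enc.upd (h : Enc T S B) (hr : r ≤ T.length) (hrc : r ≤ c) {row : List Letter} (x : Letter)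
    (hrow : ∀ j, row[j]? = if r + j = c then some x else dec S B r (r + j)) :
    Enc (setRowG T r row) (_root_.upd S r c x.ceil) (_root_.upd B r c x.primed) := by
  refine h.set hr ?_ (fun j => ?_) fun i j hi hij => ?_
  · rintro rfl
    have := hrow (c - r)
    rw [if_pos (by omega)] at this
    cases this
  · rw [hrow, dec_upd]
    grind
  · rw [dec_upd, if_neg (by omega)]

theorem Enc.upd_set (h : Enc T S B) (hrc : r ≤ c) (hf : S r c < ⊤) (hr : r < T.length) (x : Letter) :
    Enc (setRowG T r ((T.getD r []).set (c - r) x)) (_root_.upd S r c x.ceil)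
      (_root_.upd B r c x.primed) := by
  refine h.upd hr.le hrc x fun j => ?_
  have h1 : c - r < (T.getD r []).length := by
    by_contra hlt
    have := h.row r (c - r)
    rw [List.getElem?_eq_none_iff.2 (not_lt.1 hlt), Nat.add_sub_cancel' hrc] at this
    exact hf.ne (dec_eq_none.1 this.symm)
  rw [List.getElem?_set]
  by_cases hj : c - r = j
  · rw [if_pos hj, if_pos (by omega), if_pos (by omega)]
  · rw [if_neg hj, if_neg (by omega), h.row]

theorem Enc.upd_append (h : Enc T S B) (hrc : r ≤ c) (hf : ∀ j, r ≤ j → j < c → S r j < ⊤)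
    (ht : S r c = ⊤) (hS : ∀ j, c ≤ j → S r j = ⊤) (hr : r ≤ T.length) (x : Letter) :
    Enc (setRowG T r (T.getD r [] ++ [x])) (_root_.upd S r c x.ceil) (_root_.upd B r c x.primed) := by
  have hl : (T.getD r []).length = c - r := length_eq_of_getElem?
    (fun j hj => by rw [h.row, ne_eq, dec_eq_none]; exact (hf _ (by omega) (by omega)).ne)
    (by rw [h.row, dec_eq_none, Nat.add_sub_cancel' hrc, ht])
  refine h.upd hr hrc x fun j => ?_
  rcases lt_trichotomy j (c - r) with hj | hj | hj
  · rw [List.getElem?_append_left (by omega), h.row, if_neg (by omega)]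
  · rw [List.getElem?_append_right (by omega), hl, hj, Nat.sub_self, if_pos (by omega)]; rfl
  · rw [if_neg (by omega), dec_top (hS _ (by omega))]
    exact List.getElem?_eq_none_iff.2 (by rw [List.length_append, hl, List.length_singleton]; omega)

theorem setRowG_setRowG (hr : r < T.length) (x y : List Letter) :
    setRowG (setRowG T r x) r y = setRowG T r y := by
  simp [setRowG, hr]

/-- The moving letter acts on the row, not on the column, of the given index. -/
def RowPh (S : ℕ → ℕ → WithTop ℤ) (k : ℕ) (w : WithTop ℤ) : Prop := ∀ k', k = k' + 1 → S k' k < w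

theorem getD_of_getElem? {α : Type*} {l : List α} {j : ℕ} {x d : α} (h : l[j]? = some x) :
    l.getD j d = x := by
  rw [List.getD_eq_getElem?_getD, h]; rfl

theorem egRow_step (hE : Enc T S B) (hS : Inc m S) (W : Letter) (hr : RowPh S k W.ceil)
    (ha : Alive S k W.ceil) (f : ℕ) :
    ((step k ⟨S, B, W.ceil, W.primed⟩).w = ⊤ ∧ Enc (egRow (f + 1) T k W).1
      (step k ⟨S, B, W.ceil, W.primed⟩).S (step k ⟨S, B, W.ceil, W.primed⟩).B) ∨
    ∃ T' W', (step k ⟨S, B, W.ceil, W.primed⟩).w = (W'.ceil : ℤ) ∧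
      (step k ⟨S, B, W.ceil, W.primed⟩).e = W'.primed ∧
      Enc T' (step k ⟨S, B, W.ceil, W.primed⟩).S (step k ⟨S, B, W.ceil, W.primed⟩).B ∧
      ((RowPh (step k ⟨S, B, W.ceil, W.primed⟩).S (k + 1) W'.ceil ∧
          egRow (f + 1) T k W = egRow f T' (k + 1) W') ∨
        (¬RowPh (step k ⟨S, B, W.ceil, W.primed⟩).S (k + 1) W'.ceil ∧
          egRow (f + 1) T k W = egCol f T' (k + 1) W')) := by
  obtain ⟨w, e⟩ := W
  have hT : k ≤ T.length := by
    rcases Nat.eq_zero_or_pos k with rfl | hk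
    · omega
    · have h1 := hr (k - 1) (by omega)
      have h2 : S (k - 1) (k - 1) < ⊤ :=
        ((hS.row_le (k - 1) (Nat.sub_le k 1)).trans_lt h1).trans (WithTop.coe_lt_top _)
      have := hE.lt_length h2
      omega
  have hrow := hE.row k
  rcases step_cases (k := k) hS (WithTop.coe_lt_top w) with ⟨p, hpm, h1, h2⟩ | ⟨q, hqm, hq, h2⟩
  · have hkp : k ≤ p := by
      by_contra hlt
      exact lt_asymm (row_phase hS hr (not_le.1 hlt)) h2
    rw [step_gen hS h1 h2]
    simp only
    cases hSp : S k p with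
    | top =>
      refine Or.inl ⟨rfl, ?_⟩
      have hnone : (T.getD k []).findIdx? (fun x => decide (w < x.ceil)) = none := by
        refine findIdx?_eq_none_of fun j y hy => ?_
        rw [hrow, dec_eq_some] at hy
        have hj : k + j < p := by
          by_contra hlt
          have := hS.row_le k (not_lt.1 hlt)
          rw [hSp, hy.1] at this
          exact absurd (WithTop.coe_lt_top y.ceil) (not_lt.2 this)
        have := h1 _ hj
        rw [hy.1, WithTop.coe_lt_coe] at this
        simpa using this.le
      have key := hE.upd_append hkp (fun j _ hj => (h1 j hj).trans (WithTop.coe_lt_top _)) hSp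
        (fun j hj => top_le_iff.1 (hSp ▸ hS.row_le k hj)) hT ⟨w, if p = k then false else e⟩
      have hemp : (T.getD k []).isEmpty = decide (p = k) := by
        have h3 := hrow 0
        by_cases hpk : p = k
        · subst hpk
          rw [Nat.add_zero, dec_top hSp] at h3
          simpa using h3
        · have h4 : dec S B k (k + 0) ≠ none := by
            rw [ne_eq, dec_eq_none]
            exact ((h1 k (by omega)).trans (WithTop.coe_lt_top _)).ne
          rw [← h3] at h4
          simpa [hpk] using h4
      convert key using 1
      simp only [egRow, hnone, hemp, decide_eq_true_eq]
      by_cases hpk : p = k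
      · have h5 : T.getD k [] = [] := by simpa [hpk] using hemp
        rw [h5]
        cases e <;> simp [hpk, Letter.unprime]
      · simp [hpk]
    | coe y =>
      right
      have hM : (T.getD k [])[p - k]? = some ⟨y, B k p⟩ := by
        rw [hrow, Nat.add_sub_cancel' hkp, dec_coe hSp]
      have hwy : w < y := by rwa [hSp, WithTop.coe_lt_coe] at h2
      have hlow : ∀ j, j < p - k → ∀ y, (T.getD k [])[j]? = some y → y.ceil < w := by
        intro j hj y hy
        rw [hrow, dec_eq_some] at hy
        have := h1 (k + j) (by omega)
        rwa [hy.1, WithTop.coe_lt_coe] at this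
      have hkM : (T.getD k []).findIdx? (fun x => decide (w < x.ceil)) = some (p - k) :=
        findIdx?_eq_some_of hM (by simpa using hwy) fun j hj y hy => by
          simpa using (hlow j hj y hy).le
      have hkm : (T.getD k []).findIdx? (fun x => decide (w ≤ x.ceil)) = some (p - k) :=
        findIdx?_eq_some_of hM (by simpa using hwy.le) fun j hj y hy => by
          simpa using hlow j hj y hy
      have hT' : k < T.length := hE.lt_length
        ((hS.row_le k hkp).trans_lt (hSp ▸ WithTop.coe_lt_top _))
      have key := hE.upd_set hkp (hSp ▸ WithTop.coe_lt_top _) hT' ⟨w, if p = k then false else e⟩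
      refine ⟨_, ⟨y, if p = k then e else B k p⟩, rfl, rfl, key, ?_⟩
      by_cases hpk : p = k
      · subst hpk
        right
        constructor
        · intro hph
          have h3 := hph p rfl
          rw [upd_of_ne _ _ (by omega), ← hSp] at h3
          exact lt_asymm h3 ((hS.incr p p).lt (hSp ▸ WithTop.coe_lt_top _))
        · simp only [egRow, hkM, hkm, Option.getD_some, Nat.sub_self, if_true, getD_of_getElem?
            (Nat.sub_self p ▸ hM)]
          rfl
      · left
        constructor
        · intro k' hk'
          obtain rfl : k = k' := by omega
          rw [upd_row]
          change _ < ((y : ℤ) : WithTop ℤ)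
          rw [← hSp]
          split
          · exact h2
          · exact (hS.row k (show k + 1 < p by omega)).resolve_right (hSp ▸ WithTop.coe_ne_top)
        · simp only [egRow, hkM, hkm, Option.getD_some, if_true, getD_of_getElem? hM,
            if_neg (show ¬p - k = 0 by omega), if_neg hpk]
  · have hkq : k ≤ q := by
      by_contra hlt
      exact (row_phase hS hr (not_le.1 hlt)).ne hq
    have hM' := ha q w hq rfl
    rw [step_spec hS hq (WithTop.coe_lt_top _)]
    simp only
    right
    have hm : (T.getD k [])[q - k]? = some ⟨w, B k q⟩ := by
      rw [hrow, Nat.add_sub_cancel' hkq, dec_coe hq]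
    have hM : (T.getD k [])[q + 1 - k]? = some ⟨w + 1, B k (q + 1)⟩ := by
      rw [hrow, Nat.add_sub_cancel' (by omega), dec_coe hM']
    have hlow : ∀ j, j < q - k → ∀ y, (T.getD k [])[j]? = some y → y.ceil < w := by
      intro j hj y hy
      rw [hrow, dec_eq_some] at hy
      have := (hS.row k (show k + j < q by omega)).resolve_right (hq ▸ WithTop.coe_ne_top)
      rwa [hy.1, hq, WithTop.coe_lt_coe] at this
    have hkM : (T.getD k []).findIdx? (fun x => decide (w < x.ceil)) = some (q + 1 - k) :=
      findIdx?_eq_some_of hM (by simp) fun j hj y hy => by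
        rcases (show j < q - k ∨ j = q - k by omega) with h3 | rfl
        · simpa using (hlow j h3 y hy).le
        · rw [hm] at hy
          obtain rfl := Option.some_injective _ hy
          simp
    have hkm : (T.getD k []).findIdx? (fun x => decide (w ≤ x.ceil)) = some (q - k) :=
      findIdx?_eq_some_of hm (by simp) fun j hj y hy => by
        simpa using hlow j hj y hy
    have hf1 : S k q < ⊤ := hq ▸ WithTop.coe_lt_top _
    have hf2 : S k (q + 1) < ⊤ := hM' ▸ WithTop.coe_lt_top _
    have hT' : k < T.length := hE.lt_length ((hS.row_le k hkq).trans_lt hf1)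
    have key := hE.upd_set hkq hf1 hT' ⟨w, B k (q + 1)⟩
    simp only at key
    rw [← hq, upd_eq_self hS.symm] at key
    have hT2 : k < (setRowG T k ((T.getD k []).set (q - k) ⟨w, B k (q + 1)⟩)).length := by
      rw [setRowG, if_pos hT', List.length_set]
      exact hT'
    have key2 := key.upd_set (c := q + 1) (by omega) hf2 hT2 ⟨w + 1, B k q⟩
    simp only at key2
    rw [← hM', upd_eq_self hS.symm, setRowG_setRowG hT'] at key2
    refine ⟨_, ⟨w + 1, e⟩, hM', rfl, key2, ?_⟩
    have hrowq : (setRowG T k ((T.getD k []).set (q - k) ⟨w, B k (q + 1)⟩)).getD k [] =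
        (T.getD k []).set (q - k) ⟨w, B k (q + 1)⟩ :=
      getD_of_getElem? (by rw [getElem?_setRowG hT, if_pos rfl])
    rw [hrowq]
    by_cases hqk : q = k
    · subst hqk
      right
      constructor
      · intro hph
        have h3 := hph q rfl
        rw [hM'] at h3
        exact lt_irrefl _ h3
      · simp only [egRow, hkM, hkm, Option.getD_some, getD_of_getElem? hm,
          getD_of_getElem? hM, if_neg (show ¬q - q = q + 1 - q by omega), switchPrimes_eq,
          if_pos (Nat.sub_self q)]
        rfl
    · left
      constructor
      · intro k' hk'
        obtain rfl : k = k' := by omega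
        change _ < ((w + 1 : ℤ) : WithTop ℤ)
        rw [← hM']
        exact (hS.row k (show k + 1 < q + 1 by omega)).resolve_right (hM' ▸ WithTop.coe_ne_top)
      · simp only [egRow, hkM, hkm, Option.getD_some, getD_of_getElem? hm,
          getD_of_getElem? hM, if_neg (show ¬q - k = q + 1 - k by omega), switchPrimes_eq,
          if_neg (show ¬q - k = 0 by omega)]
        rfl

end

section

variable {T T' : STab} {S S' : ℕ → ℕ → WithTop ℤ} {B B' : ℕ → ℕ → Bool} {m k p r c : ℕ}

/-- The nonempty boxes of a column, from the first row up. -/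
def occL (T : STab) (c : ℕ) : List (ℕ × Letter) :=
  (List.range (c + 1)).filterMap fun r => (entry? T r c).map fun x => (r, x)

theorem Enc.occL (hE : Enc T S B) (hS : Inc m S) (c i : ℕ) :
    (_root_.occL T c)[i]? = if i < c + 1 then (dec S B i c).map fun x => (i, x) else none := by
  unfold _root_.occL
  rw [getElem?_filterMap_range fun i => entry? T i c]
  · split
    · rw [hE.entry _ _ (by omega)]
    · rfl
  · intro i j hij hj h
    rw [hE.entry _ _ (by omega), dec_eq_none] at h ⊢
    exact top_le_iff.1 (h ▸ hS.col_le c hij)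

theorem egCol_step (hE : Enc T S B) (hS : Inc m S) (hB : ∀ i j, B i j = B j i) (W : Letter)
    (hr : ¬RowPh S k W.ceil) (hv : Valid S k W.ceil) (ha : Alive S k W.ceil) (f : ℕ) :
    ((step k ⟨S, B, W.ceil, W.primed⟩).w = ⊤ ∧ Enc (egCol (f + 1) T k W).1
      (step k ⟨S, B, W.ceil, W.primed⟩).S (step k ⟨S, B, W.ceil, W.primed⟩).B) ∨
    ∃ T' W', (step k ⟨S, B, W.ceil, W.primed⟩).w = (W'.ceil : ℤ) ∧
      (step k ⟨S, B, W.ceil, W.primed⟩).e = W'.primed ∧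
      Enc T' (step k ⟨S, B, W.ceil, W.primed⟩).S (step k ⟨S, B, W.ceil, W.primed⟩).B ∧
      (¬RowPh (step k ⟨S, B, W.ceil, W.primed⟩).S (k + 1) W'.ceil ∧
        egCol (f + 1) T k W = egCol f T' (k + 1) W') := by
  obtain ⟨w, e⟩ := W
  obtain ⟨k', rfl, hk'⟩ := not_row_phase hS hr
  set k := k' + 1 with hk
  have hocc : ∀ i, i < k + 1 → (occL T k)[i]? = (dec S B i k).map fun x => (i, x) := fun i hi => by
    rw [hE.occL hS, if_pos hi]
  have hocc' : ∀ i x, (occL T k)[i]? = some x → S k i = x.2.ceil := fun i x h => by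
    rw [hE.occL hS] at h
    split at h
    · obtain ⟨y, hy, rfl⟩ := Option.map_eq_some_iff.1 h
      rw [hS.symm]
      exact (dec_eq_some.1 hy).1
    · cases h
  change w ≤ S k k' at hk'
  rcases step_cases (k := k) hS (WithTop.coe_lt_top w) with ⟨p, hpm, h1, h2⟩ | ⟨q, hqm, hq, h2⟩
  · have hpk : p ≤ k' := by
      by_contra hlt
      exact absurd (h1 k' (not_le.1 hlt)) (not_lt.2 hk')
    have hpne : p ≠ k := by omega
    have hcl : ∀ j, j < k → S p j < w := fun j hj => by
      refine lt_of_le_of_lt (hS.row_le p (show j ≤ k' by omega)) (hv.col_lt hS h1 h2 rfl)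
    rw [step_gen hS h1 h2]
    simp only [if_neg hpne]
    cases hSp : S k p with
    | top =>
      refine Or.inl ⟨rfl, ?_⟩
      have hnone : (occL T k).findIdx? (fun x => decide (w < x.2.ceil)) = none := by
        refine findIdx?_eq_none_of fun j y hy => ?_
        have hj := hocc' j y hy
        rcases lt_or_ge j p with h | h
        · have := h1 j h
          rw [hj, WithTop.coe_lt_coe] at this
          simpa using this.le
        · have := hS.row_le k h
          rw [hSp, hj] at this
          exact absurd (WithTop.coe_lt_top y.2.ceil) (not_lt.2 this)
      have hlen : (occL T k).length = p := by
        refine length_eq_of_getElem? (fun j hj => ?_) ?_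
        · rw [hocc j (by omega), ne_eq, Option.map_eq_none_iff, dec_eq_none, hS.symm]
          exact ((h1 j hj).trans (WithTop.coe_lt_top _)).ne
        · rw [hocc p (by omega), Option.map_eq_none_iff, dec_eq_none, hS.symm, hSp]
      have hpT : p ≤ T.length := by
        rcases Nat.eq_zero_or_pos p with h | h
        · omega
        · have h3 : S (p - 1) (p - 1) < ⊤ :=
            ((hS.col_le (p - 1) (show p - 1 ≤ k by omega)).trans_lt (h1 (p - 1) (by omega))).trans
              (WithTop.coe_lt_top _)
          have := hE.lt_length h3
          omega
      have hpk' : S p k = ⊤ := by rw [hS.symm, hSp]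
      have key := hE.upd_append (r := p) (c := k) (by omega)
        (fun j _ hj => (hcl j hj).trans (WithTop.coe_lt_top _)) hpk'
        (fun j hj => top_le_iff.1 (hpk' ▸ hS.row_le p hj)) hpT ⟨w, e⟩
      rw [upd_comm' S, upd_comm' B]
      convert key using 1
      unfold occL at hnone hlen
      simp only [egCol, hnone, hlen, hpne, false_and, if_false]
    | coe y =>
      right
      have hSp' : S p k = y := by rw [hS.symm, hSp]
      have hM : (occL T k)[p]? = some (p, ⟨y, B p k⟩) := by
        rw [hocc p (by omega), dec_coe hSp']; rfl
      have hwy : w < y := by rwa [hSp, WithTop.coe_lt_coe] at h2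
      have hlow : ∀ j, j < p → ∀ y, (occL T k)[j]? = some y → y.2.ceil < w := by
        intro j hj y hy
        have := h1 j hj
        rwa [hocc' j y hy, WithTop.coe_lt_coe] at this
      have hkM : (occL T k).findIdx? (fun x => decide (w < x.2.ceil)) = some p :=
        findIdx?_eq_some_of hM (by simpa using hwy) fun j hj y hy => by
          simpa using (hlow j hj y hy).le
      have hkm : (occL T k).findIdx? (fun x => decide (w ≤ x.2.ceil)) = some p :=
        findIdx?_eq_some_of hM (by simpa using hwy.le) fun j hj y hy => by
          simpa using hlow j hj y hy
      have hT' : p < T.length := hE.lt_length ((hcl p (by omega)).trans (WithTop.coe_lt_top _))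
      have key := hE.upd_set (r := p) (c := k) (by omega) (hSp' ▸ WithTop.coe_lt_top _) hT' ⟨w, e⟩
      rw [← setEntryG_eq hT'] at key
      rw [upd_comm' S, upd_comm' B]
      refine ⟨_, ⟨y, B k p⟩, rfl, rfl, key, ?_, ?_⟩
      · intro hph
        have h3 := hph k rfl
        rw [upd_of_ne _ _ (by omega)] at h3
        change _ < ((y : ℤ) : WithTop ℤ) at h3
        rw [← hSp] at h3
        exact absurd (hS.row_le k (show p ≤ k + 1 by omega)) (not_le.2 h3)
      · have hd := getD_of_getElem? (d := (0, default)) hM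
        unfold occL at hkM hkm hd
        simp only [egCol, hkM, hkm, Option.getD_some, if_true, hd, if_neg hpne, hB k p]
  · have hqk : q ≤ k' := by
      by_contra hlt
      have := (hS.row k (not_le.1 hlt)).resolve_right (hq ▸ WithTop.coe_ne_top)
      exact absurd hk' (not_le.2 (hq ▸ this))
    have hM' := ha q w hq rfl
    rw [step_spec hS hq (WithTop.coe_lt_top _)]
    simp only
    right
    have hq' : S q k = w := by rw [hS.symm, hq]
    have hM'' : S (q + 1) k = (w + 1 : ℤ) := by rw [hS.symm, hM']
    have hm : (occL T k)[q]? = some (q, ⟨w, B q k⟩) := by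
      rw [hocc q (by omega), dec_coe hq']; rfl
    have hM : (occL T k)[q + 1]? = some (q + 1, ⟨w + 1, B (q + 1) k⟩) := by
      rw [hocc (q + 1) (by omega), dec_coe hM'']; rfl
    have hlow : ∀ j, j < q → ∀ y, (occL T k)[j]? = some y → y.2.ceil < w := by
      intro j hj y hy
      have := (hS.row k hj).resolve_right (hq ▸ WithTop.coe_ne_top)
      rwa [hocc' j y hy, hq, WithTop.coe_lt_coe] at this
    have hkM : (occL T k).findIdx? (fun x => decide (w < x.2.ceil)) = some (q + 1) :=
      findIdx?_eq_some_of hM (by simp) fun j hj y hy => by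
        rcases (show j < q ∨ j = q by omega) with h3 | rfl
        · simpa using (hlow j h3 y hy).le
        · rw [hm] at hy
          obtain rfl := Option.some_injective _ hy
          simp
    have hkm : (occL T k).findIdx? (fun x => decide (w ≤ x.2.ceil)) = some q :=
      findIdx?_eq_some_of hm (by simp) fun j hj y hy => by
        simpa using hlow j hj y hy
    have hf1 : S q k < ⊤ := hq' ▸ WithTop.coe_lt_top _
    have hf2 : S (q + 1) k < ⊤ := hM'' ▸ WithTop.coe_lt_top _
    have hT1 : q < T.length := hE.lt_length ((hS.row_le q (by omega)).trans_lt hf1)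
    have hT2 : q + 1 < T.length := hE.lt_length ((hS.row_le (q + 1) (by omega)).trans_lt hf2)
    have key := hE.upd_set (by omega) hf1 hT1 ⟨w, B k (q + 1)⟩
    simp only at key
    rw [← hq', upd_eq_self hS.symm, ← setEntryG_eq hT1] at key
    have hT2' : q + 1 < (setEntryG T q k ⟨w, B k (q + 1)⟩).length := by
      rw [setEntryG, List.length_set]
      exact hT2
    have key2 := key.upd_set (r := q + 1) (c := k) (by omega) hf2 hT2' ⟨w + 1, B k q⟩
    simp only at key2
    rw [← hM'', upd_eq_self hS.symm, ← setEntryG_eq hT2', upd_comm' _ (q + 1), upd_comm' _ q] at key2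
    refine ⟨_, ⟨w + 1, e⟩, hM', rfl, key2, ?_, ?_⟩
    · intro hph
      have h3 := hph k rfl
      change _ < ((w + 1 : ℤ) : WithTop ℤ) at h3
      rw [← hM'] at h3
      exact absurd (hS.row_le k (show q + 1 ≤ k + 1 by omega)) (not_le.2 h3)
    · have hd := getD_of_getElem? (d := (0, default)) hm
      have hd' := getD_of_getElem? (d := (0, default)) hM
      unfold occL at hkM hkm hd hd'
      simp only [egCol, hkM, hkm, Option.getD_some, hd, hd', if_neg (show ¬q = q + 1 by omega),
        switchPrimes_eq, hB k]
      rfl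

end

section

variable {T T' : STab} {S S' : ℕ → ℕ → WithTop ℤ} {B B' : ℕ → ℕ → Bool} {m k p r c : ℕ} {z : PZ}
  {β : ℕ → Bool} {l : List Letter}

open Classical in
theorem enc_run {X : St} (hG : GB m 0 X) (f : ℕ) : ∀ (k : ℕ) (T : STab) (W : Letter),
    (∀ j, j < k → (runS X j).w < ⊤) → (runS X k).w = (W.ceil : ℤ) → (runS X k).e = W.primed →
    Enc T (runS X k).S (runS X k).B → m < f + k →
    ∃ K, (∀ j, j ≤ K → (runS X j).w < ⊤) ∧ (runS X (K + 1)).w = ⊤ ∧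
      Enc (if RowPh (runS X k).S k W.ceil then (egRow f T k W).1 else (egCol f T k W).1)
        (runS X (K + 1)).S (runS X (K + 1)).B := by
  induction f with
  | zero =>
    intro k T W hf hw he hE hm
    have := ((runS_GB hG hf).fin (hw ▸ WithTop.coe_lt_top _)).2
    omega
  | succ f ih =>
    intro k T W hf hw he hE hm
    have hk := runS_GB hG hf
    have hwt : (runS X k).w < ⊤ := hw ▸ WithTop.coe_lt_top _
    have hf' : ∀ j, j < k + 1 → (runS X j).w < ⊤ := fun j hj => by
      rcases Nat.lt_succ_iff_lt_or_eq.1 hj with h | rfl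
      · exact hf j h
      · exact hwt
    have hX : runS X k = ⟨(runS X k).S, (runS X k).B, W.ceil, W.primed⟩ := by
      rw [← hw, ← he]
    have hst : step k ⟨(runS X k).S, (runS X k).B, W.ceil, W.primed⟩ = runS X (k + 1) := by
      rw [← hX]; rfl
    have ha : Alive (runS X k).S k W.ceil := by
      rw [hX] at hk
      exact hk.alive (WithTop.coe_lt_top _)
    have hv : Valid (runS X k).S k W.ceil := hw ▸ hk.valid
    by_cases hr : RowPh (runS X k).S k W.ceil
    · rw [if_pos hr]
      have h := egRow_step hE hk.inc W hr ha f
      rw [hst] at h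
      rcases h with ⟨h1, h2⟩ | ⟨T', W', h1, h2, h3, h4⟩
      · exact ⟨k, fun j hj => hf' j (by omega), h1, h2⟩
      · have h5 := ih (k + 1) T' W' hf' h1 h2 h3 (by omega)
        rcases h4 with ⟨h6, h7⟩ | ⟨h6, h7⟩
        · rwa [if_pos h6, ← h7] at h5
        · rwa [if_neg h6, ← h7] at h5
    · rw [if_neg hr]
      have h := egCol_step hE hk.inc hk.wb.symm W hr hv ha f
      rw [hst] at h
      rcases h with ⟨h1, h2⟩ | ⟨T', W', h1, h2, h3, h4⟩
      · exact ⟨k, fun j hj => hf' j (by omega), h1, h2⟩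
      · have h5 := ih (k + 1) T' W' hf' h1 h2 h3 (by omega)
        rwa [if_neg h4.1, ← h4.2] at h5

theorem Inc.shrink (hS : Inc m S) {n : ℕ} (h : S 0 n = ⊤) : Inc n S :=
  ⟨hS.symm, hS.incr, fun i j hj =>
    top_le_iff.1 (h ▸ (hS.row_le 0 hj).trans (hS.col_le j (Nat.zero_le i)))⟩

theorem Enc.inc (hE : Enc T S B) (hS : Inc m S) : Inc T.flatten.length S := by
  refine hS.shrink ?_
  have h1 : (T.getD 0 []).length ≤ T.flatten.length := by
    cases T <;> simp
  have := hE.row 0 T.flatten.length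
  rw [List.getElem?_eq_none_iff.2 h1, Nat.zero_add] at this
  exact dec_eq_none.1 this.symm

theorem PB.enc (h : PB l S B β) (hr : run l.reverse = some z) : Enc (PEG l.reverse) S B := by
  induction h generalizing z with
  | nil => exact enc_nil
  | @cons l S B β S' B' e' K x h hf he ih =>
    obtain ⟨y, hy, hs⟩ := run_reverse_cons_eq_some hr
    have hE := ih hy
    obtain ⟨m, hm, hB, hev⟩ := h.pInc hy
    have hm' := hE.inc hm
    rw [← rd_eq hm (Nat.le_max_left m (PEG l.reverse).flatten.length),
      rd_eq hm' (Nat.le_max_right m (PEG l.reverse).flatten.length)] at hev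
    have hG := GB_of_stepO hm' hB hev hs
    obtain ⟨K', h1, h2, h3⟩ := enc_run hG ((PEG l.reverse).flatten.length + (PEG l.reverse).length + 2)
      0 _ x (fun j hj => absurd hj (Nat.not_lt_zero j)) rfl rfl hE (by omega)
    have hK : K = K' := by
      rcases lt_trichotomy K K' with hlt | h4 | hlt
      · have := h1 (K + 1) hlt
        rw [he] at this
        exact absurd this (lt_irrefl _)
      · exact h4
      · have := hf (K' + 1) hlt
        rw [h2] at this
        exact absurd this (lt_irrefl _)
    subst hK
    rw [if_pos (show RowPh _ 0 _ from fun k' hk' => by omega), he] at h3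
    rw [List.reverse_cons, PEG, List.foldl_append]
    exact h3

/-- The tableaux obtained by inserting primed involution words. -/
theorem mem_PEG_image {z : PZ} (T : STab) :
    T ∈ PEG '' RinvPlus z ↔ ∃ S B, IncOf z S ∧ B ∈ Fib S z ∧ Enc T S B := by
  constructor
  · rintro ⟨a, ha, rfl⟩
    rw [mem_RinvPlus_iff] at ha
    rw [← a.reverse_reverse] at ha ⊢
    obtain ⟨S, B, β, h⟩ := exists_PB ha
    exact ⟨S, B, (h.pInc ha).incOf, h.pInc ha, h.enc ha⟩
  · rintro ⟨S, B, hS, hB, hE⟩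
    obtain ⟨l, β, hr, hl⟩ := mem_Fib_insertion hS hB
    exact ⟨l.reverse, mem_RinvPlus_iff.2 hr, enc_ext (hl.enc hr) hE⟩

end

section

variable {c c' : List (ℤ × ℕ × ℕ)} {D : ℕ → ℕ → Prop} {d : ℤ →₀ ℕ} {x y z : ℤ × ℕ × ℕ}

theorem CRel.trans (h : CRel x y) (h' : CRel y z) : CRel x z := by
  unfold CRel at *
  omega

theorem CRel.asymm (h : CRel x y) (h' : CRel y x) : False := by
  unfold CRel at *
  omega

theorem isChain_CRel : c.IsChain CRel ↔ c.Pairwise CRel := by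
  have : IsTrans (ℤ × ℕ × ℕ) CRel := ⟨fun _ _ _ => CRel.trans⟩
  exact List.isChain_iff_pairwise

theorem exists_sorted {α : Type*} [DecidableEq α] {R : α → α → Prop}
    (hR : ∀ x y z, R x y → R y z → R x z) (s : Finset α)
    (hs : ∀ x ∈ s, ∀ y ∈ s, x ≠ y → R x y ∨ R y x) :
    ∃ l : List α, l.Pairwise R ∧ ∀ x, x ∈ l ↔ x ∈ s := by
  classical
  induction s using Finset.induction_on with
  | empty => exact ⟨[], List.Pairwise.nil, by simp⟩
  | insert a s ha ih =>
    obtain ⟨l, hl, hm⟩ := ih fun x hx y hy =>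
      hs x (Finset.mem_insert_of_mem hx) y (Finset.mem_insert_of_mem hy)
    refine ⟨l.filter (fun x => R x a) ++ a :: l.filter (fun x => ¬R x a), ?_, ?_⟩
    · have key : ∀ x ∈ l, ¬R x a → R a x := fun x hx hn =>
        (hs x (Finset.mem_insert_of_mem ((hm x).1 hx)) a (Finset.mem_insert_self _ _)
          (fun h => ha (h ▸ (hm x).1 hx))).resolve_left hn
      rw [List.pairwise_append, List.pairwise_cons]
      refine ⟨hl.filter _, ⟨?_, hl.filter _⟩, ?_⟩
      · intro x hx
        simp only [List.mem_filter, decide_eq_true_eq] at hx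
        exact key x hx.1 hx.2
      · intro x hx y hy
        simp only [List.mem_filter, decide_eq_true_eq, List.mem_cons] at hx hy
        obtain rfl | hy := hy
        · exact hx.2
        · exact hR _ _ _ hx.2 (key y hy.1 hy.2)
    · intro x
      simp only [List.mem_append, List.mem_filter, List.mem_cons, decide_eq_true_eq,
        Finset.mem_insert, hm]
      tauto

theorem sorted_unique {α : Type*} {R : α → α → Prop} (hR : ∀ x y, R x y → R y x → False)
    {l l' : List α} (h : l.Pairwise R) (h' : l'.Pairwise R) (hm : ∀ x, x ∈ l ↔ x ∈ l') :
    l = l' := by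
  have nd : ∀ {l : List α}, l.Pairwise R → l.Nodup := fun h =>
    h.imp fun {a b} hab he => by subst he; exact hR a a hab hab
  refine List.Perm.eq_of_pairwise (fun a b _ _ h1 h2 => (hR a b h1 h2).elim) h h' ?_
  exact (List.perm_ext_iff_of_nodup (nd h) (nd h')).2 hm

/-- The box of `x` lies weakly below and to the left of that of `y`. -/
def BoxLe (x y : ℤ × ℕ × ℕ) : Prop :=
  (x.2.1 ≤ y.2.1 ∧ x.2.2 ≤ y.2.2) ∨ (x.2.1 ≤ y.2.2 ∧ x.2.2 ≤ y.2.1)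

/-- The boxes recorded by `c` are those of `D`. -/
def Covers (c : List (ℤ × ℕ × ℕ)) (D : ℕ → ℕ → Prop) : Prop :=
  ∀ i j, D i j ↔ ∃ b, (b, i, j) ∈ c ∨ (b, j, i) ∈ c

theorem CBuild.covers (h : CBuild c D) : Covers c D := by
  induction h with
  | nil hD => intro i j; simp [hD]
  | cons b K p h hn hD h1 h2 ih =>
    intro i j
    rw [hD, ih i j]
    simp only [List.mem_cons, Prod.mk.injEq]
    constructor
    · rintro (⟨b', h | h⟩ | h | h)
      · exact ⟨b', .inl (.inr h)⟩
      · exact ⟨b', .inr (.inr h)⟩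
      · exact ⟨b, .inl (.inl ⟨rfl, h⟩)⟩
      · exact ⟨b, .inr (.inl ⟨rfl, h.2, h.1⟩)⟩
    · rintro ⟨b', (h | h) | (h | h)⟩
      · exact .inr (.inl h.2)
      · exact .inl ⟨b', .inl h⟩
      · exact .inr (.inr ⟨h.2.2, h.2.1⟩)
      · exact .inl ⟨b', .inr h⟩

theorem Covers.mem {b : ℤ} {i j : ℕ} (h : Covers c D) (hm : (b, i, j) ∈ c) : D i j ∧ D j i :=
  ⟨(h i j).2 ⟨b, .inl hm⟩, (h j i).2 ⟨b, .inr hm⟩⟩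

/-- `D` is closed under moving to smaller indices. -/
def DownCl (D : ℕ → ℕ → Prop) : Prop := ∀ i j i' j', D i j → i' ≤ i → j' ≤ j → D i' j'

theorem CBuild.pairwise (h : CBuild c D) (hd : DownCl D) : c.Pairwise fun x y => ¬BoxLe x y := by
  induction h with
  | nil hD => exact List.Pairwise.nil
  | cons b K p h hn hD h1 h2 ih =>
    rename_i c D D'
    have hs := (CBuild.cons b K p h hn hD h1 h2).symm
    have key : ∀ i j, D i j → K ≤ i → p ≤ j → False := by
      intro i j hij hi hj
      have hij' := (hD i j).2 (.inl hij)
      by_cases hK : K = i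
      · by_cases hp : p = j
        · subst hK hp; exact hn hij
        · exact h2 (hd _ _ _ _ hij' hi (by omega))
      · exact h1 (hd _ _ _ _ hij' (by omega) hj)
    have hdD : DownCl D := by
      intro i j i' j' hij hi hj
      have := hd _ _ _ _ ((hD i j).2 (.inl hij)) hi hj
      rw [hD] at this
      obtain h' | ⟨rfl, rfl⟩ | ⟨rfl, rfl⟩ := this
      · exact h'
      · exact (key _ _ hij hi hj).elim
      · exact (key _ _ ((h.symm _ _).1 hij) hj hi).elim
    refine List.Pairwise.cons ?_ (ih hdD)
    rintro ⟨b', i, j⟩ hy hle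
    obtain ⟨hy1, hy2⟩ := h.covers.mem hy
    obtain hle | hle := hle
    · exact key _ _ hy1 hle.1 hle.2
    · exact key _ _ hy2 hle.1 hle.2

theorem CBuild_of_pairwise (hc : Covers c D) (hp : c.Pairwise fun x y => ¬BoxLe x y) :
    CBuild c D := by
  induction c generalizing D with
  | nil => exact CBuild.nil fun i j h => by simpa using (hc i j).1 h
  | cons x c ih =>
    obtain ⟨b, K, p⟩ := x
    rw [List.pairwise_cons] at hp
    have hD : ∀ i j, D i j ↔ (∃ b, (b, i, j) ∈ c ∨ (b, j, i) ∈ c) ∨ (i = K ∧ j = p) ∨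
        (i = p ∧ j = K) := by
      intro i j
      rw [hc]
      simp only [List.mem_cons, Prod.mk.injEq]
      constructor
      · rintro ⟨b', (h | h) | (h | h)⟩
        · exact .inr (.inl h.2)
        · exact .inl ⟨b', .inl h⟩
        · exact .inr (.inr ⟨h.2.2, h.2.1⟩)
        · exact .inl ⟨b', .inr h⟩
      · rintro (⟨b', h | h⟩ | h | h)
        · exact ⟨b', .inl (.inr h)⟩
        · exact ⟨b', .inr (.inr h)⟩
        · exact ⟨b, .inl (.inl ⟨rfl, h⟩)⟩
        · exact ⟨b, .inr (.inl ⟨rfl, h.2, h.1⟩)⟩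
    have key : ∀ i j, (∃ b, (b, i, j) ∈ c ∨ (b, j, i) ∈ c) → K ≤ i → p ≤ j → False := by
      rintro i j ⟨b', h | h⟩ hi hj
      · exact hp.1 _ h (.inl ⟨hi, hj⟩)
      · exact hp.1 _ h (.inr ⟨hi, hj⟩)
    refine CBuild.cons b K p (ih (D := fun i j => ∃ b, (b, i, j) ∈ c ∨ (b, j, i) ∈ c)
      (fun i j => Iff.rfl) hp.2) (fun h => key _ _ h le_rfl le_rfl) hD ?_ ?_
    · intro h
      obtain h | h | h := (hD _ _).1 h
      · exact key _ _ h (by omega) le_rfl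
      · omega
      · omega
    · intro h
      obtain h | h | h := (hD _ _).1 h
      · exact key _ _ h le_rfl (by omega)
      · omega
      · omega

theorem BoxLe.total_or (x y : ℤ × ℕ × ℕ) (hx : ¬BoxLe x y) (hy : ¬BoxLe y x) :
    CRel x y ∨ CRel y x := by
  unfold BoxLe CRel at *
  omega

/-- The conditions on the set of records in a sorted construction of `D`. -/
def GoodRec (c : List (ℤ × ℕ × ℕ)) : Prop := ∀ x ∈ c, ∀ y ∈ c, x ≠ y → BoxLe x y → CRel y x

theorem mem_CB_iff (hd : DownCl D) :
    c ∈ CB D d ↔ Covers c D ∧ c.Pairwise CRel ∧ GoodRec c ∧ HasContent d (c.map Prod.fst) := by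
  constructor
  · rintro ⟨h1, h2, h3⟩
    rw [isChain_CRel] at h2
    refine ⟨h1.covers, h2, ?_, h3⟩
    have h4 := h1.pairwise hd
    have h5 := (List.pairwise_and_iff.2 ⟨h2, h4⟩)
    intro x hx y hy hxy
    have h6 := h5.imp (S := fun x y => (CRel x y ∧ ¬BoxLe x y) ∨ (CRel y x ∧ ¬BoxLe y x)) .inl
    have : Std.Symm fun x y => (CRel x y ∧ ¬BoxLe x y) ∨ (CRel y x ∧ ¬BoxLe y x) := ⟨fun _ _ => Or.symm⟩
    intro hle
    obtain h | h := h6.forall hx hy hxy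
    · exact (h.2 hle).elim
    · exact h.1
  · rintro ⟨h1, h2, h3, h4⟩
    refine ⟨CBuild_of_pairwise h1 ?_, isChain_CRel.2 h2, h4⟩
    refine h2.imp_of_mem fun {x y} hx hy h hle => ?_
    refine h.asymm (h3 x hx y hy ?_ hle)
    rintro rfl
    exact h.asymm h

end

/-- The row and column conditions on a semistandard filling. -/
structure SemiC (G : ℕ → ℕ → Option Letter) : Prop where
  row : ∀ i j j' x y, j < j' → G i j = some x → G i j' = some y →
    x.ceil < y.ceil ∨ x.ceil = y.ceil ∧ y.primed = false
  col : ∀ i i' j x y, i < i' → G i j = some x → G i' j = some y →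
    x.ceil < y.ceil ∨ x.ceil = y.ceil ∧ x.primed = true

/-- The semistandard fillings of the boxes of `D` on or above the diagonal with content `d`. -/
structure SemiF (D : ℕ → ℕ → Prop) (d : ℤ →₀ ℕ) (G : ℕ → ℕ → Option Letter) : Prop where
  dom : ∀ i j, (∃ x, G i j = some x) ↔ i ≤ j ∧ D i j
  semi : SemiC G
  pos : ∀ i j x, G i j = some x → 0 < x.ceil
  cont : ∀ b, d b = {q : ℕ × ℕ | ∃ x, G q.1 q.2 = some x ∧ x.ceil = b}.ncard

/-- The record `t` comes from a box of the filling `G`. -/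
def recd (G : ℕ → ℕ → Option Letter) (t : ℤ × ℕ × ℕ) : Prop :=
  (t.2.1 = t.2.2 ∧ ∃ x, G t.2.1 t.2.1 = some x ∧ x.ceil = t.1) ∨
  (t.2.1 < t.2.2 ∧ G t.2.1 t.2.2 = some ⟨t.1, false⟩) ∨
  (t.2.2 < t.2.1 ∧ G t.2.2 t.2.1 = some ⟨t.1, true⟩)

section

variable {c c' : List (ℤ × ℕ × ℕ)} {D : ℕ → ℕ → Prop} {d : ℤ →₀ ℕ} {s t : ℤ × ℕ × ℕ}
  {G G' : ℕ → ℕ → Option Letter} {i j i' j' n : ℕ} {x y : Letter}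

theorem SemiC.cmp (h : SemiC G) (hdom : ∀ i j, (∃ x, G i j = some x) ↔ i ≤ j ∧ D i j)
    (hd : DownCl D) (hx : G i j = some x) (hy : G i' j' = some y) (hi : i ≤ i') (hj : j ≤ j')
    (hne : ¬(i = i' ∧ j = j')) : x.ceil < y.ceil ∨ x.ceil = y.ceil ∧
      ((i = i' ∧ j < j' ∧ y.primed = false) ∨ (j = j' ∧ i < i' ∧ x.primed = true)) := by
  obtain ⟨hij, hD⟩ := (hdom i' j').1 ⟨y, hy⟩
  obtain ⟨w, hw⟩ := (hdom i j').2 ⟨by omega, hd _ _ _ _ hD hi le_rfl⟩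
  by_cases h1 : i = i'
  · subst h1
    obtain h | h := h.row i j j' x y (by omega) hx hy
    · exact .inl h
    · exact .inr ⟨h.1, .inl ⟨rfl, by omega, h.2⟩⟩
  · by_cases h2 : j = j'
    · subst h2
      obtain h | h := h.col i i' j x y (by omega) hx hy
      · exact .inl h
      · exact .inr ⟨h.1, .inr ⟨rfl, by omega, h.2⟩⟩
    · obtain h3 | ⟨h3, h4⟩ := h.row i j j' x w (by omega) hx hw <;>
      obtain h5 | ⟨h5, h6⟩ := h.col i i' j' w y (by omega) hw hy
      · left; omega
      · left; omega
      · left; omega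
      · simp [h4] at h6

/-- The box of a record. -/
def recBox (t : ℤ × ℕ × ℕ) : ℕ × ℕ := (min t.2.1 t.2.2, max t.2.1 t.2.2)

theorem recd_iff : recd G t ↔ ∃ x, G (recBox t).1 (recBox t).2 = some x ∧ x.ceil = t.1 ∧
      ((t.2.1 < t.2.2 ∧ x.primed = false) ∨ (t.2.2 < t.2.1 ∧ x.primed = true) ∨
        t.2.1 = t.2.2) := by
  obtain ⟨b, K, p⟩ := t
  simp only [recd, recBox]
  obtain h | rfl | h := lt_trichotomy K p
  · rw [min_eq_left h.le, max_eq_right h.le]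
    constructor
    · rintro (h' | h' | h')
      · omega
      · exact ⟨_, h'.2, rfl, .inl ⟨h, rfl⟩⟩
      · omega
    · rintro ⟨⟨b', e⟩, h1, rfl, h3 | h3 | h3⟩
      · obtain ⟨_, rfl⟩ := h3
        exact .inr (.inl ⟨h, h1⟩)
      · omega
      · omega
  · rw [min_self, max_self]
    constructor
    · rintro (⟨-, x, h1, h2⟩ | h' | h')
      · exact ⟨x, h1, h2, .inr (.inr rfl)⟩
      · omega
      · omega
    · rintro ⟨x, h1, h2, -⟩
      exact .inl ⟨rfl, x, h1, h2⟩
  · rw [min_eq_right h.le, max_eq_left h.le]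
    constructor
    · rintro (h' | h' | h')
      · omega
      · omega
      · exact ⟨_, h'.2, rfl, .inr (.inl ⟨h, rfl⟩)⟩
    · rintro ⟨⟨b', e⟩, h1, rfl, h3 | h3 | h3⟩
      · omega
      · obtain ⟨_, rfl⟩ := h3
        exact .inr (.inr ⟨h, h1⟩)
      · omega

theorem recd_inj (hs : recd G s) (ht : recd G t) (h : recBox s = recBox t) : s = t := by
  rw [recd_iff] at hs ht
  obtain ⟨x, h1, h2, h3⟩ := hs
  obtain ⟨y, h4, h5, h6⟩ := ht
  rw [h, h4] at h1
  obtain rfl := Option.some.inj h1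
  obtain ⟨b, K, p⟩ := s
  obtain ⟨b', K', p'⟩ := t
  simp only [recBox, Prod.mk.injEq] at *
  refine ⟨by omega, ?_⟩
  obtain ⟨yc, _ | _⟩ := y <;>
    simp only [reduceCtorEq, and_false, and_true, false_or] at h3 h6 <;> omega

theorem exists_recd (hdom : ∀ i j, (∃ x, G i j = some x) ↔ i ≤ j ∧ D i j) (hx : G i j = some x) :
    ∃ t, recd G t ∧ recBox t = (i, j) ∧ t.1 = x.ceil := by
  have hij := ((hdom i j).1 ⟨x, hx⟩).1
  obtain ⟨b, e⟩ := x
  cases e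
  · refine ⟨(b, i, j), (recd_iff).2 ?_, ?_, rfl⟩ <;> simp only [recBox] <;>
      rw [min_eq_left hij, max_eq_right hij]
    refine ⟨_, hx, rfl, ?_⟩
    simp only [and_true]
    omega
  · refine ⟨(b, j, i), (recd_iff).2 ?_, ?_, rfl⟩ <;> simp only [recBox] <;>
      rw [min_eq_right hij, max_eq_left hij]
    refine ⟨_, hx, rfl, ?_⟩
    simp only [and_true]
    omega

theorem goodRec_recd (h : SemiC G) (hdom : ∀ i j, (∃ x, G i j = some x) ↔ i ≤ j ∧ D i j)
    (hd : DownCl D) (hs : recd G s) (ht : recd G t) (hne : s ≠ t) (hle : BoxLe s t) :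
    CRel t s := by
  have hb : recBox s ≠ recBox t := fun h => hne (recd_inj hs ht h)
  rw [recd_iff] at hs ht
  obtain ⟨x, h1, h2, h3⟩ := hs
  obtain ⟨y, h4, h5, h6⟩ := ht
  obtain ⟨b, K, p⟩ := s
  obtain ⟨b', K', p'⟩ := t
  simp only [recBox, BoxLe, CRel, ne_eq, Prod.mk.injEq] at *
  have := h.cmp hdom hd h1 h4 (by omega) (by omega) hb
  obtain ⟨xc, _ | _⟩ := x <;> obtain ⟨yc, _ | _⟩ := y <;>
    simp only [reduceCtorEq, and_false, and_true, false_or, or_false] at h2 h3 h5 h6 this <;> omega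

theorem count_recd (hn : c.Nodup) (hc : ∀ t, t ∈ c ↔ recd G t)
    (hdom : ∀ i j, (∃ x, G i j = some x) ↔ i ≤ j ∧ D i j) (b : ℤ) :
    (c.map Prod.fst).count b = {q : ℕ × ℕ | ∃ x, G q.1 q.2 = some x ∧ x.ceil = b}.ncard := by
  have h1 : (c.map Prod.fst).count b = (c.filter fun t => t.1 = b).toFinset.card := by
    rw [List.toFinset_card_of_nodup (hn.filter _), List.count, List.countP_map,
      List.countP_eq_length_filter]
    congr 1
  rw [h1, ← Set.ncard_coe_finset]
  refine Set.ncard_congr (fun t _ => recBox t) ?_ ?_ ?_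
  · intro t ht
    simp only [List.coe_toFinset, List.mem_filter, decide_eq_true_eq, Set.mem_ofPred_eq, hc] at ht
    obtain ⟨x, hx, hx', -⟩ := (recd_iff).1 ht.1
    exact ⟨x, hx, hx'.trans ht.2⟩
  · intro s t hs ht h
    simp only [List.coe_toFinset, List.mem_filter, decide_eq_true_eq, Set.mem_ofPred_eq, hc] at hs ht
    exact recd_inj hs.1 ht.1 h
  · rintro ⟨i, j⟩ ⟨x, hx, hb⟩
    obtain ⟨t, h1, h2, h3⟩ := exists_recd hdom hx
    refine ⟨t, ?_, h2⟩
    simp only [List.coe_toFinset, List.mem_filter, decide_eq_true_eq, Set.mem_ofPred_eq, hc]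
    exact ⟨h1, h3.trans hb⟩

theorem CRel.nodup (h : c.Pairwise CRel) : c.Nodup :=
  h.imp fun {a b} hab he => by subst he; exact hab.asymm hab

theorem covers_recd (hs : ∀ i j, D i j ↔ D j i) (hc : ∀ t, t ∈ c ↔ recd G t)
    (hdom : ∀ i j, (∃ x, G i j = some x) ↔ i ≤ j ∧ D i j) : Covers c D := by
  have key : ∀ i j, i ≤ j → (D i j ↔ ∃ b, (b, i, j) ∈ c ∨ (b, j, i) ∈ c) := by
    intro i j hij
    have h1 : D i j ↔ ∃ x, G i j = some x := by rw [hdom]; exact (and_iff_right hij).symm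
    rw [h1]
    constructor
    · rintro ⟨x, hx⟩
      obtain ⟨t, h1', h2, h3⟩ := exists_recd hdom hx
      rw [← hc] at h1'
      obtain ⟨b, K, p⟩ := t
      simp only [recBox, Prod.mk.injEq] at h2
      obtain ⟨rfl, rfl⟩ | ⟨rfl, rfl⟩ : (K = i ∧ p = j) ∨ (K = j ∧ p = i) := by omega
      · exact ⟨b, .inl h1'⟩
      · exact ⟨b, .inr h1'⟩
    · rintro ⟨b, h | h⟩ <;> rw [hc, recd_iff] at h <;> obtain ⟨x, h, -⟩ := h <;>
        refine ⟨x, ?_⟩ <;> simp only [recBox] at h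
      · rwa [min_eq_left hij, max_eq_right hij] at h
      · rwa [min_eq_right hij, max_eq_left hij] at h
  intro i j
  obtain h | h := le_total i j
  · exact key i j h
  · rw [hs, key j i h]
    exact exists_congr fun b => or_comm

theorem SemiF.exists_CB (h : SemiF D d G) (hs : ∀ i j, D i j ↔ D j i) (hd : DownCl D)
    (hf : ∀ i j, D i j → i < n ∧ j < n) : ∃ c ∈ CB D d, ∀ t, t ∈ c ↔ recd G t := by
  classical
  have hfin : {t | recd G t}.Finite := by
    refine Set.Finite.of_injOn (f := recBox) (t := Set.Iio n ×ˢ Set.Iio n) ?_ ?_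
      ((Set.finite_Iio n).prod (Set.finite_Iio n))
    · intro t ht
      obtain ⟨x, hx, -⟩ := (recd_iff).1 ht
      exact hf _ _ ((h.dom _ _).1 ⟨x, hx⟩).2
    · intro s hs t ht hst
      exact recd_inj hs ht hst
  obtain ⟨c, hp, hm⟩ := exists_sorted (R := CRel) (fun _ _ _ => CRel.trans) hfin.toFinset (by
    intro s hs t ht hne
    rw [Set.Finite.mem_toFinset] at hs ht
    by_cases h1 : BoxLe s t
    · exact .inr (goodRec_recd h.semi h.dom hd hs ht hne h1)
    · by_cases h2 : BoxLe t s
      · exact .inl (goodRec_recd h.semi h.dom hd ht hs hne.symm h2)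
      · exact BoxLe.total_or s t h1 h2)
  simp only [Set.Finite.mem_toFinset, Set.mem_ofPred_eq] at hm
  refine ⟨c, (mem_CB_iff hd).2 ⟨covers_recd hs hm h.dom, hp, ?_, ?_, ?_⟩, hm⟩
  · intro x hx y hy
    exact goodRec_recd h.semi h.dom hd ((hm x).1 hx) ((hm y).1 hy)
  · intro b hb
    obtain ⟨t, ht, rfl⟩ := List.mem_map.1 hb
    obtain ⟨x, hx, hx', -⟩ := (recd_iff).1 ((hm t).1 ht)
    exact hx' ▸ h.pos _ _ _ hx
  · intro b
    rw [count_recd (CRel.nodup hp) hm h.dom, h.cont]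

/-- The diagonal positions of primed entries. -/
def dgP (G : ℕ → ℕ → Option Letter) : Set ℕ := {k | ∃ x, G k k = some x ∧ x.primed = true}

theorem filling_ext (h : ∀ i j, (∃ x, G i j = some x) ↔ i ≤ j ∧ D i j)
    (h' : ∀ i j, (∃ x, G' i j = some x) ↔ i ≤ j ∧ D i j) (hr : ∀ t, recd G t ↔ recd G' t)
    (hg : dgP G = dgP G') : G = G' := by
  funext i j
  by_cases hx : ∃ x, G i j = some x
  · obtain ⟨y, hy⟩ := (h' i j).2 ((h i j).1 hx)
    obtain ⟨x, hx⟩ := hx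
    rw [hx, hy]
    have hij := ((h i j).1 ⟨x, hx⟩).1
    obtain ⟨t, h1, h2, h3⟩ := exists_recd h hx
    have h1' := (hr t).1 h1
    rw [recd_iff, h2, hx] at h1
    rw [recd_iff, h2, hy] at h1'
    obtain ⟨x', h0, h4, h5⟩ := h1
    obtain rfl := Option.some.inj h0
    obtain ⟨y, h6, h7, h8⟩ := h1'
    obtain rfl := Option.some.inj h6
    congr 1
    have hc := h4.trans h7.symm
    suffices x.primed = y.primed by cases x; cases y; simp_all
    obtain h9 | h9 | h9 := lt_trichotomy t.2.1 t.2.2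
    · have : ¬ t.2.2 < t.2.1 := by omega
      have : ¬ t.2.1 = t.2.2 := by omega
      simp_all
    · obtain rfl : i = j := by simp only [recBox, Prod.mk.injEq] at h2; omega
      have := Set.ext_iff.1 hg i
      simp only [dgP, Set.mem_ofPred_eq, hx, hy, Option.some.injEq, exists_eq_left'] at this
      exact Bool.eq_iff_iff.2 this
    · have : ¬ t.2.1 < t.2.2 := by omega
      have : ¬ t.2.1 = t.2.2 := by omega
      simp_all
  · have hy := fun hy => hx ((h i j).2 ((h' i j).1 hy))
    rw [Option.eq_none_iff_forall_ne_some.2 fun x h => hx ⟨x, h⟩,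
      Option.eq_none_iff_forall_ne_some.2 fun x h => hy ⟨x, h⟩]

end

section

variable {c c' : List (ℤ × ℕ × ℕ)} {D : ℕ → ℕ → Prop} {d : ℤ →₀ ℕ} {δ : Set ℕ} {n : ℕ}

open Classical in
/-- The filling with records `c` whose primed diagonal positions are `δ`. -/
noncomputable def fillOf (c : List (ℤ × ℕ × ℕ)) (δ : Set ℕ) (i j : ℕ) : Option Letter :=
  if h : i ≤ j ∧ ∃ b, (b, i, j) ∈ c ∨ (b, j, i) ∈ c then
    some ⟨h.2.choose, decide (if i = j then i ∈ δ else (h.2.choose, j, i) ∈ c)⟩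
  else none

theorem GoodRec.unique (h : GoodRec c) {b b' : ℤ} {i j i' j' : ℕ} (hm : (b, i, j) ∈ c)
    (hm' : (b', i', j') ∈ c) (hb : (i = i' ∧ j = j') ∨ (i = j' ∧ j = i')) :
    b = b' ∧ i = i' ∧ j = j' := by
  by_contra hc
  have hne : (b, i, j) ≠ (b', i', j') := by simpa using hc
  have h1 : BoxLe (b, i, j) (b', i', j') := by simp only [BoxLe]; omega
  have h2 : BoxLe (b', i', j') (b, i, j) := by simp only [BoxLe]; omega
  exact (h _ hm _ hm' hne h1).asymm (h _ hm' _ hm hne.symm h2)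

theorem fillOf_eq_some (hg : GoodRec c) {i j : ℕ} {x : Letter} :
    fillOf c δ i j = some x ↔ (i = j ∧ (x.ceil, i, i) ∈ c ∧ (x.primed = true ↔ i ∈ δ)) ∨
      (i < j ∧ x.primed = false ∧ (x.ceil, i, j) ∈ c) ∨
      (i < j ∧ x.primed = true ∧ (x.ceil, j, i) ∈ c) := by
  classical
  unfold fillOf
  by_cases h : i ≤ j ∧ ∃ b, (b, i, j) ∈ c ∨ (b, j, i) ∈ c
  · rw [dif_pos h]
    have hch := h.2.choose_spec
    generalize h.2.choose = b at hch
    obtain ⟨b', e⟩ := x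
    simp only [Option.some.injEq, Letter.mk.injEq]
    obtain rfl | hlt := h.1.eq_or_lt
    · simp only [or_self] at hch
      simp only [if_true, lt_self_iff_false, false_and, or_false, true_and]
      constructor
      · rintro ⟨rfl, rfl⟩
        exact ⟨hch, by simp⟩
      · rintro ⟨h1, h2⟩
        refine ⟨(hg.unique hch h1 (by simp)).1, ?_⟩
        rw [Bool.eq_iff_iff, h2, decide_eq_true_eq]
    · simp only [hlt.ne, if_false, false_and, false_or, hlt, true_and]
      constructor
      · rintro ⟨rfl, rfl⟩
        by_cases hc : (b, j, i) ∈ c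
        · simp [hc]
        · simp [hc, hch.resolve_right hc]
      · rintro (⟨rfl, h1⟩ | ⟨rfl, h1⟩)
        · obtain h2 | h2 := hch
          · obtain rfl := (hg.unique h2 h1 (by simp)).1
            refine ⟨rfl, decide_eq_false fun h3 => ?_⟩
            have := hg.unique h1 h3 (by simp)
            omega
          · have := hg.unique h1 h2 (by simp)
            omega
        · obtain h2 | h2 := hch
          · have := hg.unique h1 h2 (by simp)
            omega
          · obtain rfl := (hg.unique h2 h1 (by simp)).1
            exact ⟨rfl, decide_eq_true h2⟩
  · rw [dif_neg h]
    simp only [reduceCtorEq, false_iff]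
    rintro (⟨rfl, h1, -⟩ | ⟨hlt, -, h1⟩ | ⟨hlt, -, h1⟩)
    · exact h ⟨le_rfl, _, .inl h1⟩
    · exact h ⟨hlt.le, _, .inl h1⟩
    · exact h ⟨hlt.le, _, .inr h1⟩

theorem fillOf_dom (hc : Covers c D) (i j : ℕ) :
    (∃ x, fillOf c δ i j = some x) ↔ i ≤ j ∧ D i j := by
  classical
  rw [hc i j]
  unfold fillOf
  by_cases h : i ≤ j ∧ ∃ b, (b, i, j) ∈ c ∨ (b, j, i) ∈ c
  · rw [dif_pos h]
    simpa using h
  · rw [dif_neg h]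
    simpa using h

theorem recd_fillOf (hg : GoodRec c) (t : ℤ × ℕ × ℕ) : t ∈ c ↔ recd (fillOf c δ) t := by
  classical
  obtain ⟨b, K, p⟩ := t
  simp only [recd, fillOf_eq_some hg]
  obtain h | rfl | h := lt_trichotomy K p
  · simp [h.ne, h, h.not_gt]
  · simp only [lt_self_iff_false, false_and, or_false, true_and]
    constructor
    · intro h
      exact ⟨⟨b, decide (K ∈ δ)⟩, ⟨h, by simp⟩, rfl⟩
    · rintro ⟨x, ⟨h, -⟩, rfl⟩
      exact h
  · simp [h.ne', h.ne, h.not_gt, h]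

theorem fillOf_rec (hg : GoodRec c) {i j : ℕ} {x : Letter} (h : fillOf c δ i j = some x) :
    ∃ K p, (x.ceil, K, p) ∈ c ∧ ((i = j ∧ K = i ∧ p = i) ∨
      (i < j ∧ x.primed = false ∧ K = i ∧ p = j) ∨ (i < j ∧ x.primed = true ∧ K = j ∧ p = i)) := by
  rw [fillOf_eq_some hg] at h
  obtain ⟨h1, h2, h3⟩ | ⟨h1, h2, h3⟩ | ⟨h1, h2, h3⟩ := h
  · exact ⟨_, _, h2, .inl ⟨h1, rfl, rfl⟩⟩
  · exact ⟨_, _, h3, .inr (.inl ⟨h1, h2, rfl, rfl⟩)⟩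
  · exact ⟨_, _, h3, .inr (.inr ⟨h1, h2, rfl, rfl⟩)⟩

theorem fillOf_semiC (hg : GoodRec c) : SemiC (fillOf c δ) := by
  constructor
  · intro i j j' x y hj hx hy
    obtain ⟨K, p, h1, h2⟩ := fillOf_rec hg hx
    obtain ⟨K', p', h3, h4⟩ := fillOf_rec hg hy
    have hne : (x.ceil, K, p) ≠ (y.ceil, K', p') := by
      simp only [ne_eq, Prod.mk.injEq]; omega
    have := hg _ h1 _ h3 hne (by simp only [BoxLe]; omega)
    simp only [CRel] at this
    cases hp : y.primed <;> simp only [hp, reduceCtorEq, and_false, false_and, true_and, and_true, or_false, false_or] at h4 ⊢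
    all_goals omega
  · intro i i' j x y hi hx hy
    obtain ⟨K, p, h1, h2⟩ := fillOf_rec hg hx
    obtain ⟨K', p', h3, h4⟩ := fillOf_rec hg hy
    have hne : (x.ceil, K, p) ≠ (y.ceil, K', p') := by
      simp only [ne_eq, Prod.mk.injEq]; omega
    have := hg _ h1 _ h3 hne (by simp only [BoxLe]; omega)
    simp only [CRel] at this
    cases hp : x.primed <;> simp only [hp, reduceCtorEq, and_false, false_and, true_and, and_true, or_false] at h2 ⊢ <;> omega

theorem semiF_fillOf (hd : DownCl D) (hc : c ∈ CB D d) : SemiF D d (fillOf c δ) := by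
  obtain ⟨h1, h2, h3, h4, h5⟩ := (mem_CB_iff hd).1 hc
  refine ⟨fillOf_dom h1, fillOf_semiC h3, ?_, ?_⟩
  · intro i j x hx
    obtain ⟨K, p, hm, -⟩ := fillOf_rec h3 hx
    exact h4 _ (List.mem_map_of_mem (f := Prod.fst) hm)
  · intro b
    rw [h5, count_recd (CRel.nodup h2) (recd_fillOf h3) (fillOf_dom h1)]

theorem dgP_fillOf (hg : GoodRec c) (hc : Covers c D) (hδ : δ ⊆ {k | D k k}) :
    dgP (fillOf c δ) = δ := by
  ext k
  constructor
  · rintro ⟨x, hx, hp⟩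
    rw [fillOf_eq_some hg] at hx
    simp only [true_and, lt_self_iff_false, false_and, or_false] at hx
    exact hx.2.1 hp
  · intro hk
    obtain ⟨b, hb⟩ := (hc k k).1 (hδ hk)
    rw [or_self] at hb
    refine ⟨⟨b, true⟩, ?_, rfl⟩
    rw [fillOf_eq_some hg]
    exact .inl ⟨rfl, hb, by simpa using hk⟩

theorem ncard_semiF (hs : ∀ i j, D i j ↔ D j i) (hd : DownCl D)
    (hf : ∀ i j, D i j → i < n ∧ j < n) :
    {G | SemiF D d G}.ncard = (CB D d).ncard * 2 ^ {k | D k k}.ncard := by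
  have hfin : {k | D k k}.Finite := (Set.finite_Iio n).subset fun k hk => (hf k k hk).1
  rw [← Set.ncard_powerset _ hfin, ← Set.ncard_prod]
  refine Set.ncard_congr
    (fun G (hG : SemiF D d G) => ((hG.exists_CB hs hd hf).choose, dgP G)) ?_ ?_ ?_
  · intro G hG
    refine ⟨(SemiF.exists_CB hG hs hd hf).choose_spec.1, ?_⟩
    rintro k ⟨x, hx, -⟩
    exact ((hG.dom k k).1 ⟨x, hx⟩).2
  · intro G G' hG hG' h
    rw [Prod.mk.injEq] at h
    refine filling_ext hG.dom hG'.dom (fun t => ?_) h.2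
    rw [← (SemiF.exists_CB hG hs hd hf).choose_spec.2, h.1,
      (SemiF.exists_CB hG' hs hd hf).choose_spec.2]
  · rintro ⟨c, δ⟩ ⟨hc, hδ⟩
    obtain ⟨h1, h2, h3, h4⟩ := (mem_CB_iff hd).1 hc
    have hG := semiF_fillOf (δ := δ) hd hc
    refine ⟨fillOf c δ, hG, ?_⟩
    have hsp := (hG.exists_CB hs hd hf).choose_spec
    rw [Prod.mk.injEq]
    refine ⟨sorted_unique (fun _ _ => CRel.asymm) ((mem_CB_iff hd).1 hsp.1).2.1 h2 fun t => ?_,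
      dgP_fillOf h3 h1 hδ⟩
    rw [hsp.2, recd_fillOf (δ := δ) h3]

end

theorem countP_row {α : Type*} (p : α → Bool) (l : List α) :
    {k : ℕ | ∃ x, l[k]? = some x ∧ p x = true}.Finite ∧
      l.countP p = {k : ℕ | ∃ x, l[k]? = some x ∧ p x = true}.ncard := by
  induction l with
  | nil => simp
  | cons a l ih =>
    have h : {k : ℕ | ∃ x, (a :: l)[k]? = some x ∧ p x = true} =
        {k | k = 0 ∧ p a = true} ∪ Nat.succ '' {k : ℕ | ∃ x, l[k]? = some x ∧ p x = true} := by
      ext k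
      cases k <;> simp
    have hf : {k | k = 0 ∧ p a = true}.Finite :=
      (Set.finite_singleton 0).subset fun k hk => hk.1
    rw [h]
    refine ⟨hf.union (ih.1.image _), ?_⟩
    rw [Set.ncard_union_eq ?_ hf (ih.1.image _), Set.ncard_image_of_injective _ Nat.succ_injective,
      List.countP_cons, ih.2, add_comm]
    · congr 1
      by_cases hp : p a = true <;> simp [hp]
    · rw [Set.disjoint_left]
      rintro _ ⟨rfl, -⟩ ⟨k, -, hk⟩
      exact absurd hk (Nat.succ_ne_zero k)

theorem countP_flatten {α : Type*} (p : α → Bool) (T : List (List α)) :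
    {q : ℕ × ℕ | ∃ x, (T[q.1]?).bind (·[q.2]?) = some x ∧ p x = true}.Finite ∧
      T.flatten.countP p =
        {q : ℕ × ℕ | ∃ x, (T[q.1]?).bind (·[q.2]?) = some x ∧ p x = true}.ncard := by
  induction T with
  | nil => simp
  | cons l T ih =>
    have h : {q : ℕ × ℕ | ∃ x, ((l :: T)[q.1]?).bind (·[q.2]?) = some x ∧ p x = true} =
        Prod.mk 0 '' {k : ℕ | ∃ x, l[k]? = some x ∧ p x = true} ∪ Prod.map Nat.succ id ''
          {q : ℕ × ℕ | ∃ x, (T[q.1]?).bind (·[q.2]?) = some x ∧ p x = true} := by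
      ext ⟨r, k⟩
      cases r <;> simp
    have hf := (countP_row p l).1
    have hi : Function.Injective (Prod.map Nat.succ (id : ℕ → ℕ)) :=
      Nat.succ_injective.prodMap Function.injective_id
    rw [h]
    refine ⟨(hf.image _).union (ih.1.image _), ?_⟩
    rw [Set.ncard_union_eq ?_ (hf.image _) (ih.1.image _),
      Set.ncard_image_of_injective _ (Prod.mk_right_injective 0),
      Set.ncard_image_of_injective _ hi, List.flatten_cons, List.countP_append, ih.2,
      (countP_row p l).2]
    rw [Set.disjoint_left]
    rintro _ ⟨k, -, rfl⟩ ⟨q, -, hq⟩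
    exact absurd (congrArg Prod.fst hq) (Nat.succ_ne_zero _)

/-- `D` is the symmetrized shifted diagram of the strict partition `ν`. -/
structure HasShape (D : ℕ → ℕ → Prop) (ν : List ℕ) : Prop where
  dom : ∀ r k, D r (r + k) ↔ k < ν.getD r 0
  symm : ∀ i j, D i j ↔ D j i
  down : DownCl D
  pos : ∀ m ∈ ν, 0 < m

section

variable {D : ℕ → ℕ → Prop} {d : ℤ →₀ ℕ} {ν : List ℕ} {T T' : STab} {r k i j : ℕ} {x y : Letter}

theorem entry?_add (T : STab) (r k : ℕ) : entry? T r (r + k) = (T[r]?).bind (·[k]?) := by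
  unfold entry? entryG?
  rw [if_pos (Nat.le_add_right r k), Nat.add_sub_cancel_left]

theorem entry?_of_gt (T : STab) (h : j < i) : entry? T i j = none := by
  unfold entry? entryG?
  rw [if_neg (not_le.2 h)]

theorem exists_entry_add : (∃ x, entry? T r (r + k) = some x) ↔ k < (shapeOf T).getD r 0 := by
  rw [entry?_add, shapeOf]
  by_cases h : r < T.length
  · simp [h, List.getElem?_eq_some_iff]
  · simp [not_lt.1 h]

theorem HasShape.exists_entry (hD : HasShape D (shapeOf T)) (i j : ℕ) :
    (∃ x, entry? T i j = some x) ↔ i ≤ j ∧ D i j := by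
  obtain h | h := le_or_gt i j
  · obtain ⟨k, rfl⟩ := Nat.exists_eq_add_of_le h
    rw [exists_entry_add, hD.dom, and_iff_right h]
  · rw [entry?_of_gt T h]
    simp [h.not_ge]

theorem stab_ext (hs : shapeOf T = shapeOf T') (h : ∀ i j, entry? T i j = entry? T' i j) :
    T = T' := by
  have hl : T.length = T'.length := by simpa [shapeOf] using congrArg List.length hs
  refine List.ext_getElem hl fun r h1 h2 => List.ext_getElem? fun k => ?_
  have := h r (r + k)
  rw [entry?_add, entry?_add, List.getElem?_eq_getElem h1, List.getElem?_eq_getElem h2] at this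
  exact this

theorem letter_le_iff (x y : Letter) :
    x ≤ y ↔ x.ceil < y.ceil ∨ x.ceil = y.ceil ∧ (x.primed = true ∨ y.primed = false) := by
  change toLex (x.ceil, !x.primed) ≤ toLex (y.ceil, !y.primed) ↔ _
  rw [Prod.Lex.toLex_le_toLex]
  cases x.primed <;> cases y.primed <;> simp

theorem letter_ext (h : x.ceil = y.ceil) (h' : x.primed = y.primed) : x = y := by
  cases x; cases y; simp_all

theorem isSemistandard_iff (hD : HasShape D (shapeOf T)) : IsSemistandard T ↔
    SemiC (entry? T) ∧ ∀ i j x, entry? T i j = some x → 0 < x.ceil := by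
  have hpos : (∀ x ∈ T.flatten, 0 < x.ceil) ↔ ∀ i j x, entry? T i j = some x → 0 < x.ceil := by
    constructor
    · intro h i j x hx
      obtain hij | hij := le_or_gt i j
      · obtain ⟨k, rfl⟩ := Nat.exists_eq_add_of_le hij
        rw [entry?_add] at hx
        obtain ⟨row, h1, h2⟩ := Option.bind_eq_some_iff.1 hx
        exact h x (List.mem_flatten.2 ⟨row, List.mem_of_getElem? h1, List.mem_of_getElem? h2⟩)
      · rw [entry?_of_gt T hij] at hx
        cases hx
    · intro h x hx
      obtain ⟨row, h1, h2⟩ := List.mem_flatten.1 hx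
      obtain ⟨r, h1⟩ := List.mem_iff_getElem?.1 h1
      obtain ⟨k, h2⟩ := List.mem_iff_getElem?.1 h2
      refine h r (r + k) x ?_
      rw [entry?_add, h1]
      exact h2
  unfold IsSemistandard
  rw [hpos]
  constructor
  · rintro ⟨h0, h1, h2, h3, h4⟩
    have hrow : ∀ i j k x y, entry? T i j = some x → entry? T i (j + k) = some y → x ≤ y := by
      intro i j k
      induction k with
      | zero => intro x y hx hy; rw [add_zero, hx] at hy; exact (Option.some.inj hy).le
      | succ k ih =>
        intro x y hx hy
        have hx' := ((hD.exists_entry _ _).1 ⟨x, hx⟩).1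
        have hy' := ((hD.exists_entry _ _).1 ⟨y, hy⟩).2
        obtain ⟨w, hw⟩ := (hD.exists_entry i (j + k)).2
          ⟨by omega, hD.down _ _ _ _ hy' le_rfl (by omega)⟩
        exact (ih x w hx hw).trans (h1 i (j + k) w y hw hy)
    have hcol : ∀ i j k x y, entry? T i j = some x → entry? T (i + k) j = some y → x ≤ y := by
      intro i j k
      induction k with
      | zero => intro x y hx hy; rw [add_zero, hx] at hy; exact (Option.some.inj hy).le
      | succ k ih =>
        intro x y hx hy
        have hy' := ((hD.exists_entry _ _).1 ⟨y, hy⟩)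
        obtain ⟨w, hw⟩ := (hD.exists_entry (i + k) j).2
          ⟨by omega, hD.down _ _ _ _ hy'.2 (by omega) le_rfl⟩
        exact (ih x w hx hw).trans (h2 (i + k) j w y hw hy)
    refine ⟨⟨?_, ?_⟩, h0⟩
    · intro i j j' x y hj hx hy
      obtain ⟨k, rfl⟩ := Nat.exists_eq_add_of_le hj.le
      have hle := (letter_le_iff _ _).1 (hrow i j k x y hx hy)
      refine hle.imp_right fun hle => ⟨hle.1, ?_⟩
      cases hp : y.primed
      · rfl
      · obtain rfl : x = y := letter_ext hle.1 (by simpa [hp] using hle.2)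
        exact absurd (h3 _ _ _ _ hj hx hy) (by simp [hp])
    · intro i i' j x y hi hx hy
      obtain ⟨k, rfl⟩ := Nat.exists_eq_add_of_le hi.le
      have hle := (letter_le_iff _ _).1 (hcol i j k x y hx hy)
      refine hle.imp_right fun hle => ⟨hle.1, ?_⟩
      cases hp : x.primed
      · obtain rfl : x = y := letter_ext hle.1 (by simpa [hp] using hle.2.symm)
        exact absurd (h4 _ _ _ _ hi hx hy) (by simp [hp])
      · rfl
  · rintro ⟨h, h0⟩
    refine ⟨h0, ?_, ?_, ?_, ?_⟩
    · intro r c x y hx hy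
      rw [letter_le_iff]
      have := h.row r c (c + 1) x y (by omega) hx hy
      tauto
    · intro r c x y hx hy
      rw [letter_le_iff]
      have := h.col r (r + 1) c x y (by omega) hx hy
      tauto
    · intro r c c' x hc hx hy
      exact ((h.row r c c' x x hc hx hy).resolve_left (lt_irrefl _)).2
    · intro r r' c x hc hx hy
      exact ((h.col r r' c x x hc hx hy).resolve_left (lt_irrefl _)).2

theorem countP_entry (T : STab) (b : ℤ) : T.flatten.countP (fun x => decide (x.ceil = b)) =
    {q : ℕ × ℕ | ∃ x, entry? T q.1 q.2 = some x ∧ x.ceil = b}.ncard := by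
  rw [(countP_flatten _ T).2]
  have hi : Function.Injective fun q : ℕ × ℕ => (q.1, q.1 + q.2) := by
    rintro ⟨a, b⟩ ⟨a', b'⟩ h
    simp only [Prod.mk.injEq] at h ⊢
    omega
  rw [← Set.ncard_image_of_injective _ hi]
  congr 1
  ext ⟨i, j⟩
  simp only [Set.mem_image, Set.mem_ofPred_eq, decide_eq_true_eq, Prod.mk.injEq, Prod.exists]
  constructor
  · rintro ⟨r, k, ⟨x, hx, hb⟩, rfl, rfl⟩
    exact ⟨x, by rw [entry?_add]; exact hx, hb⟩
  · rintro ⟨x, hx, hb⟩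
    obtain hij | hij := le_or_gt i j
    · obtain ⟨k, rfl⟩ := Nat.exists_eq_add_of_le hij
      rw [entry?_add] at hx
      exact ⟨i, k, ⟨x, hx, hb⟩, rfl, rfl⟩
    · rw [entry?_of_gt T hij] at hx
      cases hx

/-- The tableau of shape `ν` with the entries of `G`. -/
def tabOf (ν : List ℕ) (G : ℕ → ℕ → Option Letter) : STab :=
  (List.range ν.length).map fun r =>
    (List.range (ν.getD r 0)).map fun k => (G r (r + k)).getD ⟨0, false⟩

theorem shapeOf_tabOf (ν : List ℕ) (G : ℕ → ℕ → Option Letter) : shapeOf (tabOf ν G) = ν := by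
  refine List.ext_getElem (by simp [shapeOf, tabOf]) fun r h1 h2 => ?_
  simp [shapeOf, tabOf, h2]

theorem entry?_tabOf (hD : HasShape D ν) {G : ℕ → ℕ → Option Letter}
    (hG : ∀ i j, (∃ x, G i j = some x) ↔ i ≤ j ∧ D i j) : entry? (tabOf ν G) = G := by
  funext i j
  have hD' : HasShape D (shapeOf (tabOf ν G)) := by rwa [shapeOf_tabOf]
  by_cases h : i ≤ j ∧ D i j
  · obtain ⟨x, hx⟩ := (hG i j).2 h
    obtain ⟨hij, hd⟩ := h
    obtain ⟨k, rfl⟩ := Nat.exists_eq_add_of_le hij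
    rw [hD.dom] at hd
    have hr : i < ν.length := by
      by_contra hc
      simp [not_lt.1 hc] at hd
    rw [entry?_add, hx]
    simp only [List.getD_eq_getElem?_getD, List.getElem?_eq_getElem hr, Option.getD_some] at hd
    simp [tabOf, hr, hd, hx]
  · have h1 := mt (hG i j).1 h
    have h2 := mt (hD'.exists_entry i j).1 h
    rw [Option.eq_none_iff_forall_ne_some.2 fun x h => h1 ⟨x, h⟩,
      Option.eq_none_iff_forall_ne_some.2 fun x h => h2 ⟨x, h⟩]

theorem HasShape.ncard_semi (hD : HasShape D ν) (d : ℤ →₀ ℕ) :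
    {T : STab | shapeOf T = ν ∧ IsSemistandard T ∧
      ∀ i : ℤ, d i = T.flatten.countP (fun x => decide (x.ceil = i))}.ncard =
    {G | SemiF D d G}.ncard := by
  refine Set.ncard_congr (fun T _ => entry? T) ?_ ?_ ?_
  · rintro T ⟨rfl, h1, h2⟩
    rw [isSemistandard_iff hD] at h1
    exact ⟨hD.exists_entry, h1.1, h1.2, fun b => by rw [h2, countP_entry]⟩
  · rintro T T' ⟨h1, -⟩ ⟨h2, -⟩ h
    exact stab_ext (h1.trans h2.symm) fun i j => congrFun (congrFun h i) j
  · intro G hG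
    have he := entry?_tabOf hD hG.dom
    refine ⟨tabOf ν G, ⟨shapeOf_tabOf ν G, ?_, ?_⟩, he⟩
    · rw [isSemistandard_iff (D := D) (by rwa [shapeOf_tabOf]), he]
      exact ⟨hG.semi, hG.pos⟩
    · intro b
      rw [countP_entry, he]
      exact hG.cont b

theorem HasShape.strict (hD : HasShape D ν) : IsStrictPartition ν := by
  refine ⟨?_, hD.pos⟩
  refine List.isChain_iff_getElem.2 fun r hr => ?_
  have h1 := hD.pos _ (List.getElem_mem hr)
  obtain ⟨k, hk⟩ := Nat.exists_eq_add_of_lt h1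
  have h2 : D (r + 1) (r + 1 + k) := by
    rw [hD.dom, List.getD_eq_getElem?_getD, List.getElem?_eq_getElem hr, Option.getD_some]
    omega
  have h3 := hD.down _ _ r (r + (k + 1)) h2 (by omega) (by omega)
  have hr' : r < ν.length := by omega
  rw [hD.dom, List.getD_eq_getElem?_getD, List.getElem?_eq_getElem hr', Option.getD_some] at h3
  omega

end

section

variable {T : STab} {S : ℕ → ℕ → WithTop ℤ} {B : ℕ → ℕ → Bool} {z : PZ} {ν : List ℕ} {m : ℕ}

theorem Inc.downCl (h : Inc m S) : DownCl (dm S) := by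
  intro i j i' j' hS hi hj
  exact ((h.col_le j' hi).trans (h.row_le i hj)).trans_lt hS

theorem Enc.hasShape (h : Enc T S B) (hS : Inc m S) : HasShape (dm S) (shapeOf T) := by
  refine ⟨fun r k => ?_, fun i j => ?_, hS.downCl, ?_⟩
  · rw [← exists_entry_add, h.entry _ _ (Nat.le_add_right r k), ← Option.ne_none_iff_exists',
      Ne, dec_eq_none]
    exact lt_top_iff_ne_top
  · unfold dm
    rw [hS.symm]
  · intro a ha
    obtain ⟨row, hrow, rfl⟩ := List.mem_map.1 ha
    refine List.length_pos_iff.2 ?_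
    rintro rfl
    exact h.nil hrow

theorem HasShape.schurQ (h : HasShape (dm S) ν) (hS : Inc m S) (d : ℤ →₀ ℕ) :
    SchurQ ν d = (CB (dm S) d).ncard * 2 ^ (dgS S).ncard := by
  unfold SchurQ
  rw [h.ncard_semi, ncard_semiF (n := m) h.symm h.down, dgS]
  · push_cast
    rfl
  · intro i j hij
    by_contra hc
    refine ne_of_lt (show S i j < ⊤ from hij) ?_
    rw [not_and_or, not_lt, not_lt] at hc
    obtain hc | hc := hc
    · exact hS.bd' hc
    · exact hS.bd _ _ hc

theorem exists_Enc (hz : IncOf z S) (hB : B ∈ Fib S z) : ∃ T, Enc T S B := by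
  obtain ⟨l, β, hr, hl⟩ := mem_Fib_insertion hz hB
  exact ⟨_, hl.enc hr⟩

theorem PInc.wb (h : PInc z S B) : WB S B := by
  obtain ⟨m, -, h, -⟩ := h
  exact h

theorem IncOf.symm (h : IncOf z S) (i j : ℕ) : S i j = S j i := by
  obtain ⟨m, h, -⟩ := h
  exact h.symm i j

theorem sum_schurQ (hf : (PEG '' RinvPlus z).Finite) (d : ℤ →₀ ℕ) :
    ∑ T ∈ hf.toFinset, SchurQ (shapeOf T) d = 2 ^ kap z * (FB z d).ncard := by
  classical
  let g : STab → ℕ → ℕ → WithTop ℤ := fun T =>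
    if h : ∃ S B, IncOf z S ∧ B ∈ Fib S z ∧ Enc T S B then h.choose else fun _ _ => ⊤
  have hg : ∀ T S B, IncOf z S → B ∈ Fib S z → Enc T S B → g T = S := by
    intro T S B h1 h2 h3
    have h : ∃ S B, IncOf z S ∧ B ∈ Fib S z ∧ Enc T S B := ⟨S, B, h1, h2, h3⟩
    have e : g T = h.choose := dif_pos h
    obtain ⟨B', h4, h5, h6⟩ := h.choose_spec
    rw [e]
    exact (h6.arr_eq h3 h4.symm h1.symm h5.wb h2.wb).1
  have hm : ∀ T ∈ hf.toFinset, g T ∈ (finite_IncOf z).toFinset := by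
    intro T hT
    rw [Set.Finite.mem_toFinset, mem_PEG_image] at hT
    obtain ⟨S, B, h1, h2, h3⟩ := hT
    rw [hg T S B h1 h2 h3, Set.Finite.mem_toFinset]
    exact h1
  rw [← Finset.sum_fiberwise_of_maps_to hm, ncard_FB, Nat.cast_sum, Finset.mul_sum]
  refine Finset.sum_congr rfl fun S hS => ?_
  rw [Set.Finite.mem_toFinset] at hS
  change IncOf z S at hS
  obtain ⟨n, hn, -⟩ := id hS
  have h1 : ∀ T ∈ hf.toFinset.filter (g · = S),
      SchurQ (shapeOf T) d = (CB (dm S) d).ncard * 2 ^ (dgS S).ncard := by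
    intro T hT
    rw [Finset.mem_filter, Set.Finite.mem_toFinset, mem_PEG_image] at hT
    obtain ⟨⟨S', B, h1, h2, h3⟩, h4⟩ := hT
    obtain rfl := (hg T S' B h1 h2 h3).symm.trans h4
    exact (h3.hasShape hn).schurQ hn d
  have h2 : (hf.toFinset.filter (g · = S)).card = (Fib S z).ncard := by
    rw [← Set.ncard_coe_finset]
    symm
    refine Set.ncard_congr (fun B hB => (exists_Enc hS hB).choose) ?_ ?_ ?_
    · intro B hB
      have hE := (exists_Enc hS hB).choose_spec
      rw [Finset.coe_filter, Set.mem_ofPred_eq, Set.Finite.mem_toFinset, mem_PEG_image]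
      exact ⟨⟨S, B, hS, hB, hE⟩, hg _ S B hS hB hE⟩
    · intro B B' hB hB' h
      have hE := (exists_Enc hS hB).choose_spec
      rw [h] at hE
      exact (hE.arr_eq (exists_Enc hS hB').choose_spec hS.symm hS.symm
        (show PInc z S B from hB).wb (show PInc z S B' from hB').wb).2
    · intro T hT
      rw [Finset.coe_filter, Set.mem_ofPred_eq, Set.Finite.mem_toFinset, mem_PEG_image] at hT
      obtain ⟨⟨S', B, h5, h6, h7⟩, h4⟩ := hT
      obtain rfl := (hg T S' B h5 h6 h7).symm.trans h4
      exact ⟨B, h6, enc_ext (exists_Enc h5 h6).choose_spec h7⟩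
  rw [Finset.sum_congr rfl h1, Finset.sum_const, h2, nsmul_eq_mul]
  have h3 := congrArg (Nat.cast (R := ℤ)) (ncard_Fib hS)
  push_cast at h3
  rw [← h3]
  ring

theorem finsum_schurQ (hf : (PEG '' RinvPlus z).Finite) :
    ∑ᶠ ν ∈ {ν : List ℕ | IsStrictPartition ν},
      ({T | T ∈ PEG '' RinvPlus z ∧ shapeOf T = ν} : Set STab).ncard • SchurQ ν =
    ∑ T ∈ hf.toFinset, SchurQ (shapeOf T) := by
  classical
  have hc : ∀ ν, ({T | T ∈ PEG '' RinvPlus z ∧ shapeOf T = ν} : Set STab).ncard =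
      (hf.toFinset.filter (shapeOf · = ν)).card := by
    intro ν
    rw [← Set.ncard_coe_finset]
    congr 1
    ext T
    simp
  simp only [hc]
  rw [Finset.sum_comp SchurQ shapeOf]
  refine finsum_mem_eq_sum_of_inter_support_eq _ ?_
  ext ν
  simp only [Set.mem_inter_iff, Set.mem_ofPred_eq, Finset.coe_image, Set.mem_image,
    Finset.mem_coe, Set.Finite.mem_toFinset, and_congr_left_iff, Function.mem_support]
  intro h0
  constructor
  · intro _
    by_contra hn
    refine h0 ?_
    rw [Finset.filter_false_of_mem, Finset.card_empty, zero_smul]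
    intro T hT h
    rw [Set.Finite.mem_toFinset] at hT
    exact hn ⟨T, hT, h⟩
  · rintro ⟨T, hT, rfl⟩
    change T ∈ PEG '' RinvPlus z at hT
    rw [mem_PEG_image] at hT
    obtain ⟨S, B, ⟨m, hm, -⟩, -, h⟩ := hT
    exact (h.hasShape hm).strict

end

/-- The permutation `y` preserves the integers up to `m`, acts on them as `y₁`, and acts on the
others as the shift of `y₂`. -/
structure Split (m : ℤ) (y y₁ y₂ : PZ) : Prop where
  lo : ∀ x, x ≤ m → y x = y₁ x ∧ y₁ x ≤ m
  lo' : ∀ x, m < x → y₁ x = x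
  hi : ∀ x, 0 < x → y (m + x) = m + y₂ x ∧ 0 < y₂ x
  hi' : ∀ x, x ≤ 0 → y₂ x = x

section

variable {m u : ℤ} {y y₁ y₂ z z₁ z₂ : PZ}

theorem Split.hi_sub (h : Split m y y₁ y₂) {x : ℤ} (hx : m < x) :
    y x = m + y₂ (x - m) ∧ 0 < y₂ (x - m) := by
  have := h.hi (x - m) (by omega)
  rwa [add_sub_cancel] at this

theorem Split.unique (h : Split m z y₁ y₂) (h' : Split m z z₁ z₂) : y₁ = z₁ ∧ y₂ = z₂ := by
  constructor <;> ext x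
  · by_cases hx : x ≤ m
    · rw [← (h.lo x hx).1, (h'.lo x hx).1]
    · rw [h.lo' x (by omega), h'.lo' x (by omega)]
  · by_cases hx : x ≤ 0
    · rw [h.hi' x hx, h'.hi' x hx]
    · have h1 := (h.hi x (by omega)).1
      have h2 := (h'.hi x (by omega)).1
      omega

theorem Split.unique' (h : Split m y y₁ y₂) (h' : Split m z y₁ y₂) : y = z := by
  ext x
  by_cases hx : x ≤ m
  · rw [(h.lo x hx).1, (h'.lo x hx).1]
  · rw [(h.hi_sub (not_le.1 hx)).1, (h'.hi_sub (not_le.1 hx)).1]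

theorem Split.one (m : ℤ) : Split m 1 1 1 := by
  constructor <;> simp

theorem Split.mul_self' (h : Split m y y₁ y₂) (h1 : y₁ * y₁ = 1) (h2 : y₂ * y₂ = 1) :
    y * y = 1 := by
  ext x
  rw [Equiv.Perm.mul_apply, Equiv.Perm.one_apply]
  by_cases hx : x ≤ m
  · have h3 := h.lo x hx
    rw [h3.1, (h.lo _ h3.2).1, apply_self h1]
  · have h3 := h.hi_sub (not_le.1 hx)
    rw [h3.1, (h.hi _ h3.2).1, apply_self h2]
    omega

theorem act_apply_of_lt (h : y u < y (u + 1)) (t : ℤ) : act y u t =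
    if y u = u ∧ y (u + 1) = u + 1 then y (sPerm u t) else sPerm u (y (sPerm u t)) := by
  split_ifs with h'
  · exact act_apply_comm h'.1 h'.2 t
  · exact act_apply_conj h h' t

theorem sPerm_le {t : ℤ} (h : u ≠ m) : sPerm u t ≤ m ↔ t ≤ m := by
  rw [sPerm_apply]
  split_ifs <;> omega

theorem sPerm_of_ne {t : ℤ} (h : t ≠ u) (h' : t ≠ u + 1) : sPerm u t = t := by
  rw [sPerm_apply, if_neg h, if_neg h']

theorem Split.lo_lt (h : Split m y y₁ y₂) (hu : u < m) : y u < y (u + 1) ↔ y₁ u < y₁ (u + 1) := by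
  rw [(h.lo u (by omega)).1, (h.lo (u + 1) (by omega)).1]

theorem Split.hi_lt (h : Split m y y₁ y₂) (hu : m < u) :
    y u < y (u + 1) ↔ y₂ (u - m) < y₂ (u - m + 1) := by
  rw [(h.hi_sub hu).1, (h.hi_sub (show m < u + 1 by omega)).1,
    show u + 1 - m = u - m + 1 by ring]
  omega

theorem Split.act_lo (h : Split m y y₁ y₂) (hu : u < m) (hlt : y u < y (u + 1)) :
    Split m (act y u) (act y₁ u) y₂ := by
  have hlt' := (h.lo_lt hu).1 hlt
  have e1 := (h.lo u (by omega)).1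
  have e2 := (h.lo (u + 1) (by omega)).1
  refine ⟨fun x hx => ?_, fun x hx => ?_, fun x hx => ?_, h.hi'⟩
  · have hs : sPerm u x ≤ m := (sPerm_le hu.ne).2 hx
    obtain ⟨h1, h2⟩ := h.lo _ hs
    rw [act_apply_of_lt hlt, act_apply_of_lt hlt', e1, e2, h1]
    refine ⟨rfl, ?_⟩
    split_ifs
    · exact h2
    · rwa [sPerm_le hu.ne]
  · have hs : sPerm u x = x := sPerm_of_ne (by omega) (by omega)
    rw [act_apply_of_lt hlt', hs, h.lo' x hx, hs, ite_self]
  · have hs : sPerm u (m + x) = m + x := sPerm_of_ne (by omega) (by omega)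
    obtain ⟨h1, h2⟩ := h.hi x hx
    have hs' : sPerm u (m + y₂ x) = m + y₂ x := sPerm_of_ne (by omega) (by omega)
    rw [act_apply_of_lt hlt, hs, h1, hs', ite_self]
    exact ⟨rfl, h2⟩

theorem Split.act_hi (h : Split m y y₁ y₂) (hu : m < u) (hlt : y u < y (u + 1)) :
    Split m (act y u) y₁ (act y₂ (u - m)) := by
  have hlt' := (h.hi_lt hu).1 hlt
  have hsh : ∀ t, sPerm u (m + t) = m + sPerm (u - m) t := by
    intro t
    simp only [sPerm_apply]
    split_ifs <;> omega
  refine ⟨fun x hx => ?_, h.lo', fun x hx => ?_, fun x hx => ?_⟩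
  · have hs : sPerm u x = x := sPerm_of_ne (by omega) (by omega)
    obtain ⟨h1, h2⟩ := h.lo x hx
    have hs' : sPerm u (y₁ x) = y₁ x := sPerm_of_ne (by omega) (by omega)
    rw [act_apply_of_lt hlt, hs, h1, hs', ite_self]
    exact ⟨rfl, h2⟩
  · have hs : 0 < sPerm (u - m) x := by
      rw [sPerm_apply]
      split_ifs <;> omega
    obtain ⟨h1, h2⟩ := h.hi _ hs
    have h3 : (y u = u ∧ y (u + 1) = u + 1) ↔
        (y₂ (u - m) = u - m ∧ y₂ (u - m + 1) = u - m + 1) := by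
      rw [(h.hi_sub hu).1, (h.hi_sub (show m < u + 1 by omega)).1,
        show u + 1 - m = u - m + 1 by ring]
      omega
    rw [act_apply_of_lt hlt, act_apply_of_lt hlt', hsh, h1, hsh]
    simp only [h3]
    split_ifs
    · exact ⟨rfl, h2⟩
    · refine ⟨rfl, ?_⟩
      rw [sPerm_apply]
      split_ifs <;> omega
  · have hs : sPerm (u - m) x = x := sPerm_of_ne (by omega) (by omega)
    rw [act_apply_of_lt hlt', hs, h.hi' x hx, hs, ite_self]

theorem Split.le_iff (h : Split m y y₁ y₂) (x : ℤ) : y x ≤ m ↔ x ≤ m := by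
  by_cases hx : x ≤ m
  · have := h.lo x hx
    omega
  · have := h.hi_sub (not_le.1 hx)
    omega

theorem le_iff_of_act (hlt : y u < y (u + 1)) (h : ∀ x, act y u x ≤ m ↔ x ≤ m) :
    u ≠ m ∧ ∀ x, y x ≤ m ↔ x ≤ m := by
  have hu : u ≠ m := by
    rintro rfl
    have h1 := (h u).2 le_rfl
    have h2 := mt (h (u + 1)).1 (by omega)
    rw [act_apply_of_lt hlt] at h1 h2
    have e1 : sPerm u u = u + 1 := by simp [sPerm]
    have e2 : sPerm u (u + 1) = u := by simp [sPerm]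
    rw [e1] at h1
    rw [e2] at h2
    split_ifs at h1 h2 with hc
    · omega
    · rw [sPerm_apply] at h1 h2
      split_ifs at h1 h2 <;> omega
  refine ⟨hu, fun x => ?_⟩
  have h1 := h (sPerm u x)
  rw [act_apply_of_lt hlt, sPerm_sPerm, sPerm_le hu] at h1
  split_ifs at h1
  · exact h1
  · rwa [sPerm_le hu] at h1

theorem exists_split (h : ∀ x, y x ≤ m ↔ x ≤ m) : ∃ y₁ y₂, Split m y y₁ y₂ := by
  have h' : ∀ x, m < y x ↔ m < x := fun x => by rw [← not_le, h, not_le]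
  let σ : PZ := Equiv.Perm.ofSubtype (y.subtypePerm (p := fun x => m < x) h')
  have hσ : ∀ x, m < x → σ x = y x := fun x hx => by
    rw [Equiv.Perm.ofSubtype_apply_of_mem (p := fun x => m < x) _ hx]
    rfl
  refine ⟨Equiv.Perm.ofSubtype (y.subtypePerm (p := fun x => x ≤ m) h),
    (Equiv.addLeft m).symm.permCongr σ, fun x hx => ?_, fun x hx => ?_, fun x hx => ?_,
    fun x hx => ?_⟩
  · rw [Equiv.Perm.ofSubtype_apply_of_mem (p := fun x => x ≤ m) _ hx]
    exact ⟨rfl, (h x).2 hx⟩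
  · exact Equiv.Perm.ofSubtype_apply_of_not_mem (p := fun x => x ≤ m) _ (not_le.2 hx)
  · have h1 := hσ (m + x) (by omega)
    have h2 := (h' (m + x)).2 (by omega)
    simp only [Equiv.permCongr_apply, Equiv.coe_addLeft, Equiv.addLeft_symm, neg_neg, h1]
    omega
  · have h1 : σ (m + x) = m + x :=
      Equiv.Perm.ofSubtype_apply_of_not_mem (p := fun x => m < x) _ (by omega)
    simp [h1]

theorem runR_cons_eq_some {l : List ℤ} : runR (u :: l) = some z ↔
    ∃ y, runR l = some y ∧ y u < y (u + 1) ∧ act y u = z := by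
  rw [runR_eq, List.reverse_cons, List.map_append, List.map_singleton,
    run_append_singleton_eq_some, ← runR_eq]
  refine exists_congr fun y => and_congr_right fun h => ?_
  rw [runR_eq] at h
  have hy := run_mul_self h
  simp [Ok, toL, hy]

/-- The part of a biword with letters less than `m`. -/
def biLo (m : ℤ) (w : List (ℤ × ℤ)) : List (ℤ × ℤ) := w.filter fun x => x.2 < m

/-- The shifted part of a biword with letters at least `m`. -/
def biHi (m : ℤ) (w : List (ℤ × ℤ)) : List (ℤ × ℤ) :=
  (w.filter fun x => ¬x.2 < m).map fun x => (x.1, x.2 - m)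

theorem split_mul (h1 : ∀ x, m < x → y₁ x = x) (h2 : ∀ x, x ≤ 0 → y₂ x = x) :
    Split m (y₁ * (Equiv.addLeft m).permCongr y₂) y₁ y₂ := by
  have h3 : ∀ x, x ≤ m → y₁ x ≤ m := fun x hx => by
    by_contra! h
    have := y₁.injective (h1 _ h)
    omega
  have h4 : ∀ x, 0 < x → 0 < y₂ x := fun x hx => by
    by_contra! h
    have := y₂.injective (h2 _ h)
    omega
  refine ⟨fun x hx => ⟨?_, h3 x hx⟩, h1, fun x hx => ⟨?_, h4 x hx⟩, h2⟩
  · have h5 : y₂ (-m + x) = -m + x := h2 _ (by omega)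
    simp [h5]
  · have h5 := h1 (m + y₂ x) (by linarith [h4 x hx])
    simp [h5]

theorem fix_of_act {x : ℤ} (hlt : y u < y (u + 1)) (h : act y u x = x) (h1 : x ≠ u)
    (h2 : x ≠ u + 1) : y x = x := by
  have hs : sPerm u x = x := sPerm_of_ne h1 h2
  rw [act_apply_of_lt hlt, hs] at h
  split_ifs at h
  · exact h
  · have h3 := congrArg (sPerm u) h
    rwa [sPerm_sPerm, hs] at h3

theorem runR_split {w : List (ℤ × ℤ)} (h : Split m z z₁ z₂) : runR (w.map Prod.snd) = some z ↔
    (∀ x ∈ w, x.2 ≠ m) ∧ runR ((biLo m w).map Prod.snd) = some z₁ ∧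
      runR ((biHi m w).map Prod.snd) = some z₂ := by
  induction w generalizing z z₁ z₂ with
  | nil =>
    simp only [List.map_nil, runR, biLo, biHi, List.filter_nil, Option.some.injEq]
    constructor
    · rintro rfl
      exact ⟨by simp, (Split.one m).unique h⟩
    · rintro ⟨-, rfl, rfl⟩
      exact (Split.one m).unique' h
  | cons x w ih =>
    obtain ⟨b, u⟩ := x
    rw [List.map_cons, runR_cons_eq_some]
    obtain hu | rfl | hu := lt_trichotomy u m
    · have e1 : biLo m ((b, u) :: w) = (b, u) :: biLo m w := by simp [biLo, hu]
      have e2 : biHi m ((b, u) :: w) = biHi m w := by simp [biHi, hu]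
      rw [e1, e2, List.map_cons, runR_cons_eq_some]
      constructor
      · rintro ⟨y, hy, hlt, rfl⟩
        obtain ⟨y₁, y₂, hs⟩ := exists_split (le_iff_of_act hlt h.le_iff).2
        obtain ⟨rfl, rfl⟩ := (hs.act_lo hu hlt).unique h
        obtain ⟨h1, h2, h3⟩ := (ih hs).1 hy
        exact ⟨List.forall_mem_cons.2 ⟨hu.ne, h1⟩, ⟨y₁, h2, (hs.lo_lt hu).1 hlt, rfl⟩, h3⟩
      · rintro ⟨h1, ⟨y₁, h2, hlt, rfl⟩, h3⟩
        simp only at hlt h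
        have hs := split_mul (fun x hx => fix_of_act hlt (h.lo' x hx) (by omega) (by omega)) h.hi'
        have hlt' := (hs.lo_lt hu).2 hlt
        exact ⟨_, (ih hs).2 ⟨fun x hx => h1 x (List.mem_cons_of_mem _ hx), h2, h3⟩, hlt',
          (hs.act_lo hu hlt').unique' h⟩
    · constructor
      · rintro ⟨y, -, hlt, rfl⟩
        exact absurd rfl (le_iff_of_act hlt h.le_iff).1
      · rintro ⟨h1, -⟩
        exact absurd rfl (h1 _ List.mem_cons_self)
    · have e1 : biLo m ((b, u) :: w) = biLo m w := by simp [biLo, hu.le]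
      have e2 : biHi m ((b, u) :: w) = (b, u - m) :: biHi m w := by simp [biHi, hu.le]
      rw [e1, e2, List.map_cons, runR_cons_eq_some]
      constructor
      · rintro ⟨y, hy, hlt, rfl⟩
        obtain ⟨y₁, y₂, hs⟩ := exists_split (le_iff_of_act hlt h.le_iff).2
        obtain ⟨rfl, rfl⟩ := (hs.act_hi hu hlt).unique h
        obtain ⟨h1, h2, h3⟩ := (ih hs).1 hy
        exact ⟨List.forall_mem_cons.2 ⟨hu.ne', h1⟩, h2, y₂, h3, (hs.hi_lt hu).1 hlt, rfl⟩
      · rintro ⟨h1, h2, y₂, h3, hlt, rfl⟩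
        simp only at hlt h
        have hs := split_mul h.lo'
          (fun x hx => fix_of_act hlt (h.hi' x hx) (by omega) (by omega))
        have hlt' := (hs.hi_lt hu).2 hlt
        exact ⟨_, (ih hs).2 ⟨fun x hx => h1 x (List.mem_cons_of_mem _ hx), h2, h3⟩, hlt',
          (hs.act_hi hu hlt').unique' h⟩

end

section

variable {m : ℤ} {z z₁ z₂ : PZ} {d d₁ d₂ : ℤ →₀ ℕ} {w w' : List (ℤ × ℤ)} {x y t : ℤ × ℤ}

theorem BRel.trans (h : BRel x y) (h' : BRel y t) : BRel x t := by
  unfold BRel at *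
  omega

theorem BRel.asymm (h : BRel x y) (h' : BRel y x) : False := by
  unfold BRel at *
  omega

theorem isChain_BRel : w.IsChain BRel ↔ w.Pairwise BRel := by
  have : IsTrans (ℤ × ℤ) BRel := ⟨fun _ _ _ => BRel.trans⟩
  exact List.isChain_iff_pairwise

theorem BRel.total (h : x ≠ y) : BRel x y ∨ BRel y x := by
  obtain ⟨a, b⟩ := x
  obtain ⟨c, e⟩ := y
  simp only [ne_eq, Prod.mk.injEq] at h
  unfold BRel
  simp only
  omega

/-- The content of a list. -/
noncomputable def ct (l : List ℤ) : ℤ →₀ ℕ := Multiset.toFinsupp (l : Multiset ℤ)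

theorem hasContent_iff {l : List ℤ} : HasContent d l ↔ (∀ b ∈ l, 0 < b) ∧ ct l = d := by
  refine and_congr_right fun _ => ?_
  rw [DFunLike.ext_iff]
  refine forall_congr' fun i => ?_
  rw [eq_comm, ct, Multiset.toFinsupp_apply, Multiset.coe_count]

theorem perm_bi (m : ℤ) (w : List (ℤ × ℤ)) :
    (w.map Prod.fst).Perm ((biLo m w).map Prod.fst ++ (biHi m w).map Prod.fst) := by
  have h := (List.filter_append_perm (fun x : ℤ × ℤ => decide (x.2 < m)) w).symm.map Prod.fst
  rw [List.map_append] at h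
  rw [biHi, List.map_map]
  simpa only [biLo, Bool.decide_eq_false, decide_not, Function.comp_def] using h

theorem ct_bi (m : ℤ) (w : List (ℤ × ℤ)) :
    ct (w.map Prod.fst) = ct ((biLo m w).map Prod.fst) + ct ((biHi m w).map Prod.fst) := by
  rw [ct, ct, ct, ← map_add, Multiset.coe_add, Multiset.coe_eq_coe.2 (perm_bi m w)]

theorem mem_biLo : x ∈ biLo m w ↔ x ∈ w ∧ x.2 < m := by
  simp [biLo]

theorem mem_biHi : x ∈ biHi m w ↔ (x.1, m + x.2) ∈ w ∧ 0 ≤ x.2 := by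
  obtain ⟨a, b⟩ := x
  simp only [biHi, List.mem_map, List.mem_filter, decide_eq_true_eq, Prod.mk.injEq, Prod.exists]
  constructor
  · rintro ⟨a', b', ⟨h1, h2⟩, rfl, rfl⟩
    exact ⟨by rwa [add_sub_cancel], by omega⟩
  · rintro ⟨h1, h2⟩
    exact ⟨a, m + b, ⟨h1, by omega⟩, rfl, by omega⟩

theorem pairwise_biLo (h : w.Pairwise BRel) : (biLo m w).Pairwise BRel := h.filter _

theorem pairwise_biHi (h : w.Pairwise BRel) : (biHi m w).Pairwise BRel := by
  rw [biHi, List.pairwise_map]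
  refine (h.filter _).imp fun {x y} h => ?_
  unfold BRel at *
  simp only
  omega

theorem mem_FB_split (h : Split m z z₁ z₂) : w ∈ FB z d ∧
    (ct ((biLo m w).map Prod.fst), ct ((biHi m w).map Prod.fst)) = (d₁, d₂) ↔
    w.Pairwise BRel ∧ (∀ x ∈ w, x.2 ≠ m) ∧ biLo m w ∈ FB z₁ d₁ ∧ biHi m w ∈ FB z₂ d₂ ∧
      d₁ + d₂ = d := by
  simp only [FB, Set.mem_ofPred_eq, isChain_BRel, runR_split h, hasContent_iff, Prod.mk.injEq]
  have h1 : (∀ b ∈ w.map Prod.fst, 0 < b) ↔ (∀ b ∈ (biLo m w).map Prod.fst, 0 < b) ∧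
      ∀ b ∈ (biHi m w).map Prod.fst, 0 < b := by
    simp only [(perm_bi m w).mem_iff, List.mem_append, or_imp, forall_and]
  rw [h1, ct_bi m]
  constructor
  · rintro ⟨⟨h2, ⟨h3, h4, h5⟩, ⟨h6, h7⟩, rfl⟩, rfl, rfl⟩
    exact ⟨h2, h3, ⟨pairwise_biLo h2, h4, h6, rfl⟩, ⟨pairwise_biHi h2, h5, h7, rfl⟩, rfl⟩
  · rintro ⟨h2, h3, ⟨-, h4, h6, rfl⟩, ⟨-, h5, h7, rfl⟩, rfl⟩
    exact ⟨⟨h2, ⟨h3, h4, h5⟩, ⟨h6, h7⟩, rfl⟩, rfl, rfl⟩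

theorem bi_inj (h : w.Pairwise BRel) (h' : w'.Pairwise BRel) (h1 : biLo m w = biLo m w')
    (h2 : biHi m w = biHi m w') : w = w' := by
  refine sorted_unique (fun _ _ => BRel.asymm) h h' fun x => ?_
  by_cases hx : x.2 < m
  · have : x ∈ biLo m w ↔ x ∈ biLo m w' := by rw [h1]
    simpa [mem_biLo, hx] using this
  · have : (x.1, x.2 - m) ∈ biHi m w ↔ (x.1, x.2 - m) ∈ biHi m w' := by rw [h2]
    simpa [mem_biHi, not_lt.1 hx] using this

theorem exists_bi (h : w.Pairwise BRel) (h' : w'.Pairwise BRel) (h1 : ∀ x ∈ w, x.2 < m)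
    (h2 : ∀ x ∈ w', 0 < x.2) : ∃ v : List (ℤ × ℤ), v.Pairwise BRel ∧ (∀ x ∈ v, x.2 ≠ m) ∧
      biLo m v = w ∧ biHi m v = w' := by
  classical
  obtain ⟨v, hv, hm⟩ := exists_sorted (R := BRel) (fun _ _ _ => BRel.trans)
    (w ++ w'.map fun x => (x.1, m + x.2)).toFinset (fun _ _ _ _ => BRel.total)
  simp only [List.mem_toFinset, List.mem_append, List.mem_map] at hm
  refine ⟨v, hv, fun x hx => ?_, ?_, ?_⟩
  · obtain hx | ⟨y, hy, rfl⟩ := (hm x).1 hx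
    · exact (h1 x hx).ne
    · have := h2 y hy
      simp only
      omega
  · refine sorted_unique (fun _ _ => BRel.asymm) (pairwise_biLo hv) h fun x => ?_
    rw [mem_biLo, hm]
    constructor
    · rintro ⟨hx | ⟨x, hx, rfl⟩, hlt⟩
      · exact hx
      · have := h2 x hx
        simp only at hlt
        omega
    · exact fun hx => ⟨.inl hx, h1 x hx⟩
  · refine sorted_unique (fun _ _ => BRel.asymm) (pairwise_biHi hv) h' fun x => ?_
    rw [mem_biHi, hm]
    constructor
    · rintro ⟨hx | ⟨⟨a, b⟩, hx, he⟩, hle⟩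
      · have := h1 _ hx
        simp only at this
        omega
      · obtain ⟨a', b'⟩ := x
        simp only [Prod.mk.injEq, add_right_inj] at he
        obtain ⟨rfl, rfl⟩ := he
        exact hx
    · exact fun hx => ⟨.inr ⟨x, hx, rfl⟩, (h2 x hx).le⟩

theorem ncard_FB_split (h : Split m z z₁ z₂) (h1 : ∀ l, runR l = some z₁ → ∀ u ∈ l, u < m)
    (h2 : ∀ l, runR l = some z₂ → ∀ u ∈ l, 0 < u) (d : ℤ →₀ ℕ) :
    (FB z d).ncard = ∑ p ∈ Finset.HasAntidiagonal.antidiagonal d, (FB z₁ p.1).ncard * (FB z₂ p.2).ncard := by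
  rw [ncard_fiberwise (FB_finite z d) (Finset.HasAntidiagonal.antidiagonal d)
    (fun w => (ct ((biLo m w).map Prod.fst), ct ((biHi m w).map Prod.fst)))]
  · refine Finset.sum_congr rfl fun p hp => ?_
    obtain ⟨d₁, d₂⟩ := p
    rw [Finset.HasAntidiagonal.mem_antidiagonal] at hp
    rw [← Set.ncard_prod]
    refine Set.ncard_congr (fun w _ => (biLo m w, biHi m w)) ?_ ?_ ?_
    · intro w hw
      obtain ⟨-, -, h3, h4, -⟩ := (mem_FB_split h).1 hw
      exact ⟨h3, h4⟩
    · intro w w' hw hw' he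
      simp only [Prod.mk.injEq] at he
      exact bi_inj ((mem_FB_split h).1 hw).1 ((mem_FB_split h).1 hw').1 he.1 he.2
    · rintro ⟨w, w'⟩ ⟨hw, hw'⟩
      obtain ⟨v, hv, hv', rfl, rfl⟩ := exists_bi (m := m) (isChain_BRel.1 hw.1)
        (isChain_BRel.1 hw'.1) (fun x hx => h1 _ hw.2.1 _ (List.mem_map_of_mem hx))
        (fun x hx => h2 _ hw'.2.1 _ (List.mem_map_of_mem hx))
      exact ⟨v, (mem_FB_split h).2 ⟨hv, hv', hw, hw', hp⟩, rfl⟩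
  · intro w hw
    rw [Finset.HasAntidiagonal.mem_antidiagonal, ← ct_bi]
    exact (hasContent_iff.1 hw.2.2).2

theorem runR_bound {l : List ℤ} {A B : ℤ} (h : runR l = some z)
    (hs : ∀ t, t < A ∨ B < t → z t = t) : ∀ u ∈ l, A ≤ u ∧ u + 1 ≤ B := by
  rw [runR_eq] at h
  intro u hu
  exact run_letters_bound h hs (toL u) (List.mem_map_of_mem (List.mem_reverse.2 hu))

theorem runR_stats {l : List ℤ} (h : runR l = some z) :
    (mvSet z).Finite ∧ Even (mvSet z).ncard := by
  rw [runR_eq] at h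
  obtain ⟨-, h1, h2, -⟩ := run_stats h
  exact ⟨h1, by rw [h2]; exact even_two_mul _⟩

theorem mvSet_split (h : Split m z z₁ z₂) : mvSet z = mvSet z₁ ∪ (m + ·) '' mvSet z₂ := by
  ext x
  simp only [mvSet, Set.mem_union, Set.mem_ofPred_eq, Set.mem_image]
  by_cases hx : x ≤ m
  · rw [(h.lo x hx).1]
    refine ⟨.inl, fun h' => h'.resolve_right ?_⟩
    rintro ⟨t, ht, rfl⟩
    exact ht (h.hi' t (by omega))
  · rw [(h.hi_sub (not_le.1 hx)).1, h.lo' x (not_le.1 hx)]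
    constructor
    · exact fun h' => .inr ⟨x - m, by omega, by omega⟩
    · rintro (h' | ⟨t, ht, rfl⟩)
      · exact absurd rfl h'
      · rw [add_sub_cancel_left]
        omega

theorem kap_split (h : Split m z z₁ z₂) {l l' : List ℤ} (h1 : runR l = some z₁)
    (h2 : runR l' = some z₂) : kap z = kap z₁ + kap z₂ := by
  obtain ⟨f1, a, ha⟩ := runR_stats h1
  obtain ⟨f2, b, hb⟩ := runR_stats h2
  rw [kap, kap, kap, mvSet_split h, Set.ncard_union_eq ?_ f1 (f2.image _),
    Set.ncard_image_of_injective _ (add_right_injective m)]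
  · omega
  · rw [Set.disjoint_left]
    rintro _ hx ⟨t, ht, rfl⟩
    have h3 : 0 < t := by
      by_contra! h'
      exact ht (h.hi' t h')
    exact hx (h.lo' _ (lt_add_of_pos_right m h3))

end

/-! ## Peeling off the first row -/

section

variable {y z : PZ} {t : List Letter} {u : ℤ} {S : ℕ → ℕ → WithTop ℤ} {n : ℕ}

theorem descent_act (h : y u < y (u + 1)) : act y u (u + 1) < act y u u := by
  have e1 : sPerm u u = u + 1 := by simp [sPerm]
  have e2 : sPerm u (u + 1) = u := by simp [sPerm]
  rw [act_apply_of_lt h, act_apply_of_lt h, e1, e2]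
  split_ifs with hc
  · omega
  · rw [sPerm_lt_iff hc]
    · exact h
    · omega

/-- Letters at least `A` only move points at least `A`. -/
theorem run_fix {A : ℤ} (h : run t = some z) (hA : ∀ l ∈ t, A ≤ l.ceil) :
    ∀ x < A, z x = x := by
  induction t using List.reverseRecOn generalizing z with
  | nil =>
    obtain rfl : (1 : PZ) = z := Option.some_injective _ h
    simp
  | append_singleton t l ih =>
    obtain ⟨y, h1, h2, rfl⟩ := run_append_singleton_eq_some.1 h
    intro x hx
    have h3 := ih h1 (fun l hl => hA l (List.mem_append_left _ hl)) x hx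
    have h4 := hA l (by simp)
    have hs : sPerm l.ceil x = x := sPerm_of_ne (by omega) (by omega)
    rw [act_apply_of_lt h2.2.1, hs, h3, hs, ite_self]

theorem gt_of_fix {a : ℤ} (hy : ∀ x < a, y x = x) {x : ℤ} (hx : a ≤ x) : a ≤ y x := by
  by_contra! h
  have := y.injective (hy _ h)
  omega

/-- Relabeling caused by a row of consecutive letters. -/
def rowMap (a : ℤ) (q : ℕ) (x : ℤ) : ℤ := if x ≤ a + q + 1 then x - 1 else x

theorem row_inv {r : ℕ → ℤ} (hy : run t = some y) (hf : ∀ x < r 0 + 2, y x = x) (q : ℕ)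
    (hr : ∀ j < q, r j < r (j + 1))
    (hz : run (t ++ (List.range (q + 1)).map fun j => toL (r j)) = some z) :
    z (r 0) ≤ r 0 + q + 1 ∧ r 0 + q ≤ r q ∧ z (r q + 1) < z (r q) ∧
      (z (r 0) = r 0 + q + 1 → (∀ j ≤ q, r j = r 0 + j) ∧
        ∀ x, r 0 + 2 ≤ x → z (rowMap (r 0) q x) = rowMap (r 0) q (y x)) := by
  induction q generalizing z with
  | zero =>
    obtain ⟨w, h1, h2, rfl⟩ := run_append_singleton_eq_some.1
      (show run (t ++ [toL (r 0)]) = some z from hz)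
    obtain rfl : y = w := Option.some_injective _ (hy.symm.trans h1)
    have h3 : y (r 0) < y (r 0 + 1) := h2.2.1
    have h4 := descent_act h3
    change act y (r 0) (r 0) ≤ _ ∧ _ ∧ act y (r 0) (r 0 + 1) < act y (r 0) (r 0) ∧ _
    have e1 := hf (r 0) (by omega)
    have e2 := hf (r 0 + 1) (by omega)
    have e3 : sPerm (r 0) (r 0) = r 0 + 1 := by simp [sPerm]
    have key : ∀ x, act y (r 0) x = y (sPerm (r 0) x) := act_apply_comm e1 e2
    refine ⟨by rw [key, e3, e2]; simp, by simp, h4, fun _ => ⟨?_, ?_⟩⟩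
    · intro j hj
      obtain rfl : j = 0 := by omega
      simp
    · intro x hx
      have h5 := gt_of_fix hf hx
      have e4 : ∀ x, r 0 + 2 ≤ x → rowMap (r 0) 0 x = x := fun x hx => by
        rw [rowMap, if_neg (by push_cast; omega)]
      rw [e4 x hx, e4 _ h5]
      change act y (r 0) x = _
      rw [key, sPerm_of_ne (by omega) (by omega)]
  | succ q ih =>
    rw [List.range_succ, List.map_append, ← List.append_assoc] at hz
    obtain ⟨w, h1, h2, rfl⟩ := run_append_singleton_eq_some.1 hz
    obtain ⟨i1, i2, -, i4⟩ := ih (fun j hj => hr j (by omega)) h1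
    have h3 := hr q (by omega)
    obtain ⟨u, hu⟩ : ∃ u, r (q + 1) = u := ⟨_, rfl⟩
    obtain ⟨a, ha⟩ : ∃ a, r 0 = a := ⟨_, rfl⟩
    rw [ha] at hf i1 i2 i4
    simp only at h2
    rw [hu] at h3 h2
    have h5 : w u < w (u + 1) := h2.2.1
    have hcl : (toL u).ceil = u := rfl
    simp only [hu, ha, hcl]
    change act w u a ≤ _ ∧ _ ∧ act w u (u + 1) < act w u u ∧ _
    have hq : 0 ≤ (q : ℤ) := by positivity
    have e1 : sPerm u a = a := sPerm_of_ne (by omega) (by omega)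
    have e2 := act_apply_of_lt h5 a
    rw [e1] at e2
    have e3 := sPerm_apply u (w a)
    push_cast
    refine ⟨?_, by omega, descent_act h5, fun he => ?_⟩
    · rw [e2]
      split_ifs
      · omega
      · rw [e3]
        split_ifs <;> omega
    · rw [e2] at he
      split_ifs at he with hc
      · omega
      · have hwa : w a = a + q + 1 ∧ u = a + q + 1 := by
          rw [e3] at he
          split_ifs at he <;> omega
        obtain ⟨j1, j2⟩ := i4 hwa.1
        refine ⟨fun j hj => ?_, fun x hx => ?_⟩
        · obtain hj | rfl := Nat.le_or_eq_of_le_succ hj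
          · exact j1 j hj
          · rw [hu, hwa.2]
            push_cast
            ring
        · have hm : ∀ x, a + 2 ≤ x → rowMap a (q + 1) x = sPerm u (rowMap a q x) := by
            intro x hx
            rw [sPerm_apply]
            unfold rowMap
            push_cast
            split_ifs <;> omega
          rw [hm x hx, hm _ (gt_of_fix hf hx), act_apply_conj h5 hc, sPerm_sPerm, j2 x hx]

/-- The array without its first row. -/
def tailS (S : ℕ → ℕ → WithTop ℤ) : ℕ → ℕ → WithTop ℤ := fun i j => S (i + 1) (j + 1)

theorem Inc.tailS (h : Inc n S) : Inc n (tailS S) :=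
  ⟨fun i j => h.symm _ _, fun i j => h.incr _ _, fun i j hj => h.bd _ _ (by omega)⟩

theorem rdL_succ (S : ℕ → ℕ → WithTop ℤ) (n : ℕ) :
    rdL S nob (n + 1) = rdL (tailS S) nob n ++ rowL S nob (n + 1) 0 := by
  rw [rdL, List.range_succ_eq_map, List.reverse_cons, List.flatMap_append, List.flatMap_singleton,
    ← List.map_reverse, List.flatMap_map, rdL]
  congr 2
  funext i
  rw [rowL, rowL, Nat.succ_eq_add_one, Nat.add_sub_add_right, add_comm i 1,
    ← List.map_add_range', List.flatMap_map]
  congr 1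
  funext j
  rw [cellL, cellL, tailS, add_comm 1 i, add_comm 1 j]
  rfl

theorem mem_rdL {l : Letter} (h : l ∈ rdL S nob n) : ∃ i j, S i j = l.ceil := by
  simp only [rdL, rowL, List.mem_flatMap] at h
  obtain ⟨i, -, j, -, h⟩ := h
  refine ⟨i, j, ?_⟩
  cases hs : S i j with
  | top => rw [cellL_top hs] at h; simp at h
  | coe x =>
    rw [cellL_coe hs, List.mem_singleton] at h
    rw [h]

theorem exists_row (hS : Inc n S) : ∃ (q : ℕ) (r : ℕ → ℤ), (∀ j < q, S 0 j = r j) ∧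
    (∀ j, q ≤ j → S 0 j = ⊤) ∧ (∀ j, j + 1 < q → r j < r (j + 1)) ∧
    rowL S nob (n + 1) 0 = (List.range q).map fun j => toL (r j) := by
  classical
  have hex : ∃ j, S 0 j = ⊤ := ⟨n, hS.bd 0 n le_rfl⟩
  obtain ⟨q, h1, h2⟩ : ∃ q, (∀ j < q, S 0 j ≠ ⊤) ∧ S 0 q = ⊤ :=
    ⟨Nat.find hex, fun j hj => Nat.find_min hex hj, Nat.find_spec hex⟩
  have h3 : ∀ j < q, S 0 j = ((S 0 j).untopD 0 : ℤ) := fun j hj => by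
    obtain ⟨x, hx⟩ := WithTop.ne_top_iff_exists.1 (h1 j hj)
    rw [← hx]
    rfl
  have h4 : ∀ j, q ≤ j → S 0 j = ⊤ := fun j hj => top_le_iff.1 (h2 ▸ hS.row_le 0 hj)
  have hq : q ≤ n := by
    by_contra! hc
    exact h1 n hc (hS.bd 0 n le_rfl)
  refine ⟨q, fun j => (S 0 j).untopD 0, h3, h4, fun j hj => ?_, ?_⟩
  · have h5 := (hS.row 0 (Nat.lt_succ_self j)).lt (lt_top_iff_ne_top.2 (h1 j (by omega)))
    rw [h3 j (by omega), h3 (j + 1) hj] at h5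
    exact WithTop.coe_lt_coe.1 h5
  · have h6 : n + 1 = q + (n + 1 - q) := by omega
    rw [rowL, Nat.sub_zero, ← List.range_eq_range', h6, List.range_add, List.flatMap_append]
    have h7 : ((List.range (n + 1 - q)).map fun x => q + x).flatMap (cellL S nob 0) = [] := by
      rw [List.flatMap_eq_nil_iff]
      intro j hj
      obtain ⟨k, -, rfl⟩ := List.mem_map.1 hj
      exact cellL_top (h4 _ (by omega))
    rw [h7, List.append_nil, List.map_eq_flatMap]
    refine List.flatMap_congr fun j hj => ?_
    rw [cellL_coe (h3 j (List.mem_range.1 hj))]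
    rfl

theorem run_left {a b : List Letter} (h : run (a ++ b) = some z) : ∃ y, run a = some y := by
  induction b using List.reverseRecOn generalizing z with
  | nil => exact ⟨z, by rwa [List.append_nil] at h⟩
  | append_singleton b l ih =>
    rw [← List.append_assoc] at h
    obtain ⟨y, h1, -⟩ := run_append_singleton_eq_some.1 h
    exact ih h1

theorem IncOf.peel (h : IncOf z S) : ∃ (q : ℕ) (r : ℕ → ℤ) (t : List Letter) (y : PZ),
    (∀ j < q, S 0 j = r j) ∧ (∀ j, q ≤ j → S 0 j = ⊤) ∧ (∀ j, j + 1 < q → r j < r (j + 1)) ∧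
    run t = some y ∧ IncOf y (tailS S) ∧
    run (t ++ (List.range q).map fun j => toL (r j)) = some z ∧
    ∀ l ∈ t, ∃ i j, S (i + 1) (j + 1) = l.ceil := by
  obtain ⟨n, hS, hz⟩ := h
  obtain ⟨q, r, h1, h2, h3, h4⟩ := exists_row hS
  have h5 : run (rdL S nob (n + 1)) = some z := by
    rw [run_rdL, rd_eq hS (Nat.le_succ n), hz]
  rw [rdL_succ, h4] at h5
  obtain ⟨y, hy⟩ := run_left h5
  refine ⟨q, r, _, y, h1, h2, h3, hy, ⟨n, hS.tailS, ?_⟩, h5, fun l hl => mem_rdL hl⟩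
  rw [← run_rdL, hy]

end

/-! ## Dominant involutions -/

section

variable {z y : PZ} {S : ℕ → ℕ → WithTop ℤ} {c d : ℤ} {ν : List ℕ} {l : ℕ}

/-- The involution Rothe diagram of `z` is the transposed shifted diagram of `ν` moved by `c`. -/
def Dom (c : ℤ) (ν : List ℕ) (z : PZ) : Prop :=
  ∀ i j, (i, j) ∈ invRothe z ↔ ∃ k : ℕ, j = c + 1 + k ∧ j ≤ i ∧ i < j + (ν.getD k 0 : ℕ)

theorem mem_invRothe {i j : ℤ} : (i, j) ∈ invRothe z ↔ j < z i ∧ j ≤ i ∧ i < z j := Iff.rfl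

theorem IsStrictPartition.tail (h : IsStrictPartition (l :: ν)) : IsStrictPartition ν :=
  ⟨(List.isChain_cons.1 h.1).2, fun m hm => h.2 m (List.mem_cons_of_mem _ hm)⟩

theorem IsStrictPartition.getD_add_le (h : IsStrictPartition (l :: ν)) (k : ℕ) :
    ν.getD k 0 = 0 ∨ ν.getD k 0 + k + 1 ≤ l := by
  induction ν generalizing l k with
  | nil => simp
  | cons b ν ih =>
    have h1 : b < l := (List.isChain_cons_cons.1 h.1).1
    cases k with
    | zero => right; simpa using h1
    | succ k =>
      rw [List.getD_cons_succ]
      have := ih h.tail k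
      omega

theorem exists_invRothe_of_descent (hz : z * z = 1) (h : z (d + 1) < z d) :
    ∃ j, (d, j) ∈ invRothe z := by
  by_cases h1 : z (d + 1) ≤ d
  · exact ⟨_, h, h1, by rw [apply_self hz]; omega⟩
  · have h2 : d < z d := by omega
    exact ⟨d, h2, le_rfl, h2⟩

theorem Dom.cell_le (h : Dom c (l :: ν) z) (hν : IsStrictPartition (l :: ν)) {i j : ℤ}
    (hm : (i, j) ∈ invRothe z) : i ≤ c + l := by
  obtain ⟨k, rfl, h1, h2⟩ := (h i j).1 hm
  cases k with
  | zero =>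
    rw [List.getD_cons_zero] at h2
    push_cast at h2
    omega
  | succ k =>
    rw [List.getD_cons_succ] at h2
    have := hν.getD_add_le k
    push_cast at h1 h2
    omega

theorem Inc.eq_top {n : ℕ} (hS : Inc n S) {i j i' j' : ℕ} (h : S i j = ⊤) (hi : i ≤ i')
    (hj : j ≤ j') : S i' j' = ⊤ :=
  top_le_iff.1 (h ▸ (hS.row_le i hj).trans (hS.col_le j' hi))

theorem rowMap_lt_iff {a x x' : ℤ} {q : ℕ} :
    rowMap a q x < rowMap a q x' ↔ x < x' := by
  unfold rowMap
  split_ifs <;> omega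

theorem Dom.peel {q : ℕ} (h : Dom c ((q + 1) :: ν) z) (hν : IsStrictPartition ((q + 1) :: ν))
    (hy : ∀ x < c + 1 + 2, y x = x)
    (hz : ∀ x, c + 1 + 2 ≤ x → z (rowMap (c + 1) q x) = rowMap (c + 1) q (y x)) :
    Dom (c + 2) ν y := by
  intro i j
  rw [mem_invRothe]
  by_cases hj : j < c + 1 + 2
  · rw [hy j hj]
    constructor
    · rintro ⟨-, h1, h2⟩
      omega
    · rintro ⟨k, h1, -⟩
      omega
  by_cases hij : j ≤ i
  swap
  · simp [hij]
  rw [not_lt] at hj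
  have hi := hj.trans hij
  have hyi := gt_of_fix hy hi
  have hyj := gt_of_fix hy hj
  have h1 : (rowMap (c + 1) q i, rowMap (c + 1) q j) ∈ invRothe z ↔
      j < y i ∧ j ≤ i ∧ i < y j := by
    rw [mem_invRothe, hz i hi, hz j hj, rowMap_lt_iff, rowMap_lt_iff, ← not_lt,
      rowMap_lt_iff, not_lt]
  rw [← h1]
  constructor
  · intro h2
    have h3 := h.cell_le hν h2
    push_cast at h3
    have hi' : i ≤ c + 1 + q + 1 := by
      unfold rowMap at h3
      split_ifs at h3 <;> omega
    obtain ⟨k, h4, -, h5⟩ := (h _ _).1 h2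
    rw [rowMap, if_pos hi'] at h5
    rw [rowMap, if_pos (by omega)] at h4 h5
    cases k with
    | zero =>
      push_cast at h4
      omega
    | succ k =>
      rw [List.getD_cons_succ] at h5
      push_cast at h4
      exact ⟨k, by omega, hij, by omega⟩
  · rintro ⟨k, h2, -, h3⟩
    have h4 := hν.getD_add_le k
    have hi' : i ≤ c + 1 + q + 1 := by omega
    rw [h, rowMap, rowMap, if_pos hi', if_pos (by omega)]
    refine ⟨k + 1, ?_, by omega, ?_⟩
    · push_cast
      omega
    · rw [List.getD_cons_succ]
      omega

theorem peel_fix {n : ℕ} {t : List Letter} {r₀ : ℤ} (hI : Inc n S) (e0 : S 0 0 = r₀)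
    (hy : run t = some y) (ht : ∀ l ∈ t, ∃ i j, S (i + 1) (j + 1) = l.ceil) :
    ∀ x < r₀ + 2, y x = x := by
  refine run_fix hy fun l hl => ?_
  obtain ⟨i, j, hij⟩ := ht l hl
  have e1 : S 1 1 ≤ l.ceil := by
    rw [← hij]
    exact (hI.row_le 1 (by omega)).trans (hI.col_le _ (by omega))
  have e2 : S 1 1 < ⊤ := e1.trans_lt (WithTop.coe_lt_top _)
  have e3 : S 0 1 < S 1 1 := (hI.col 1 one_pos).lt ((hI.col_le 1 zero_le_one).trans_lt e2)
  obtain ⟨x, hx⟩ := WithTop.ne_top_iff_exists.1 (e3.trans e2).ne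
  have e4 : S 0 0 < S 0 1 := (hI.row 0 one_pos).lt (e0 ▸ WithTop.coe_lt_top _)
  have e5 := e3.trans_le e1
  rw [← hx] at e4 e5
  rw [e0] at e4
  have e6 := WithTop.coe_lt_coe.1 e4
  have e7 := WithTop.coe_lt_coe.1 e5
  omega
theorem Dom.array (hν : IsStrictPartition ν) (hc : ∀ x < c + 1, z x = x) (hD : Dom c ν z)
    (hS : IncOf z S) (i k : ℕ) :
    S i (i + k) = if k < ν.getD i 0 then ((c + 1 + 2 * i + k : ℤ) : WithTop ℤ) else ⊤ := by
  induction ν generalizing c z S i k with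
  | nil =>
    obtain ⟨n, hI, -⟩ := id hS
    obtain ⟨q, r, t, y, h1, h2, h3, hy, hyS, hr, ht⟩ := hS.peel
    have hz2 : z * z = 1 := run_mul_self hr
    rw [if_neg (by simp)]
    cases q with
    | zero => exact hI.eq_top (h2 0 le_rfl) (Nat.zero_le _) (Nat.zero_le _)
    | succ q =>
      obtain ⟨-, -, h4, -⟩ := row_inv hy (peel_fix hI (h1 0 (Nat.succ_pos _)) hy ht) q (fun j hj => h3 j (by omega)) hr
      obtain ⟨j, hj⟩ := exists_invRothe_of_descent hz2 h4
      obtain ⟨k, -, h5, h6⟩ := (hD _ _).1 hj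
      simp at h6
      omega
  | cons l ν ih =>
    obtain ⟨n, hI, -⟩ := id hS
    obtain ⟨q, r, t, y, h1, h2, h3, hy, hyS, hr, ht⟩ := hS.peel
    have hz2 : z * z = 1 := run_mul_self hr
    have hl : 0 < l := hν.2 l List.mem_cons_self
    have hcell := (hD (c + l) (c + 1)).2 ⟨0, by simp, by omega, by simp⟩
    rw [mem_invRothe] at hcell
    cases q with
    | zero =>
      exfalso
      have : t = [] := by
        rw [List.eq_nil_iff_forall_not_mem]
        intro l hl
        obtain ⟨i, j, hij⟩ := ht l hl
        rw [hI.eq_top (h2 0 le_rfl) (Nat.zero_le _) (Nat.zero_le _)] at hij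
        exact WithTop.coe_ne_top hij.symm
      subst this
      obtain rfl : (1 : PZ) = z := Option.some_injective _ hr
      rw [Equiv.Perm.one_apply, Equiv.Perm.one_apply] at hcell
      omega
    | succ q =>
      have hf := peel_fix hI (h1 0 (Nat.succ_pos _)) hy ht
      obtain ⟨i1, i2, i3, i4⟩ := row_inv hy hf q (fun j hj => h3 j (by omega)) hr
      obtain ⟨B, hB⟩ := (run_stats hr).2.1.bddAbove
      have hlb : c + 1 ≤ r 0 := by
        refine (run_letters_bound hr (A := c + 1) (B := B) ?_ (toL (r 0)) ?_).1
        · rintro x (hx | hx)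
          · exact hc x hx
          · by_contra hne
            exact absurd (hB hne) (not_le.2 hx)
        · exact List.mem_append_right _
            (List.mem_map.2 ⟨0, List.mem_range.2 (Nat.succ_pos _), rfl⟩)
      have hub : r 0 ≤ c + 1 := by
        by_contra! hlt
        have hmv : z (c + 1) = c + 1 := by
          refine run_fix hr (A := r 0) (fun l hl => ?_) _ hlt
          have e0 := h1 0 (Nat.succ_pos _)
          rcases List.mem_append.1 hl with hl | hl
          · obtain ⟨i, j, hij⟩ := ht l hl
            rw [← WithTop.coe_le_coe, ← hij, ← e0]
            exact (hI.row_le 0 (Nat.zero_le _)).trans (hI.col_le _ (Nat.zero_le _))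
          · obtain ⟨j, hj, rfl⟩ := List.mem_map.1 hl
            change r 0 ≤ r j
            rw [← WithTop.coe_le_coe, ← h1 j (List.mem_range.1 hj), ← e0]
            exact hI.row_le 0 (Nat.zero_le _)
        omega
      obtain ha : r 0 = c + 1 := le_antisymm hub hlb
      rw [ha] at i1 i2 i4 hf
      obtain ⟨j, hj⟩ := exists_invRothe_of_descent hz2 i3
      have hle := hD.cell_le hν hj
      obtain rfl : l = q + 1 := by omega
      obtain ⟨j1, j2⟩ := i4 (by omega)
      have hD' := hD.peel hν hf j2
      cases i with
      | zero =>
        rw [List.getD_cons_zero, Nat.zero_add]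
        split_ifs with hk
        · rw [h1 k hk, j1 k (by omega)]
          simp
        · exact h2 k (by omega)
      | succ i =>
        have h5 := ih hν.tail (fun x hx => hf x (by omega)) hD' hyS i k
        rw [tailS, show i + k + 1 = i + 1 + k by omega] at h5
        rw [h5, List.getD_cons_succ,
          show c + 2 + 1 + 2 * (i : ℤ) + k = c + 1 + 2 * ((i + 1 : ℕ) : ℤ) + k by push_cast; ring]

theorem kap_eq_ncard (hz : z * z = 1) (hf : (mvSet z).Finite) : kap z = {i | i < z i}.ncard := by
  have hs := apply_self hz
  have h1 : mvSet z = {i | i < z i} ∪ z '' {i | i < z i} := by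
    ext x
    simp only [mvSet, Set.mem_ofPred_eq, Set.mem_union, Set.mem_image]
    constructor
    · intro h
      obtain h | h := lt_or_gt_of_ne h
      · exact .inr ⟨z x, by rwa [hs], hs x⟩
      · exact .inl h
    · rintro (h | ⟨t, h, rfl⟩)
      · exact h.ne'
      · rw [hs]
        exact h.ne
  have h2 : {i | i < z i}.Finite := hf.subset (h1 ▸ Set.subset_union_left)
  rw [kap, h1, Set.ncard_union_eq ?_ h2 (h2.image _),
    Set.ncard_image_of_injective _ z.injective]
  · omega
  · rw [Set.disjoint_left]
    rintro _ hx ⟨t, ht, rfl⟩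
    simp only [Set.mem_ofPred_eq, hs] at hx ht
    omega

theorem Dom.ncard_dgS (hν : IsStrictPartition ν) (hc : ∀ x < c + 1, z x = x) (hD : Dom c ν z)
    (hz : IZ z) (hS : IncOf z S) : (dgS S).ncard = kap z := by
  rw [kap_eq_ncard hz.2 hz.1]
  refine Set.ncard_congr (fun k _ => c + 1 + (k : ℤ)) ?_ ?_ ?_
  · intro k hk
    have h1 := hD.array hν hc hS k 0
    have h2 : S k (k + 0) ≠ ⊤ := ne_of_lt hk
    split_ifs at h1 with h3
    · exact ((hD _ _).2 ⟨k, rfl, le_rfl, by omega⟩ : (c + 1 + (k : ℤ), c + 1 + (k : ℤ)) ∈ _).1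
    · exact absurd h1 h2
  · intro a b _ _ h
    simpa using h
  · intro i hi
    obtain ⟨k, rfl, -, h⟩ := (hD i i).1 ⟨hi, le_rfl, hi⟩
    refine ⟨k, ?_, rfl⟩
    have h1 := hD.array hν hc hS k 0
    rw [if_pos (by omega)] at h1
    change S k (k + 0) < ⊤
    rw [h1]
    exact WithTop.coe_lt_top _

theorem Dom.hasShape (hν : IsStrictPartition ν) (hc : ∀ x < c + 1, z x = x) (hD : Dom c ν z)
    (hS : IncOf z S) : HasShape (dm S) ν := by
  obtain ⟨m, hm, -⟩ := id hS
  refine ⟨fun r k => ?_, fun i j => by rw [dm, dm, hm.symm], hm.downCl, hν.2⟩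
  rw [dm, hD.array hν hc hS]
  split_ifs with h
  · exact iff_of_true (WithTop.coe_lt_top _) h
  · exact iff_of_false (lt_irrefl _) h

theorem exists_incOf (hz : IZ z) : ∃ S, IncOf z S := by
  obtain ⟨a, ha⟩ := exists_run hz
  have h : runR ((a.reverse.map fun u => ((0 : ℤ), u)).map Prod.snd) = some z := by
    rw [runR_eq, List.map_map, ← ha]
    congr 1
    simp [Function.comp_def]
  obtain ⟨S, c, hP⟩ := exists_Ph h
  exact ⟨S, hP.incOf h⟩

theorem Dom.unique {S' : ℕ → ℕ → WithTop ℤ} (hν : IsStrictPartition ν)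
    (hc : ∀ x < c + 1, z x = x) (hD : Dom c ν z) (hS : IncOf z S) (hS' : IncOf z S') : S = S' := by
  have key : ∀ i j, i ≤ j → S i j = S' i j := fun i j hij => by
    obtain ⟨k, rfl⟩ := Nat.exists_eq_add_of_le hij
    rw [hD.array hν hc hS, hD.array hν hc hS']
  funext i j
  obtain h | h := le_total i j
  · exact key i j h
  · rw [hS.symm, hS'.symm, key j i h]

theorem Dom.schurQ (hν : IsStrictPartition ν) (hc : ∀ x < c + 1, z x = x) (hD : Dom c ν z)
    (hz : IZ z) (e : ℤ →₀ ℕ) : SchurQ ν e = 2 ^ kap z * (FB z e).ncard := by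
  obtain ⟨S, hS⟩ := exists_incOf hz
  obtain ⟨m, hm, -⟩ := id hS
  have h1 : (finite_IncOf z).toFinset = {S} := by
    ext S'
    simp only [Set.Finite.mem_toFinset, Set.mem_ofPred_eq, Finset.mem_singleton]
    exact ⟨fun h => hD.unique hν hc h hS, fun h => h ▸ hS⟩
  rw [ncard_FB, h1, Finset.sum_singleton, (hD.hasShape hν hc hS).schurQ hm, hD.ncard_dgS hν hc hz hS]
  ring

theorem dom_of_invRothe (hz : invRothe z = Prod.swap '' SDset ν) : Dom 0 ν z := by
  intro i j
  rw [hz]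
  simp only [Set.mem_image, SDset, Set.mem_ofPred_eq, Prod.exists, Prod.swap_prod_mk,
    Prod.mk.injEq]
  constructor
  · rintro ⟨a, b, ⟨i', j', h1, h2, h3, h4, h5, h6⟩, h7, h8⟩
    exact ⟨i' - 1, by omega, by omega, by omega⟩
  · rintro ⟨k, h1, h2, h3⟩
    have h4 : k < ν.length := by
      by_contra! h
      rw [List.getD_eq_default _ _ h] at h3
      push_cast at h3
      omega
    exact ⟨j, i, ⟨k + 1, (i - j + 1).toNat, by omega, by omega, by omega,
      by rw [Nat.add_sub_cancel]; omega, by omega, by omega⟩, rfl, rfl⟩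

end

theorem exists_runR {z : PZ} (hz : IZ z) : ∃ l, runR l = some z := by
  obtain ⟨a, ha⟩ := exists_run hz
  exact ⟨a.reverse, by rw [runR_eq, List.reverse_reverse, ha]⟩

theorem Split.isIZ {m : ℤ} {z z₁ z₂ : PZ} (h : Split m z z₁ z₂) (h1 : IZ z₁) (h2 : IZ z₂) : IZ z := by
  refine ⟨?_, h.mul_self' h1.2 h2.2⟩
  change (mvSet z).Finite
  rw [mvSet_split h]
  exact Set.Finite.union h1.1 (Set.Finite.image _ h2.1)

/-- Corollary 3.26: `Q_λ · Q_μ = Σ_ν g^ν_{λμ} Q_ν`, where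
`g^ν_{λμ}` counts the tableaux of shape `ν` in `{P_EGᴼ(a) : a ∈ R_inv⁺(z_λ × z_μ)}`. -/
theorem stmt11 (shl shm : List ℕ) (hl : IsStrictPartition shl) (hm : IsStrictPartition shm)
    (m n : ℕ) (z1 z2 : Equiv.Perm ℤ) (hz1 : IZ z1) (hz2 : IZ z2)
    (hD1 : invRothe z1 = Prod.swap '' SDset shl)
    (hD2 : invRothe z2 = Prod.swap '' SDset shm)
    (hs1 : SupportedOn z1 m) (hs2 : SupportedOn z2 n) :
    SchurQ shl * SchurQ shm =
      ∑ᶠ ν ∈ {ν : List ℕ | IsStrictPartition ν},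
        ({T | T ∈ PEG '' RinvPlus (z1 * shiftPerm m z2) ∧ shapeOf T = ν} : Set STab).ncard •
          SchurQ ν := by
  have hsp : Split (m : ℤ) (z1 * shiftPerm m z2) z1 z2 :=
    split_mul (fun x hx => hs1 x (Or.inr hx)) (fun x hx => hs2 x (Or.inl (by omega)))
  have hz := hsp.isIZ hz1 hz2
  obtain ⟨l1, r1⟩ := exists_runR hz1
  obtain ⟨l2, r2⟩ := exists_runR hz2
  have hf := (RinvPlus_finite hz).image PEG
  rw [finsum_schurQ hf]
  ext d
  rw [MvPowerSeries.coeff_mul, map_sum]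
  have e1 : ∀ d, MvPowerSeries.coeff d (SchurQ shl) = 2 ^ kap z1 * (FB z1 d).ncard := fun d =>
    (dom_of_invRothe hD1).schurQ hl (fun x hx => hs1 x (Or.inl (by omega))) hz1 d
  have e2 : ∀ d, MvPowerSeries.coeff d (SchurQ shm) = 2 ^ kap z2 * (FB z2 d).ncard := fun d =>
    (dom_of_invRothe hD2).schurQ hm (fun x hx => hs2 x (Or.inl (by omega))) hz2 d
  refine Eq.trans ?_ (sum_schurQ hf d).symm
  rw [ncard_FB_split hsp
    (fun l hl u hu => by have := runR_bound hl (A := 1) (B := m) (fun t ht => hs1 t ht) u hu; omega)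
    (fun l hl u hu => by have := runR_bound hl (A := 1) (B := n) (fun t ht => hs2 t ht) u hu; omega) d,
    kap_split hsp r1 r2, pow_add, Nat.cast_sum, Finset.mul_sum]
  refine Finset.sum_congr rfl fun p _ => ?_
  rw [e1, e2]
  push_cast
  ring
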